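/- Let b ∈ L¹_loc(ℝⁿ;ℂⁿ) and let A ∈ L^∞(ℝⁿ; L(ℂⁿ)) satisfy the Gårding inequality Re ∫⟨A(x)∇u(x), ∇u(x)⟩ dx ≥ κ^A‖∇u‖₂² for all u ∈ H¹(ℝⁿ), for some κ^A > 0. Suppose that D((∇+b)*(∇+b) − Δ) ⊆ D(−Δ) ∩ D((∇+b)*(∇+b)) and that there exists c_b > 0 with ‖Δu‖₂ ≤ c_b‖((∇+b)*(∇+b) − Δ)u‖₂ for all u ∈ D((∇+b)*(∇+b) − Δ). Then there exists a constant c > 0 independent of b such that (c(1+c_b))^{-2}(‖(∇+b)u‖₂ + ‖∇u‖₂) ≤ ‖√(L^A_b) u‖₂ ≤ (c(1+c_b))²(‖(∇+b)u‖₂ + ‖∇u‖₂) for all u ∈ H¹_b(ℝⁿ). -/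

import Mathlib

open MeasureTheory Complex Set

noncomputable section

/-- An (unbounded, partially defined) operator on `H`: a domain together with an
assignment of values (junk values outside the domain). -/
structure UOp (H : Type*) where
  dom : Set H
  toFun : H → H

variable {H : Type*} [NormedAddCommGroup H] [InnerProductSpace ℂ H]

/-- `T` is a linear operator (on its domain). -/
def UOp.IsLinear (T : UOp H) : Prop :=
  (0 : H) ∈ T.dom ∧
  (∀ u ∈ T.dom, ∀ v ∈ T.dom, u + v ∈ T.dom ∧ T.toFun (u + v) = T.toFun u + T.toFun v) ∧
  (∀ (c : ℂ), ∀ u ∈ T.dom, c • u ∈ T.dom ∧ T.toFun (c • u) = c • T.toFun u)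

/-- The range of an unbounded operator. -/
def UOp.range (T : UOp H) : Set H := T.toFun '' T.dom

/-- The graph of `T` is closed. -/
def UOp.IsClosedOp (T : UOp H) : Prop :=
  IsClosed ((fun u => (u, T.toFun u)) '' T.dom)

/-- Composition `T ∘ S` of unbounded operators. -/
def UOp.comp (T S : UOp H) : UOp H :=
  ⟨{u ∈ S.dom | S.toFun u ∈ T.dom}, fun u => T.toFun (S.toFun u)⟩

/-- Sum of two unbounded operators (on the intersection of the domains). -/
def UOp.add (T S : UOp H) : UOp H :=
  ⟨T.dom ∩ S.dom, fun u => T.toFun u + S.toFun u⟩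

/-- Two unbounded operators agree (same domain, same values on it). -/
def UOp.EqOn (T S : UOp H) : Prop :=
  T.dom = S.dom ∧ ∀ u ∈ T.dom, T.toFun u = S.toFun u

/-- `S` is the (Hilbert-space) adjoint of `T`. -/
def IsAdjointPair (T S : UOp H) : Prop :=
  (∀ y, y ∈ S.dom ↔ ∃ w, ∀ u ∈ T.dom, inner (𝕜 := ℂ) (T.toFun u) y = inner (𝕜 := ℂ) u w) ∧
  (∀ u ∈ T.dom, ∀ y ∈ S.dom,
    inner (𝕜 := ℂ) (T.toFun u) y = inner (𝕜 := ℂ) u (S.toFun y))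

/-- `T` is self-adjoint. -/
def UOp.IsSelfAdjointOp (T : UOp H) : Prop := IsAdjointPair T T

/-- `T` is a nonnegative operator. -/
def UOp.IsNonneg (T : UOp H) : Prop :=
  ∀ u ∈ T.dom, 0 ≤ (inner (𝕜 := ℂ) (T.toFun u) u).re

/-- `T` is maximal accretive. -/
def UOp.IsMaximalAccretive (T : UOp H) : Prop :=
  T.IsLinear ∧ T.IsClosedOp ∧ Dense T.dom ∧
  (∀ u ∈ T.dom, 0 ≤ (inner (𝕜 := ℂ) (T.toFun u) u).re) ∧
  (∀ w : H, ∃ u ∈ T.dom, u + T.toFun u = w)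

/-- `P = (I + t² A)⁻¹` (a two-sided bounded inverse of `I + t² A`). -/
def IsResolventOfSq (A : UOp H) (P : H →L[ℂ] H) (t : ℝ) : Prop :=
  (∀ u : H, P u ∈ A.dom ∧ P u + (t ^ 2 : ℂ) • A.toFun (P u) = u) ∧
  (∀ v ∈ A.dom, P (v + (t ^ 2 : ℂ) • A.toFun v) = v)

/-- `R = (ζ - A)⁻¹` (a two-sided bounded inverse of `ζ • I - A`). -/
def IsResolventAt (A : UOp H) (ζ : ℂ) (R : H →L[ℂ] H) : Prop :=
  (∀ u : H, R u ∈ A.dom ∧ ζ • R u - A.toFun (R u) = u) ∧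
  (∀ v ∈ A.dom, R (ζ • v - A.toFun v) = v)

/-- The square-function integral `∫₀^∞ ‖F t‖² dt/t` (as an extended real). -/
def sqInt (F : ℝ → H) : ENNReal :=
  ∫⁻ t in Ioi (0 : ℝ), ENNReal.ofReal (‖F t‖ ^ 2 / t)

/-- `pow` is the family of fractional powers of the nonnegative self-adjoint
operator `A`, with the convention `pow s = A^(s/2)` (so `pow 2 = A`). -/
def PowerFamily {H : Type*} [NormedAddCommGroup H] [InnerProductSpace ℂ H]
    (A : UOp H) (pow : ℝ → UOp H) : Prop :=
  UOp.EqOn (pow 2) A ∧ UOp.EqOn (pow 0) ⟨Set.univ, id⟩ ∧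
  (∀ s, 0 ≤ s →
    (pow s).IsLinear ∧ (pow s).IsClosedOp ∧ (pow s).IsSelfAdjointOp ∧ (pow s).IsNonneg) ∧
  (∀ s t, 0 ≤ s → 0 ≤ t → UOp.EqOn (pow (s + t)) ((pow s).comp (pow t)))

/-- Euclidean space `ℝⁿ`. -/
abbrev Rn (n : ℕ) := EuclideanSpace ℝ (Fin n)

/-- The Hilbert space `L²(ℝⁿ; ℂ)`. -/
abbrev L2 (n : ℕ) := Lp ℂ 2 (volume : Measure (Rn n))

/-- `g` is the `i`-th weak (distributional) partial derivative of `u ∈ L²(ℝⁿ)`,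
and lies in `L²`. -/
def IsWeakPartial {n : ℕ} (u : L2 n) (i : Fin n) (g : Rn n → ℂ) : Prop :=
  MemLp g 2 (volume : Measure (Rn n)) ∧
  ∀ φ : Rn n → ℝ, ContDiff ℝ (⊤ : ℕ∞) φ → HasCompactSupport φ →
    ∫ x, (φ x : ℂ) * g x =
      - ∫ x, ((fderiv ℝ φ x (EuclideanSpace.single i (1 : ℝ)) : ℝ) : ℂ) * u x

/-- `T` is the nonnegative self-adjoint operator on `L²(ℝⁿ)` associated with the
form `u ↦ ∫ (|∇u|² + w |u|²)` (for `w = |V|` this is `|V| - Δ`; for `w = 0` it is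
`-Δ`). -/
def IsFormOp {n : ℕ} (w : Rn n → ℝ) (T : UOp (L2 n)) : Prop :=
  T.IsLinear ∧ T.IsClosedOp ∧ Dense T.dom ∧ T.IsSelfAdjointOp ∧ T.IsNonneg ∧
  (∀ u ∈ T.dom, ∃ g : Fin n → Rn n → ℂ,
      (∀ i, IsWeakPartial u i (g i)) ∧
      MemLp (fun x => ((Real.sqrt (w x) : ℝ) : ℂ) * u x) 2 volume ∧
      ∀ (v : L2 n) (gv : Fin n → Rn n → ℂ),
        (∀ i, IsWeakPartial v i (gv i)) →
        MemLp (fun x => ((Real.sqrt (w x) : ℝ) : ℂ) * v x) 2 volume →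
        inner (𝕜 := ℂ) v (T.toFun u) =
          (∑ i : Fin n, ∫ x, g i x * (starRingEnd ℂ) (gv i x))
            + ∫ x, ((w x : ℝ) : ℂ) * (u x * (starRingEnd ℂ) (v x))) ∧
  (∀ (u fu : L2 n) (g : Fin n → Rn n → ℂ),
      (∀ i, IsWeakPartial u i (g i)) →
      MemLp (fun x => ((Real.sqrt (w x) : ℝ) : ℂ) * u x) 2 volume →
      (∀ (v : L2 n) (gv : Fin n → Rn n → ℂ),
        (∀ i, IsWeakPartial v i (gv i)) →
        MemLp (fun x => ((Real.sqrt (w x) : ℝ) : ℂ) * v x) 2 volume →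
        inner (𝕜 := ℂ) v fu =
          (∑ i : Fin n, ∫ x, g i x * (starRingEnd ℂ) (gv i x))
            + ∫ x, ((w x : ℝ) : ℂ) * (u x * (starRingEnd ℂ) (v x))) →
      u ∈ T.dom ∧ T.toFun u = fu)

/-- The estimate defining the class `W_α`, with constant `c`:
`‖|V|^(α/2) u‖₂ + ‖(-Δ)^(α/2) u‖₂ ≤ c ‖(|V| - Δ)^(α/2) u‖₂` for all
`u ∈ D(|V| - Δ)`.  Here `T = |V| - Δ` with fractional powers `powT s = T^(s/2)`,
and `powLap s = (-Δ)^(s/2)`. -/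
def WBound {n : ℕ} (V : Rn n → ℂ) (T : UOp (L2 n)) (powT powLap : ℝ → UOp (L2 n))
    (α c : ℝ) : Prop :=
  ∀ u ∈ T.dom, u ∈ (powLap α).dom ∧
    eLpNorm (fun x => ((‖V x‖ ^ (α / 2) : ℝ) : ℂ) * u x) 2 volume
        + ENNReal.ofReal ‖(powLap α).toFun u‖
      ≤ ENNReal.ofReal (c * ‖(powT α).toFun u‖)

/-- `ℂⁿ`. -/
abbrev Cn (n : ℕ) := EuclideanSpace ℂ (Fin n)

/-- Assemble the weak partial derivatives into a gradient vector in `ℂⁿ`. -/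
def vecOf {n : ℕ} (g : Fin n → Rn n → ℂ) (x : Rn n) : Cn n :=
  (WithLp.equiv 2 (Fin n → ℂ)).symm (fun i => g i x)

/-- Membership of `u` in `H¹_b(ℝⁿ) = {u ∈ H¹ : |b u| ∈ L²}`, with a designated
weak gradient `g`. -/
def MemH1b {n : ℕ} (b : Rn n → Cn n) (u : L2 n) (g : Fin n → Rn n → ℂ) : Prop :=
  (∀ i, IsWeakPartial u i (g i)) ∧
  MemLp (fun x => u x • b x) 2 (volume : Measure (Rn n))

/-- `(∇ + b) u` computed from a weak gradient `g` of `u`. -/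
def gradPlusB {n : ℕ} (b : Rn n → Cn n) (u : L2 n) (g : Fin n → Rn n → ℂ)
    (x : Rn n) : Cn n :=
  vecOf g x + u x • b x

/-- `T` is the operator associated with the sesquilinear form
`(u,v) ↦ F u v g gv` with form domain `H¹_b` (forms conjugate-linear in `v`,
evaluated through weak gradients). -/
def IsAssocOpH1b {n : ℕ} (b : Rn n → Cn n)
    (F : L2 n → L2 n → (Fin n → Rn n → ℂ) → (Fin n → Rn n → ℂ) → ℂ)
    (T : UOp (L2 n)) : Prop :=
  T.IsLinear ∧
  (∀ u ∈ T.dom, ∃ g : Fin n → Rn n → ℂ, MemH1b b u g ∧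
      ∀ (v : L2 n) (gv : Fin n → Rn n → ℂ), MemH1b b v gv →
        inner (𝕜 := ℂ) v (T.toFun u) = F u v g gv) ∧
  (∀ (u fu : L2 n) (g : Fin n → Rn n → ℂ), MemH1b b u g →
      (∀ (v : L2 n) (gv : Fin n → Rn n → ℂ), MemH1b b v gv →
        inner (𝕜 := ℂ) v fu = F u v g gv) →
      u ∈ T.dom ∧ T.toFun u = fu)

section

/-! ### Resolvents of accretive forms -/

/-- An accretive form `v ↦ ⟪v, N v⟫` on a Hilbert space `V` mapped by a contraction `J` into `E`,
coercive with respect to `‖v‖² - ‖J v‖²`. -/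
structure AccForm (V E : Type*) [NormedAddCommGroup V] [InnerProductSpace ℂ V]
    [NormedAddCommGroup E] [InnerProductSpace ℂ E] where
  J : V →L[ℂ] E
  N : V →L[ℂ] V
  κ : ℝ
  κ_pos : 0 < κ
  norm_J_le : ∀ v, ‖J v‖ ≤ ‖v‖
  coercive : ∀ v, κ * (‖v‖ ^ 2 - ‖J v‖ ^ 2) ≤ (inner ℂ v (N v)).re

namespace AccForm

open ContinuousLinearMap

variable {V E : Type*} [NormedAddCommGroup V] [InnerProductSpace ℂ V] [CompleteSpace V]
  [NormedAddCommGroup E] [InnerProductSpace ℂ E] [CompleteSpace E] (a : AccForm V E)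

/-- The operator `J† J + t² N`. -/
def M (t : ℝ) : V →L[ℂ] V := adjoint a.J ∘L a.J + ((t ^ 2 : ℝ) : ℂ) • a.N

/-- The inverse of `a.M t`. -/
def Minv (t : ℝ) : V →L[ℂ] V := Ring.inverse (a.M t)

/-- The resolvent of the form, with values in the form domain. -/
def rho (t : ℝ) : E →L[ℂ] V := a.Minv t ∘L adjoint a.J

/-- The resolvent `(1 + t² L)⁻¹` of the operator `L` of the form. -/
def R (t : ℝ) : E →L[ℂ] E := a.J ∘L a.rho t

/-- The adjoint form. -/
def adj : AccForm V E where
  J := a.J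
  N := adjoint a.N
  κ := a.κ
  κ_pos := a.κ_pos
  norm_J_le := a.norm_J_le
  coercive v := by
    rw [adjoint_inner_right, ← inner_conj_symm, conj_re]
    exact a.coercive v

theorem inner_M (t : ℝ) (v w : V) :
    inner ℂ v (a.M t w) = inner ℂ (a.J v) (a.J w) + ((t ^ 2 : ℝ) : ℂ) * inner ℂ v (a.N w) := by
  simp only [M, add_apply, comp_apply, smul_apply, inner_add_right, inner_smul_right,
    adjoint_inner_right]

theorem re_inner_M (t : ℝ) (v : V) :
    (inner ℂ v (a.M t v)).re = ‖a.J v‖ ^ 2 + t ^ 2 * (inner ℂ v (a.N v)).re := by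
  rw [inner_M, add_re, re_ofReal_mul]
  congr 1
  exact inner_self_eq_norm_sq (𝕜 := ℂ) _

theorem re_inner_M_ge (t : ℝ) (v : V) :
    ‖a.J v‖ ^ 2 + t ^ 2 * (a.κ * (‖v‖ ^ 2 - ‖a.J v‖ ^ 2)) ≤ (inner ℂ v (a.M t v)).re := by
  rw [re_inner_M]
  gcongr
  exact a.coercive v

theorem sq_norm_J_le (v : V) : ‖a.J v‖ ^ 2 ≤ ‖v‖ ^ 2 := by
  gcongr
  exact a.norm_J_le v

theorem isUnit_M {t : ℝ} (ht : 0 < t) : IsUnit (a.M t) := by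
  have hκ := a.κ_pos
  have hc : 0 < min 1 (t ^ 2 * a.κ) := by positivity
  refine isUnit_of_forall_le_norm_inner_map _ (c := ⟨_, hc.le⟩) hc fun v => ?_
  rw [← inner_conj_symm, RCLike.norm_conj]
  refine le_trans ?_ (RCLike.re_le_norm _)
  refine le_trans ?_ (a.re_inner_M_ge t v)
  have h1 := min_le_left 1 (t ^ 2 * a.κ)
  have h2 := min_le_right 1 (t ^ 2 * a.κ)
  have h3 := a.sq_norm_J_le v
  change ‖v‖ ^ 2 * min 1 (t ^ 2 * a.κ) ≤ _
  nlinarith [sq_nonneg ‖a.J v‖, sq_nonneg ‖v‖, mul_le_mul_of_nonneg_left h1 (sq_nonneg ‖a.J v‖),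
    mul_le_mul_of_nonneg_right h2 (sub_nonneg.2 h3)]

theorem M_mul_Minv {t : ℝ} (ht : 0 < t) : a.M t * a.Minv t = 1 :=
  Ring.mul_inverse_cancel _ (a.isUnit_M ht)

theorem Minv_mul_M {t : ℝ} (ht : 0 < t) : a.Minv t * a.M t = 1 :=
  Ring.inverse_mul_cancel _ (a.isUnit_M ht)

theorem M_Minv_apply {t : ℝ} (ht : 0 < t) (v : V) : a.M t (a.Minv t v) = v :=
  congrArg (fun T : V →L[ℂ] V => T v) (a.M_mul_Minv ht)

theorem Minv_M_apply {t : ℝ} (ht : 0 < t) (v : V) : a.Minv t (a.M t v) = v :=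
  congrArg (fun T : V →L[ℂ] V => T v) (a.Minv_mul_M ht)

theorem M_apply (t : ℝ) (v : V) :
    a.M t v = adjoint a.J (a.J v) + ((t ^ 2 : ℝ) : ℂ) • a.N v := rfl

theorem R_apply (t : ℝ) (f : E) : a.R t f = a.J (a.rho t f) := rfl

theorem M_rho {t : ℝ} (ht : 0 < t) (f : E) : a.M t (a.rho t f) = adjoint a.J f :=
  a.M_Minv_apply ht _

theorem N_rho {t : ℝ} (ht : 0 < t) (f : E) :
    a.N (a.rho t f) = ((t ^ 2 : ℝ) : ℂ)⁻¹ • adjoint a.J (f - a.R t f) := by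
  have h := a.M_rho ht f
  rw [M_apply] at h
  have ht' : ((t ^ 2 : ℝ) : ℂ) ≠ 0 := by exact_mod_cast (pow_pos ht 2).ne'
  rw [eq_inv_smul_iff₀ ht', map_sub, ← h, R_apply]
  abel

theorem rho_J {t : ℝ} (ht : 0 < t) (v : V) :
    v - a.rho t (a.J v) = ((t ^ 2 : ℝ) : ℂ) • a.Minv t (a.N v) := by
  have h : a.Minv t (a.M t v) = v := a.Minv_M_apply ht v
  rw [M_apply, map_add, map_smul] at h
  rw [sub_eq_iff_eq_add, add_comm]
  exact h.symm

/-- The resolvent identity. -/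
theorem R_sub {s t : ℝ} (hs : 0 < s) (ht : 0 < t) (f : E) :
    ((t ^ 2 : ℝ) : ℂ) • a.R t f - ((s ^ 2 : ℝ) : ℂ) • a.R s f =
      ((t ^ 2 - s ^ 2 : ℝ) : ℂ) • a.R s (a.R t f) := by
  have h := a.rho_J hs (a.rho t f)
  rw [N_rho a ht, map_smul, map_sub] at h
  change _ = _ • _ • (a.Minv s (adjoint a.J f - adjoint a.J (a.R t f))) at h
  rw [map_sub] at h
  change a.rho t f - a.rho s (a.R t f) = _ • _ • (a.rho s f - a.rho s (a.R t f)) at h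
  have h2 := congrArg a.J h
  simp only [map_sub, map_smul] at h2
  simp only [← R_apply] at h2
  have ht' : ((t ^ 2 : ℝ) : ℂ) ≠ 0 := by exact_mod_cast (pow_pos ht 2).ne'
  have h3 := congrArg (fun x => ((t ^ 2 : ℝ) : ℂ) • x) h2
  simp only [smul_sub, smul_smul] at h3
  have h4 : ((t ^ 2 : ℝ) : ℂ) * (((s ^ 2 : ℝ) : ℂ) * ((t ^ 2 : ℝ) : ℂ)⁻¹) = ((s ^ 2 : ℝ) : ℂ) := by
    field_simp
  rw [h4] at h3
  rw [ofReal_sub, sub_smul, sub_eq_sub_iff_add_eq_add]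
  rw [sub_eq_sub_iff_add_eq_add] at h3
  rw [h3, add_comm]

theorem M_adj (t : ℝ) : a.adj.M t = adjoint (a.M t) := by
  refine (eq_adjoint_iff _ _).2 fun x y => ?_
  rw [← inner_conj_symm, inner_M, inner_M]
  simp only [adj, map_add, map_mul, conj_ofReal, inner_conj_symm, adjoint_inner_right]

theorem inner_Minv_adj {t : ℝ} (ht : 0 < t) (x y : V) :
    inner ℂ (a.adj.Minv t x) y = inner ℂ x (a.Minv t y) := by
  conv_lhs => rw [← a.M_Minv_apply ht y]
  rw [← adjoint_inner_left, ← M_adj, M_Minv_apply _ ht]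

theorem inner_R_adj {t : ℝ} (ht : 0 < t) (x y : E) :
    inner ℂ (a.adj.R t x) y = inner ℂ x (a.R t y) := by
  change inner ℂ (a.J (a.adj.Minv t (adjoint a.J x))) y = inner ℂ x (a.J (a.Minv t (adjoint a.J y)))
  rw [← adjoint_inner_right, inner_Minv_adj a ht, adjoint_inner_left]

theorem re_inner_R {t : ℝ} (ht : 0 < t) (f : E) :
    ‖a.R t f‖ ^ 2 + t ^ 2 * (a.κ * (‖a.rho t f‖ ^ 2 - ‖a.R t f‖ ^ 2)) ≤ (inner ℂ (a.R t f) f).re := by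
  have h := a.re_inner_M_ge t (a.rho t f)
  rw [M_rho a ht, adjoint_inner_right] at h
  exact h

theorem sq_norm_R_le {t : ℝ} (ht : 0 < t) (f : E) :
    ‖a.R t f‖ ^ 2 ≤ (inner ℂ (a.R t f) f).re := by
  refine le_trans ?_ (a.re_inner_R ht f)
  have := a.sq_norm_J_le (a.rho t f)
  have hκ := a.κ_pos
  rw [← R_apply] at this
  have : 0 ≤ ‖a.rho t f‖ ^ 2 - ‖a.R t f‖ ^ 2 := sub_nonneg.2 this
  have : 0 ≤ t ^ 2 * (a.κ * (‖a.rho t f‖ ^ 2 - ‖a.R t f‖ ^ 2)) := by positivity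
  linarith

theorem norm_R_le {t : ℝ} (ht : 0 < t) (f : E) : ‖a.R t f‖ ≤ ‖f‖ := by
  have h1 := a.sq_norm_R_le ht f
  have h2 : (inner ℂ (a.R t f) f).re ≤ ‖a.R t f‖ * ‖f‖ := re_inner_le_norm (𝕜 := ℂ) _ _
  by_contra! h
  nlinarith [norm_nonneg f, norm_nonneg (a.R t f)]

theorem norm_sub_R_le {t : ℝ} (ht : 0 < t) (f : E) : ‖f - a.R t f‖ ≤ ‖f‖ := by
  have h1 := a.sq_norm_R_le ht f
  have h2 := norm_sub_sq (𝕜 := ℂ) f (a.R t f)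
  have h3 : RCLike.re (inner ℂ f (a.R t f)) = (inner ℂ (a.R t f) f).re := by
    exact inner_re_symm _ _
  rw [h3] at h2
  refine le_of_sq_le_sq ?_ (norm_nonneg _)
  nlinarith [sq_nonneg ‖a.R t f‖]

end AccForm

end

section

/-! ### Dyadic resolvents and discrete square functions -/

theorem sum_mul_le_of_sq_le {N : ℕ} {a b : ℕ → ℝ} {A B : ℝ} (hA : 0 ≤ A) (hB : 0 ≤ B)
    (ha : ∑ i ∈ Finset.range N, a i ^ 2 ≤ A ^ 2) (hb : ∑ i ∈ Finset.range N, b i ^ 2 ≤ B ^ 2) :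
    ∑ i ∈ Finset.range N, a i * b i ≤ A * B := by
  refine le_of_sq_le_sq ?_ (by positivity)
  refine (Finset.sum_mul_sq_le_sq_mul_sq _ a b).trans ?_
  rw [mul_pow]
  gcongr

namespace AccForm

open ContinuousLinearMap Filter Topology

variable {V E : Type*} [NormedAddCommGroup V] [InnerProductSpace ℂ V] [CompleteSpace V]
  [NormedAddCommGroup E] [InnerProductSpace ℂ E] [CompleteSpace E] (a : AccForm V E)

/-- The resolvent at the dyadic scale `2 ^ k`. -/
def Rd (k : ℤ) : E →L[ℂ] E := a.R ((2 : ℝ) ^ k)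

/-- Differences of consecutive dyadic resolvents. -/
def Psi (k : ℤ) : E →L[ℂ] E := a.Rd k - a.Rd (k + 1)

theorem two_zpow_pos (k : ℤ) : (0 : ℝ) < (2 : ℝ) ^ k := by positivity

theorem Rd_Rd_succ (k : ℤ) (f : E) :
    a.Rd k (a.Rd (k + 1) f) = (4 / 3 : ℂ) • a.Rd (k + 1) f - (1 / 3 : ℂ) • a.Rd k f := by
  have h := a.R_sub (two_zpow_pos k) (two_zpow_pos (k + 1)) f
  have h2 : ((2 : ℝ) ^ (k + 1)) = 2 * 2 ^ k := by rw [zpow_add_one₀ (by norm_num)]; ring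
  have hk : ((((2 : ℝ) ^ k) ^ 2 : ℝ) : ℂ) ≠ 0 := by
    exact_mod_cast (pow_pos (two_zpow_pos k) 2).ne'
  have e1 : ((((2 : ℝ) ^ (k + 1)) ^ 2 : ℝ) : ℂ) = (((2 : ℝ) ^ k) ^ 2 : ℝ) * (4 : ℂ) := by
    rw [h2]; push_cast; ring
  have e2 : (((((2 : ℝ) ^ (k + 1)) ^ 2 - ((2 : ℝ) ^ k) ^ 2) : ℝ) : ℂ) =
      (((2 : ℝ) ^ k) ^ 2 : ℝ) * (3 : ℂ) := by
    rw [h2]; push_cast; ring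
  rw [e1, e2, mul_smul, mul_smul, ← smul_sub] at h
  have h3 := smul_right_injective E hk h
  change (4 : ℂ) • a.Rd (k + 1) f - a.Rd k f = (3 : ℂ) • a.Rd k (a.Rd (k + 1) f) at h3
  have h4 := congrArg (fun x => (1 / 3 : ℂ) • x) h3
  simp only [smul_smul, smul_sub] at h4
  norm_num at h4
  rw [← h4]

theorem Rd_succ_Rd (k : ℤ) (f : E) :
    a.Rd (k + 1) (a.Rd k f) = (4 / 3 : ℂ) • a.Rd (k + 1) f - (1 / 3 : ℂ) • a.Rd k f := by
  rw [← Rd_Rd_succ]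
  have h1 := a.R_sub (two_zpow_pos k) (two_zpow_pos (k + 1)) f
  have h2 := a.R_sub (two_zpow_pos (k + 1)) (two_zpow_pos k) f
  have h3 : ((((2 : ℝ) ^ (k + 1)) ^ 2 - ((2 : ℝ) ^ k) ^ 2 : ℝ) : ℂ) ≠ 0 := by
    norm_cast
    have : ((2 : ℝ) ^ (k + 1)) = 2 * 2 ^ k := by rw [zpow_add_one₀ (by norm_num)]; ring
    rw [this]
    have := pow_pos (two_zpow_pos k) 2
    nlinarith
  rw [← neg_sub, h1, ← neg_sub (((2 : ℝ) ^ (k + 1)) ^ 2) (((2 : ℝ) ^ k) ^ 2), ofReal_neg, neg_smul, neg_inj] at h2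
  exact (smul_right_injective E h3 h2).symm

theorem norm_Rd_le (k : ℤ) (f : E) : ‖a.Rd k f‖ ≤ ‖f‖ := a.norm_R_le (two_zpow_pos k) f

theorem norm_sub_Rd_le (k : ℤ) (f : E) : ‖f - a.Rd k f‖ ≤ ‖f‖ := a.norm_sub_R_le (two_zpow_pos k) f

theorem sq_norm_Rd_le (k : ℤ) (f : E) : ‖a.Rd k f‖ ^ 2 ≤ (inner ℂ (a.Rd k f) f).re :=
  a.sq_norm_R_le (two_zpow_pos k) f

theorem inner_Rd_adj (k : ℤ) (x y : E) : inner ℂ (a.adj.Rd k x) y = inner ℂ x (a.Rd k y) :=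
  a.inner_R_adj (two_zpow_pos k) x y

theorem inner_Psi_adj (k : ℤ) (x y : E) : inner ℂ (a.adj.Psi k x) y = inner ℂ x (a.Psi k y) := by
  simp [Psi, inner_Rd_adj]

theorem Psi_eq (k : ℤ) (f : E) : a.Psi k f = (3 : ℂ) • a.Rd (k + 1) (f - a.Rd k f) := by
  simp only [Psi, sub_apply, map_sub, Rd_succ_Rd]
  module

theorem Psi_eq' (k : ℤ) (f : E) :
    a.Psi k f = (3 : ℂ) • (a.Rd (k + 1) f - a.Rd k (a.Rd (k + 1) f)) := by
  simp only [Psi, sub_apply, Rd_Rd_succ]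
  module

theorem norm_Psi_le (k : ℤ) (f : E) : ‖a.Psi k f‖ ≤ 2 * ‖f‖ := by
  change ‖a.Rd k f - a.Rd (k + 1) f‖ ≤ _
  refine (norm_sub_le _ _).trans ?_
  linarith [a.norm_Rd_le k f, a.norm_Rd_le (k + 1) f]

theorem sq_norm_Psi_le (k : ℤ) (v : E) :
    ‖a.Psi k v‖ ^ 2 ≤ 3 / 5 * (‖a.Rd k v‖ ^ 2 - ‖a.Rd (k + 1) v‖ ^ 2) := by
  have h0 := a.sq_norm_Rd_le (k + 1) (a.Rd k v)
  set w := a.Rd k v with hw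
  set z := a.Rd (k + 1) w with hz
  have hq : a.Rd (k + 1) v = (1 / 4 : ℝ) • w + (3 / 4 : ℝ) • z := by
    rw [hz, hw, Rd_succ_Rd, RCLike.real_smul_eq_coe_smul (K := ℂ),
      RCLike.real_smul_eq_coe_smul (K := ℂ)]
    push_cast
    module
  have hp : a.Psi k v = (3 / 4 : ℝ) • (w - z) := by
    rw [Psi, sub_apply, hq, ← hw]
    module
  rw [hp, hq, norm_smul, mul_pow]
  have e1 := norm_sub_sq (𝕜 := ℂ) w z
  have e2 := norm_add_sq (𝕜 := ℂ) ((1 / 4 : ℝ) • w) ((3 / 4 : ℝ) • z)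
  rw [inner_re_symm] at e1
  rw [inner_re_symm, RCLike.real_smul_eq_coe_smul (K := ℂ) (1 / 4 : ℝ) w,
    RCLike.real_smul_eq_coe_smul (K := ℂ) (3 / 4 : ℝ) z, inner_smul_left, inner_smul_right] at e2
  rw [RCLike.conj_ofReal, RCLike.re_ofReal_mul, RCLike.re_ofReal_mul] at e2
  rw [← RCLike.real_smul_eq_coe_smul (K := ℂ), ← RCLike.real_smul_eq_coe_smul (K := ℂ)] at e2
  rw [e1, e2, norm_smul, norm_smul]
  norm_num
  nlinarith

theorem sum_sq_norm_Psi_le (m : ℤ) (N : ℕ) (v : E) :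
    ∑ i ∈ Finset.range N, ‖a.Psi (m + i) v‖ ^ 2 ≤ ‖v‖ ^ 2 := by
  have h : ∑ i ∈ Finset.range N, ‖a.Psi (m + i) v‖ ^ 2 ≤
      3 / 5 * (‖a.Rd m v‖ ^ 2 - ‖a.Rd (m + N) v‖ ^ 2) := by
    have := Finset.sum_range_sub' (fun i : ℕ => ‖a.Rd (m + i) v‖ ^ 2) N
    simp only [Nat.cast_zero, add_zero] at this
    rw [← this, Finset.mul_sum]
    refine Finset.sum_le_sum fun i _ => ?_
    have := a.sq_norm_Psi_le (m + i) v
    rwa [add_assoc] at this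
  have h2 : ‖a.Rd m v‖ ^ 2 ≤ ‖v‖ ^ 2 := by
    gcongr
    exact a.norm_Rd_le m v
  nlinarith [sq_nonneg ‖a.Rd (m + N) v‖, sq_nonneg ‖v‖]

/-- The polynomial `3 r² - 2 r³` of the dyadic resolvent. -/
def pR (k : ℤ) (f : E) : E := a.Rd k ((3 : ℂ) • a.Rd k f - (2 : ℂ) • a.Rd k (a.Rd k f))

theorem pR_sub (k : ℤ) (f : E) :
    a.pR k f - a.pR (k + 1) f = a.Psi k (a.Psi k ((5 : ℂ) • f - (2 : ℂ) • a.Psi k f)) := by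
  simp only [pR, Psi, sub_apply, map_sub, map_smul, Rd_Rd_succ, Rd_succ_Rd]
  module

theorem norm_five_sub_le (k : ℤ) (f : E) : ‖(5 : ℂ) • f - (2 : ℂ) • a.Psi k f‖ ≤ 9 * ‖f‖ := by
  refine (norm_sub_le _ _).trans ?_
  rw [norm_smul, norm_smul]
  have := a.norm_Psi_le k f
  norm_num
  linarith

theorem norm_three_sub_le (k : ℤ) (f : E) :
    ‖(3 : ℂ) • a.Rd k f - (2 : ℂ) • a.Rd k (a.Rd k f)‖ ≤ 5 * ‖f‖ := by
  refine (norm_sub_le _ _).trans ?_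
  rw [norm_smul, norm_smul]
  have := a.norm_Rd_le k f
  have := a.norm_Rd_le k (a.Rd k f)
  norm_num
  linarith

/-! ### The square root -/

/-- `S` squares to the operator whose resolvents are `a.R t`. -/
structure IsSqrt (S : UOp E) : Prop where
  maxAcc : S.IsMaximalAccretive
  range_R : ∀ t : ℝ, 0 < t → ∀ f, a.R t f ∈ S.dom ∧ S.toFun (a.R t f) ∈ S.dom ∧
    S.toFun (S.toFun (a.R t f)) = ((t ^ 2 : ℝ) : ℂ)⁻¹ • (f - a.R t f)
  left_inv : ∀ t : ℝ, 0 < t → ∀ u ∈ S.dom, S.toFun u ∈ S.dom →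
    a.R t (u + ((t ^ 2 : ℝ) : ℂ) • S.toFun (S.toFun u)) = u

variable {a} {S : UOp E}

namespace IsSqrt

theorem map_add (h : a.IsSqrt S) {x y : E} (hx : x ∈ S.dom) (hy : y ∈ S.dom) :
    x + y ∈ S.dom ∧ S.toFun (x + y) = S.toFun x + S.toFun y := h.maxAcc.1.2.1 x hx y hy

theorem map_smul (h : a.IsSqrt S) (c : ℂ) {x : E} (hx : x ∈ S.dom) :
    c • x ∈ S.dom ∧ S.toFun (c • x) = c • S.toFun x := h.maxAcc.1.2.2 c x hx

theorem map_sub (h : a.IsSqrt S) {x y : E} (hx : x ∈ S.dom) (hy : y ∈ S.dom) :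
    x - y ∈ S.dom ∧ S.toFun (x - y) = S.toFun x - S.toFun y := by
  have h1 := h.map_smul (-1) hy
  have h2 := h.map_add hx h1.1
  rw [h1.2] at h2
  simpa [sub_eq_add_neg] using h2

theorem norm_apply_le (h : a.IsSqrt S) {u : E} (hu : u ∈ S.dom) (hu' : S.toFun u ∈ S.dom)
    {s : ℝ} (hs : 0 < s) :
    ‖S.toFun u‖ ≤ 2 * (s⁻¹ * ‖S.toFun (S.toFun u)‖ + s * ‖u‖) := by
  have hsu := h.map_smul (s : ℂ) hu
  have hz := h.map_sub hu' hsu.1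
  have hacc := h.maxAcc.2.2.2.1 _ hz.1
  rw [hz.2, hsu.2] at hacc
  set y := S.toFun u
  set w := S.toFun y
  simp only [inner_sub_left, inner_sub_right, inner_smul_left, inner_smul_right, conj_ofReal,
    sub_re, re_ofReal_mul] at hacc
  have e0 : (inner ℂ y y).re = ‖y‖ ^ 2 := inner_self_eq_norm_sq (𝕜 := ℂ) y
  have e1 : (inner ℂ w y).re ≤ ‖w‖ * ‖y‖ := re_inner_le_norm (𝕜 := ℂ) _ _
  have e2 : -(‖w‖ * ‖u‖) ≤ (inner ℂ w u).re :=
    neg_le_of_abs_le ((abs_re_le_norm _).trans (norm_inner_le_norm _ _))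
  have e3 : (inner ℂ y u).re ≤ ‖y‖ * ‖u‖ := re_inner_le_norm (𝕜 := ℂ) _ _
  rw [e0] at hacc
  set A := s⁻¹ * ‖w‖ with hA
  have hw : ‖w‖ = s * A := by rw [hA]; field_simp
  set B := s * ‖u‖ with hB
  have hA0 : 0 ≤ A := by positivity
  have hB0 : 0 ≤ B := by positivity
  have key : s * ‖y‖ ^ 2 ≤ s * ((A + B) * ‖y‖ + A * B) := by
    rw [hw] at e1 e2
    have e2' := mul_le_mul_of_nonneg_left e2 hs.le
    have e3' := mul_le_mul_of_nonneg_left e3 (mul_pos hs hs).le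
    have : s * (s * A * ‖u‖) = s * (A * B) := by rw [hB]; ring
    have : s * s * (‖y‖ * ‖u‖) = s * (B * ‖y‖) := by rw [hB]; ring
    nlinarith
  have key' := le_of_mul_le_mul_left key hs
  by_contra! hlt
  nlinarith [norm_nonneg y]

theorem norm_R_le (h : a.IsSqrt S) {t : ℝ} (ht : 0 < t) (f : E) :
    ‖S.toFun (a.R t f)‖ ≤ 4 * t⁻¹ * ‖f‖ := by
  obtain ⟨h1, h2, h3⟩ := h.range_R t ht f
  refine (h.norm_apply_le h1 h2 (inv_pos.2 ht)).trans ?_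
  rw [h3, norm_smul, norm_inv, inv_inv, norm_real, Real.norm_of_nonneg (by positivity)]
  have e1 := a.norm_R_le ht f
  have e2 := a.norm_sub_R_le ht f
  have e3 : t * ((t ^ 2)⁻¹ * ‖f - a.R t f‖) = t⁻¹ * ‖f - a.R t f‖ := by field_simp
  rw [e3]
  have ht' := inv_pos.2 ht
  nlinarith

theorem R_comm (h : a.IsSqrt S) {t : ℝ} (ht : 0 < t) {u : E} (hu : u ∈ S.dom) :
    S.toFun (a.R t u) = a.R t (S.toFun u) := by
  obtain ⟨h1, h2, h3⟩ := h.range_R t ht u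
  have e1 := h.map_sub hu h1
  have e2 := h.map_smul ((t ^ 2 : ℝ) : ℂ)⁻¹ e1.1
  rw [← h3] at e2
  have h4 := h.left_inv t ht _ h2 e2.1
  rw [e2.2, e1.2, smul_inv_smul₀ (by exact_mod_cast (pow_pos ht 2).ne')] at h4
  rw [← h4]
  simp

theorem Psi_comm (h : a.IsSqrt S) (k : ℤ) {u : E} (hu : u ∈ S.dom) :
    a.Psi k u ∈ S.dom ∧ S.toFun (a.Psi k u) = a.Psi k (S.toFun u) := by
  have h1 := h.map_sub (h.range_R _ (two_zpow_pos k) u).1 (h.range_R _ (two_zpow_pos (k + 1)) u).1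
  rw [h.R_comm (two_zpow_pos k) hu, h.R_comm (two_zpow_pos (k + 1)) hu] at h1
  exact h1

theorem pR_mem (h : a.IsSqrt S) (k : ℤ) (u : E) : a.pR k u ∈ S.dom :=
  (h.range_R _ (two_zpow_pos k) _).1

theorem norm_pR_le (h : a.IsSqrt S) (k : ℤ) (u : E) :
    ‖S.toFun (a.pR k u)‖ ≤ 20 * ((2 : ℝ) ^ k)⁻¹ * ‖u‖ := by
  refine (h.norm_R_le (two_zpow_pos k) _).trans ?_
  have := a.norm_three_sub_le k u
  have h2 := inv_pos.2 (two_zpow_pos k)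
  nlinarith

/-- The operator `f ↦ 3 · S R f` at scale `2 ^ (k + 1)`. -/
theorem norm_S_Rd_succ_le (h : a.IsSqrt S) (k : ℤ) (f : E) :
    ‖S.toFun (a.Rd (k + 1) f)‖ ≤ 2 * ((2 : ℝ) ^ k)⁻¹ * ‖f‖ := by
  refine (h.norm_R_le (two_zpow_pos (k + 1)) f).trans (le_of_eq ?_)
  rw [zpow_add_one₀ (by norm_num)]
  field_simp
  norm_num

theorem norm_inner_pR_sub_le (h : a.IsSqrt S) (k : ℤ) (u v : E) :
    ‖inner ℂ v (S.toFun (a.pR k u) - S.toFun (a.pR (k + 1) u))‖ ≤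
      (((2 : ℝ) ^ k)⁻¹ * ‖u - a.Rd k u‖) * (54 * ‖a.adj.Psi k v‖) := by
  rw [← (h.map_sub (h.pR_mem k u) (h.pR_mem (k + 1) u)).2, pR_sub]
  set g := (5 : ℂ) • (u - a.Rd k u) - (2 : ℂ) • a.Psi k (u - a.Rd k u) with hg
  have e : a.Psi k (a.Psi k ((5 : ℂ) • u - (2 : ℂ) • a.Psi k u)) =
      a.Psi k ((3 : ℂ) • a.Rd (k + 1) g) := by
    congr 1
    rw [hg, Psi_eq]
    congr 2
    simp only [Psi, sub_apply, _root_.map_sub, _root_.map_smul, Rd_Rd_succ, Rd_succ_Rd]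
    module
  have hm : a.Rd (k + 1) g ∈ S.dom := (h.range_R _ (two_zpow_pos (k + 1)) g).1
  rw [e, (h.Psi_comm k (h.map_smul 3 hm).1).2, (h.map_smul 3 hm).2, ← inner_Psi_adj]
  refine (norm_inner_le_norm _ _).trans ?_
  rw [norm_smul]
  have e1 := h.norm_S_Rd_succ_le k g
  have e2 : ‖g‖ ≤ 9 * ‖u - a.Rd k u‖ := a.norm_five_sub_le k _
  have e3 := inv_pos.2 (two_zpow_pos k)
  have e4 : ‖S.toFun (a.Rd (k + 1) g)‖ ≤ 18 * (((2 : ℝ) ^ k)⁻¹ * ‖u - a.Rd k u‖) := by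
    refine e1.trans ?_
    nlinarith
  norm_num
  calc ‖a.adj.Psi k v‖ * (3 * ‖S.toFun (a.Rd (k + 1) g)‖)
      ≤ ‖a.adj.Psi k v‖ * (3 * (18 * (((2 : ℝ) ^ k)⁻¹ * ‖u - a.Rd k u‖))) := by gcongr
    _ = _ := by ring

theorem norm_pR_sub_le (h : a.IsSqrt S) {u : E} {m : ℤ} {N : ℕ} {A : ℝ} (hA : 0 ≤ A)
    (hu : ∑ i ∈ Finset.range N, (((2 : ℝ) ^ (m + i))⁻¹ * ‖u - a.Rd (m + i) u‖) ^ 2 ≤ A ^ 2) :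
    ‖S.toFun (a.pR m u) - S.toFun (a.pR (m + N) u)‖ ≤ 54 * A := by
  set y := S.toFun (a.pR m u) - S.toFun (a.pR (m + N) u) with hy
  have h1 : ‖inner ℂ y y‖ ≤ A * (54 * ‖y‖) := by
    have := Finset.sum_range_sub' (fun i : ℕ => S.toFun (a.pR (m + i) u)) N
    simp only [Nat.cast_zero, add_zero] at this
    conv_lhs => rw [show inner ℂ y y = inner ℂ y (∑ i ∈ Finset.range N,
      (S.toFun (a.pR (m + i) u) - S.toFun (a.pR (m + (i + 1 : ℕ)) u))) by rw [this]]
    rw [inner_sum]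
    refine (norm_sum_le _ _).trans ?_
    refine le_trans (Finset.sum_le_sum (g := fun i : ℕ =>
      (((2 : ℝ) ^ (m + i))⁻¹ * ‖u - a.Rd (m + i) u‖) * (54 * ‖a.adj.Psi (m + i) y‖)) ?_) ?_
    · intro i _
      have := h.norm_inner_pR_sub_le (m + i) u y
      rw [add_assoc] at this
      exact_mod_cast this
    · refine sum_mul_le_of_sq_le hA (by positivity) hu ?_
      simp_rw [mul_pow]
      rw [← Finset.mul_sum]
      gcongr
      exact a.adj.sum_sq_norm_Psi_le m N y
  rw [inner_self_eq_norm_sq_to_K] at h1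
  simp only [norm_pow, coe_algebraMap, norm_real, norm_norm] at h1
  by_contra! hlt
  nlinarith [norm_nonneg y]

theorem norm_inner_pR_SS_sub_le (h : a.IsSqrt S) (k : ℤ) {u : E} (v : E) (hu : u ∈ S.dom)
    (hu' : S.toFun u ∈ S.dom) :
    ‖inner ℂ v (a.pR k (S.toFun (S.toFun u)) - a.pR (k + 1) (S.toFun (S.toFun u)))‖ ≤
      (((2 : ℝ) ^ k)⁻¹ * ‖v - a.adj.Rd k v‖) * (54 * ‖a.Psi k (S.toFun u)‖) := by
  rw [pR_sub]
  set g := (5 : ℂ) • u - (2 : ℂ) • a.Psi k u with hg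
  have g1 := h.map_smul 5 hu
  have g2 := h.Psi_comm k hu
  have g3 := h.map_smul 2 g2.1
  have g4 := h.map_sub g1.1 g3.1
  rw [g1.2, g3.2, g2.2] at g4
  have g1' := h.map_smul 5 hu'
  have g2' := h.Psi_comm k hu'
  have g3' := h.map_smul 2 g2'.1
  have g4' := h.map_sub g1'.1 g3'.1
  rw [g1'.2, g3'.2, g2'.2] at g4'
  set g' := (5 : ℂ) • S.toFun u - (2 : ℂ) • a.Psi k (S.toFun u) with hg'
  have hP := h.Psi_comm k g4'.1
  have hR : S.toFun (a.Rd (k + 1) (a.Psi k g')) = a.Rd (k + 1) (S.toFun (a.Psi k g')) :=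
    h.R_comm (two_zpow_pos (k + 1)) hP.1
  have e : a.Psi k (a.Psi k ((5 : ℂ) • S.toFun (S.toFun u) - (2 : ℂ) • a.Psi k (S.toFun (S.toFun u))))
      = (3 : ℂ) • (S.toFun (a.Rd (k + 1) (a.Psi k g')) -
        a.Rd k (S.toFun (a.Rd (k + 1) (a.Psi k g')))) := by
    rw [hR, hP.2, g4'.2, ← Psi_eq']
  have e' : inner ℂ v ((3 : ℂ) • (S.toFun (a.Rd (k + 1) (a.Psi k g')) -
        a.Rd k (S.toFun (a.Rd (k + 1) (a.Psi k g'))))) =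
        3 * inner ℂ (v - a.adj.Rd k v) (S.toFun (a.Rd (k + 1) (a.Psi k g'))) := by
    rw [inner_smul_right, inner_sub_right, inner_sub_left, inner_Rd_adj]
  rw [e, e', norm_mul]
  have b1 := norm_inner_le_norm (𝕜 := ℂ) (v - a.adj.Rd k v) (S.toFun (a.Rd (k + 1) (a.Psi k g')))
  have b2 := h.norm_S_Rd_succ_le k (a.Psi k g')
  have b3 : a.Psi k g' = (5 : ℂ) • a.Psi k (S.toFun u) -
      (2 : ℂ) • a.Psi k (a.Psi k (S.toFun u)) := by
    rw [hg', _root_.map_sub, _root_.map_smul, _root_.map_smul]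
  have b4 : ‖a.Psi k g'‖ ≤ 9 * ‖a.Psi k (S.toFun u)‖ := by
    rw [b3]; exact a.norm_five_sub_le k _
  have e3 := inv_pos.2 (two_zpow_pos k)
  rw [show ‖(3 : ℂ)‖ = 3 by norm_num]
  calc _ ≤ 3 * (‖v - a.adj.Rd k v‖ * (2 * ((2 : ℝ) ^ k)⁻¹ * (9 * ‖a.Psi k (S.toFun u)‖))) := by
        gcongr
        refine b1.trans ?_
        gcongr
        refine b2.trans ?_
        gcongr
    _ = _ := by ring

end IsSqrt
end AccForm

end

section

/-! ### Kato estimates from square function estimates -/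

open Filter Topology

theorem tendsto_apply_of_dense {X : Type*} [NormedAddCommGroup X] [NormedSpace ℂ X]
    {T : ℕ → X →L[ℂ] X} {C : ℝ} (hT : ∀ j x, ‖T j x‖ ≤ C * ‖x‖) {D : Set X} (hD : Dense D)
    (h : ∀ x ∈ D, Tendsto (fun j => T j x) atTop (𝓝 x)) (x : X) :
    Tendsto (fun j => T j x) atTop (𝓝 x) := by
  have hC : 0 ≤ |C| := abs_nonneg C
  have hT' : ∀ j x, ‖T j x‖ ≤ |C| * ‖x‖ := fun j x =>
    (hT j x).trans (mul_le_mul_of_nonneg_right (le_abs_self C) (norm_nonneg x))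
  rw [Metric.tendsto_atTop]
  intro ε hε
  obtain ⟨y, hy, hxy⟩ := hD.exists_dist_lt x (ε := ε / (2 * (|C| + 1))) (by positivity)
  obtain ⟨N, hN⟩ := Metric.tendsto_atTop.1 (h y hy) (ε / 2) (by positivity)
  refine ⟨N, fun j hj => ?_⟩
  have h1 := hN j hj
  rw [dist_eq_norm] at *
  rw [lt_div_iff₀ (by positivity)] at hxy
  have h2 : T j x - x = T j (x - y) + (T j y - y) - (x - y) := by rw [map_sub]; abel
  rw [h2]
  refine (norm_sub_le _ _).trans_lt ?_
  have h3 := norm_add_le (T j (x - y)) (T j y - y)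
  have h4 := hT' j (x - y)
  nlinarith

namespace AccForm

variable {V E : Type*} [NormedAddCommGroup V] [InnerProductSpace ℂ V] [CompleteSpace V]
  [NormedAddCommGroup E] [InnerProductSpace ℂ E] [CompleteSpace E] {a : AccForm V E}
  {S : UOp E}

theorem tendsto_two_zpow_neg : Tendsto (fun j : ℕ => (2 : ℝ) ^ (-(j : ℤ))) atTop (𝓝 0) := by
  have := tendsto_pow_atTop_nhds_zero_of_lt_one (r := (1 / 2 : ℝ)) (by norm_num) (by norm_num)
  refine this.congr fun j => ?_
  simp

theorem norm_sub_pR_le (a : AccForm V E) (k : ℤ) (u : E) :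
    ‖u - a.pR k u‖ ≤ 4 * ‖u - a.Rd k u‖ := by
  set x := u - a.Rd k u with hx
  have h : u - a.pR k u = x + a.Rd k x - (2 : ℂ) • a.Rd k (a.Rd k x) := by
    simp only [pR, hx, map_sub, map_smul]
    module
  rw [h]
  refine (norm_sub_le _ _).trans ?_
  have h1 := norm_add_le x (a.Rd k x)
  have h2 := a.norm_Rd_le k x
  have h3 := a.norm_Rd_le k (a.Rd k x)
  rw [norm_smul, show ‖(2 : ℂ)‖ = 2 by norm_num]
  linarith

theorem norm_pR_le_five (a : AccForm V E) (k : ℤ) (u : E) : ‖a.pR k u‖ ≤ 5 * ‖a.Rd k u‖ := by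
  have h := a.norm_three_sub_le k (a.Rd k u)
  have e : a.pR k u = (3 : ℂ) • a.Rd k (a.Rd k u) - (2 : ℂ) • a.Rd k (a.Rd k (a.Rd k u)) := by
    simp only [pR, map_sub, map_smul]
  rwa [e]

theorem IsSqrt.apply_le_of_sum_le (h : a.IsSqrt S) {u : E} {A : ℝ} (hA : 0 ≤ A)
    (hu : ∀ (m : ℤ) (N : ℕ),
      ∑ i ∈ Finset.range N, (((2 : ℝ) ^ (m + i))⁻¹ * ‖u - a.Rd (m + i) u‖) ^ 2 ≤ A ^ 2) :
    u ∈ S.dom ∧ ‖S.toFun u‖ ≤ 54 * A := by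
  set y : ℕ → E := fun j => S.toFun (a.pR (-j) u) with hy
  set d : ℤ → ℝ := fun k => (((2 : ℝ) ^ k)⁻¹ * ‖u - a.Rd k u‖) ^ 2 with hd
  set G : ℕ → ℝ := fun j => ∑ i ∈ Finset.range j, d (-j + i) with hG
  have hGsub : ∀ l j : ℕ, l ≤ j → ∑ i ∈ Finset.range (j - l), d (-j + i) = G j - G l := by
    intro l j hlj
    obtain ⟨m, rfl⟩ := Nat.exists_eq_add_of_le' hlj
    simp only [hG, Finset.sum_range_add]
    rw [add_tsub_cancel_right, add_sub_assoc, left_eq_add, sub_eq_zero]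
    refine Finset.sum_congr rfl fun i _ => ?_
    congr 1
    push_cast
    ring
  have hd0 : ∀ k, 0 ≤ d k := fun k => sq_nonneg _
  have hmono : Monotone G := fun l j hlj => by
    have := hGsub l j hlj
    have h2 : 0 ≤ ∑ i ∈ Finset.range (j - l), d (-j + i) := Finset.sum_nonneg fun i _ => hd0 _
    linarith
  have hbdd : BddAbove (range G) := ⟨A ^ 2, by rintro _ ⟨j, rfl⟩; exact hu _ _⟩
  have hlim := tendsto_atTop_ciSup hmono hbdd
  set L := ⨆ i, G i
  have hcau : CauchySeq y := by
    refine cauchySeq_of_le_tendsto_0' (fun l => 54 * Real.sqrt (L - G l)) (fun l j hlj => ?_) ?_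
    · rw [dist_comm, dist_eq_norm]
      have hL : G j ≤ L := le_ciSup hbdd j
      have e1 := h.norm_pR_sub_le (u := u) (m := -j) (N := j - l) (Real.sqrt_nonneg (L - G l)) (by
        rw [Real.sq_sqrt (by linarith [hmono hlj])]
        have := hGsub l j hlj
        simp only [hd] at this
        rw [this]
        linarith)
      have e2 : (-(j : ℤ) + ((j - l : ℕ) : ℤ)) = -l := by omega
      rwa [e2] at e1
    · have : Tendsto (fun l => 54 * Real.sqrt (L - G l)) atTop (𝓝 (54 * Real.sqrt (L - L))) :=
        ((Real.continuous_sqrt.tendsto _).comp (hlim.const_sub L)).const_mul 54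
      simpa using this
  obtain ⟨z, hz⟩ := cauchySeq_tendsto_of_complete hcau
  have hpu : Tendsto (fun j : ℕ => a.pR (-j) u) atTop (𝓝 u) := by
    rw [tendsto_iff_norm_sub_tendsto_zero]
    refine squeeze_zero (g := fun j : ℕ => 4 * A * (2 : ℝ) ^ (-(j : ℤ))) (fun _ => norm_nonneg _)
      (fun j => ?_) ?_
    · rw [norm_sub_rev]
      refine (a.norm_sub_pR_le _ u).trans ?_
      have := hu (-j) 1
      simp only [Finset.sum_range_one, Nat.cast_zero, add_zero] at this
      have := le_of_sq_le_sq this hA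
      rw [inv_mul_le_iff₀ (by positivity)] at this
      linarith
    · simpa using tendsto_two_zpow_neg.const_mul (4 * A)
  have hgraph : (u, z) ∈ (fun u => (u, S.toFun u)) '' S.dom := by
    refine h.maxAcc.2.1.mem_of_tendsto (b := atTop) (f := fun j : ℕ => (a.pR (-j) u, y j))
      (hpu.prodMk_nhds hz) (Eventually.of_forall fun j => ?_)
    exact ⟨_, h.pR_mem _ u, rfl⟩
  obtain ⟨u', hu', he⟩ := hgraph
  simp only [Prod.mk.injEq] at he
  obtain ⟨rfl, rfl⟩ := he
  refine ⟨hu', le_of_tendsto hz.norm (Eventually.of_forall fun j => ?_)⟩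
  refine ge_of_tendsto (x := atTop) (f := fun N : ℕ => 54 * A + 20 * ((2 : ℝ) ^ (-(j : ℤ) + N))⁻¹ * ‖u'‖)
    ?_ (Eventually.of_forall fun N => ?_)
  · have : (fun N : ℕ => 54 * A + 20 * ((2 : ℝ) ^ (-(j : ℤ) + N))⁻¹ * ‖u'‖) =
        fun N : ℕ => 54 * A + (20 * ((2 : ℝ) ^ (-(j : ℤ)))⁻¹ * ‖u'‖) * (2 : ℝ) ^ (-(N : ℤ)) := by
      funext N
      rw [zpow_add₀ (by norm_num), zpow_neg _ (N : ℤ), mul_inv]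
      ring
    rw [this]
    simpa using (tendsto_two_zpow_neg.const_mul
      (20 * ((2 : ℝ) ^ (-(j : ℤ)))⁻¹ * ‖u'‖)).const_add (54 * A)
  · have e1 := h.norm_pR_sub_le (u := u') (m := -j) (N := N) hA (hu _ _)
    have e2 := h.norm_pR_le (-j + N) u'
    have e3 := norm_sub_norm_le (y j) (S.toFun (a.pR (-j + N) u'))
    simp only [hy] at *
    linarith

theorem tendsto_Rd (hJ : DenseRange a.J) (f : E) :
    Tendsto (fun j : ℕ => a.Rd (-j) f) atTop (𝓝 f) := by
  have hdense : Dense (range (a.R 1)) := by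
    have : (a.R 1).toLinearMap.range.topologicalClosure = ⊤ := by
      rw [Submodule.topologicalClosure_eq_top_iff, Submodule.eq_bot_iff]
      intro x hx
      have h0 : ∀ g, inner ℂ (a.adj.R 1 x) g = 0 := fun g => by
        rw [a.inner_R_adj one_pos]
        rw [Submodule.mem_orthogonal'] at hx
        exact hx _ ⟨g, rfl⟩
      have h1 : a.adj.R 1 x = 0 := inner_self_eq_zero.1 (h0 _)
      have h2 := a.adj.re_inner_R one_pos x
      have h3 : a.adj.rho 1 x = 0 := by
        rw [h1] at h2
        simp only [norm_zero, inner_zero_left, zero_re] at h2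
        have := a.adj.κ_pos
        have h4 : ‖a.adj.rho 1 x‖ ^ 2 ≤ 0 := by
          by_contra! hlt
          nlinarith
        have h5 : ‖a.adj.rho 1 x‖ = 0 := by nlinarith [norm_nonneg (a.adj.rho 1 x)]
        exact norm_eq_zero.1 h5
      have h4 := a.adj.M_rho one_pos x
      rw [h3, map_zero] at h4
      refine hJ.eq_zero_of_inner_right ℂ (x := x) fun y => ?_
      rw [← ContinuousLinearMap.adjoint_inner_right]
      exact (congrArg (inner ℂ y) h4.symm).trans (inner_zero_right y)
    have h2 := (Submodule.dense_iff_topologicalClosure_eq_top).2 this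
    exact h2
  refine tendsto_apply_of_dense (C := 1) (fun j x => ?_) hdense ?_ f
  · rw [one_mul]; exact a.norm_Rd_le _ x
  · rintro _ ⟨g, rfl⟩
    rw [tendsto_iff_norm_sub_tendsto_zero]
    refine squeeze_zero (g := fun j : ℕ => 2 * ‖g‖ * ((2 : ℝ) ^ (-(j : ℤ))) ^ 2)
      (fun _ => norm_nonneg _) (fun j => ?_) ?_
    · have e := a.R_sub (two_zpow_pos (-j)) one_pos g
      have e' : a.R 1 g - a.Rd (-j) (a.R 1 g) =
          ((((2 : ℝ) ^ (-(j : ℤ))) ^ 2 : ℝ) : ℂ) • (a.Rd (-j) g - a.Rd (-j) (a.R 1 g)) := by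
        simp only [one_pow, ofReal_one, one_smul, ofReal_sub, sub_smul] at e
        simp only [Rd]
        rw [smul_sub, ← sub_eq_zero]
        rw [← sub_eq_zero] at e
        rw [← e]
        abel
      rw [norm_sub_rev, e', norm_smul, norm_real, Real.norm_of_nonneg (by positivity), mul_comm]
      gcongr
      refine (norm_sub_le _ _).trans ?_
      linarith [a.norm_Rd_le (-j) g, a.norm_Rd_le (-j) (a.R 1 g), a.norm_R_le one_pos g]
    · simpa using (tendsto_two_zpow_neg.pow 2).const_mul (2 * ‖g‖)

theorem IsSqrt.norm_inner_le (h : a.IsSqrt S) (hJ : DenseRange a.J) {u v : E} {A : ℝ} (hA : 0 ≤ A)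
    (hu : u ∈ S.dom) (hu' : S.toFun u ∈ S.dom)
    (hv : ∀ (m : ℤ) (N : ℕ),
      ∑ i ∈ Finset.range N, (((2 : ℝ) ^ (m + i))⁻¹ * ‖v - a.adj.Rd (m + i) v‖) ^ 2 ≤ A ^ 2) :
    ‖inner ℂ v (S.toFun (S.toFun u))‖ ≤ A * (54 * ‖S.toFun u‖) := by
  set w := S.toFun (S.toFun u) with hw
  have hbound : ∀ (m : ℤ) (N : ℕ), ‖inner ℂ v (a.pR m w - a.pR (m + N) w)‖ ≤
      A * (54 * ‖S.toFun u‖) := by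
    intro m N
    have := Finset.sum_range_sub' (fun i : ℕ => a.pR (m + i) w) N
    simp only [Nat.cast_zero, add_zero] at this
    rw [← this, inner_sum]
    refine (norm_sum_le _ _).trans ?_
    refine le_trans (Finset.sum_le_sum (g := fun i : ℕ =>
      (((2 : ℝ) ^ (m + i))⁻¹ * ‖v - a.adj.Rd (m + i) v‖) * (54 * ‖a.Psi (m + i) (S.toFun u)‖)) ?_) ?_
    · intro i _
      have := h.norm_inner_pR_SS_sub_le (m + i) v hu hu'
      rw [add_assoc] at this
      exact_mod_cast this
    · refine sum_mul_le_of_sq_le hA (by positivity) (hv m N) ?_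
      simp_rw [mul_pow]
      rw [← Finset.mul_sum]
      gcongr
      exact a.sum_sq_norm_Psi_le m N _
  have h1 : Tendsto (fun j : ℕ => a.pR (-j) w) atTop (𝓝 w) := by
    rw [tendsto_iff_norm_sub_tendsto_zero]
    refine squeeze_zero (fun _ => norm_nonneg _) (fun j => ?_)
      (by simpa using (tendsto_iff_norm_sub_tendsto_zero.1 (tendsto_Rd hJ w)).const_mul 4)
    rw [norm_sub_rev, norm_sub_rev _ w]
    exact a.norm_sub_pR_le _ w
  have h2 : Tendsto (fun j : ℕ => a.pR j w) atTop (𝓝 0) := by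
    rw [tendsto_zero_iff_norm_tendsto_zero]
    refine squeeze_zero (g := fun j : ℕ => 5 * ‖u‖ * ((2 : ℝ) ^ (-(j : ℤ))) ^ 2)
      (fun _ => norm_nonneg _) (fun j => ?_) ?_
    · refine (a.norm_pR_le_five _ w).trans ?_
      have e := h.left_inv _ (two_zpow_pos j) u hu hu'
      rw [_root_.map_add, _root_.map_smul] at e
      have e' : a.Rd j w = ((((2 : ℝ) ^ (j : ℤ)) ^ 2 : ℝ) : ℂ)⁻¹ • (u - a.Rd j u) := by
        rw [eq_inv_smul_iff₀ (by exact_mod_cast (pow_pos (two_zpow_pos j) 2).ne'), eq_sub_iff_add_eq,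
          add_comm]
        exact e
      rw [e', norm_smul, norm_inv, norm_real, Real.norm_of_nonneg (by positivity), zpow_neg, inv_pow]
      have := a.norm_sub_Rd_le j u
      calc 5 * ((((2 : ℝ) ^ (j : ℤ)) ^ 2)⁻¹ * ‖u - a.Rd j u‖)
          ≤ 5 * ((((2 : ℝ) ^ (j : ℤ)) ^ 2)⁻¹ * ‖u‖) := by gcongr
        _ = _ := by ring
    · simpa using (tendsto_two_zpow_neg.pow 2).const_mul (5 * ‖u‖)
  have h3 : Tendsto (fun j : ℕ => ‖inner ℂ v (a.pR (-j) w - a.pR j w)‖) atTop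
      (𝓝 ‖inner ℂ v (w - 0)‖) := (tendsto_const_nhds.inner (h1.sub h2)).norm
  rw [sub_zero] at h3
  refine le_of_tendsto h3 (Eventually.of_forall fun j => ?_)
  have := hbound (-j) (2 * j)
  rwa [show (-(j : ℤ) + ((2 * j : ℕ) : ℤ)) = j by push_cast; ring] at this

theorem tendsto_rho_J (hκ : a.κ ≤ 1) (hJ : Function.Injective a.J) (v : V) :
    Tendsto (fun j : ℕ => a.rho ((2 : ℝ) ^ (-(j : ℤ))) (a.J v)) atTop (𝓝 v) := by
  have hκ0 := a.κ_pos
  have hle : ∀ j : ℕ, (2 : ℝ) ^ (-(j : ℤ)) ≤ 1 := fun j => by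
    rw [zpow_neg, zpow_natCast]
    exact inv_le_one_of_one_le₀ (one_le_pow₀ (by norm_num))
  have hdense : Dense (range (a.rho 1)) := by
    have : (a.rho 1).toLinearMap.range.topologicalClosure = ⊤ := by
      rw [Submodule.topologicalClosure_eq_top_iff, Submodule.eq_bot_iff]
      intro x hx
      have h0 : ∀ g, inner ℂ (a.J (a.adj.Minv 1 x)) g = 0 := fun g => by
        rw [← ContinuousLinearMap.adjoint_inner_right, a.inner_Minv_adj one_pos]
        rw [Submodule.mem_orthogonal'] at hx
        exact hx _ ⟨g, rfl⟩
      have h1 : a.J (a.adj.Minv 1 x) = 0 := inner_self_eq_zero.1 (h0 _)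
      have h2 : a.adj.Minv 1 x = 0 := hJ (by rw [h1, map_zero])
      have h3 := a.adj.M_Minv_apply one_pos x
      rw [h2, map_zero] at h3
      exact h3.symm
    exact (Submodule.dense_iff_topologicalClosure_eq_top).2 this
  refine tendsto_apply_of_dense (C := 1 + ‖a.N‖ / a.κ)
    (T := fun j => a.rho ((2 : ℝ) ^ (-(j : ℤ))) ∘L a.J) (fun j x => ?_) hdense ?_ v
  · set t := (2 : ℝ) ^ (-(j : ℤ)) with ht
    have ht0 : 0 < t := two_zpow_pos _
    set w := x - a.rho t (a.J x) with hw
    have e := a.rho_J ht0 x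
    rw [← hw] at e
    have e1 : a.M t w = ((t ^ 2 : ℝ) : ℂ) • a.N x := by
      rw [e, map_smul, a.M_Minv_apply ht0]
    have e2 := a.re_inner_M_ge t w
    rw [e1, inner_smul_right, re_ofReal_mul] at e2
    have e3 : (inner ℂ w (a.N x)).re ≤ ‖w‖ * ‖a.N x‖ := re_inner_le_norm (𝕜 := ℂ) _ _
    have e4 : ‖a.N x‖ ≤ ‖a.N‖ * ‖x‖ := a.N.le_opNorm x
    have ht2 : t ^ 2 * a.κ ≤ 1 := by
      have : t ^ 2 ≤ 1 := pow_le_one₀ ht0.le (hle j)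
      nlinarith [pow_pos ht0 2]
    have e5 : t ^ 2 * (a.κ * ‖w‖ ^ 2) ≤ t ^ 2 * (‖w‖ * (‖a.N‖ * ‖x‖)) := by
      have := mul_le_mul_of_nonneg_left e3 (pow_pos ht0 2).le
      have h7 : ‖w‖ * ‖a.N x‖ ≤ ‖w‖ * (‖a.N‖ * ‖x‖) := by gcongr
      have := mul_le_mul_of_nonneg_left h7 (pow_pos ht0 2).le
      nlinarith [sq_nonneg ‖a.J w‖]
    have e6 := le_of_mul_le_mul_left e5 (pow_pos ht0 2)
    have e7 : ‖w‖ ≤ ‖a.N‖ / a.κ * ‖x‖ := by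
      rw [div_mul_eq_mul_div, le_div_iff₀ hκ0]
      rcases (norm_nonneg w).eq_or_lt with h0 | h0
      · rw [← h0, zero_mul]; positivity
      · refine le_of_mul_le_mul_left ?_ h0
        linarith
    have e8 : a.rho t (a.J x) = x - w := by rw [hw]; abel
    change ‖a.rho t (a.J x)‖ ≤ _
    rw [e8]
    refine (norm_sub_le _ _).trans ?_
    linarith
  · rintro _ ⟨g, rfl⟩
    rw [tendsto_iff_norm_sub_tendsto_zero]
    refine squeeze_zero (g := fun j : ℕ => (1 + 1 / Real.sqrt a.κ) * ‖g‖ * ((2 : ℝ) ^ (-(j : ℤ))))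
      (fun _ => norm_nonneg _) (fun j => ?_) ?_
    · set t := (2 : ℝ) ^ (-(j : ℤ)) with ht
      have ht0 : 0 < t := two_zpow_pos _
      have e := a.rho_J ht0 (a.rho 1 g)
      have e0 := a.N_rho one_pos g
      simp only [one_pow, ofReal_one, inv_one, one_smul] at e0
      rw [e0] at e
      set f := g - a.R 1 g with hf
      have e1 : a.rho 1 g - a.rho t (a.J (a.rho 1 g)) = ((t ^ 2 : ℝ) : ℂ) • a.rho t f := e
      change ‖a.rho t (a.J (a.rho 1 g)) - a.rho 1 g‖ ≤ _
      rw [norm_sub_rev, e1, norm_smul, norm_real, Real.norm_of_nonneg (by positivity)]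
      have e2 := a.re_inner_R ht0 f
      have e3 : (inner ℂ (a.R t f) f).re ≤ ‖a.R t f‖ * ‖f‖ := re_inner_le_norm (𝕜 := ℂ) _ _
      have e4 := a.norm_R_le ht0 f
      have e5 : ‖f‖ ≤ ‖g‖ := a.norm_sub_R_le one_pos g
      have e6 : (t * ‖a.rho t f‖) ^ 2 ≤ ((1 + 1 / Real.sqrt a.κ) * ‖g‖) ^ 2 := by
        have h1 : t ^ 2 * ‖a.rho t f‖ ^ 2 ≤ (1 + 1 / a.κ) * ‖g‖ ^ 2 := by
          have k1 : t ^ 2 * a.κ * ‖a.rho t f‖ ^ 2 ≤ ‖g‖ ^ 2 + t ^ 2 * a.κ * ‖g‖ ^ 2 := by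
            have k2 : ‖a.R t f‖ * ‖f‖ ≤ ‖g‖ ^ 2 := by
              rw [sq]; exact mul_le_mul (e4.trans e5) e5 (norm_nonneg _) (norm_nonneg _)
            have k3 : ‖a.R t f‖ ^ 2 ≤ ‖g‖ ^ 2 := by gcongr; exact e4.trans e5
            have k4 : t ^ 2 * a.κ * ‖a.R t f‖ ^ 2 ≤ t ^ 2 * a.κ * ‖g‖ ^ 2 := by gcongr
            nlinarith [sq_nonneg ‖a.R t f‖]
          have k5 : t ^ 2 ≤ 1 := pow_le_one₀ ht0.le (hle j)
          have k6 : t ^ 2 * a.κ * ‖g‖ ^ 2 ≤ a.κ * ‖g‖ ^ 2 := by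
            have : t ^ 2 * a.κ ≤ 1 * a.κ := by gcongr
            nlinarith [sq_nonneg ‖g‖]
          rw [one_add_div hκ0.ne', div_mul_eq_mul_div, le_div_iff₀ hκ0]
          nlinarith
        have h2 : (1 + 1 / a.κ) ≤ (1 + 1 / Real.sqrt a.κ) ^ 2 := by
          have : (1 / Real.sqrt a.κ) ^ 2 = 1 / a.κ := by rw [div_pow, Real.sq_sqrt hκ0.le, one_pow]
          have h3 : 0 ≤ 1 / Real.sqrt a.κ := by positivity
          nlinarith
        rw [mul_pow, mul_pow]
        exact h1.trans (by gcongr)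
      have e7 := le_of_sq_le_sq e6 (by positivity)
      nlinarith
    · simpa using tendsto_two_zpow_neg.const_mul ((1 + 1 / Real.sqrt a.κ) * ‖g‖)

theorem IsSqrt.le_norm_apply (h : a.IsSqrt S) (hκ : a.κ ≤ 1) (hJ : Function.Injective a.J)
    (hJd : DenseRange a.J) {C : ℝ} (hC : 0 ≤ C)
    (hmain : ∀ (v : V) (m : ℤ) (N : ℕ), ∑ i ∈ Finset.range N,
      (((2 : ℝ) ^ (m + i))⁻¹ * ‖a.J v - a.adj.Rd (m + i) (a.J v)‖) ^ 2 ≤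
        C ^ 2 * (‖v‖ ^ 2 - ‖a.J v‖ ^ 2))
    {v : V} (hv : a.J v ∈ S.dom) :
    a.κ * Real.sqrt (‖v‖ ^ 2 - ‖a.J v‖ ^ 2) ≤ 54 * C * ‖S.toFun (a.J v)‖ := by
  have hκ0 := a.κ_pos
  have hlim := tendsto_rho_J hκ hJ v
  have hlim2 : Tendsto (fun j : ℕ => a.κ * Real.sqrt (‖a.rho ((2 : ℝ) ^ (-(j : ℤ))) (a.J v)‖ ^ 2 -
      ‖a.J (a.rho ((2 : ℝ) ^ (-(j : ℤ))) (a.J v))‖ ^ 2)) atTop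
      (𝓝 (a.κ * Real.sqrt (‖v‖ ^ 2 - ‖a.J v‖ ^ 2))) := by
    refine Tendsto.const_mul _ ((Real.continuous_sqrt.tendsto _).comp ?_)
    exact (hlim.norm.pow 2).sub ((((a.J.continuous.tendsto _).comp hlim).norm).pow 2)
  refine le_of_tendsto hlim2 (Eventually.of_forall fun j => ?_)
  set t := (2 : ℝ) ^ (-(j : ℤ)) with ht
  have ht0 : 0 < t := two_zpow_pos _
  obtain ⟨r1, r2, r3⟩ := h.range_R t ht0 (a.J v)
  set v' := a.rho t (a.J v) with hv'
  have hJv' : a.J v' = a.R t (a.J v) := rfl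
  set D := Real.sqrt (‖v'‖ ^ 2 - ‖a.J v'‖ ^ 2) with hD
  have hD0 : 0 ≤ D := Real.sqrt_nonneg _
  have hD2 : D ^ 2 = ‖v'‖ ^ 2 - ‖a.J v'‖ ^ 2 := Real.sq_sqrt (by linarith [a.sq_norm_J_le v'])
  have e1 := h.norm_inner_le (v := a.J v') hJd (A := C * D) (by positivity) r1 r2 (fun m N => by
    rw [mul_pow, hD2]; exact hmain v' m N)
  have e2 : inner ℂ (a.J v') (S.toFun (S.toFun (a.R t (a.J v)))) = inner ℂ v' (a.N v') := by
    rw [a.N_rho ht0, r3, inner_smul_right, inner_smul_right, ContinuousLinearMap.adjoint_inner_right]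
  have e3 := a.coercive v'
  rw [← hD2] at e3
  have e4 : ‖S.toFun (a.R t (a.J v))‖ ≤ ‖S.toFun (a.J v)‖ := by
    rw [h.R_comm ht0 hv]; exact a.norm_R_le ht0 _
  have e5 : a.κ * D ^ 2 ≤ C * D * (54 * ‖S.toFun (a.J v)‖) := by
    refine e3.trans (((re_le_norm _).trans (e2 ▸ e1)).trans ?_)
    gcongr
  rcases hD0.eq_or_lt with h0 | h0
  · rw [← h0]; simp; positivity
  · refine le_of_mul_le_mul_left ?_ h0
    linarith

end AccForm

end

section

/-! ### Symmetric forms -/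

open Filter Topology

namespace AccForm

variable {V E : Type*} [NormedAddCommGroup V] [InnerProductSpace ℂ V] [CompleteSpace V]
  [NormedAddCommGroup E] [InnerProductSpace ℂ E] [CompleteSpace E]

/-- The form `‖v‖² - ‖J v‖²` itself. -/
structure IsSymm (a : AccForm V E) : Prop where
  symm : ∀ x y, inner ℂ (a.N x) y = inner ℂ x (a.N y)
  re_inner : ∀ v, (inner ℂ v (a.N v)).re = ‖v‖ ^ 2 - ‖a.J v‖ ^ 2
  κ_le : a.κ ≤ 1
  inj : Function.Injective a.J

variable {a : AccForm V E}

namespace IsSymm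

theorem adj_eq (h : a.IsSymm) : a.adj = a := by
  have : ContinuousLinearMap.adjoint a.N = a.N :=
    ((ContinuousLinearMap.eq_adjoint_iff _ _).2 h.symm).symm
  cases a
  simp only [adj] at *
  simp only [this]

theorem inner_Rd (h : a.IsSymm) (k : ℤ) (x y : E) :
    inner ℂ (a.Rd k x) y = inner ℂ x (a.Rd k y) := by
  have := a.inner_Rd_adj k x y
  rwa [h.adj_eq] at this

theorem re_inner_sub_Rd_le (h : a.IsSymm) (k : ℤ) (v : V) :
    (((2 : ℝ) ^ k) ^ 2)⁻¹ * (inner ℂ (a.J v - a.Rd k (a.J v)) (a.J v)).re ≤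
      ‖v‖ ^ 2 - ‖a.J v‖ ^ 2 := by
  set t := (2 : ℝ) ^ k with ht
  have ht0 : 0 < t := two_zpow_pos k
  set w := a.Minv t (a.N v) with hw
  have e := congrArg a.J (a.rho_J ht0 v)
  rw [map_sub, map_smul] at e
  have e' : a.J v - a.Rd k (a.J v) = ((t ^ 2 : ℝ) : ℂ) • a.J w := e
  rw [e', inner_smul_left, conj_ofReal, re_ofReal_mul, inv_mul_cancel_left₀ (by positivity)]
  have e1 : a.M t w = a.N v := a.M_Minv_apply ht0 _
  have e2 := a.inner_M t w v
  have e3 := a.inner_M t v w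
  rw [e1] at e3
  have e4 := a.re_inner_M_ge t w
  rw [e1] at e4
  have e5 : 0 ≤ a.κ * (‖w‖ ^ 2 - ‖a.J w‖ ^ 2) :=
    mul_nonneg a.κ_pos.le (by linarith [a.sq_norm_J_le w])
  have e6 := h.re_inner v
  have e7 : (inner ℂ (a.J w) (a.J v)).re = (inner ℂ (a.J v) (a.J w)).re :=
    inner_re_symm (𝕜 := ℂ) _ _
  have e8 : (inner ℂ v (a.N w)).re = (inner ℂ w (a.N v)).re := by
    rw [← h.symm]; exact inner_re_symm (𝕜 := ℂ) _ _
  have e9 := congrArg re e3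
  rw [add_re, re_ofReal_mul, e6, e8] at e9
  have : 0 ≤ t ^ 2 * (inner ℂ w (a.N v)).re := mul_nonneg (by positivity) (by
    refine le_trans ?_ e4
    positivity)
  linarith

theorem sq_norm_sub_Rd_le (h : a.IsSymm) (k : ℤ) (u : E) :
    3 / 4 * ‖u - a.Rd k u‖ ^ 2 ≤ (inner ℂ (u - a.Rd k u) u).re -
      1 / 4 * (inner ℂ (u - a.Rd (k + 1) u) u).re := by
  set x := u - a.Rd k u with hx
  have e1 : inner ℂ (x - a.Rd k x + (a.Psi k x)) u = inner ℂ (x + (3 : ℂ) • a.Rd (k + 1) x) x := by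
    rw [← Psi_eq, inner_add_left, inner_sub_left, h.inner_Rd, ← inner_sub_right, ← hx,
      inner_add_left, hx, map_sub, Psi, sub_apply,
      sub_apply]
    simp only [inner_sub_left, inner_sub_right, h.inner_Rd, Rd_succ_Rd, inner_smul_left,
      inner_smul_right, map_div₀, map_ofNat, map_one]
  have e2 : x - a.Rd k x + a.Psi k x = (4 / 3 : ℂ) • x - (1 / 3 : ℂ) • (u - a.Rd (k + 1) u) := by
    simp only [hx, Psi, map_sub, sub_apply, Rd_succ_Rd]
    module
  have e3 := a.sq_norm_Rd_le (k + 1) x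
  rw [e2, inner_sub_left, inner_smul_left, inner_smul_left, inner_add_left, inner_smul_left] at e1
  have e4 := congrArg re e1
  have e5 : (inner ℂ x x).re = ‖x‖ ^ 2 := inner_self_eq_norm_sq (𝕜 := ℂ) x
  rw [show (4 / 3 : ℂ) = ((4 / 3 : ℝ) : ℂ) by push_cast; rfl,
    show (1 / 3 : ℂ) = ((1 / 3 : ℝ) : ℂ) by push_cast; rfl,
    show (3 : ℂ) = ((3 : ℝ) : ℂ) by push_cast; rfl] at e4
  simp only [conj_ofReal, add_re, sub_re, re_ofReal_mul, e5] at e4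
  nlinarith [sq_nonneg ‖a.Rd (k + 1) x‖]

/-- The square function estimate for symmetric forms. -/
theorem sum_sq_le (h : a.IsSymm) (v : V) (m : ℤ) (N : ℕ) :
    ∑ i ∈ Finset.range N, (((2 : ℝ) ^ (m + i))⁻¹ * ‖a.J v - a.Rd (m + i) (a.J v)‖) ^ 2 ≤
      4 / 3 * (‖v‖ ^ 2 - ‖a.J v‖ ^ 2) := by
  set u := a.J v
  set c : ℤ → ℝ := fun k => (((2 : ℝ) ^ k) ^ 2)⁻¹ * (inner ℂ (u - a.Rd k u) u).re with hc
  have hstep : ∀ k, (((2 : ℝ) ^ k)⁻¹ * ‖u - a.Rd k u‖) ^ 2 ≤ 4 / 3 * (c k - c (k + 1)) := by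
    intro k
    have e := h.sq_norm_sub_Rd_le k u
    have e2 : (((2 : ℝ) ^ (k + 1)) ^ 2)⁻¹ = 1 / 4 * (((2 : ℝ) ^ k) ^ 2)⁻¹ := by
      rw [zpow_add_one₀ (by norm_num), mul_pow, mul_inv]; ring
    simp only [hc, e2]
    rw [mul_pow, inv_pow]
    have h0 : 0 ≤ (((2 : ℝ) ^ k) ^ 2)⁻¹ := by positivity
    nlinarith
  have hsum : ∑ i ∈ Finset.range N, (((2 : ℝ) ^ (m + i))⁻¹ * ‖u - a.Rd (m + i) u‖) ^ 2 ≤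
      4 / 3 * (c m - c (m + N)) := by
    have := Finset.sum_range_sub' (fun i : ℕ => c (m + i)) N
    simp only [Nat.cast_zero, add_zero] at this
    rw [← this, Finset.mul_sum]
    refine Finset.sum_le_sum fun i _ => ?_
    have := hstep (m + i)
    rw [add_assoc] at this
    exact_mod_cast this
  have h1 : c m ≤ ‖v‖ ^ 2 - ‖u‖ ^ 2 := h.re_inner_sub_Rd_le m v
  have h2 : 0 ≤ c (m + N) := by
    refine mul_nonneg (by positivity) ?_
    have e := a.sq_norm_Rd_le (m + N) u
    rw [inner_sub_left, sub_re]
    have e5 : (inner ℂ u u).re = ‖u‖ ^ 2 := inner_self_eq_norm_sq (𝕜 := ℂ) u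
    have e6 : (inner ℂ (a.Rd (m + N) u) u).re ≤ ‖a.Rd (m + N) u‖ * ‖u‖ :=
      re_inner_le_norm (𝕜 := ℂ) _ _
    have e7 := a.norm_Rd_le (m + N) u
    nlinarith [norm_nonneg u]
  linarith

end IsSymm

/-- The scaled distance of `J v` to its dyadic resolvents. -/
def tau (a : AccForm V E) (v : V) (k : ℤ) : ℝ := ((2 : ℝ) ^ k)⁻¹ * ‖a.J v - a.Rd k (a.J v)‖

/-- The smoothing operators `ρ J` at dyadic scales. -/
def pi (a : AccForm V E) (k : ℤ) (v : V) : V := a.rho ((2 : ℝ) ^ k) (a.J v)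

theorem tau_nonneg (v : V) (k : ℤ) : 0 ≤ a.tau v k := by unfold tau; positivity

theorem norm_sub_eq_tau (v : V) (k : ℤ) : ‖a.J v - a.Rd k (a.J v)‖ = (2 : ℝ) ^ k * a.tau v k := by
  unfold tau
  field_simp

theorem norm_J_pi_sub_le (v : V) (k : ℤ) :
    ‖a.J (a.pi k v - a.pi (k + 1) v)‖ ≤ 2 * (2 : ℝ) ^ k * (a.tau v k + a.tau v (k + 1)) := by
  have e : a.J (a.pi k v - a.pi (k + 1) v) =
      (a.J v - a.Rd (k + 1) (a.J v)) - (a.J v - a.Rd k (a.J v)) := by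
    rw [map_sub]; simp only [pi, Rd, R_apply]; abel
  rw [e]
  refine (norm_sub_le _ _).trans ?_
  rw [norm_sub_eq_tau, norm_sub_eq_tau, zpow_add_one₀ (by norm_num)]
  have := mul_nonneg (two_zpow_pos k).le (tau_nonneg (a := a) v k)
  nlinarith

theorem IsSymm.energy_pi_sub_le (h : a.IsSymm) (v : V) (k : ℤ) :
    ‖a.pi k v - a.pi (k + 1) v‖ ^ 2 - ‖a.J (a.pi k v - a.pi (k + 1) v)‖ ^ 2 ≤
      2 * (a.tau v k + a.tau v (k + 1)) ^ 2 := by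
  set w := a.pi k v - a.pi (k + 1) v with hw
  have hJ := norm_J_pi_sub_le (a := a) v k
  rw [← hw] at hJ
  rw [← h.re_inner w]
  have e1 := a.N_rho (two_zpow_pos k) (a.J v)
  have e2 := a.N_rho (two_zpow_pos (k + 1)) (a.J v)
  have e3 : inner ℂ w (a.N w) = inner ℂ (a.J w)
      (((((2 : ℝ) ^ k) ^ 2 : ℝ) : ℂ)⁻¹ • (a.J v - a.Rd k (a.J v)) -
        ((((2 : ℝ) ^ (k + 1)) ^ 2 : ℝ) : ℂ)⁻¹ • (a.J v - a.Rd (k + 1) (a.J v))) := by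
    have : a.N w = a.N (a.rho ((2 : ℝ) ^ k) (a.J v)) - a.N (a.rho ((2 : ℝ) ^ (k + 1)) (a.J v)) := by
      rw [hw, map_sub]; rfl
    rw [this, e1, e2, ← map_smul, ← map_smul, ← map_sub, ContinuousLinearMap.adjoint_inner_right]
    rfl
  rw [e3]
  refine (re_inner_le_norm (𝕜 := ℂ) _ _).trans ?_
  have e4 : ‖(((((2 : ℝ) ^ k) ^ 2 : ℝ) : ℂ)⁻¹ • (a.J v - a.Rd k (a.J v)) -
        ((((2 : ℝ) ^ (k + 1)) ^ 2 : ℝ) : ℂ)⁻¹ • (a.J v - a.Rd (k + 1) (a.J v)))‖ ≤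
        ((2 : ℝ) ^ k)⁻¹ * (a.tau v k + a.tau v (k + 1)) := by
    refine (norm_sub_le _ _).trans ?_
    rw [norm_smul, norm_smul, norm_inv, norm_inv, norm_real, norm_real,
      Real.norm_of_nonneg (by positivity), Real.norm_of_nonneg (by positivity), norm_sub_eq_tau,
      norm_sub_eq_tau, mul_add]
    refine add_le_add (le_of_eq (by field_simp)) ?_
    have := tau_nonneg (a := a) v (k + 1)
    rw [zpow_add_one₀ (by norm_num)]
    have h2 := two_zpow_pos k
    calc (((2 : ℝ) ^ k * 2) ^ 2)⁻¹ * ((2 : ℝ) ^ k * 2 * a.tau v (k + 1)) =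
        1 / 2 * (((2 : ℝ) ^ k)⁻¹ * a.tau v (k + 1)) := by field_simp
      _ ≤ 1 * (((2 : ℝ) ^ k)⁻¹ * a.tau v (k + 1)) := by gcongr; norm_num
      _ = _ := one_mul _
  calc _ ≤ (2 * (2 : ℝ) ^ k * (a.tau v k + a.tau v (k + 1))) *
        (((2 : ℝ) ^ k)⁻¹ * (a.tau v k + a.tau v (k + 1))) := mul_le_mul hJ e4 (norm_nonneg _) (by
          have := tau_nonneg (a := a) v (k + 1)
          have := tau_nonneg (a := a) v k
          positivity)
    _ = _ := by field_simp

/-- A discrete Young inequality. -/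
theorem sum_sq_conv_le {b : ℤ → ℝ} {β S B : ℝ} (hβ : 0 ≤ β)
    (hβS : ∀ M : ℕ, ∑ i ∈ Finset.range M, β ^ i ≤ S)
    (hB : ∀ (m : ℤ) (N : ℕ), ∑ i ∈ Finset.range N, b (m + i) ^ 2 ≤ B) (m : ℤ) (N M : ℕ) :
    ∑ i ∈ Finset.range N, (∑ j ∈ Finset.range M, β ^ j * b (m + i - 1 - j)) ^ 2 ≤ S ^ 2 * B := by
  have hS : 0 ≤ S := by simpa using hβS 0
  calc ∑ i ∈ Finset.range N, (∑ j ∈ Finset.range M, β ^ j * b (m + i - 1 - j)) ^ 2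
      ≤ ∑ i ∈ Finset.range N, S * ∑ j ∈ Finset.range M, β ^ j * b (m + i - 1 - j) ^ 2 := by
        refine Finset.sum_le_sum fun i _ => ?_
        have := Finset.sum_sq_le_sum_mul_sum_of_sq_le_mul (Finset.range M)
          (r := fun j => β ^ j * b (m + i - 1 - j))
          (f := fun j => β ^ j) (g := fun j : ℕ => β ^ j * b (m + i - 1 - j) ^ 2)
          (fun _ _ => by positivity) (fun _ _ => by positivity) (fun _ _ => le_of_eq (by ring))
        refine this.trans ?_
        have h0 : 0 ≤ ∑ j ∈ Finset.range M, β ^ j * b (m + i - 1 - j) ^ 2 :=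
          Finset.sum_nonneg fun _ _ => by positivity
        exact mul_le_mul_of_nonneg_right (hβS M) h0
    _ = S * ∑ j ∈ Finset.range M, β ^ j * ∑ i ∈ Finset.range N, b ((m - 1 - j) + i) ^ 2 := by
        rw [← Finset.mul_sum, Finset.sum_comm]
        congr 1
        refine Finset.sum_congr rfl fun j _ => ?_
        rw [Finset.mul_sum]
        refine Finset.sum_congr rfl fun i _ => ?_
        congr 3
        ring
    _ ≤ S * ∑ j ∈ Finset.range M, β ^ j * B := by
        gcongr
        exact hB _ _
    _ ≤ S * (S * B) := by
        rw [← Finset.sum_mul]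
        have hB0 : 0 ≤ B := by simpa using hB 0 0
        gcongr
        exact hβS M
    _ = _ := by ring

theorem exists_young_const : ∃ β S : ℝ, 0 < β ∧ β ≤ 1 ∧ β ^ 4 = 1 / 2 ∧ 0 ≤ S ∧
    ∀ M : ℕ, ∑ i ∈ Finset.range M, β ^ i ≤ S := by
  set β := Real.sqrt (Real.sqrt (1 / 2)) with hβ
  have h4 : β ^ 4 = 1 / 2 := by
    rw [show β ^ 4 = (β ^ 2) ^ 2 by ring, hβ, Real.sq_sqrt (by positivity),
      Real.sq_sqrt (by positivity)]
  have h0 : 0 < β := by positivity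
  have h1 : β < 1 := by
    by_contra! h
    have := one_le_pow₀ (n := 4) h
    linarith
  refine ⟨β, (1 - β)⁻¹, h0, h1.le, h4, inv_nonneg.2 (by linarith), fun M => ?_⟩
  have := (summable_geometric_of_lt_one h0.le h1).sum_le_tsum (Finset.range M)
    (fun i _ => by positivity)
  rwa [tsum_geometric_of_lt_one h0.le h1] at this

theorem exists_sum_sq_sub_pi_le : ∃ C₀ : ℝ, 0 ≤ C₀ ∧
    ∀ {V E F : Type} [NormedAddCommGroup V] [InnerProductSpace ℂ V] [CompleteSpace V]
      [NormedAddCommGroup E] [InnerProductSpace ℂ E] [CompleteSpace E]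
      [NormedAddCommGroup F] [NormedSpace ℂ F] {a : AccForm V E} (_ : a.IsSymm)
      (G : ℤ → V →L[ℂ] F) {C : ℝ} (_ : 0 ≤ C)
      (_ : ∀ (k : ℤ) (w : V) (s : ℝ), 0 < s → s ≤ 1 → ‖G k w‖ ^ 2 ≤
        C * ((s ^ 2)⁻¹ * (((2 : ℝ) ^ k) ^ 2)⁻¹ * ‖a.J w‖ ^ 2 + s * (‖w‖ ^ 2 - ‖a.J w‖ ^ 2)))
      (v : V) (m : ℤ) (N : ℕ),
      ∑ i ∈ Finset.range N, ‖G (m + i) (v - a.pi (m + i) v)‖ ^ 2 ≤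
        C₀ * C * (‖v‖ ^ 2 - ‖a.J v‖ ^ 2) := by
  obtain ⟨β, S, hβ, hβ1, hβ4, hS, hsum⟩ := exists_young_const
  refine ⟨6 * (S ^ 2 * (16 / 3)), by positivity, ?_⟩
  intro V E F _ _ _ _ _ _ _ _ a ha G C hC hG v m N
  set b : ℤ → ℝ := fun k => a.tau v k + a.tau v (k + 1) with hb
  have hb0 : ∀ k, 0 ≤ b k := fun k => add_nonneg (tau_nonneg _ _) (tau_nonneg _ _)
  have hB : ∀ (m : ℤ) (N : ℕ), ∑ i ∈ Finset.range N, b (m + i) ^ 2 ≤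
      16 / 3 * (‖v‖ ^ 2 - ‖a.J v‖ ^ 2) := by
    intro m N
    have e1 := ha.sum_sq_le v m N
    have e2 := ha.sum_sq_le v (m + 1) N
    calc _ ≤ ∑ i ∈ Finset.range N, (2 * a.tau v (m + i) ^ 2 + 2 * a.tau v (m + 1 + i) ^ 2) := by
          refine Finset.sum_le_sum fun i _ => ?_
          simp only [hb]
          rw [show m + (i : ℤ) + 1 = m + 1 + i by ring]
          nlinarith [sq_nonneg (a.tau v (m + i) - a.tau v (m + 1 + i))]
      _ ≤ _ := by
          rw [Finset.sum_add_distrib, ← Finset.mul_sum, ← Finset.mul_sum]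
          simp only [tau]
          linarith
  have hterm : ∀ (k : ℤ) (j : ℕ), ‖G k (a.pi (k - 1 - j) v - a.pi (k - j) v)‖ ≤
      Real.sqrt (6 * C) * (β ^ j * b (k - 1 - j)) := by
    intro k j
    set l := k - 1 - j with hl
    have hlk : k - j = l + 1 := by rw [hl]; ring
    rw [hlk]
    set w := a.pi l v - a.pi (l + 1) v
    have e1 := norm_J_pi_sub_le (a := a) v l
    have e2 := ha.energy_pi_sub_le v l
    change ‖a.J w‖ ≤ 2 * (2 : ℝ) ^ l * b l at e1
    change ‖w‖ ^ 2 - ‖a.J w‖ ^ 2 ≤ 2 * b l ^ 2 at e2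
    have e3 := hG k w (β ^ (2 * j)) (by positivity) (pow_le_one₀ hβ.le hβ1)
    refine le_of_sq_le_sq ?_ (by have := hb0 l; positivity)
    rw [mul_pow, Real.sq_sqrt (by positivity)]
    refine e3.trans ?_
    rw [show ∀ z, 6 * C * z = C * (6 * z) from fun z => by ring]
    refine mul_le_mul_of_nonneg_left ?_ hC
    have e4 : ‖a.J w‖ ^ 2 ≤ (2 * (2 : ℝ) ^ l * b l) ^ 2 := by gcongr
    have hk2 : (2 : ℝ) ^ k = (2 : ℝ) ^ l * 2 * 2 ^ j := by
      rw [show k = l + 1 + j by rw [hl]; ring, zpow_add₀ (by norm_num), zpow_add_one₀ (by norm_num),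
        zpow_natCast]
    have hs2 : ((β ^ (2 * j)) ^ 2)⁻¹ = 2 ^ j := by
      rw [← pow_mul, show 2 * j * 2 = 4 * j by ring, pow_mul, hβ4, one_div, inv_pow, inv_inv]
    rw [hs2, hk2]
    have hβj : (1 / 2 : ℝ) ^ j ≤ β ^ (2 * j) := by
      rw [← hβ4, ← pow_mul]
      exact pow_le_pow_of_le_one hβ.le hβ1 (by omega)
    have hl0 := two_zpow_pos l
    have e5 : (2 : ℝ) ^ j * (((2 : ℝ) ^ l * 2 * 2 ^ j) ^ 2)⁻¹ * ‖a.J w‖ ^ 2 ≤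
        (1 / 2 : ℝ) ^ j * b l ^ 2 := by
      calc _ ≤ (2 : ℝ) ^ j * (((2 : ℝ) ^ l * 2 * 2 ^ j) ^ 2)⁻¹ * (2 * (2 : ℝ) ^ l * b l) ^ 2 := by
            gcongr
        _ = _ := by
            rw [one_div, inv_pow]
            field_simp
    have e6 : β ^ (2 * j) * (‖w‖ ^ 2 - ‖a.J w‖ ^ 2) ≤ β ^ (2 * j) * (2 * b l ^ 2) := by gcongr
    have e7 : (1 / 2 : ℝ) ^ j * b l ^ 2 ≤ β ^ (2 * j) * b l ^ 2 := by gcongr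
    have e8 : (β ^ j * b l) ^ 2 = β ^ (2 * j) * b l ^ 2 := by rw [mul_pow, ← pow_mul, mul_comm j 2]
    rw [e8]
    have : 0 ≤ β ^ (2 * j) * b l ^ 2 := by positivity
    linarith
  have htel : ∀ (k : ℤ) (M : ℕ), ‖G k (a.pi (k - M) v - a.pi k v)‖ ≤
      Real.sqrt (6 * C) * ∑ j ∈ Finset.range M, β ^ j * b (k - 1 - j) := by
    intro k M
    have := Finset.sum_range_sub (fun j : ℕ => a.pi (k - j) v) M
    simp only [Nat.cast_zero, sub_zero] at this
    rw [← this, map_sum, Finset.mul_sum]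
    refine (norm_sum_le _ _).trans (Finset.sum_le_sum fun j _ => ?_)
    have := hterm k j
    rwa [show k - 1 - (j : ℤ) = k - ((j + 1 : ℕ) : ℤ) by push_cast; ring] at this ⊢
  have hM : ∀ M : ℕ, ∑ i ∈ Finset.range N, ‖G (m + i) (a.pi (m + i - M) v - a.pi (m + i) v)‖ ^ 2 ≤
      6 * (S ^ 2 * (16 / 3)) * C * (‖v‖ ^ 2 - ‖a.J v‖ ^ 2) := by
    intro M
    have e := sum_sq_conv_le hβ.le hsum hB m N M
    calc _ ≤ ∑ i ∈ Finset.range N, (6 * C) *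
          (∑ j ∈ Finset.range M, β ^ j * b (m + i - 1 - j)) ^ 2 := by
          refine Finset.sum_le_sum fun i _ => ?_
          have h1 := htel (m + i) M
          have h2 : (Real.sqrt (6 * C) * ∑ j ∈ Finset.range M, β ^ j * b (m + i - 1 - j)) ^ 2 =
              6 * C * (∑ j ∈ Finset.range M, β ^ j * b (m + i - 1 - j)) ^ 2 := by
            rw [mul_pow, Real.sq_sqrt (by positivity)]
          rw [← h2]
          gcongr
      _ ≤ 6 * C * (S ^ 2 * (16 / 3 * (‖v‖ ^ 2 - ‖a.J v‖ ^ 2))) := by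
          rw [← Finset.mul_sum]
          gcongr
      _ = _ := by ring
  have hlim : Tendsto (fun M : ℕ => ∑ i ∈ Finset.range N,
      ‖G (m + i) (a.pi (m + i - M) v - a.pi (m + i) v)‖ ^ 2) atTop
      (𝓝 (∑ i ∈ Finset.range N, ‖G (m + i) (v - a.pi (m + i) v)‖ ^ 2)) := by
    refine tendsto_finsetSum _ fun i _ => ?_
    refine Tendsto.pow (Tendsto.norm (((G (m + i)).continuous.tendsto _).comp
      (Tendsto.sub_const ?_ _))) 2
    set k := m + (i : ℤ)
    have h1 := tendsto_rho_J ha.κ_le ha.inj v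
    have h2 : Tendsto (fun j : ℤ => a.pi j v) atBot (𝓝 v) := by
      have h3 : Tendsto (fun j : ℕ => a.pi (-j) v) atTop (𝓝 v) := h1
      rw [Metric.tendsto_atTop] at h3
      rw [Metric.tendsto_nhds]
      intro ε hε
      obtain ⟨n, hn⟩ := h3 ε hε
      filter_upwards [eventually_le_atBot (-(n : ℤ))] with j hj
      have := hn (-j).toNat (by omega)
      rwa [show -(((-j).toNat : ℕ) : ℤ) = j by omega] at this
    refine h2.comp ?_
    exact tendsto_atBot_add_const_left atTop k
      (tendsto_neg_atTop_atBot.comp tendsto_natCast_atTop_atTop)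
  exact le_of_tendsto hlim (Eventually.of_forall hM)

end AccForm

end

section

/-! ### Multiplication operators on `L²` -/

section MulOp

variable {α X Y : Type*} [MeasurableSpace α] {μ : Measure α}
  [NormedAddCommGroup X] [NormedSpace ℂ X] [NormedAddCommGroup Y] [NormedSpace ℂ Y]

theorem memLp_apply_of_ae_norm_le {A : α → X →L[ℂ] Y} (hA : AEStronglyMeasurable A μ) {M : ℝ}
    (hM : ∀ᵐ x ∂μ, ‖A x‖ ≤ M) {f : α → X} (hf : MemLp f 2 μ) : MemLp (fun x => A x (f x)) 2 μ := by
  refine hf.of_le_mul (c := M)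
    (ContinuousLinearMap.aestronglyMeasurable_comp₂ (ContinuousLinearMap.id ℂ _) hA hf.1) ?_
  filter_upwards [hM] with x hx
  exact (A x).le_of_opNorm_le hx _

/-- Multiplication by an essentially bounded family of operators. -/
def mulOp (A : α → X →L[ℂ] Y) (hA : AEStronglyMeasurable A μ) {M : ℝ}
    (hM : ∀ᵐ x ∂μ, ‖A x‖ ≤ M) : Lp X 2 μ →L[ℂ] Lp Y 2 μ :=
  LinearMap.mkContinuous
    { toFun := fun f => (memLp_apply_of_ae_norm_le hA hM (Lp.memLp f)).toLp _
      map_add' := fun f g => by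
        rw [← MemLp.toLp_add]
        refine MemLp.toLp_congr _ _ ?_
        filter_upwards [Lp.coeFn_add f g] with x hx
        exact (congrArg (A x) hx).trans (map_add _ _ _)
      map_smul' := fun c f => by
        rw [RingHom.id_apply, ← MemLp.toLp_const_smul]
        refine MemLp.toLp_congr _ _ ?_
        filter_upwards [Lp.coeFn_smul c f] with x hx
        exact (congrArg (A x) hx).trans (map_smul _ _ _) } M fun f => by
      refine Lp.norm_le_mul_norm_of_ae_le_mul ?_
      filter_upwards [hM, (memLp_apply_of_ae_norm_le hA hM (Lp.memLp f)).coeFn_toLp] with x hx h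
      exact (congrArg norm h).trans_le ((A x).le_of_opNorm_le hx _)

theorem coeFn_mulOp {A : α → X →L[ℂ] Y} (hA : AEStronglyMeasurable A μ) {M : ℝ}
    (hM : ∀ᵐ x ∂μ, ‖A x‖ ≤ M) (f : Lp X 2 μ) : mulOp A hA hM f =ᵐ[μ] fun x => A x (f x) :=
  (memLp_apply_of_ae_norm_le hA hM (Lp.memLp f)).coeFn_toLp

theorem norm_mulOp_le {A : α → X →L[ℂ] Y} (hA : AEStronglyMeasurable A μ) {M : ℝ}
    (hM : ∀ᵐ x ∂μ, ‖A x‖ ≤ M) (f : Lp X 2 μ) : ‖mulOp A hA hM f‖ ≤ M * ‖f‖ := by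
  refine Lp.norm_le_mul_norm_of_ae_le_mul ?_
  filter_upwards [hM, coeFn_mulOp hA hM f] with x hx h
  exact (congrArg norm h).trans_le ((A x).le_of_opNorm_le hx _)

theorem norm_le_norm_of_ae_le {f : Lp X 2 μ} {g : Lp Y 2 μ} (h : ∀ᵐ x ∂μ, ‖f x‖ ≤ ‖g x‖) :
    ‖f‖ ≤ ‖g‖ :=
  (Lp.norm_le_mul_norm_of_ae_le_mul (c := 1) (by simpa using h)).trans_eq (one_mul _)

end MulOp

/-! ### The form domain -/

/-- The Hilbert space `L²(ℝⁿ; ℂⁿ)`. -/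
abbrev Lc (n : ℕ) := Lp (Cn n) 2 (volume : Measure (Rn n))

variable {n : ℕ}

/-- The directional derivative in direction `i`. -/
def pd (φ : Rn n → ℝ) (i : Fin n) (x : Rn n) : ℝ := fderiv ℝ φ x (EuclideanSpace.single i (1 : ℝ))

/-- The class of test functions. -/
def IsTest (φ : Rn n → ℝ) : Prop := ContDiff ℝ (⊤ : ℕ∞) φ ∧ HasCompactSupport φ

theorem IsTest.pd {φ : Rn n → ℝ} (h : IsTest φ) (i : Fin n) : IsTest (pd φ i) := by
  refine ⟨(h.1.fderiv_right (m := (⊤ : ℕ∞)) (by simp)).clm_apply contDiff_const, ?_⟩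
  exact h.2.fderiv_apply ℝ _

theorem IsTest.memLp {φ : Rn n → ℝ} (h : IsTest φ) :
    MemLp (fun x => (φ x : ℂ)) 2 (volume : Measure (Rn n)) :=
  (h.1.continuous.memLp_of_hasCompactSupport h.2).ofReal

open Classical in
/-- A real function as an element of `L²`. -/
def toL2 (φ : Rn n → ℝ) : L2 n :=
  if h : MemLp (fun x => (φ x : ℂ)) 2 (volume : Measure (Rn n)) then h.toLp _ else 0

theorem IsTest.coeFn_toL2 {φ : Rn n → ℝ} (h : IsTest φ) : toL2 φ =ᵐ[volume] fun x => (φ x : ℂ) := by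
  rw [toL2, dif_pos h.memLp]
  exact h.memLp.coeFn_toLp

theorem IsTest.inner_toL2 {φ : Rn n → ℝ} (h : IsTest φ) (f : L2 n) :
    inner ℂ (toL2 φ) f = ∫ x, (φ x : ℂ) * f x := by
  rw [L2.inner_def]
  refine integral_congr_ae ?_
  filter_upwards [h.coeFn_toL2] with x hx
  rw [hx]
  simp [mul_comm]

/-- The `i`-th component of a vector field. -/
def coordL (i : Fin n) : Lc n →L[ℂ] L2 n :=
  (EuclideanSpace.proj (𝕜 := ℂ) i : Cn n →L[ℂ] ℂ).compLpL 2 volume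

theorem coeFn_coordL (i : Fin n) (F : Lc n) : coordL i F =ᵐ[volume] fun x => F x i :=
  ContinuousLinearMap.coeFn_compLpL _ F

/-- `q` is the weak gradient of `u`. -/
def IsWGrad (u : L2 n) (q : Lc n) : Prop :=
  ∀ i, ∀ φ, IsTest φ → inner ℂ (toL2 φ) (coordL i q) = - inner ℂ (toL2 (pd φ i)) u

theorem IsWGrad.integral_eq {u : L2 n} {q : Lc n} (h : IsWGrad u q) (i : Fin n) {φ : Rn n → ℝ}
    (hφ : IsTest φ) : ∫ x, (φ x : ℂ) * q x i = - ∫ x, (pd φ i x : ℂ) * u x := by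
  rw [← (hφ.pd i).inner_toL2, ← h i φ hφ, hφ.inner_toL2]
  refine integral_congr_ae ?_
  filter_upwards [coeFn_coordL i q] with x hx
  rw [hx]

theorem isWGrad_iff {u : L2 n} {q : Lc n} :
    IsWGrad u q ↔ ∀ i, IsWeakPartial u i (fun x => q x i) := by
  refine ⟨fun h i => ⟨(Lp.memLp q).eval_piLp i, fun φ h1 h2 => h.integral_eq i ⟨h1, h2⟩⟩,
    fun h i φ hφ => ?_⟩
  rw [(hφ.pd i).inner_toL2, hφ.inner_toL2]
  refine Eq.trans (integral_congr_ae ?_) ((h i).2 φ hφ.1 hφ.2)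
  filter_upwards [coeFn_coordL i q] with x hx
  rw [hx]

theorem IsWGrad.unique {u : L2 n} {q q' : Lc n} (h : IsWGrad u q) (h' : IsWGrad u q') : q = q' := by
  apply Lp.ext
  have key : ∀ i, ∀ᵐ x, q x i = q' x i := fun i => by
    refine ae_eq_of_integral_contDiff_smul_eq
      (((Lp.memLp q).eval_piLp i).locallyIntegrable one_le_two)
      (((Lp.memLp q').eval_piLp i).locallyIntegrable one_le_two) fun φ h1 h2 => ?_
    simp only [real_smul]
    rw [h.integral_eq i ⟨h1, h2⟩, h'.integral_eq i ⟨h1, h2⟩]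
  filter_upwards [ae_all_iff.2 key] with x hx
  ext i
  exact hx i

/-- The ambient Hilbert space of triples `(u, (p, q))`. -/
abbrev W (n : ℕ) := WithLp 2 (L2 n × WithLp 2 (Lc n × Lc n))

/-- First component. -/
def W.J : W n →L[ℂ] L2 n := WithLp.fstL 2 ℂ _ _
/-- Second component. -/
def W.D1 : W n →L[ℂ] Lc n := WithLp.fstL 2 ℂ _ _ ∘L WithLp.sndL 2 ℂ _ _
/-- Third component. -/
def W.D2 : W n →L[ℂ] Lc n := WithLp.sndL 2 ℂ _ _ ∘L WithLp.sndL 2 ℂ _ _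

theorem W.norm_sq (w : W n) : ‖w‖ ^ 2 = ‖W.J w‖ ^ 2 + ‖W.D1 w‖ ^ 2 + ‖W.D2 w‖ ^ 2 := by
  rw [WithLp.prod_norm_sq_eq_of_L2, WithLp.prod_norm_sq_eq_of_L2, add_assoc]
  rfl

theorem aestronglyMeasurable_inv_one_add {b : Rn n → Cn n} (hb : AEStronglyMeasurable b volume) :
    AEStronglyMeasurable (fun x => (((1 + ‖b x‖)⁻¹ : ℝ) : ℂ)) volume :=
  Complex.continuous_ofReal.comp_aestronglyMeasurable
    ((hb.norm.aemeasurable.const_add 1).inv.aestronglyMeasurable)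

/-- The multiplier `(1 + |b|)⁻¹`. -/
def mulInv (b : Rn n → Cn n) (hb : AEStronglyMeasurable b volume) : Lc n →L[ℂ] Lc n :=
  mulOp (M := 1) (fun x => (((1 + ‖b x‖)⁻¹ : ℝ) : ℂ) • ContinuousLinearMap.id ℂ (Cn n))
    ((aestronglyMeasurable_inv_one_add hb).smul_const _) (by
      refine Filter.Eventually.of_forall fun x => ?_
      rw [norm_smul, norm_real, Real.norm_of_nonneg (by positivity)]
      exact mul_le_one₀ (inv_le_one_of_one_le₀ (by linarith [norm_nonneg (b x)])) (norm_nonneg _)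
        ContinuousLinearMap.norm_id_le)

/-- The multiplier `(1 + |b|)⁻¹ b`. -/
def mulInvB (b : Rn n → Cn n) (hb : AEStronglyMeasurable b volume) : L2 n →L[ℂ] Lc n :=
  mulOp (M := 1) (fun x => ContinuousLinearMap.toSpanSingleton ℂ ((((1 + ‖b x‖)⁻¹ : ℝ) : ℂ) • b x))
    ((ContinuousLinearMap.toSpanSingletonCLE (𝕜 := ℂ) (E := Cn n)).continuous.comp_aestronglyMeasurable
      ((aestronglyMeasurable_inv_one_add hb).smul hb)) (by
      refine Filter.Eventually.of_forall fun x => ?_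
      rw [ContinuousLinearMap.norm_toSpanSingleton, norm_smul, norm_real,
        Real.norm_of_nonneg (by positivity), inv_mul_le_iff₀ (by positivity)]
      linarith)

theorem coeFn_mulInv {b : Rn n → Cn n} (hb : AEStronglyMeasurable b volume) (F : Lc n) :
    mulInv b hb F =ᵐ[volume] fun x => (((1 + ‖b x‖)⁻¹ : ℝ) : ℂ) • F x :=
  coeFn_mulOp _ _ F

theorem coeFn_mulInvB {b : Rn n → Cn n} (hb : AEStronglyMeasurable b volume) (u : L2 n) :
    mulInvB b hb u =ᵐ[volume] fun x => u x • (((1 + ‖b x‖)⁻¹ : ℝ) : ℂ) • b x :=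
  coeFn_mulOp _ _ u

/-- The condition `p = q + u b`. -/
def compatL (b : Rn n → Cn n) (hb : AEStronglyMeasurable b volume) : W n →L[ℂ] Lc n :=
  mulInv b hb ∘L (W.D1 - W.D2) - mulInvB b hb ∘L W.J

theorem compatL_eq_zero_iff {b : Rn n → Cn n} (hb : AEStronglyMeasurable b volume) (w : W n) :
    compatL b hb w = 0 ↔ ∀ᵐ x, W.D1 w x = W.D2 w x + W.J w x • b x := by
  have h1 : compatL b hb w = mulInv b hb (W.D1 w - W.D2 w) - mulInvB b hb (W.J w) := rfl
  rw [h1, sub_eq_zero, Lp.ext_iff]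
  have key : ∀ᵐ x, (mulInv b hb (W.D1 w - W.D2 w) x = mulInvB b hb (W.J w) x ↔
      W.D1 w x = W.D2 w x + W.J w x • b x) := by
    filter_upwards [coeFn_mulInv hb (W.D1 w - W.D2 w), coeFn_mulInvB hb (W.J w),
      Lp.coeFn_sub (W.D1 w) (W.D2 w)] with x h1 h2 h3
    rw [h1, h2, h3]
    have hc : (((1 + ‖b x‖)⁻¹ : ℝ) : ℂ) ≠ 0 := by
      have : (1 + ‖b x‖)⁻¹ ≠ 0 := by positivity
      exact_mod_cast this
    rw [smul_comm (W.J w x), smul_right_inj hc, Pi.sub_apply, sub_eq_iff_eq_add']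
  exact ⟨fun h => by filter_upwards [h, key] with x h1 h2 using h2.1 h1,
    fun h => by filter_upwards [h, key] with x h1 h2 using h2.2 h1⟩

/-- The defect in the weak gradient condition. -/
def wgradL (i : Fin n) (φ : Rn n → ℝ) : W n →L[ℂ] ℂ :=
  innerSL ℂ (toL2 φ) ∘L coordL i ∘L W.D2 + innerSL ℂ (toL2 (pd φ i)) ∘L W.J

/-- The form domain `H¹_b`. -/
def VS (b : Rn n → Cn n) (hb : AEStronglyMeasurable b volume) : Submodule ℂ (W n) :=
  (compatL b hb).ker ⊓ ⨅ (i : Fin n) (φ : {φ : Rn n → ℝ // IsTest φ}), (wgradL i φ.1).ker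

theorem mem_VS {b : Rn n → Cn n} {hb : AEStronglyMeasurable b volume} {w : W n} :
    w ∈ VS b hb ↔ IsWGrad (W.J w) (W.D2 w) ∧ ∀ᵐ x, W.D1 w x = W.D2 w x + W.J w x • b x := by
  rw [VS, Submodule.mem_inf, and_comm, LinearMap.mem_ker]
  refine and_congr ?_ (compatL_eq_zero_iff hb w)
  simp only [Submodule.mem_iInf, LinearMap.mem_ker, Subtype.forall, IsWGrad]
  refine forall₃_congr fun i φ hφ => ?_
  rw [eq_neg_iff_add_eq_zero]
  rfl

theorem isClosed_VS (b : Rn n → Cn n) (hb : AEStronglyMeasurable b volume) :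
    IsClosed (VS b hb : Set (W n)) := by
  rw [VS, Submodule.coe_inf]
  refine (ContinuousLinearMap.isClosed_ker _).inter ?_
  simp only [Submodule.coe_iInf]
  exact isClosed_iInter fun i => isClosed_iInter fun φ => ContinuousLinearMap.isClosed_ker _

instance (b : Rn n → Cn n) (hb : AEStronglyMeasurable b volume) : CompleteSpace (VS b hb) :=
  (isClosed_VS b hb).completeSpace_coe

end

section

variable {n : ℕ}

/-! ### Multiplication of the form domain by smooth functions -/

/-- The gradient as a complex vector. -/
def gradC (φ : Rn n → ℝ) (x : Rn n) : Cn n := WithLp.toLp 2 fun i => (pd φ i x : ℂ)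

@[simp] theorem gradC_apply (φ : Rn n → ℝ) (x : Rn n) (i : Fin n) : gradC φ x i = (pd φ i x : ℂ) := rfl

/-- A smooth bounded function with bounded gradient. -/
structure IsWeight (ω : Rn n → ℝ) : Prop where
  contDiff : ContDiff ℝ (⊤ : ℕ∞) ω
  bdd : ∃ C, ∀ x, |ω x| ≤ C
  grad_bdd : ∃ C, ∀ x, ‖gradC ω x‖ ≤ C

theorem continuous_pd {ω : Rn n → ℝ} (h : ContDiff ℝ (⊤ : ℕ∞) ω) (i : Fin n) :
    Continuous (pd ω i) :=
  ((h.fderiv_right (m := (⊤ : ℕ∞)) (by simp)).clm_apply contDiff_const).continuous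

theorem continuous_gradC {ω : Rn n → ℝ} (h : ContDiff ℝ (⊤ : ℕ∞) ω) : Continuous (gradC ω) :=
  (PiLp.continuous_toLp 2 _).comp (continuous_pi fun i =>
    Complex.continuous_ofReal.comp (continuous_pd h i))

theorem pd_mul {φ ω : Rn n → ℝ} (hφ : ContDiff ℝ (⊤ : ℕ∞) φ) (hω : ContDiff ℝ (⊤ : ℕ∞) ω)
    (i : Fin n) (x : Rn n) : pd (φ * ω) i x = pd φ i x * ω x + φ x * pd ω i x := by
  rw [pd, fderiv_mul (hφ.differentiable (by simp) x) (hω.differentiable (by simp) x)]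
  simp only [add_apply, smul_apply, smul_eq_mul, pd]
  ring

namespace IsWeight

variable {ω : Rn n → ℝ} (h : IsWeight ω)

/-- Multiplication by a weight. -/
def mul (h : IsWeight ω) (X : Type*) [NormedAddCommGroup X] [NormedSpace ℂ X] :
    Lp X 2 (volume : Measure (Rn n)) →L[ℂ] Lp X 2 (volume : Measure (Rn n)) :=
  mulOp (M := h.bdd.choose) (fun x => (ω x : ℂ) • ContinuousLinearMap.id ℂ X)
    ((Complex.continuous_ofReal.comp h.contDiff.continuous).aestronglyMeasurable.smul_const _) (by
      refine Filter.Eventually.of_forall fun x => ?_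
      rw [norm_smul, norm_real]
      exact (mul_le_of_le_one_right (norm_nonneg _) ContinuousLinearMap.norm_id_le).trans
        (h.bdd.choose_spec x))

/-- Multiplication by the gradient of a weight. -/
def gmul : L2 n →L[ℂ] Lc n :=
  mulOp (M := h.grad_bdd.choose) (fun x => ContinuousLinearMap.toSpanSingleton ℂ (gradC ω x))
    (((ContinuousLinearMap.toSpanSingletonCLE (𝕜 := ℂ) (E := Cn n)).continuous.comp
      (continuous_gradC h.contDiff)).aestronglyMeasurable) (by
      refine Filter.Eventually.of_forall fun x => ?_
      rw [ContinuousLinearMap.norm_toSpanSingleton]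
      exact h.grad_bdd.choose_spec x)

theorem coeFn_mul {X : Type*} [NormedAddCommGroup X] [NormedSpace ℂ X]
    (f : Lp X 2 (volume : Measure (Rn n))) : h.mul X f =ᵐ[volume] fun x => (ω x : ℂ) • f x :=
  coeFn_mulOp _ _ f

theorem coeFn_gmul (f : L2 n) : h.gmul f =ᵐ[volume] fun x => f x • gradC ω x :=
  coeFn_mulOp _ _ f

theorem isWGrad_mul {u : L2 n} {q : Lc n} (hu : IsWGrad u q) :
    IsWGrad (h.mul ℂ u) (h.mul (Cn n) q + h.gmul u) := by
  intro i φ hφ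
  have hφω : IsTest (φ * ω) := ⟨hφ.1.mul h.contDiff, hφ.2.mul_right⟩
  have h1 : IsTest (φ * pd ω i) := ⟨hφ.1.mul
    ((h.contDiff.fderiv_right (m := (⊤ : ℕ∞)) (by simp)).clm_apply contDiff_const), hφ.2.mul_right⟩
  have h2 : IsTest (pd φ i * ω) := ⟨(hφ.pd i).1.mul h.contDiff, (hφ.pd i).2.mul_right⟩
  have key := hu i _ hφω
  have e1 : toL2 (pd (φ * ω) i) = toL2 (pd φ i * ω) + toL2 (φ * pd ω i) := by
    apply Lp.ext
    filter_upwards [(hφω.pd i).coeFn_toL2, h1.coeFn_toL2, h2.coeFn_toL2,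
      Lp.coeFn_add (toL2 (pd φ i * ω)) (toL2 (φ * pd ω i))] with x a1 a2 a3 a4
    rw [a1, a4, Pi.add_apply, a2, a3, pd_mul hφ.1 h.contDiff]
    simp
  have e2 : inner ℂ (toL2 φ) (coordL i (h.mul (Cn n) q)) = inner ℂ (toL2 (φ * ω)) (coordL i q) := by
    rw [L2.inner_def, L2.inner_def]
    refine integral_congr_ae ?_
    filter_upwards [hφ.coeFn_toL2, hφω.coeFn_toL2, coeFn_coordL i q,
      coeFn_coordL i (h.mul (Cn n) q), h.coeFn_mul q] with x a1 a2 a3 a4 a5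
    rw [a1, a2, a3, a4, a5]
    simp
    ring
  have e3 : inner ℂ (toL2 φ) (coordL i (h.gmul u)) = inner ℂ (toL2 (φ * pd ω i)) u := by
    rw [L2.inner_def, L2.inner_def]
    refine integral_congr_ae ?_
    filter_upwards [hφ.coeFn_toL2, h1.coeFn_toL2, coeFn_coordL i (h.gmul u),
      h.coeFn_gmul u] with x a1 a2 a3 a4
    rw [a1, a2, a3, a4]
    simp
    ring
  have e4 : inner ℂ (toL2 (pd φ i)) (h.mul ℂ u) = inner ℂ (toL2 (pd φ i * ω)) u := by
    rw [L2.inner_def, L2.inner_def]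
    refine integral_congr_ae ?_
    filter_upwards [(hφ.pd i).coeFn_toL2, h2.coeFn_toL2, h.coeFn_mul u] with x a1 a2 a3
    rw [a1, a2, a3]
    simp
    ring
  rw [map_add, inner_add_right, e2, e3, e4, key, e1, inner_add_left]
  ring

theorem mul_inner {X : Type*} [NormedAddCommGroup X] [InnerProductSpace ℂ X]
    (f g : Lp X 2 (volume : Measure (Rn n))) : inner ℂ (h.mul X f) g = inner ℂ f (h.mul X g) := by
  rw [L2.inner_def, L2.inner_def]
  refine integral_congr_ae ?_
  filter_upwards [h.coeFn_mul f, h.coeFn_mul g] with x a1 a2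
  rw [a1, a2, inner_smul_left, inner_smul_right, conj_ofReal]

theorem gmul_mul (u : L2 n) : h.gmul (h.mul ℂ u) = h.mul (Cn n) (h.gmul u) := by
  apply Lp.ext
  filter_upwards [h.coeFn_gmul (h.mul ℂ u), h.coeFn_mul u, h.coeFn_mul (h.gmul u),
    h.coeFn_gmul u] with x a1 a2 a3 a4
  rw [a1, a2, a3, a4, smul_eq_mul, mul_smul]

theorem mul_mulOp {A : Rn n → Cn n →L[ℂ] Cn n} (hA : AEStronglyMeasurable A volume) {M : ℝ}
    (hM : ∀ᵐ x, ‖A x‖ ≤ M) (F : Lc n) :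
    h.mul (Cn n) (mulOp A hA hM F) = mulOp A hA hM (h.mul (Cn n) F) := by
  apply Lp.ext
  filter_upwards [coeFn_mulOp hA hM F, h.coeFn_mul F, h.coeFn_mul (mulOp A hA hM F),
    coeFn_mulOp hA hM (h.mul (Cn n) F)] with x a1 a2 a3 a4
  rw [a3, a1, a4, a2, map_smul]

end IsWeight

/-- The abstract data of the operator `L^A_b`: the form domain `V`, the operators `J` (embedding
into `L²`), `D1 = ∇ + b`, `D2 = ∇` and the multiplication `AL` by `A`, with bound `M` and Gårding
constant `κ`. -/
structure KData (n : ℕ) (M κ : ℝ) (V : Type) [NormedAddCommGroup V] [InnerProductSpace ℂ V] where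
  J : V →L[ℂ] L2 n
  D1 : V →L[ℂ] Lc n
  D2 : V →L[ℂ] Lc n
  AL : Lc n →L[ℂ] Lc n
  norm_sq : ∀ v, ‖v‖ ^ 2 = ‖J v‖ ^ 2 + ‖D1 v‖ ^ 2 + ‖D2 v‖ ^ 2
  isWGrad : ∀ v, IsWGrad (J v) (D2 v)
  injective_J : Function.Injective J
  norm_AL_le : ∀ F, ‖AL F‖ ≤ M * ‖F‖
  AL_mul : ∀ {ω : Rn n → ℝ} (h : IsWeight ω) F, h.mul (Cn n) (AL F) = AL (h.mul (Cn n) F)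
  exists_mulV : ∀ {ω : Rn n → ℝ} (h : IsWeight ω) (v : V), ∃ w : V, J w = h.mul ℂ (J v) ∧
    D1 w = h.mul (Cn n) (D1 v) + h.gmul (J v) ∧ D2 w = h.mul (Cn n) (D2 v) + h.gmul (J v)
  M_nonneg : 0 ≤ M
  κ_pos : 0 < κ
  κ_le : κ ≤ 1
  garding : ∀ v, κ * ‖D2 v‖ ^ 2 ≤ (inner ℂ (D2 v) (AL (D2 v))).re

namespace KData

open ContinuousLinearMap

variable {M κ : ℝ} {V : Type} [NormedAddCommGroup V] [InnerProductSpace ℂ V] [CompleteSpace V]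
  (D : KData n M κ V)

theorem norm_J_le (v : V) : ‖D.J v‖ ≤ ‖v‖ := by
  refine le_of_sq_le_sq ?_ (norm_nonneg _)
  rw [D.norm_sq]
  nlinarith [sq_nonneg ‖D.D1 v‖, sq_nonneg ‖D.D2 v‖]

/-- The form of `L^A_b`. -/
def form : AccForm V (L2 n) where
  J := D.J
  N := adjoint D.D1 ∘L D.D1 + adjoint D.D2 ∘L D.AL ∘L D.D2
  κ := κ
  κ_pos := D.κ_pos
  norm_J_le := D.norm_J_le
  coercive v := by
    simp only [add_apply, comp_apply, inner_add_right, adjoint_inner_right, add_re]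
    have h1 : (inner ℂ (D.D1 v) (D.D1 v)).re = ‖D.D1 v‖ ^ 2 := inner_self_eq_norm_sq (𝕜 := ℂ) _
    have h2 := D.garding v
    rw [h1, D.norm_sq]
    have h3 := D.κ_le
    nlinarith [sq_nonneg ‖D.D1 v‖]

/-- The form of `(∇+b)*(∇+b) - Δ`. -/
def formT : AccForm V (L2 n) where
  J := D.J
  N := adjoint D.D1 ∘L D.D1 + adjoint D.D2 ∘L D.D2
  κ := 1
  κ_pos := one_pos
  norm_J_le := D.norm_J_le
  coercive v := by
    simp only [add_apply, comp_apply, inner_add_right, adjoint_inner_right, add_re]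
    have h1 : (inner ℂ (D.D1 v) (D.D1 v)).re = ‖D.D1 v‖ ^ 2 := inner_self_eq_norm_sq (𝕜 := ℂ) _
    have h2 : (inner ℂ (D.D2 v) (D.D2 v)).re = ‖D.D2 v‖ ^ 2 := inner_self_eq_norm_sq (𝕜 := ℂ) _
    rw [h1, h2, D.norm_sq]
    linarith

theorem inner_formT_N (x y : V) :
    inner ℂ x (D.formT.N y) = inner ℂ (D.D1 x) (D.D1 y) + inner ℂ (D.D2 x) (D.D2 y) := by
  simp only [formT, add_apply, comp_apply, inner_add_right, adjoint_inner_right]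

theorem inner_form_N (x y : V) :
    inner ℂ x (D.form.N y) = inner ℂ (D.D1 x) (D.D1 y) + inner ℂ (D.D2 x) (D.AL (D.D2 y)) := by
  simp only [form, add_apply, comp_apply, inner_add_right, adjoint_inner_right]

theorem isSymm_formT : D.formT.IsSymm where
  symm x y := by
    rw [inner_formT_N, ← inner_conj_symm, inner_formT_N, map_add, inner_conj_symm, inner_conj_symm]
  re_inner v := by
    rw [inner_formT_N, add_re]
    have h1 : (inner ℂ (D.D1 v) (D.D1 v)).re = ‖D.D1 v‖ ^ 2 := inner_self_eq_norm_sq (𝕜 := ℂ) _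
    have h2 : (inner ℂ (D.D2 v) (D.D2 v)).re = ‖D.D2 v‖ ^ 2 := inner_self_eq_norm_sq (𝕜 := ℂ) _
    rw [h1, h2, D.norm_sq]
    change _ = _ - ‖D.J v‖ ^ 2
    ring
  κ_le := le_rfl
  inj := D.injective_J

/-- The data of the adjoint operator. -/
def adj : KData n M κ V where
  __ := D
  AL := adjoint D.AL
  norm_AL_le F := by
    refine (adjoint D.AL).le_of_opNorm_le ?_ F
    rw [LinearIsometryEquiv.norm_map]
    exact opNorm_le_bound _ D.M_nonneg D.norm_AL_le
  AL_mul h F := by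
    refine ext_inner_left ℂ fun G => ?_
    rw [← h.mul_inner, adjoint_inner_right, adjoint_inner_right, ← h.mul_inner, D.AL_mul]
  garding v := by
    rw [adjoint_inner_right, ← inner_conj_symm, conj_re]
    exact D.garding v

theorem adj_form : D.adj.form = D.form.adj := by
  have : D.adj.form.N = D.form.adj.N := by
    refine ContinuousLinearMap.ext fun v => ext_inner_left ℂ fun w => ?_
    have h1 : inner ℂ w (D.form.adj.N v) = inner ℂ (D.form.N w) v := adjoint_inner_right _ _ _
    have h2 : inner ℂ (D.D2 w) (D.adj.AL (D.D2 v)) = inner ℂ (D.AL (D.D2 w)) (D.D2 v) :=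
      adjoint_inner_right _ _ _
    rw [h1, inner_form_N, ← inner_conj_symm (D.form.N w), inner_form_N, map_add, inner_conj_symm,
      inner_conj_symm]
    exact congrArg₂ _ rfl h2
  unfold form AccForm.adj
  congr 1

/-! ### The operators `θ` -/

/-- The operator `(1 + t² L)⁻¹ t D₂† A`, with values in the form domain. -/
def sig (t : ℝ) : Lc n →L[ℂ] V := (t : ℂ) • (D.form.Minv t ∘L adjoint D.D2 ∘L D.AL)

/-- The operator `(1 + t² L)⁻¹ t D₂† A`. -/
def theta (t : ℝ) : Lc n →L[ℂ] L2 n := D.J ∘L D.sig t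

theorem theta_apply (t : ℝ) (G : Lc n) : D.theta t G = D.J (D.sig t G) := rfl

theorem M_sig {t : ℝ} (ht : 0 < t) (G : Lc n) :
    D.form.M t (D.sig t G) = (t : ℂ) • adjoint D.D2 (D.AL G) := by
  simp only [sig, smul_apply, map_smul, comp_apply, D.form.M_Minv_apply ht]

theorem sig_eq {t : ℝ} (ht : 0 < t) (G : Lc n) (z : V) :
    inner ℂ (D.J z) (D.J (D.sig t G)) + ((t ^ 2 : ℝ) : ℂ) *
      (inner ℂ (D.D1 z) (D.D1 (D.sig t G)) + inner ℂ (D.D2 z) (D.AL (D.D2 (D.sig t G)))) =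
    (t : ℂ) * inner ℂ (D.D2 z) (D.AL G) := by
  rw [← inner_form_N]
  have h1 := D.form.inner_M t z (D.sig t G)
  rw [D.M_sig ht, inner_smul_right, adjoint_inner_right] at h1
  exact h1.symm

/-- The energy estimate for `sig`. -/
theorem energy_sig_le {t : ℝ} (ht : 0 < t) (G : Lc n) :
    ‖D.theta t G‖ ^ 2 + κ / 2 * (t ^ 2 * (‖D.D1 (D.sig t G)‖ ^ 2 + ‖D.D2 (D.sig t G)‖ ^ 2)) ≤
      M ^ 2 / (2 * κ) * ‖G‖ ^ 2 := by
  set s := D.sig t G with hs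
  have h1 := congrArg re (D.sig_eq ht G s)
  have h2 : (inner ℂ (D.J s) (D.J s)).re = ‖D.J s‖ ^ 2 := inner_self_eq_norm_sq (𝕜 := ℂ) _
  have h3 : (inner ℂ (D.D1 s) (D.D1 s)).re = ‖D.D1 s‖ ^ 2 := inner_self_eq_norm_sq (𝕜 := ℂ) _
  have h4 : κ * ‖D.D2 s‖ ^ 2 ≤ (inner ℂ (D.D2 s) (D.AL (D.D2 s))).re := D.garding s
  have h5 : (inner ℂ (D.D2 s) (D.AL G)).re ≤ ‖D.D2 s‖ * (M * ‖G‖) := by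
    refine (re_le_norm _).trans ((norm_inner_le_norm _ _).trans ?_)
    gcongr
    exact D.norm_AL_le G
  rw [← hs, add_re, re_ofReal_mul, re_ofReal_mul, add_re, h2, h3] at h1
  have hκ := D.κ_pos
  have hκ1 := D.κ_le
  rw [theta_apply, ← hs]
  have h6 : t * (inner ℂ (D.D2 s) (D.AL G)).re ≤
      κ / 2 * (t ^ 2 * ‖D.D2 s‖ ^ 2) + M ^ 2 / (2 * κ) * ‖G‖ ^ 2 := by
    calc t * (inner ℂ (D.D2 s) (D.AL G)).re ≤ t * (‖D.D2 s‖ * (M * ‖G‖)) := by gcongr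
      _ ≤ _ := by
        have : 0 ≤ κ / 2 * (t * ‖D.D2 s‖ - M * ‖G‖ / κ) ^ 2 := by positivity
        have e : κ / 2 * (t * ‖D.D2 s‖ - M * ‖G‖ / κ) ^ 2 = κ / 2 * (t ^ 2 * ‖D.D2 s‖ ^ 2) +
          M ^ 2 / (2 * κ) * ‖G‖ ^ 2 - t * (‖D.D2 s‖ * (M * ‖G‖)) := by
          field_simp
          ring
        linarith
  have h7 : t ^ 2 * (κ / 2 * ‖D.D1 s‖ ^ 2) ≤ t ^ 2 * ‖D.D1 s‖ ^ 2 := by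
    gcongr
    nlinarith [sq_nonneg ‖D.D1 s‖]
  have h8 : t ^ 2 * (κ * ‖D.D2 s‖ ^ 2) ≤ t ^ 2 * (inner ℂ (D.D2 s) (D.AL (D.D2 s))).re := by gcongr
  nlinarith

/-- The absorption argument in the weighted energy estimate. -/
theorem absorb_weighted {M κ η t X Z r w : ℝ} (hM : 0 ≤ M) (hκ : 0 < κ) (hκ1 : κ ≤ 1)
    (hη : η = κ / (4 * (1 + M))) (ht : 0 < t) (he0 : 0 ≤ r)
    (h6 : t * r ≤ η * Z)
    (m1 : Z ^ 2 + κ * (t * X) ^ 2 ≤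
      (1 + M) * (t * r) ^ 2 + 2 * M * (t * X) * (t * r) + M * (t * X + t * r) * w) :
    Z ^ 2 ≤ 8 * M ^ 2 / κ * w ^ 2 := by
  have hr : (t * r) ^ 2 ≤ η ^ 2 * Z ^ 2 := by
    rw [← mul_pow]
    exact pow_le_pow_left₀ (by positivity) h6 2
  have m2 : 2 * M * (t * X) * (t * r) ≤ κ / 4 * (t * X) ^ 2 + 4 * M ^ 2 / κ * (t * r) ^ 2 := by
    have : 0 ≤ κ / 4 * (t * X - 4 * M / κ * (t * r)) ^ 2 := by positivity
    have e : κ / 4 * (t * X - 4 * M / κ * (t * r)) ^ 2 = κ / 4 * (t * X) ^ 2 +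
      4 * M ^ 2 / κ * (t * r) ^ 2 - 2 * M * (t * X) * (t * r) := by field_simp; ring
    linarith
  have m3 : M * (t * X) * w ≤ κ / 4 * (t * X) ^ 2 + M ^ 2 / κ * w ^ 2 := by
    have : 0 ≤ κ / 4 * (t * X - 2 * M / κ * w) ^ 2 := by positivity
    have e : κ / 4 * (t * X - 2 * M / κ * w) ^ 2 = κ / 4 * (t * X) ^ 2 +
      M ^ 2 / κ * w ^ 2 - M * (t * X) * w := by field_simp; ring
    linarith
  have m4 : M * (t * r) * w ≤ (t * r) ^ 2 + M ^ 2 / 4 * w ^ 2 := by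
    nlinarith [sq_nonneg (t * r - M / 2 * w)]
  have m5 : (1 + M + 4 * M ^ 2 / κ + 1) * η ^ 2 ≤ 1 / 2 := by
    rw [hη]
    have : (1 + M + 4 * M ^ 2 / κ + 1) * (κ / (4 * (1 + M))) ^ 2 =
      ((2 + M) * κ ^ 2 + 4 * M ^ 2 * κ) / (16 * (1 + M) ^ 2) := by field_simp; ring
    rw [this, div_le_iff₀ (by positivity)]
    have : κ ^ 2 ≤ 1 := by nlinarith
    nlinarith [mul_nonneg hM hM, mul_le_mul_of_nonneg_left hκ1 (mul_nonneg hM hM),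
      mul_le_mul_of_nonneg_left this hM]
  have m6 : (1 + M + 4 * M ^ 2 / κ + 1) * (t * r) ^ 2 ≤ 1 / 2 * Z ^ 2 := by
    calc (1 + M + 4 * M ^ 2 / κ + 1) * (t * r) ^ 2
        ≤ (1 + M + 4 * M ^ 2 / κ + 1) * (η ^ 2 * Z ^ 2) := by gcongr
      _ = (1 + M + 4 * M ^ 2 / κ + 1) * η ^ 2 * Z ^ 2 := by ring
      _ ≤ _ := by gcongr
  have m7 : M ^ 2 ≤ M ^ 2 / κ := by
    rw [le_div_iff₀ hκ]
    nlinarith [sq_nonneg M]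
  have m8 : M ^ 2 * w ^ 2 ≤ M ^ 2 / κ * w ^ 2 := by gcongr
  have m9 : 8 * M ^ 2 / κ * w ^ 2 = 8 * (M ^ 2 / κ * w ^ 2) := by ring
  rw [m9]
  have m10 : 0 ≤ κ * (t * X) ^ 2 := by positivity
  nlinarith

set_option maxHeartbeats 1000000 in
/-- The weighted energy estimate. -/
theorem weighted_theta_le {t η : ℝ} (ht : 0 < t) (hη : η = κ / (4 * (1 + M))) {ω : Rn n → ℝ}
    (h : IsWeight ω) (hω : ∀ x, t * ‖gradC ω x‖ ≤ η * |ω x|) (G : Lc n) :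
    ‖h.mul ℂ (D.theta t G)‖ ^ 2 ≤ 8 * M ^ 2 / κ * ‖h.mul (Cn n) G‖ ^ 2 := by
  set s := D.sig t G with hs
  have hM := D.M_nonneg
  have hκ := D.κ_pos
  have hκ1 := D.κ_le
  have hη0 : 0 < η := by rw [hη]; positivity
  obtain ⟨y, y1, y2, y3⟩ := D.exists_mulV h s
  obtain ⟨z, z1, z2, z3⟩ := D.exists_mulV h y
  set e := h.gmul (D.J s) with he
  have k1 : D.D1 z = h.mul (Cn n) (D.D1 y + e) := by rw [z2, y1, h.gmul_mul, map_add]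
  have k2 : D.D2 z = h.mul (Cn n) (D.D2 y + e) := by rw [z3, y1, h.gmul_mul, map_add]
  have k3 : h.mul (Cn n) (D.D1 s) = D.D1 y - e := by rw [y2, add_sub_cancel_right]
  have k4 : h.mul (Cn n) (D.D2 s) = D.D2 y - e := by rw [y3, add_sub_cancel_right]
  have k5 : h.mul (Cn n) (D.AL (D.D2 s)) = D.AL (D.D2 y - e) := by
    rw [← k4]
    exact D.AL_mul h _
  have k6 : h.mul (Cn n) (D.AL G) = D.AL (h.mul (Cn n) G) := D.AL_mul h _
  have h1 := congrArg re (D.sig_eq ht G z)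
  rw [← hs, z1, k1, k2, h.mul_inner, h.mul_inner, h.mul_inner, h.mul_inner, k3, k5, k6, ← y1,
    add_re, re_ofReal_mul, re_ofReal_mul, add_re] at h1
  rw [theta_apply, ← hs, ← y1]
  set g := h.mul (Cn n) G
  have h2 : (inner ℂ (D.J y) (D.J y)).re = ‖D.J y‖ ^ 2 := inner_self_eq_norm_sq (𝕜 := ℂ) _
  have h3 : (inner ℂ (D.D1 y + e) (D.D1 y - e)).re = ‖D.D1 y‖ ^ 2 - ‖e‖ ^ 2 := by
    have a1 : (inner ℂ (D.D1 y) (D.D1 y)).re = ‖D.D1 y‖ ^ 2 := inner_self_eq_norm_sq (𝕜 := ℂ) _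
    have a2 : (inner ℂ e e).re = ‖e‖ ^ 2 := inner_self_eq_norm_sq (𝕜 := ℂ) _
    have a3 : (inner ℂ e (D.D1 y)).re = (inner ℂ (D.D1 y) e).re := by
      rw [← inner_conj_symm, conj_re]
    simp only [inner_add_left, inner_sub_right, add_re, sub_re, a1, a2, a3]
    ring
  have h4 : κ * ‖D.D2 y‖ ^ 2 - 2 * M * ‖D.D2 y‖ * ‖e‖ - M * ‖e‖ ^ 2 ≤
      (inner ℂ (D.D2 y + e) (D.AL (D.D2 y - e))).re := by
    have a1 : κ * ‖D.D2 y‖ ^ 2 ≤ (inner ℂ (D.D2 y) (D.AL (D.D2 y))).re :=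
      D.garding y
    have bd : ∀ F F' : Lc n, |(inner ℂ F (D.AL F')).re| ≤ ‖F‖ * (M * ‖F'‖) := fun F F' => by
      refine (abs_re_le_norm _).trans ((norm_inner_le_norm _ _).trans ?_)
      gcongr
      exact D.norm_AL_le F'
    have a2 := abs_le.1 (bd (D.D2 y) e)
    have a3 := abs_le.1 (bd e (D.D2 y))
    have a4 := abs_le.1 (bd e e)
    simp only [inner_add_left, map_sub, inner_sub_right, add_re, sub_re]
    nlinarith
  have h5 : (inner ℂ (D.D2 y + e) (D.AL g)).re ≤ (‖D.D2 y‖ + ‖e‖) * (M * ‖g‖) := by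
    refine (re_le_norm _).trans ((norm_inner_le_norm _ _).trans ?_)
    gcongr
    · exact norm_add_le _ _
    · exact D.norm_AL_le g
  have h6 : t * ‖e‖ ≤ η * ‖D.J y‖ := by
    have : ‖e‖ ≤ (η / t) * ‖D.J y‖ := by
      refine Lp.norm_le_mul_norm_of_ae_le_mul ?_
      rw [y1]
      filter_upwards [h.coeFn_gmul (D.J s), h.coeFn_mul (D.J s)] with x a1 a2
      rw [a1, a2, norm_smul, norm_smul, norm_real, Real.norm_eq_abs]
      have := hω x
      rw [mul_comm] at this
      rw [div_mul_eq_mul_div, le_div_iff₀ ht]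
      nlinarith [norm_nonneg (D.J s x)]
    calc t * ‖e‖ ≤ t * ((η / t) * ‖D.J y‖) := by gcongr
      _ = η * ‖D.J y‖ := by field_simp
  rw [h2, h3] at h1
  refine absorb_weighted (X := ‖D.D2 y‖) (r := ‖e‖) hM hκ hκ1 hη ht (norm_nonneg _) h6 ?_
  have e1 := mul_le_mul_of_nonneg_left h4 (sq_nonneg t)
  have e2 := mul_le_mul_of_nonneg_left h5 ht.le
  have e3 : 0 ≤ t ^ 2 * ‖D.D1 y‖ ^ 2 := by positivity
  nlinarith only [e1, e2, e3, h1]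

end KData

end

section

variable {n : ℕ}

/-! ### Dyadic cubes -/

/-- The index of the dyadic cube of side `2 ^ k` containing `x`. -/
def idx (k : ℤ) (x : Rn n) : Fin n → ℤ := fun i => ⌊x i / (2 : ℝ) ^ k⌋

/-- The dyadic cube of side `2 ^ k` with index `m`. -/
def cube (k : ℤ) (m : Fin n → ℤ) : Set (Rn n) := {x | idx k x = m}

theorem mem_cube {k : ℤ} {m : Fin n → ℤ} {x : Rn n} :
    x ∈ cube k m ↔ ∀ i, x i ∈ Ico (m i * (2 : ℝ) ^ k) ((m i + 1) * (2 : ℝ) ^ k) := by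
  have h2 : (0 : ℝ) < 2 ^ k := by positivity
  simp only [cube, mem_ofPred_eq, funext_iff, idx, Int.floor_eq_iff, mem_Ico, le_div_iff₀ h2,
    div_lt_iff₀ h2]

theorem mem_cube_idx (k : ℤ) (x : Rn n) : x ∈ cube k (idx k x) := rfl

/-- The measure of a dyadic cube of side `2 ^ k`. -/
def vol (n : ℕ) (k : ℤ) : ℝ := ((2 : ℝ) ^ k) ^ n

theorem vol_pos (n : ℕ) (k : ℤ) : 0 < vol n k := by unfold vol; positivity

theorem volume_box (a b : Fin n → ℝ) :
    volume {x : Rn n | ∀ i, x i ∈ Ico (a i) (b i)} = ∏ i, ENNReal.ofReal (b i - a i) := by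
  rw [← Real.volume_pi_Ico]
  have h := (EuclideanSpace.volume_preserving_symm_measurableEquiv_toLp (Fin n)).symm
  rw [← h.measure_preimage_equiv]
  congr 1
  ext x
  simp [mem_pi]

theorem measurableSet_box (a b : Fin n → ℝ) :
    MeasurableSet {x : Rn n | ∀ i, x i ∈ Ico (a i) (b i)} := by
  rw [ofPred_forall]
  exact MeasurableSet.iInter fun i => measurableSet_Ico.preimage (by fun_prop)

theorem cube_eq_box (k : ℤ) (m : Fin n → ℤ) :
    cube k m = {x : Rn n | ∀ i, x i ∈ Ico (m i * (2 : ℝ) ^ k) ((m i + 1) * (2 : ℝ) ^ k)} := by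
  ext x
  exact mem_cube

theorem measurableSet_cube (k : ℤ) (m : Fin n → ℤ) : MeasurableSet (cube k m) := by
  rw [cube_eq_box]
  exact measurableSet_box _ _

theorem volume_cube (k : ℤ) (m : Fin n → ℤ) :
    volume (cube k m) = ENNReal.ofReal (vol n k) := by
  rw [cube_eq_box, volume_box]
  simp only [add_mul, one_mul, add_sub_cancel_left, Finset.prod_const, Finset.card_univ,
    Fintype.card_fin, vol]
  rw [ENNReal.ofReal_pow (by positivity)]

theorem volume_cube_ne_top (k : ℤ) (m : Fin n → ℤ) : volume (cube k m) ≠ ⊤ := by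
  rw [volume_cube]
  exact ENNReal.ofReal_ne_top

theorem volume_cube_ne_zero (k : ℤ) (m : Fin n → ℤ) : volume (cube k m) ≠ 0 := by
  rw [volume_cube]
  exact (ENNReal.ofReal_pos.2 (vol_pos n k)).ne'

theorem real_cube (k : ℤ) (m : Fin n → ℤ) : volume.real (cube k m) = vol n k := by
  rw [Measure.real, volume_cube, ENNReal.toReal_ofReal (vol_pos n k).le]

instance (k : ℤ) (m : Fin n → ℤ) : IsFiniteMeasure (volume.restrict (cube k m)) :=
  ⟨by rw [Measure.restrict_apply_univ]; exact (volume_cube_ne_top k m).lt_top⟩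

theorem measurable_idx (k : ℤ) : Measurable (idx k : Rn n → Fin n → ℤ) :=
  measurable_pi_lambda _ fun i => Int.measurable_floor.comp (by fun_prop)

theorem pairwise_disjoint_cube (k : ℤ) :
    Pairwise (Function.onFun Disjoint (cube k : (Fin n → ℤ) → Set (Rn n))) := fun m m' h => by
  refine Set.disjoint_left.2 fun x h1 h2 => h ?_
  exact (h1 : idx k x = m).symm.trans h2

theorem iUnion_cube (k : ℤ) : ⋃ m, cube k m = (univ : Set (Rn n)) :=
  eq_univ_of_forall fun x => mem_iUnion.2 ⟨idx k x, rfl⟩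

theorem lintegral_eq_tsum_cube (k : ℤ) (f : Rn n → ENNReal) :
    ∫⁻ x, f x = ∑' m, ∫⁻ x in cube k m, f x := by
  rw [← lintegral_iUnion (measurableSet_cube k) (pairwise_disjoint_cube k), iUnion_cube,
    Measure.restrict_univ]

/-- The indices of the dyadic children of a cube. -/
def kids (m : Fin n → ℤ) : Finset (Fin n → ℤ) := Fintype.piFinset fun i => {2 * m i, 2 * m i + 1}

theorem idx_mem_kids {k : ℤ} {m : Fin n → ℤ} {x : Rn n} : idx k x ∈ kids m ↔ x ∈ cube (k + 1) m := by
  simp only [kids, Fintype.mem_piFinset, Finset.mem_insert, Finset.mem_singleton, mem_cube, mem_Ico]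
  refine forall_congr' fun i => ?_
  have h2 : (0 : ℝ) < 2 ^ k := by positivity
  rw [zpow_add_one₀ (by norm_num : (2 : ℝ) ≠ 0)]
  have e1 : (m i : ℝ) * (2 ^ k * 2) = ((2 * m i : ℤ) : ℝ) * 2 ^ k := by push_cast; ring
  have e2 : ((m i : ℝ) + 1) * (2 ^ k * 2) = ((2 * m i + 2 : ℤ) : ℝ) * 2 ^ k := by push_cast; ring
  rw [e1, e2, ← le_div_iff₀ h2, ← div_lt_iff₀ h2, ← Int.le_floor, ← Int.floor_lt]
  simp only [idx]
  omega

theorem cube_succ (k : ℤ) (m : Fin n → ℤ) : cube (k + 1) m = ⋃ c ∈ kids m, cube k c := by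
  ext x
  rw [← idx_mem_kids]
  simp only [mem_iUnion, exists_prop]
  exact ⟨fun h => ⟨_, h, rfl⟩, fun ⟨c, hc, h⟩ => (h : idx k x = c) ▸ hc⟩

theorem cube_subset_of_mem_kids {k : ℤ} {m c : Fin n → ℤ} (hc : c ∈ kids m) :
    cube k c ⊆ cube (k + 1) m := by
  rw [cube_succ]
  exact subset_biUnion_of_mem (u := fun c => cube k c) hc

theorem lintegral_cube_succ (k : ℤ) (m : Fin n → ℤ) (f : Rn n → ENNReal) :
    ∫⁻ x in cube (k + 1) m, f x = ∑ c ∈ kids m, ∫⁻ x in cube k c, f x := by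
  rw [cube_succ, lintegral_biUnion_finset (fun c _ c' _ h => pairwise_disjoint_cube k h)
    fun c _ => measurableSet_cube k c]

theorem integral_cube_succ {X : Type*} [NormedAddCommGroup X] [NormedSpace ℝ X] (k : ℤ)
    (m : Fin n → ℤ) {f : Rn n → X} (hf : IntegrableOn f (cube (k + 1) m)) :
    ∫ x in cube (k + 1) m, f x = ∑ c ∈ kids m, ∫ x in cube k c, f x := by
  have h : ∀ c ∈ kids m, IntegrableOn f (cube k c) := fun c hc =>
    hf.mono_set (cube_subset_of_mem_kids hc)
  rw [cube_succ, integral_biUnion_finset _ (fun c _ => measurableSet_cube k c)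
    (fun c _ c' _ h => pairwise_disjoint_cube k h) h]

theorem sum_vol_kids (k : ℤ) (m : Fin n → ℤ) : ∑ _c ∈ kids m, vol n k = vol n (k + 1) := by
  have h := lintegral_cube_succ k m (fun _ => (1 : ENNReal))
  simp only [lintegral_const, Measure.restrict_apply_univ, one_mul, volume_cube] at h
  rw [← ENNReal.ofReal_sum_of_nonneg fun _ _ => (vol_pos n k).le] at h
  exact ((ENNReal.ofReal_eq_ofReal_iff (vol_pos _ _).le
    (Finset.sum_nonneg fun _ _ => (vol_pos n k).le)).1 h).symm

theorem norm_sub_le_of_mem_cube {k : ℤ} {m : Fin n → ℤ} {x y : Rn n} (hx : x ∈ cube k m)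
    (hy : y ∈ cube k m) : ‖x - y‖ ≤ n * (2 : ℝ) ^ k := by
  have h2 : (0 : ℝ) < 2 ^ k := by positivity
  have h1 : ∀ i, ‖(x - y) i‖ ≤ 2 ^ k := fun i => by
    have a := mem_cube.1 hx i
    have b := mem_cube.1 hy i
    rw [mem_Ico] at a b
    rw [Real.norm_eq_abs, PiLp.sub_apply, abs_le]
    constructor <;> nlinarith
  have h3 : ‖x - y‖ ^ 2 ≤ (n * (2 : ℝ) ^ k) ^ 2 := by
    rw [EuclideanSpace.norm_sq_eq]
    calc ∑ i, ‖(x - y) i‖ ^ 2 ≤ ∑ _i : Fin n, ((2 : ℝ) ^ k) ^ 2 := by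
          refine Finset.sum_le_sum fun i _ => ?_
          gcongr
          exact h1 i
      _ = n * ((2 : ℝ) ^ k) ^ 2 := by simp
      _ ≤ _ := by
        rw [mul_pow]
        gcongr
        rcases Nat.eq_zero_or_pos n with h | h
        · simp [h]
        · have : (1 : ℝ) ≤ n := by exact_mod_cast h
          nlinarith
  exact le_of_sq_le_sq h3 (by positivity)

/-! ### Averages -/

section Average

variable {X : Type*} [NormedAddCommGroup X] [NormedSpace ℝ X]

/-- The average of `F` on the dyadic cube with index `m`. -/
def cav (k : ℤ) (m : Fin n → ℤ) (F : Rn n → X) : X := (vol n k)⁻¹ • ∫ x in cube k m, F x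

/-- The dyadic average at scale `2 ^ k`. -/
def av (k : ℤ) (F : Rn n → X) (x : Rn n) : X := cav k (idx k x) F

theorem av_eq {k : ℤ} {m : Fin n → ℤ} {x : Rn n} (hx : x ∈ cube k m) (F : Rn n → X) :
    av k F x = cav k m F := by
  rw [av, (hx : idx k x = m)]

theorem stronglyMeasurable_av (k : ℤ) (F : Rn n → X) : StronglyMeasurable (av k F) :=
  (StronglyMeasurable.of_discrete (f := fun m => cav k m F)).comp_measurable (measurable_idx k)

theorem cav_congr {k : ℤ} {m : Fin n → ℤ} {F G : Rn n → X} (h : F =ᵐ[volume] G) :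
    cav k m F = cav k m G := by
  rw [cav, cav, integral_congr_ae (ae_restrict_of_ae h)]

theorem av_congr {k : ℤ} {F G : Rn n → X} (h : F =ᵐ[volume] G) : av k F = av k G :=
  funext fun _ => cav_congr h

theorem cav_add {k : ℤ} {m : Fin n → ℤ} {F G : Rn n → X} (hF : IntegrableOn F (cube k m))
    (hG : IntegrableOn G (cube k m)) : cav k m (F + G) = cav k m F + cav k m G := by
  rw [cav, cav, cav, ← smul_add]
  congr 1
  exact integral_add hF hG

theorem enorm_setIntegral_sq_le {s : Set (Rn n)} {F : Rn n → X}
    (hF : AEStronglyMeasurable F (volume.restrict s)) :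
    ‖∫ x in s, F x‖ₑ ^ 2 ≤ volume s * ∫⁻ x in s, ‖F x‖ₑ ^ 2 := by
  have h1 : ∫⁻ x in s, ‖F x‖ₑ ≤ volume s ^ (1 / 2 : ℝ) * (∫⁻ x in s, ‖F x‖ₑ ^ (2 : ℝ)) ^ (1 / 2 : ℝ) := by
    have := ENNReal.lintegral_mul_le_Lp_mul_Lq (volume.restrict s) Real.HolderConjugate.two_two
      (f := fun _ => 1) (g := fun x => ‖F x‖ₑ) aemeasurable_const hF.enorm
    simpa using this
  calc ‖∫ x in s, F x‖ₑ ^ 2 ≤ (∫⁻ x in s, ‖F x‖ₑ) ^ 2 := by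
        gcongr
        exact enorm_integral_le_lintegral_enorm _
    _ ≤ (volume s ^ (1 / 2 : ℝ) * (∫⁻ x in s, ‖F x‖ₑ ^ (2 : ℝ)) ^ (1 / 2 : ℝ)) ^ 2 := by gcongr
    _ = volume s * ∫⁻ x in s, ‖F x‖ₑ ^ 2 := by
        rw [mul_pow, ← ENNReal.rpow_natCast, ← ENNReal.rpow_natCast, ← ENNReal.rpow_mul,
          ← ENNReal.rpow_mul]
        simp

theorem vol_mul_enorm_cav_sq_le {k : ℤ} {m : Fin n → ℤ} {F : Rn n → X}
    (hF : AEStronglyMeasurable F volume) :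
    ENNReal.ofReal (vol n k) * ‖cav k m F‖ₑ ^ 2 ≤ ∫⁻ x in cube k m, ‖F x‖ₑ ^ 2 := by
  have h := enorm_setIntegral_sq_le (s := cube k m) hF.restrict
  have hv := vol_pos n k
  have hv0 : ENNReal.ofReal (vol n k) ≠ 0 := (ENNReal.ofReal_pos.2 hv).ne'
  have e : ‖cav k m F‖ₑ = (ENNReal.ofReal (vol n k))⁻¹ * ‖∫ x in cube k m, F x‖ₑ := by
    rw [cav, enorm_smul, Real.enorm_eq_ofReal (inv_nonneg.2 hv.le), ENNReal.ofReal_inv_of_pos hv]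
  rw [volume_cube] at h
  rw [e, mul_pow]
  calc ENNReal.ofReal (vol n k) * ((ENNReal.ofReal (vol n k))⁻¹ ^ 2 * ‖∫ x in cube k m, F x‖ₑ ^ 2)
      ≤ ENNReal.ofReal (vol n k) * ((ENNReal.ofReal (vol n k))⁻¹ ^ 2 *
        (ENNReal.ofReal (vol n k) * ∫⁻ x in cube k m, ‖F x‖ₑ ^ 2)) := by gcongr
    _ = (ENNReal.ofReal (vol n k) * (ENNReal.ofReal (vol n k))⁻¹) ^ 2 *
        ∫⁻ x in cube k m, ‖F x‖ₑ ^ 2 := by ring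
    _ = _ := by rw [ENNReal.mul_inv_cancel hv0 ENNReal.ofReal_ne_top, one_pow, one_mul]

theorem lintegral_cube_av_sq (k : ℤ) (m : Fin n → ℤ) (F : Rn n → X) (h : Rn n → ENNReal) :
    ∫⁻ x in cube k m, h x * ‖av k F x‖ₑ ^ 2 = (∫⁻ x in cube k m, h x) * ‖cav k m F‖ₑ ^ 2 := by
  rw [← lintegral_mul_const' _ _ (by simp)]
  refine setLIntegral_congr_fun (measurableSet_cube k m) fun x hx => ?_
  simp only [av_eq hx]

theorem lintegral_cube_enorm_av_sq (k : ℤ) (m : Fin n → ℤ) (F : Rn n → X) :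
    ∫⁻ x in cube k m, ‖av k F x‖ₑ ^ 2 = ENNReal.ofReal (vol n k) * ‖cav k m F‖ₑ ^ 2 := by
  have := lintegral_cube_av_sq k m F (fun _ => 1)
  simpa [volume_cube] using this

theorem lintegral_av_sq_le (k : ℤ) {F : Rn n → X} (hF : AEStronglyMeasurable F volume) :
    ∫⁻ x, ‖av k F x‖ₑ ^ 2 ≤ ∫⁻ x, ‖F x‖ₑ ^ 2 := by
  rw [lintegral_eq_tsum_cube k, lintegral_eq_tsum_cube k (fun x => ‖F x‖ₑ ^ 2)]
  refine ENNReal.tsum_le_tsum fun m => ?_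
  rw [lintegral_cube_enorm_av_sq]
  exact vol_mul_enorm_cav_sq_le hF

end Average

section LpNorm

variable {X : Type*} [NormedAddCommGroup X]

theorem eLpNorm_two_sq (f : Rn n → X) : eLpNorm f 2 volume ^ 2 = ∫⁻ x, ‖f x‖ₑ ^ 2 := by
  have := eLpNorm_nnreal_pow_eq_lintegral (μ := volume) (f := f) (p := 2) (by norm_num)
  simpa using this

theorem ofReal_norm_sq (f : Lp X 2 (volume : Measure (Rn n))) :
    ENNReal.ofReal (‖f‖ ^ 2) = ∫⁻ x, ‖f x‖ₑ ^ 2 := by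
  rw [ENNReal.ofReal_pow (norm_nonneg _), ofReal_norm, Lp.enorm_def, eLpNorm_two_sq]

theorem norm_sq_le_of_lintegral_le {f : Lp X 2 (volume : Measure (Rn n))} {c : ℝ} (hc : 0 ≤ c)
    (h : ∫⁻ x, ‖f x‖ₑ ^ 2 ≤ ENNReal.ofReal c) : ‖f‖ ^ 2 ≤ c := by
  rw [← ofReal_norm_sq] at h
  exact (ENNReal.ofReal_le_ofReal_iff hc).1 h

theorem memLp_of_lintegral_sq_lt_top {f : Rn n → X} (hf : AEStronglyMeasurable f volume)
    (h : ∫⁻ x, ‖f x‖ₑ ^ 2 < ⊤) : MemLp f 2 volume := by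
  refine ⟨hf, ?_⟩
  rw [← eLpNorm_two_sq] at h
  by_contra hc
  rw [not_lt, top_le_iff] at hc
  simp [hc] at h

theorem lintegral_sq_lt_top (f : Lp X 2 (volume : Measure (Rn n))) : ∫⁻ x, ‖f x‖ₑ ^ 2 < ⊤ := by
  rw [← ofReal_norm_sq]
  exact ENNReal.ofReal_lt_top

theorem integrableOn_cube (f : Lp X 2 (volume : Measure (Rn n))) (k : ℤ) (m : Fin n → ℤ) :
    IntegrableOn f (cube k m) :=
  ((Lp.memLp f).restrict _).integrable one_le_two

end LpNorm

theorem memLp_av (k : ℤ) (F : Lc n) : MemLp (av k F) 2 volume :=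
  memLp_of_lintegral_sq_lt_top (stronglyMeasurable_av k F).aestronglyMeasurable
    ((lintegral_av_sq_le k (Lp.aestronglyMeasurable F)).trans_lt (lintegral_sq_lt_top F))

theorem av_add (k : ℤ) (F G : Lc n) : av k (F + G : Lc n) = av k F + av k G := by
  rw [av_congr (Lp.coeFn_add F G)]
  funext x
  exact cav_add (integrableOn_cube F k _) (integrableOn_cube G k _)

theorem av_smul (k : ℤ) (c : ℂ) (F : Lc n) : av k (c • F : Lc n) = c • av k F := by
  rw [av_congr (Lp.coeFn_smul c F)]
  funext x
  have h : ∫ y in cube k (idx k x), c • F y = c • ∫ y in cube k (idx k x), F y :=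
    integral_smul c _
  have e : av k (c • ⇑F) x = (vol n k)⁻¹ • ∫ y in cube k (idx k x), c • F y := rfl
  rw [e, h, smul_comm]
  rfl

/-- The dyadic averaging operator on `L²(ℝⁿ; ℂⁿ)`, as a linear map. -/
def avLin (k : ℤ) : Lc n →ₗ[ℂ] Lc n where
  toFun F := MemLp.toLp (av k F) (memLp_av k F)
  map_add' F G := by
    rw [← MemLp.toLp_add]
    exact MemLp.toLp_congr _ _ (Filter.Eventually.of_forall fun x => congrFun (av_add k F G) x)
  map_smul' c F := by
    rw [RingHom.id_apply, ← MemLp.toLp_const_smul]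
    exact MemLp.toLp_congr _ _ (Filter.Eventually.of_forall fun x => congrFun (av_smul k c F) x)

theorem coeFn_avLin (k : ℤ) (F : Lc n) : avLin k F =ᵐ[volume] av k F :=
  MemLp.coeFn_toLp (memLp_av k F)

theorem norm_avLin_le (k : ℤ) (F : Lc n) : ‖avLin k F‖ ≤ 1 * ‖F‖ := by
  rw [one_mul]
  refine le_of_sq_le_sq (norm_sq_le_of_lintegral_le (sq_nonneg _) ?_) (norm_nonneg _)
  rw [ofReal_norm_sq]
  refine le_trans (le_of_eq (lintegral_congr_ae ?_))
    (lintegral_av_sq_le k (Lp.aestronglyMeasurable F))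
  filter_upwards [coeFn_avLin k F] with x hx
  rw [hx]

/-- The dyadic averaging operator on `L²(ℝⁿ; ℂⁿ)`. -/
def avL (k : ℤ) : Lc n →L[ℂ] Lc n := (avLin k).mkContinuous 1 (norm_avLin_le k)

theorem coeFn_avL (k : ℤ) (F : Lc n) : avL k F =ᵐ[volume] av k F := coeFn_avLin k F

theorem ofReal_norm_avL_sq (k : ℤ) (F : Lc n) :
    ENNReal.ofReal (‖avL k F‖ ^ 2) = ∫⁻ x, ‖av k F x‖ₑ ^ 2 := by
  rw [ofReal_norm_sq]
  refine lintegral_congr_ae ?_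
  filter_upwards [coeFn_avL k F] with x hx
  rw [hx]

end

section

variable {n : ℕ}

/-! ### Smooth cut-offs of dyadic cubes -/

theorem exists_abs_deriv_smoothTransition_le :
    ∃ B : ℝ, 0 ≤ B ∧ ∀ x, |deriv Real.smoothTransition x| ≤ B := by
  have hc : Continuous (deriv Real.smoothTransition) :=
    (Real.smoothTransition.contDiff (n := 1)).continuous_deriv le_rfl
  obtain ⟨B, hB⟩ := (isCompact_Icc (a := (0 : ℝ)) (b := 1)).exists_bound_of_continuousOn hc.continuousOn
  refine ⟨max B 0, le_max_right _ _, fun x => ?_⟩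
  by_cases hx : x ∈ Icc (0 : ℝ) 1
  · exact (hB x hx).trans (le_max_left _ _)
  · have h0 : deriv Real.smoothTransition x = 0 := by
      rcases lt_or_ge x 0 with h | h
      · have : Real.smoothTransition =ᶠ[nhds x] fun _ => 0 := by
          filter_upwards [gt_mem_nhds h] with y hy
          exact Real.smoothTransition.zero_of_nonpos hy.le
        rw [this.deriv_eq, deriv_const]
      · have h1 : 1 < x := by
          by_contra hc
          exact hx ⟨h, not_lt.1 hc⟩
        have : Real.smoothTransition =ᶠ[nhds x] fun _ => 1 := by
          filter_upwards [lt_mem_nhds h1] with y hy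
          exact Real.smoothTransition.one_of_one_le hy.le
        rw [this.deriv_eq, deriv_const]
    rw [h0, abs_zero]
    exact le_max_right _ _

/-- A smooth bump on `[a, a + t]` equal to `1` at distance `≥ d` from the end points. -/
def bmp (a t d s : ℝ) : ℝ :=
  Real.smoothTransition ((s - a) / d) * Real.smoothTransition ((a + t - s) / d)

theorem bmp_nonneg (a t d s : ℝ) : 0 ≤ bmp a t d s :=
  mul_nonneg (Real.smoothTransition.nonneg _) (Real.smoothTransition.nonneg _)

theorem bmp_le_one (a t d s : ℝ) : bmp a t d s ≤ 1 :=
  mul_le_one₀ (Real.smoothTransition.le_one _) (Real.smoothTransition.nonneg _)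
    (Real.smoothTransition.le_one _)

theorem contDiff_bmp (a t d : ℝ) : ContDiff ℝ (⊤ : ℕ∞) (bmp a t d) := by
  unfold bmp
  exact (Real.smoothTransition.contDiff.comp (by fun_prop)).mul
    (Real.smoothTransition.contDiff.comp (by fun_prop))

theorem bmp_eq_zero {a t d s : ℝ} (hd : 0 < d) (h : s ∉ Ioo a (a + t)) : bmp a t d s = 0 := by
  rcases le_or_gt s a with h1 | h1
  · rw [bmp, Real.smoothTransition.zero_of_nonpos, zero_mul]
    exact div_nonpos_of_nonpos_of_nonneg (by linarith) hd.le
  · have h2 : a + t ≤ s := by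
      by_contra hc
      exact h ⟨h1, not_le.1 hc⟩
    rw [bmp, Real.smoothTransition.zero_of_nonpos (x := (a + t - s) / d), mul_zero]
    exact div_nonpos_of_nonpos_of_nonneg (by linarith) hd.le

theorem bmp_eq_one {a t d s : ℝ} (hd : 0 < d) (h : s ∈ Ico (a + d) (a + t - d)) :
    bmp a t d s = 1 := by
  rw [bmp, Real.smoothTransition.one_of_one_le, Real.smoothTransition.one_of_one_le, one_mul]
  · rw [one_le_div hd]; linarith [h.2]
  · rw [one_le_div hd]; linarith [h.1]

theorem abs_deriv_bmp_le {B : ℝ} (hB : ∀ x, |deriv Real.smoothTransition x| ≤ B) (a t : ℝ) {d : ℝ}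
    (hd : 0 < d) (s : ℝ) : |deriv (bmp a t d) s| ≤ 2 * B / d := by
  have hS : ∀ x, HasDerivAt Real.smoothTransition (deriv Real.smoothTransition x) x := fun x =>
    ((Real.smoothTransition.contDiff (n := 1)).differentiable (by norm_num) x).hasDerivAt
  have e1 : HasDerivAt (fun s => (s - a) / d) (1 / d) s := ((hasDerivAt_id s).sub_const a).div_const d
  have e2 : HasDerivAt (fun s => (a + t - s) / d) (-1 / d) s :=
    ((hasDerivAt_id s).const_sub (a + t)).div_const d
  have h1 := (hS ((s - a) / d)).comp s e1
  have h2 := (hS ((a + t - s) / d)).comp s e2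
  have h3 : HasDerivAt (bmp a t d) _ s := h1.mul h2
  rw [h3.deriv]
  have b1 := hB ((s - a) / d)
  have b2 := hB ((a + t - s) / d)
  have c1 := abs_of_nonneg (Real.smoothTransition.nonneg ((s - a) / d))
  have c2 := abs_of_nonneg (Real.smoothTransition.nonneg ((a + t - s) / d))
  have c3 := Real.smoothTransition.le_one ((s - a) / d)
  have c4 := Real.smoothTransition.le_one ((a + t - s) / d)
  have hB0 : 0 ≤ B := (abs_nonneg _).trans b1
  refine (abs_add_le _ _).trans ?_
  simp only [Function.comp_apply, abs_mul, abs_div, abs_neg, abs_one, abs_of_pos hd]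
  rw [c1, c2]
  have hd' : 0 ≤ 1 / d := by positivity
  calc _ ≤ B * (1 / d) * 1 + 1 * (B * (1 / d)) := by
        gcongr
        exact Real.smoothTransition.nonneg _
    _ = _ := by ring

/-- The smooth cut-off of the box with corner `a` and side `t`. -/
def boxBump (a : Fin n → ℝ) (t d : ℝ) (x : Rn n) : ℝ := ∏ j, bmp (a j) t d (x j)

theorem boxBump_nonneg (a : Fin n → ℝ) (t d : ℝ) (x : Rn n) : 0 ≤ boxBump a t d x :=
  Finset.prod_nonneg fun _ _ => bmp_nonneg _ _ _ _

theorem boxBump_le_one (a : Fin n → ℝ) (t d : ℝ) (x : Rn n) : boxBump a t d x ≤ 1 :=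
  Finset.prod_le_one (fun _ _ => bmp_nonneg _ _ _ _) fun _ _ => bmp_le_one _ _ _ _

theorem contDiff_boxBump (a : Fin n → ℝ) (t d : ℝ) : ContDiff ℝ (⊤ : ℕ∞) (boxBump a t d) := by
  unfold boxBump
  refine contDiff_prod fun j _ => ?_
  exact (contDiff_bmp (a j) t d).comp
    (EuclideanSpace.proj j : Rn n →L[ℝ] ℝ).contDiff

theorem boxBump_eq_zero {a : Fin n → ℝ} {t d : ℝ} (hd : 0 < d) {x : Rn n} {j : Fin n}
    (h : x j ∉ Ioo (a j) (a j + t)) : boxBump a t d x = 0 :=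
  Finset.prod_eq_zero (Finset.mem_univ j) (bmp_eq_zero hd h)

theorem boxBump_eq_one {a : Fin n → ℝ} {t d : ℝ} (hd : 0 < d) {x : Rn n}
    (h : ∀ j, x j ∈ Ico (a j + d) (a j + t - d)) : boxBump a t d x = 1 :=
  Finset.prod_eq_one fun j _ => bmp_eq_one hd (h j)

theorem isTest_boxBump (a : Fin n → ℝ) (t : ℝ) {d : ℝ} (hd : 0 < d) : IsTest (boxBump a t d) := by
  refine ⟨contDiff_boxBump a t d, ?_⟩
  refine HasCompactSupport.intro (K := WithLp.toLp 2 '' (Set.univ.pi fun j => Icc (a j) (a j + t)))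
    ((isCompact_univ_pi fun j => isCompact_Icc).image (PiLp.continuous_toLp 2 _)) fun x hx => ?_
  by_contra h0
  refine hx ⟨WithLp.ofLp x, ?_, rfl⟩
  intro j _
  by_contra hj
  exact h0 (boxBump_eq_zero (j := j) hd fun h => hj ⟨h.1.le, h.2.le⟩)

theorem pd_boxBump_eq_zero {a : Fin n → ℝ} {t d : ℝ} (hd : 0 < d) {x : Rn n} {j : Fin n}
    (h : x j ∉ Ioo (a j) (a j + t)) (i : Fin n) : pd (boxBump a t d) i x = 0 := by
  have : IsLocalMin (boxBump a t d) x := Filter.Eventually.of_forall fun y => by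
    simp only [boxBump_eq_zero hd h]
    exact boxBump_nonneg _ _ _ _
  rw [pd, this.fderiv_eq_zero]
  rfl

theorem abs_pd_boxBump_le {B : ℝ} (hB : ∀ x, |deriv Real.smoothTransition x| ≤ B) (a : Fin n → ℝ)
    (t : ℝ) {d : ℝ} (hd : 0 < d) (i : Fin n) (x : Rn n) :
    |pd (boxBump a t d) i x| ≤ 2 * B / d := by
  have hB0 : 0 ≤ B := (abs_nonneg _).trans (hB 0)
  have h1 : HasFDerivAt (boxBump a t d) (fderiv ℝ (boxBump a t d) x) x :=
    ((contDiff_boxBump a t d).differentiable (by simp) x).hasFDerivAt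
  have h2 : HasDerivAt (fun s : ℝ => boxBump a t d (x + s • EuclideanSpace.single i (1 : ℝ)))
      (pd (boxBump a t d) i x) 0 := h1.hasLineDerivAt _
  have e : (fun s : ℝ => boxBump a t d (x + s • EuclideanSpace.single i (1 : ℝ))) =
      fun s => bmp (a i) t d (x i + s) * ∏ j ∈ Finset.univ.erase i, bmp (a j) t d (x j) := by
    funext s
    rw [boxBump, ← Finset.mul_prod_erase _ _ (Finset.mem_univ i)]
    congr 1
    · simp
    · refine Finset.prod_congr rfl fun j hj => ?_
      simp [Finset.ne_of_mem_erase hj]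
  rw [e] at h2
  have h3 : HasDerivAt (bmp (a i) t d) (deriv (bmp (a i) t d) (x i + 0)) (x i + 0) :=
    ((contDiff_bmp (a i) t d).differentiable (by simp) _).hasDerivAt
  have h4 := (h3.comp_const_add (x i) 0).mul_const
    (∏ j ∈ Finset.univ.erase i, bmp (a j) t d (x j))
  rw [h2.unique h4, abs_mul]
  have h5 : |∏ j ∈ Finset.univ.erase i, bmp (a j) t d (x j)| ≤ 1 := by
    rw [abs_of_nonneg (Finset.prod_nonneg fun _ _ => bmp_nonneg _ _ _ _)]
    exact Finset.prod_le_one (fun _ _ => bmp_nonneg _ _ _ _) fun _ _ => bmp_le_one _ _ _ _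
  calc _ ≤ 2 * B / d * 1 := by
        gcongr
        exact abs_deriv_bmp_le hB _ _ hd _
    _ = _ := mul_one _

theorem volume_cube_diff_inner_le (k : ℤ) (m : Fin n → ℤ) {τ : ℝ} (hτ : 0 < τ) (hτ' : τ ≤ 1 / 2) :
    volume (cube k m \ {x : Rn n | ∀ i, x i ∈ Ico (m i * (2 : ℝ) ^ k + τ * 2 ^ k)
      (m i * (2 : ℝ) ^ k + 2 ^ k - τ * 2 ^ k)}) ≤ ENNReal.ofReal (2 * n * τ * vol n k) := by
  have h2 : (0 : ℝ) < 2 ^ k := by positivity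
  have hsub : {x : Rn n | ∀ i, x i ∈ Ico (m i * (2 : ℝ) ^ k + τ * 2 ^ k)
      (m i * (2 : ℝ) ^ k + 2 ^ k - τ * 2 ^ k)} ⊆ cube k m := fun x hx => by
    rw [mem_cube]
    intro i
    have := hx i
    rw [mem_Ico] at this ⊢
    constructor <;> nlinarith [this.1, this.2]
  have hvol : volume {x : Rn n | ∀ i, x i ∈ Ico (m i * (2 : ℝ) ^ k + τ * 2 ^ k)
      (m i * (2 : ℝ) ^ k + 2 ^ k - τ * 2 ^ k)} = ENNReal.ofReal ((1 - 2 * τ) ^ n * vol n k) := by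
    rw [volume_box]
    have : ∀ i : Fin n, (m i * (2 : ℝ) ^ k + 2 ^ k - τ * 2 ^ k) - (m i * (2 : ℝ) ^ k + τ * 2 ^ k) =
      (1 - 2 * τ) * 2 ^ k := fun i => by ring
    simp only [this, Finset.prod_const, Finset.card_univ, Fintype.card_fin, vol]
    rw [← mul_pow, ENNReal.ofReal_pow (mul_nonneg (by linarith) h2.le)]
  have hp : 0 ≤ (1 - 2 * τ) ^ n * vol n k :=
    mul_nonneg (pow_nonneg (by linarith) _) (vol_pos n k).le
  rw [measure_sdiff hsub (measurableSet_box _ _).nullMeasurableSet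
    (by rw [hvol]; exact ENNReal.ofReal_ne_top), volume_cube, hvol, ← ENNReal.ofReal_sub _ hp]
  refine ENNReal.ofReal_le_ofReal ?_
  have := one_add_mul_le_pow (a := -(2 * τ)) (by linarith) n
  have h3 : 1 - 2 * n * τ ≤ (1 - 2 * τ) ^ n := by
    rw [sub_eq_add_neg 1 (2 * τ)]
    linarith
  nlinarith [vol_pos n k]

theorem lintegral_enorm_sq_le {X : Type*} [NormedAddCommGroup X] {s : Set (Rn n)} {F : Rn n → X}
    (hF : AEStronglyMeasurable F (volume.restrict s)) :
    (∫⁻ x in s, ‖F x‖ₑ) ^ 2 ≤ volume s * ∫⁻ x in s, ‖F x‖ₑ ^ 2 := by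
  have h1 : ∫⁻ x in s, ‖F x‖ₑ ≤
      volume s ^ (1 / 2 : ℝ) * (∫⁻ x in s, ‖F x‖ₑ ^ (2 : ℝ)) ^ (1 / 2 : ℝ) := by
    have := ENNReal.lintegral_mul_le_Lp_mul_Lq (volume.restrict s) Real.HolderConjugate.two_two
      (f := fun _ => 1) (g := fun x => ‖F x‖ₑ) aemeasurable_const hF.enorm
    simpa using this
  calc (∫⁻ x in s, ‖F x‖ₑ) ^ 2
      ≤ (volume s ^ (1 / 2 : ℝ) * (∫⁻ x in s, ‖F x‖ₑ ^ (2 : ℝ)) ^ (1 / 2 : ℝ)) ^ 2 := by gcongr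
    _ = volume s * ∫⁻ x in s, ‖F x‖ₑ ^ 2 := by
        rw [mul_pow, ← ENNReal.rpow_natCast, ← ENNReal.rpow_natCast, ← ENNReal.rpow_mul,
          ← ENNReal.rpow_mul]
        simp

theorem ENNReal.add_sq_le (a b : ENNReal) : (a + b) ^ 2 ≤ 2 * a ^ 2 + 2 * b ^ 2 := by
  have := ENNReal.rpow_add_le_mul_rpow_add_rpow a b (p := 2) one_le_two
  norm_num at this
  rw [← mul_add]
  exact this

theorem enorm_coord_le (v : Cn n) (i : Fin n) : ‖v i‖ₑ ≤ ‖v‖ₑ := by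
  rw [← ofReal_norm, ← ofReal_norm]
  exact ENNReal.ofReal_le_ofReal (PiLp.norm_apply_le v i)

theorem enorm_sq_eq_sum (v : Cn n) : ‖v‖ₑ ^ 2 = ∑ i, ‖v i‖ₑ ^ 2 := by
  simp_rw [← ofReal_norm, ← ENNReal.ofReal_pow (norm_nonneg _)]
  rw [EuclideanSpace.norm_sq_eq, ENNReal.ofReal_sum_of_nonneg fun _ _ => by positivity]

theorem IsWGrad.enorm_setIntegral_coord_le {u : L2 n} {q : Lc n} (h : IsWGrad u q) {B : ℝ}
    (hB : ∀ x, |deriv Real.smoothTransition x| ≤ B) (k : ℤ) (m : Fin n → ℤ) {τ : ℝ} (hτ : 0 < τ)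
    (i : Fin n) :
    ‖∫ x in cube k m, q x i‖ₑ ≤ ENNReal.ofReal (2 * B / (τ * 2 ^ k)) * (∫⁻ x in cube k m, ‖u x‖ₑ) +
      ∫⁻ x in cube k m \ {x : Rn n | ∀ i, x i ∈ Ico (m i * (2 : ℝ) ^ k + τ * 2 ^ k)
        (m i * (2 : ℝ) ^ k + 2 ^ k - τ * 2 ^ k)}, ‖q x‖ₑ := by
  have hd : 0 < τ * (2 : ℝ) ^ k := by positivity
  set a : Fin n → ℝ := fun j => m j * (2 : ℝ) ^ k with ha
  set ψ := boxBump a (2 ^ k) (τ * 2 ^ k) with hψ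
  set R' := {x : Rn n | ∀ i, x i ∈ Ico (m i * (2 : ℝ) ^ k + τ * 2 ^ k)
        (m i * (2 : ℝ) ^ k + 2 ^ k - τ * 2 ^ k)} with hR'
  have hT : IsTest ψ := isTest_boxBump a _ hd
  have hout : ∀ x, x ∉ cube k m → ∃ j, x j ∉ Ioo (a j) (a j + 2 ^ k) := fun x hx => by
    by_contra! hc
    refine hx (mem_cube.2 fun j => ?_)
    have := hc j
    rw [add_mul, one_mul]
    exact ⟨this.1.le, this.2⟩
  have hqi : IntegrableOn (fun x => q x i) (cube k m) := by
    have := (EuclideanSpace.proj i : Cn n →L[ℂ] ℂ).integrable_comp (integrableOn_cube q k m)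
    exact this
  have hψq : Integrable (fun x => (ψ x : ℂ) * q x i) := by
    have h1 : Integrable (fun x => (toL2 ψ x) * (coordL i q x)) :=
      (Lp.memLp (toL2 ψ)).integrable_mul (Lp.memLp (coordL i q))
    refine h1.congr ?_
    filter_upwards [hT.coeFn_toL2, coeFn_coordL i q] with x h1 h2
    rw [h1, h2]
  have hind : Integrable ((cube k m).indicator fun x => q x i) :=
    (integrable_indicator_iff (measurableSet_cube k m)).2 hqi
  have key : ∫ x in cube k m, q x i = -(∫ x, (pd ψ i x : ℂ) * u x) +
      ∫ x, ((cube k m).indicator (fun x => q x i) x - (ψ x : ℂ) * q x i) := by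
    rw [integral_sub hind hψq, h.integral_eq i hT, integral_indicator (measurableSet_cube k m)]
    ring
  rw [key]
  refine (enorm_add_le _ _).trans (add_le_add ?_ ?_)
  · rw [enorm_neg]
    refine (enorm_integral_le_lintegral_enorm _).trans ?_
    rw [← lintegral_const_mul'' _ (Lp.aestronglyMeasurable u).enorm.restrict,
      ← lintegral_indicator (measurableSet_cube k m)]
    refine lintegral_mono fun x => ?_
    by_cases hx : x ∈ cube k m
    · rw [indicator_of_mem hx, enorm_mul]
      gcongr
      rw [← ofReal_norm]
      refine ENNReal.ofReal_le_ofReal ?_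
      rw [Complex.norm_real]
      exact abs_pd_boxBump_le hB a _ hd i x
    · obtain ⟨j, hj⟩ := hout x hx
      rw [hψ, pd_boxBump_eq_zero hd hj i]
      simp
  · refine (enorm_integral_le_lintegral_enorm _).trans ?_
    rw [← lintegral_indicator ((measurableSet_cube k m).diff (measurableSet_box _ _))]
    refine lintegral_mono fun x => ?_
    by_cases hx : x ∈ cube k m
    · rw [indicator_of_mem hx]
      by_cases hx' : x ∈ R'
      · rw [hψ, boxBump_eq_one hd hx']
        simp
      · rw [indicator_of_mem (show x ∈ cube k m \ R' from ⟨hx, hx'⟩)]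
        have e : q x i - (ψ x : ℂ) * q x i = ((1 - ψ x : ℝ) : ℂ) * q x i := by push_cast; ring
        rw [e, enorm_mul]
        have h1 : ‖((1 - ψ x : ℝ) : ℂ)‖ₑ ≤ 1 := by
          rw [← ofReal_norm, ENNReal.ofReal_le_one, Complex.norm_real, Real.norm_eq_abs, abs_le]
          have h1 := boxBump_nonneg a (2 ^ k) (τ * 2 ^ k) x
          have h2 := boxBump_le_one a (2 ^ k) (τ * 2 ^ k) x
          constructor <;> linarith
        calc _ ≤ 1 * ‖q x‖ₑ := mul_le_mul' h1 (enorm_coord_le _ i)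
          _ = _ := one_mul _
    · obtain ⟨j, hj⟩ := hout x hx
      rw [indicator_of_notMem hx, hψ, boxBump_eq_zero hd hj]
      simp

theorem IsWGrad.enorm_setIntegral_sq_le {u : L2 n} {q : Lc n} (h : IsWGrad u q) {B : ℝ}
    (hB0 : 0 ≤ B) (hB : ∀ x, |deriv Real.smoothTransition x| ≤ B) (k : ℤ) (m : Fin n → ℤ) {τ : ℝ}
    (hτ : 0 < τ) (hτ' : τ ≤ 1 / 2) :
    ‖∫ x in cube k m, q x‖ₑ ^ 2 ≤ ENNReal.ofReal (vol n k) *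
      (ENNReal.ofReal (2 * n * (2 * B / (τ * 2 ^ k)) ^ 2) * (∫⁻ x in cube k m, ‖u x‖ₑ ^ 2) +
        ENNReal.ofReal (2 * n * (2 * n * τ)) * ∫⁻ x in cube k m, ‖q x‖ₑ ^ 2) := by
  rw [enorm_sq_eq_sum]
  set U := ∫⁻ x in cube k m, ‖u x‖ₑ ^ 2
  set Q := ∫⁻ x in cube k m, ‖q x‖ₑ ^ 2
  have hL : 0 ≤ 2 * B / (τ * 2 ^ k) := by positivity
  have hi : ∀ i, ‖(∫ x in cube k m, q x) i‖ₑ ^ 2 ≤ 2 * (ENNReal.ofReal ((2 * B / (τ * 2 ^ k)) ^ 2) *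
      (ENNReal.ofReal (vol n k) * U)) + 2 * (ENNReal.ofReal (2 * n * τ * vol n k) * Q) := fun i => by
    have e : (∫ x in cube k m, q x) i = ∫ x in cube k m, q x i :=
      ((EuclideanSpace.proj i : Cn n →L[ℂ] ℂ).integral_comp_comm (integrableOn_cube q k m)).symm
    rw [e]
    refine (pow_le_pow_left' (h.enorm_setIntegral_coord_le hB k m hτ i) 2).trans ?_
    refine (ENNReal.add_sq_le _ _).trans ?_
    refine add_le_add ?_ ?_
    · rw [mul_pow, ENNReal.ofReal_pow hL, ← volume_cube k m]
      gcongr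
      exact lintegral_enorm_sq_le (Lp.aestronglyMeasurable u).restrict
    · gcongr
      refine (lintegral_enorm_sq_le (Lp.aestronglyMeasurable q).restrict).trans ?_
      gcongr
      · exact volume_cube_diff_inner_le k m hτ hτ'
      · exact lintegral_mono_set sdiff_subset
  refine (Finset.sum_le_sum fun i _ => hi i).trans (le_of_eq ?_)
  have h2 : (2 : ENNReal) = ENNReal.ofReal 2 := by simp
  have hn : (n : ENNReal) = ENNReal.ofReal n := by simp
  rw [Finset.sum_const, Finset.card_univ, Fintype.card_fin, nsmul_eq_mul]
  rw [ENNReal.ofReal_mul (p := 2 * (n : ℝ)) (by positivity),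
    ENNReal.ofReal_mul (p := 2 * (n : ℝ)) (by positivity),
    ENNReal.ofReal_mul (p := 2 * (n : ℝ) * τ) (by positivity),
    ENNReal.ofReal_mul (p := (2 : ℝ)) (by positivity), ← h2, ← hn]
  ring

/-- Interpolated bound for averages of a weak gradient. -/
theorem exists_vol_mul_enorm_cav_sq_le (n : ℕ) : ∃ C : ℝ, 0 ≤ C ∧ ∀ (u : L2 n) (q : Lc n),
    IsWGrad u q → ∀ (k : ℤ) (m : Fin n → ℤ) (τ : ℝ), 0 < τ → τ ≤ 1 →
    ENNReal.ofReal (vol n k) * ‖cav k m q‖ₑ ^ 2 ≤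
      ENNReal.ofReal (C * ((τ ^ 2)⁻¹ * (((2 : ℝ) ^ k) ^ 2)⁻¹)) * (∫⁻ x in cube k m, ‖u x‖ₑ ^ 2) +
        ENNReal.ofReal (C * τ) * ∫⁻ x in cube k m, ‖q x‖ₑ ^ 2 := by
  obtain ⟨B, hB0, hB⟩ := exists_abs_deriv_smoothTransition_le
  refine ⟨32 * n * B ^ 2 + 2 * n ^ 2, by positivity, fun u q h k m τ hτ hτ' => ?_⟩
  have h1 := h.enorm_setIntegral_sq_le hB0 hB k m (τ := τ / 2) (by linarith) (by linarith)
  have hv := vol_pos n k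
  have hv0 : ENNReal.ofReal (vol n k) ≠ 0 := (ENNReal.ofReal_pos.2 hv).ne'
  have e : ‖cav k m q‖ₑ = (ENNReal.ofReal (vol n k))⁻¹ * ‖∫ x in cube k m, q x‖ₑ := by
    rw [cav, enorm_smul, Real.enorm_eq_ofReal (inv_nonneg.2 hv.le), ENNReal.ofReal_inv_of_pos hv]
  rw [e, mul_pow]
  refine (mul_le_mul_right (mul_le_mul_right h1 _) _).trans ?_
  set v := ENNReal.ofReal (vol n k)
  have h3 : ∀ X : ENNReal, v * (v⁻¹ ^ 2 * (v * X)) = X := fun X => by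
    calc v * (v⁻¹ ^ 2 * (v * X)) = (v * v⁻¹) ^ 2 * X := by ring
      _ = X := by rw [ENNReal.mul_inv_cancel hv0 ENNReal.ofReal_ne_top, one_pow, one_mul]
  rw [h3]
  have ht : (0 : ℝ) < 2 ^ k := by positivity
  refine add_le_add (mul_le_mul_left (ENNReal.ofReal_le_ofReal ?_) _)
    (mul_le_mul_left (ENNReal.ofReal_le_ofReal ?_) _)
  · have : 2 * n * (2 * B / (τ / 2 * 2 ^ k)) ^ 2 = (32 * n * B ^ 2) *
        ((τ ^ 2)⁻¹ * (((2 : ℝ) ^ k) ^ 2)⁻¹) := by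
      field_simp
      ring
    rw [this]
    gcongr
    linarith [show (0 : ℝ) ≤ 2 * n ^ 2 by positivity]
  · have : 2 * n * (2 * n * (τ / 2)) = 2 * n ^ 2 * τ := by ring
    rw [this]
    gcongr
    linarith [show (0 : ℝ) ≤ 32 * n * B ^ 2 by positivity]

theorem exists_norm_avL_sq_le (n : ℕ) : ∃ C : ℝ, 0 ≤ C ∧ ∀ (u : L2 n) (q : Lc n),
    IsWGrad u q → ∀ (k : ℤ) (τ : ℝ), 0 < τ → τ ≤ 1 →
    ‖avL k q‖ ^ 2 ≤ C * ((τ ^ 2)⁻¹ * (((2 : ℝ) ^ k) ^ 2)⁻¹ * ‖u‖ ^ 2 + τ * ‖q‖ ^ 2) := by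
  obtain ⟨C, hC, h⟩ := exists_vol_mul_enorm_cav_sq_le n
  refine ⟨C, hC, fun u q hq k τ hτ hτ' => ?_⟩
  have ht : (0 : ℝ) < 2 ^ k := by positivity
  rw [← ENNReal.ofReal_le_ofReal_iff (by positivity), ofReal_norm_avL_sq]
  have e : C * ((τ ^ 2)⁻¹ * (((2 : ℝ) ^ k) ^ 2)⁻¹ * ‖u‖ ^ 2 + τ * ‖q‖ ^ 2) =
    C * ((τ ^ 2)⁻¹ * (((2 : ℝ) ^ k) ^ 2)⁻¹) * ‖u‖ ^ 2 + C * τ * ‖q‖ ^ 2 := by ring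
  rw [e, ENNReal.ofReal_add (by positivity) (by positivity),
    ENNReal.ofReal_mul (q := ‖u‖ ^ 2) (by positivity),
    ENNReal.ofReal_mul (q := ‖q‖ ^ 2) (by positivity), ofReal_norm_sq, ofReal_norm_sq,
    lintegral_eq_tsum_cube k, lintegral_eq_tsum_cube k (fun x => ‖u x‖ₑ ^ 2),
    lintegral_eq_tsum_cube k (fun x => ‖q x‖ₑ ^ 2), ← ENNReal.tsum_mul_left,
    ← ENNReal.tsum_mul_left, ← ENNReal.tsum_add]
  refine ENNReal.tsum_le_tsum fun m => ?_
  rw [lintegral_cube_enorm_av_sq]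
  exact h u q hq k m τ hτ hτ'

end

section

variable {n : ℕ}

/-! ### Polynomial weights -/

/-- The polynomial weight at the origin. -/
def wt0 (y : Rn n) : ℝ := ((1 + ‖y‖ ^ 2) ^ (n + 2))⁻¹

theorem wt0_pos (y : Rn n) : 0 < wt0 y := by unfold wt0; positivity

theorem wt0_le_one (y : Rn n) : wt0 y ≤ 1 := by
  unfold wt0
  refine inv_le_one_of_one_le₀ (one_le_pow₀ ?_)
  linarith [sq_nonneg ‖y‖]

theorem contDiff_wt0 : ContDiff ℝ (⊤ : ℕ∞) (wt0 : Rn n → ℝ) := by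
  unfold wt0
  refine ContDiff.inv ?_ fun x => by positivity
  exact (contDiff_const.add (contDiff_norm_sq ℝ)).pow _

theorem hasFDerivAt_wt0 (y : Rn n) : HasFDerivAt (wt0 : Rn n → ℝ)
    ((-(2 * (n + 2) * (1 + ‖y‖ ^ 2)⁻¹ * wt0 y)) • innerSL ℝ y) y := by
  have h1 : HasFDerivAt (fun y : Rn n => ‖y‖ ^ 2) (2 • innerSL ℝ y) y :=
    (hasStrictFDerivAt_norm_sq y).hasFDerivAt
  have h2 : HasDerivAt (fun q : ℝ => ((1 + q) ^ (n + 2))⁻¹)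
      (-((n + 2 : ℕ) * (1 + ‖y‖ ^ 2) ^ (n + 1) * 1) / ((1 + ‖y‖ ^ 2) ^ (n + 2)) ^ 2) (‖y‖ ^ 2) := by
    refine HasDerivAt.inv ?_ (by positivity)
    have := ((hasDerivAt_id (‖y‖ ^ 2)).const_add 1).pow (n + 2)
    exact this
  have h3 := h2.comp_hasFDerivAt y h1
  refine h3.congr_fderiv ?_
  rw [← Nat.cast_smul_eq_nsmul ℝ 2, smul_smul]
  congr 1
  rw [wt0]
  have : (0 : ℝ) < 1 + ‖y‖ ^ 2 := by positivity
  push_cast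
  field_simp
  ring

theorem pd_wt0 (y : Rn n) (i : Fin n) :
    pd wt0 i y = -(2 * (n + 2) * (1 + ‖y‖ ^ 2)⁻¹ * wt0 y) * y i := by
  rw [pd, (hasFDerivAt_wt0 y).fderiv, smul_apply, innerSL_apply_apply,
    real_inner_comm, EuclideanSpace.inner_single_left]
  simp

/-- The polynomial weight at scale `s` centred at `x₀`. -/
def wt (s : ℝ) (x0 x : Rn n) : ℝ := wt0 (s⁻¹ • (x - x0))

theorem wt_pos (s : ℝ) (x0 x : Rn n) : 0 < wt s x0 x := wt0_pos _

theorem wt_le_one (s : ℝ) (x0 x : Rn n) : wt s x0 x ≤ 1 := wt0_le_one _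

theorem contDiff_wt (s : ℝ) (x0 : Rn n) : ContDiff ℝ (⊤ : ℕ∞) (wt s x0) :=
  contDiff_wt0.comp (by fun_prop)

theorem continuous_wt (s : ℝ) (x0 : Rn n) : Continuous (wt s x0) := (contDiff_wt s x0).continuous

theorem pd_wt (s : ℝ) (x0 x : Rn n) (i : Fin n) :
    pd (wt s x0) i x = s⁻¹ * pd wt0 i (s⁻¹ • (x - x0)) := by
  have h1 : HasFDerivAt (fun x : Rn n => s⁻¹ • (x - x0)) (s⁻¹ • ContinuousLinearMap.id ℝ (Rn n)) x :=
    ((hasFDerivAt_id x).sub_const x0).const_smul s⁻¹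
  have h2 := (hasFDerivAt_wt0 (s⁻¹ • (x - x0))).comp x h1
  have h3 : fderiv ℝ (wt s x0) x = _ := h2.fderiv
  rw [pd, h3, pd, (hasFDerivAt_wt0 (s⁻¹ • (x - x0))).fderiv]
  simp

theorem norm_gradC_wt_le {s : ℝ} (hs : 0 < s) (x0 x : Rn n) :
    ‖gradC (wt s x0) x‖ ≤ (n + 2) / s * wt s x0 x := by
  set y := s⁻¹ • (x - x0) with hy
  have e : gradC (wt s x0) x = ((s⁻¹ * -(2 * (n + 2) * (1 + ‖y‖ ^ 2)⁻¹ * wt0 y) : ℝ) : ℂ) •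
      (WithLp.toLp 2 fun i => (y i : ℂ) : Cn n) := by
    ext i
    rw [gradC_apply, pd_wt, pd_wt0, ← hy]
    change _ = ((s⁻¹ * -(2 * (n + 2) * (1 + ‖y‖ ^ 2)⁻¹ * wt0 y) : ℝ) : ℂ) * (y i : ℂ)
    push_cast
    ring
  have e2 : ‖(WithLp.toLp 2 fun i => (y i : ℂ) : Cn n)‖ = ‖y‖ := by
    rw [EuclideanSpace.norm_eq, EuclideanSpace.norm_eq]
    simp
  have hw := wt0_pos y
  rw [e, norm_smul, e2, Complex.norm_real, Real.norm_eq_abs, abs_mul, abs_neg,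
    abs_of_pos (inv_pos.2 hs), abs_of_pos (by positivity), show wt s x0 x = wt0 y from rfl]
  have h3 : 2 * ‖y‖ ≤ 1 + ‖y‖ ^ 2 := by nlinarith [sq_nonneg (‖y‖ - 1)]
  have hy0 : (0 : ℝ) < 1 + ‖y‖ ^ 2 := by positivity
  have h4 : 2 * ‖y‖ * (1 + ‖y‖ ^ 2)⁻¹ ≤ 1 := by
    rw [← div_eq_mul_inv, div_le_one hy0]; exact h3
  calc s⁻¹ * (2 * (n + 2) * (1 + ‖y‖ ^ 2)⁻¹ * wt0 y) * ‖y‖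
      = ((n + 2) / s * wt0 y) * (2 * ‖y‖ * (1 + ‖y‖ ^ 2)⁻¹) := by ring
    _ ≤ ((n + 2) / s * wt0 y) * 1 := by gcongr
    _ = _ := mul_one _

theorem isWeight_wt {s : ℝ} (hs : 0 < s) (x0 : Rn n) : IsWeight (wt s x0) where
  contDiff := contDiff_wt s x0
  bdd := ⟨1, fun x => by rw [abs_of_pos (wt_pos _ _ _)]; exact wt_le_one _ _ _⟩
  grad_bdd := ⟨(n + 2) / s, fun x => (norm_gradC_wt_le hs x0 x).trans
    (mul_le_of_le_one_right (by positivity) (wt_le_one _ _ _))⟩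

theorem lintegral_comp_scale {s : ℝ} (hs : 0 < s) (x0 : Rn n) (g : Rn n → ENNReal) 
    (hg : Measurable g) :
    ∫⁻ x, g (s⁻¹ • (x - x0)) = ENNReal.ofReal (s ^ n) * ∫⁻ y, g y := by
  rw [lintegral_sub_right_eq_self (fun x => g (s⁻¹ • x)) x0]
  have h := Measure.map_addHaar_smul (volume : Measure (Rn n)) (inv_pos.2 hs).ne'
  rw [← lintegral_map hg (measurable_const_smul s⁻¹), h, lintegral_smul_measure, smul_eq_mul]
  congr 2
  rw [finrank_euclideanSpace_fin, inv_pow, inv_inv, abs_of_pos (by positivity)]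

/-- The second moment of the square of the weight. -/
def wtMom (n : ℕ) : ENNReal := ∫⁻ y : Rn n, ENNReal.ofReal ((1 + ‖y‖ ^ 2) * wt0 y ^ 2)

theorem wtMom_lt_top (n : ℕ) : wtMom n < ⊤ := by
  have h := integrable_rpow_neg_one_add_norm_sq (E := Rn n) (μ := volume) (r := n + 1) (by simp)
  refine lt_of_le_of_lt (lintegral_mono fun y => ?_) h.lintegral_lt_top
  refine ENNReal.ofReal_le_ofReal ?_
  have hy : (1 : ℝ) ≤ 1 + ‖y‖ ^ 2 := by linarith [sq_nonneg ‖y‖]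
  have h0 : (0 : ℝ) < 1 + ‖y‖ ^ 2 := by linarith
  have e : (1 + ‖y‖ ^ 2) * wt0 y ^ 2 = (1 + ‖y‖ ^ 2) ^ (-(2 * n + 3 : ℝ)) := by
    rw [Real.rpow_neg h0.le, wt0, show (2 * n + 3 : ℝ) = ((2 * n + 3 : ℕ) : ℝ) by push_cast; ring,
      Real.rpow_natCast]
    field_simp
    ring
  rw [e]
  refine Real.rpow_le_rpow_of_exponent_le hy ?_
  have : (0 : ℝ) ≤ n := by positivity
  linarith

theorem lintegral_moment_wt {s : ℝ} (hs : 0 < s) (x0 : Rn n) :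
    ∫⁻ x, ENNReal.ofReal ((1 + ‖s⁻¹ • (x - x0)‖ ^ 2) * wt s x0 x ^ 2) =
      ENNReal.ofReal (s ^ n) * wtMom n := by
  refine lintegral_comp_scale hs x0 (fun y => ENNReal.ofReal ((1 + ‖y‖ ^ 2) * wt0 y ^ 2)) ?_
  have := (contDiff_wt0 (n := n)).continuous
  fun_prop

theorem lintegral_wt_sq_le {s : ℝ} (hs : 0 < s) (x0 : Rn n) :
    ∫⁻ x, ENNReal.ofReal (wt s x0 x ^ 2) ≤ ENNReal.ofReal (s ^ n) * wtMom n := by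
  rw [← lintegral_moment_wt hs x0]
  refine lintegral_mono fun x => ENNReal.ofReal_le_ofReal ?_
  nlinarith [mul_nonneg (sq_nonneg ‖s⁻¹ • (x - x0)‖) (sq_nonneg (wt s x0 x))]

theorem wt_le_mul_wt_zero (s : ℝ) (x0 x : Rn n) :
    wt s x0 x ≤ (2 + 2 * ‖s⁻¹ • x0‖ ^ 2) ^ (n + 2) * wt s 0 x := by
  rw [wt, wt, wt0, wt0, sub_zero, smul_sub]
  set a := s⁻¹ • x
  set b := s⁻¹ • x0
  rw [← div_eq_mul_inv, le_div_iff₀ (by positivity), inv_mul_eq_div, div_le_iff₀ (by positivity),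
    ← mul_pow]
  refine pow_le_pow_left₀ (by positivity) ?_ _
  have h1 : ‖a‖ ≤ ‖a - b‖ + ‖b‖ := by simpa using norm_add_le (a - b) b
  have h2 : ‖a‖ ^ 2 ≤ (‖a - b‖ + ‖b‖) ^ 2 := by gcongr
  nlinarith [sq_nonneg (‖a - b‖ - ‖b‖), mul_nonneg (sq_nonneg ‖a - b‖) (sq_nonneg ‖b‖),
    sq_nonneg ‖a - b‖, sq_nonneg ‖b‖]

theorem wt_ge_of_norm_sub_le {s r : ℝ} (hs : 0 < s) {x0 x : Rn n} (h : ‖x - x0‖ ≤ r * s) :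
    ((1 + r ^ 2) ^ (n + 2))⁻¹ ≤ wt s x0 x := by
  rw [wt, wt0]
  have : ‖s⁻¹ • (x - x0)‖ ≤ r := by
    rw [norm_smul, norm_inv, Real.norm_of_nonneg hs.le, inv_mul_le_iff₀ hs]
    linarith
  gcongr

/-- Multiplication by a bounded continuous function. -/
def smulOp (m : Rn n → ℝ) (hm : Continuous m) {C : ℝ} (hC : ∀ x, |m x| ≤ C) (X : Type*)
    [NormedAddCommGroup X] [NormedSpace ℂ X] :
    Lp X 2 (volume : Measure (Rn n)) →L[ℂ] Lp X 2 (volume : Measure (Rn n)) :=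
  mulOp (M := C) (fun x => (m x : ℂ) • ContinuousLinearMap.id ℂ X)
    ((Complex.continuous_ofReal.comp hm).aestronglyMeasurable.smul_const _) (by
      refine Filter.Eventually.of_forall fun x => ?_
      rw [norm_smul, norm_real]
      exact (mul_le_of_le_one_right (norm_nonneg _) ContinuousLinearMap.norm_id_le).trans (hC x))

theorem coeFn_smulOp (m : Rn n → ℝ) (hm : Continuous m) {C : ℝ} (hC : ∀ x, |m x| ≤ C) {X : Type*}
    [NormedAddCommGroup X] [NormedSpace ℂ X] (f : Lp X 2 (volume : Measure (Rn n))) :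
    smulOp m hm hC X f =ᵐ[volume] fun x => (m x : ℂ) • f x :=
  coeFn_mulOp _ _ f

theorem IsWeight.denseRange_mul {ω : Rn n → ℝ} (h : IsWeight ω) (h0 : ∀ x, ω x ≠ 0) :
    DenseRange (h.mul (Cn n)) := by
  have h1 : ((h.mul (Cn n)).range.topologicalClosure) = ⊤ := by
    rw [Submodule.topologicalClosure_eq_top_iff, Submodule.eq_bot_iff]
    intro f hf
    rw [Submodule.mem_orthogonal] at hf
    have h2 : h.mul (Cn n) f = 0 := by
      refine ext_inner_left ℂ fun G => ?_
      have h3 : inner ℂ (h.mul (Cn n) G) f = 0 := hf _ ⟨G, rfl⟩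
      rw [← h.mul_inner, h3, inner_zero_right]
    rw [Lp.eq_zero_iff_ae_eq_zero] at h2 ⊢
    filter_upwards [h2, h.coeFn_mul f] with x h3 h4
    rw [h4] at h3
    have : (ω x : ℂ) ≠ 0 := by exact_mod_cast h0 x
    exact (smul_eq_zero.1 h3).resolve_left this
  have := Submodule.dense_iff_topologicalClosure_eq_top.2 h1
  exact this

/-- The constant field `w` multiplied by the weight at the origin. -/
theorem memLp_wt_smul {s : ℝ} (hs : 0 < s) (x0 : Rn n) (w : Cn n) :
    MemLp (fun x => (wt s x0 x : ℂ) • w) 2 volume := by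
  refine memLp_of_lintegral_sq_lt_top ((Complex.continuous_ofReal.comp
    (continuous_wt s x0)).smul continuous_const).aestronglyMeasurable ?_
  have e : ∀ x, ‖(wt s x0 x : ℂ) • w‖ₑ ^ 2 = ENNReal.ofReal (wt s x0 x ^ 2) * ‖w‖ₑ ^ 2 := fun x => by
    rw [enorm_smul, mul_pow, ← ofReal_norm, norm_real, Real.norm_of_nonneg (wt_pos s x0 x).le,
      ENNReal.ofReal_pow (wt_pos s x0 x).le]
  simp_rw [e]
  rw [lintegral_mul_const' _ _ (by simp)]
  refine ENNReal.mul_lt_top ((lintegral_wt_sq_le hs x0).trans_lt ?_) (by simp)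
  exact ENNReal.mul_lt_top ENNReal.ofReal_lt_top (wtMom_lt_top n)

/-- Weighted constant fields as a linear map into `L²`. -/
def wtConst {s : ℝ} (hs : 0 < s) : Cn n →ₗ[ℂ] Lc n where
  toFun w := (memLp_wt_smul hs 0 w).toLp
  map_add' v w := by
    rw [← MemLp.toLp_add]
    exact MemLp.toLp_congr _ _ (Filter.Eventually.of_forall fun x => smul_add _ _ _)
  map_smul' c w := by
    rw [RingHom.id_apply, ← MemLp.toLp_const_smul]
    exact MemLp.toLp_congr _ _ (Filter.Eventually.of_forall fun x => smul_comm _ _ _)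

theorem coeFn_wtConst {s : ℝ} (hs : 0 < s) (w : Cn n) :
    wtConst hs w =ᵐ[volume] fun x => (wt s 0 x : ℂ) • w :=
  MemLp.coeFn_toLp (memLp_wt_smul hs 0 w)

namespace KData

variable {M κ : ℝ} {V : Type} [NormedAddCommGroup V] [InnerProductSpace ℂ V] [CompleteSpace V]
  (D : KData n M κ V)

/-- The ratio of the scale of the weights to the scale of the resolvent. -/
def lam (n : ℕ) (M κ : ℝ) : ℝ := (n + 2) * (4 * (1 + M)) / κ

theorem lam_pos (D : KData n M κ V) : 0 < lam n M κ := by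
  have := D.M_nonneg
  have := D.κ_pos
  unfold lam
  positivity

theorem norm_mul_wt_theta_le {t s : ℝ} (ht : 0 < t) (hs : 0 < s) (hst : s = lam n M κ * t)
    (x0 : Rn n) (G : Lc n) :
    ‖(isWeight_wt hs x0).mul ℂ (D.theta t G)‖ ^ 2 ≤
      8 * M ^ 2 / κ * ‖(isWeight_wt hs x0).mul (Cn n) G‖ ^ 2 := by
  refine D.weighted_theta_le ht rfl _ (fun x => ?_) G
  have hM := D.M_nonneg
  have hκ := D.κ_pos
  rw [abs_of_pos (wt_pos _ _ _)]
  calc t * ‖gradC (wt s x0) x‖ ≤ t * ((n + 2) / s * wt s x0 x) := by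
        gcongr
        exact norm_gradC_wt_le hs x0 x
    _ = κ / (4 * (1 + M)) * wt s x0 x := by
        rw [hst, lam]
        field_simp

/-- The extension of `ω θ ω⁻¹` to all of `L²`. -/
theorem exists_weighted_extension {t s : ℝ} (ht : 0 < t) (hs : 0 < s)
    (hst : s = lam n M κ * t) : ∃ T : Lc n →L[ℂ] L2 n,
    ∀ G, T ((isWeight_wt hs 0).mul (Cn n) G) = (isWeight_wt hs 0).mul ℂ (D.theta t G) := by
  have hd : DenseRange ((isWeight_wt hs (0 : Rn n)).mul (Cn n)).toLinearMap :=
    (isWeight_wt hs (0 : Rn n)).denseRange_mul fun x => (wt_pos _ _ _).ne'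
  have hb : ∃ C, ∀ G, ‖((isWeight_wt hs (0 : Rn n)).mul ℂ ∘L D.theta t).toLinearMap G‖ ≤
      C * ‖((isWeight_wt hs (0 : Rn n)).mul (Cn n)).toLinearMap G‖ := by
    have hκ := D.κ_pos
    refine ⟨Real.sqrt (8 * M ^ 2 / κ), fun G => ?_⟩
    refine le_of_sq_le_sq ?_ (by positivity)
    rw [mul_pow, Real.sq_sqrt (by positivity)]
    exact D.norm_mul_wt_theta_le ht hs hst 0 G
  exact ⟨_, fun G => LinearMap.extendOfNorm_eq hd hb G⟩

theorem norm_extension_le {t s : ℝ} (ht : 0 < t) (hs : 0 < s) (hst : s = lam n M κ * t)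
    {T : Lc n →L[ℂ] L2 n}
    (hT : ∀ G, T ((isWeight_wt hs 0).mul (Cn n) G) = (isWeight_wt hs 0).mul ℂ (D.theta t G))
    {m : Rn n → ℝ} (hm : Continuous m) {C : ℝ} (hC : ∀ x, |m x| ≤ C) {x0 : Rn n}
    (hmx : ∀ x, m x * wt s 0 x = wt s x0 x) (Y : Lc n) :
    ‖smulOp m hm hC ℂ (T Y)‖ ^ 2 ≤ 8 * M ^ 2 / κ * ‖smulOp m hm hC (Cn n) Y‖ ^ 2 := by
  have hd : DenseRange ((isWeight_wt hs (0 : Rn n)).mul (Cn n)) :=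
    (isWeight_wt hs (0 : Rn n)).denseRange_mul fun x => (wt_pos _ _ _).ne'
  refine hd.induction_on (p := fun Y => ‖smulOp m hm hC ℂ (T Y)‖ ^ 2 ≤
    8 * M ^ 2 / κ * ‖smulOp m hm hC (Cn n) Y‖ ^ 2) Y ?_ fun G => ?_
  · refine isClosed_le ?_ ?_
    · exact (((smulOp m hm hC ℂ).continuous.comp T.continuous).norm).pow 2
    · exact (((smulOp m hm hC (Cn n)).continuous.norm).pow 2).const_mul _
  · have e : ∀ (X : Type) [NormedAddCommGroup X] [NormedSpace ℂ X]
        (f : Lp X 2 (volume : Measure (Rn n))),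
        smulOp m hm hC X ((isWeight_wt hs 0).mul X f) = (isWeight_wt hs x0).mul X f := by
      intro X _ _ f
      refine Lp.ext ?_
      filter_upwards [coeFn_smulOp m hm hC ((isWeight_wt hs 0).mul X f),
        (isWeight_wt hs (0 : Rn n)).coeFn_mul f, (isWeight_wt hs x0).coeFn_mul f] with x h1 h2 h3
      rw [h1, h2, h3, smul_smul, ← hmx]
      push_cast
      rfl
    rw [hT, e, e]
    exact D.norm_mul_wt_theta_le ht hs hst x0 G

set_option maxHeartbeats 1000000 in
theorem lintegral_sub_gamma_le {t s : ℝ} (ht : 0 < t) (hs : 0 < s) (hst : s = lam n M κ * t)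
    {T : Lc n →L[ℂ] L2 n}
    (hT : ∀ G, T ((isWeight_wt hs 0).mul (Cn n) G) = (isWeight_wt hs 0).mul ℂ (D.theta t G))
    {g : Rn n → ℂ} {F : Lc n} {w : Cn n}
    (hg : ∀ᵐ x, T (wtConst hs w) x = (wt s 0 x : ℂ) * g x) (x0 : Rn n) :
    ∫⁻ x, ENNReal.ofReal (wt s x0 x ^ 2) * ‖D.theta t F x - g x‖ₑ ^ 2 ≤
      ENNReal.ofReal (8 * M ^ 2 / κ) *
        ∫⁻ x, ENNReal.ofReal (wt s x0 x ^ 2) * ‖F x - w‖ₑ ^ 2 := by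
  have hκ := D.κ_pos
  set m : Rn n → ℝ := fun x => wt s x0 x / wt s 0 x with hm0
  have hm : Continuous m := (continuous_wt s x0).div (continuous_wt s 0) fun x => (wt_pos _ _ _).ne'
  have hC : ∀ x, |m x| ≤ (2 + 2 * ‖s⁻¹ • x0‖ ^ 2) ^ (n + 2) := fun x => by
    rw [abs_of_pos (div_pos (wt_pos _ _ _) (wt_pos _ _ _)), div_le_iff₀ (wt_pos _ _ _)]
    exact wt_le_mul_wt_zero s x0 x
  have hmx : ∀ x, m x * wt s 0 x = wt s x0 x := fun x => div_mul_cancel₀ _ (wt_pos _ _ _).ne'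
  have key := D.norm_extension_le ht hs hst hT hm hC hmx
    ((isWeight_wt hs 0).mul (Cn n) F - wtConst hs w)
  have he : ∀ (x : Rn n) (X : Type) [NormedAddCommGroup X] [NormedSpace ℂ X] (z : X),
      ‖(wt s x0 x : ℂ) • z‖ₑ ^ 2 = ENNReal.ofReal (wt s x0 x ^ 2) * ‖z‖ₑ ^ 2 := fun x X _ _ z => by
    rw [enorm_smul, mul_pow, ← ofReal_norm, norm_real, Real.norm_of_nonneg (wt_pos s x0 x).le,
      ENNReal.ofReal_pow (wt_pos s x0 x).le]
  have h1 : smulOp m hm hC ℂ (T ((isWeight_wt hs 0).mul (Cn n) F - wtConst hs w)) =ᵐ[volume]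
      fun x => (wt s x0 x : ℂ) • (D.theta t F x - g x) := by
    rw [map_sub, hT]
    filter_upwards [coeFn_smulOp m hm hC ((isWeight_wt hs 0).mul ℂ (D.theta t F) -
      T (wtConst hs w)), Lp.coeFn_sub ((isWeight_wt hs 0).mul ℂ (D.theta t F)) (T (wtConst hs w)),
      (isWeight_wt hs (0 : Rn n)).coeFn_mul (D.theta t F), hg] with x a1 a2 a3 a4
    rw [a1, a2, Pi.sub_apply, a3, a4, ← hmx]
    simp only [smul_eq_mul]
    push_cast
    ring
  have h2 : smulOp m hm hC (Cn n) ((isWeight_wt hs 0).mul (Cn n) F - wtConst hs w) =ᵐ[volume]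
      fun x => (wt s x0 x : ℂ) • (F x - w) := by
    filter_upwards [coeFn_smulOp m hm hC ((isWeight_wt hs 0).mul (Cn n) F - wtConst hs w),
      Lp.coeFn_sub ((isWeight_wt hs 0).mul (Cn n) F) (wtConst hs w),
      (isWeight_wt hs (0 : Rn n)).coeFn_mul F, coeFn_wtConst hs w] with x a1 a2 a3 a4
    rw [a1, a2, Pi.sub_apply, a3, a4, ← hmx, ← smul_sub, smul_smul]
    push_cast
    rfl
  have h3 := ENNReal.ofReal_le_ofReal key
  rw [ENNReal.ofReal_mul (by positivity), ofReal_norm_sq, ofReal_norm_sq] at h3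
  calc _ = ∫⁻ x, ‖smulOp m hm hC ℂ (T ((isWeight_wt hs 0).mul (Cn n) F - wtConst hs w)) x‖ₑ ^ 2 := by
        refine lintegral_congr_ae ?_
        filter_upwards [h1] with x hx
        rw [hx, he]
    _ ≤ _ := h3
    _ = _ := by
        congr 1
        refine lintegral_congr_ae ?_
        filter_upwards [h2] with x hx
        rw [hx, he]

set_option maxHeartbeats 1000000 in
/-- The principal part of `θ_t`: a field `γ` such that `θ_t` acts on constants as `γ`. -/
theorem exists_gamma {t : ℝ} (ht : 0 < t) : ∃ γ : Rn n → Cn n, Measurable γ ∧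
    ∀ (F : Lc n) (w : Cn n) (x0 : Rn n),
      ∫⁻ x, ENNReal.ofReal (wt (lam n M κ * t) x0 x ^ 2) *
          ‖D.theta t F x - inner ℂ (γ x) w‖ₑ ^ 2 ≤
        ENNReal.ofReal (8 * M ^ 2 / κ) *
          ∫⁻ x, ENNReal.ofReal (wt (lam n M κ * t) x0 x ^ 2) * ‖F x - w‖ₑ ^ 2 := by
  have hs : 0 < lam n M κ * t := mul_pos D.lam_pos ht
  obtain ⟨T, hT⟩ := D.exists_weighted_extension ht hs rfl
  set Z : Fin n → L2 n := fun i => T (wtConst hs (EuclideanSpace.single i 1)) with hZ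
  set γ : Rn n → Cn n := fun x => WithLp.toLp 2 fun i =>
    (starRingEnd ℂ) ((wt (lam n M κ * t) 0 x : ℂ)⁻¹ * Z i x) with hγ
  refine ⟨γ, ?_, fun F w x0 => D.lintegral_sub_gamma_le ht hs rfl hT ?_ x0⟩
  · refine (WithLp.measurable_toLp 2 (Fin n → ℂ)).comp (measurable_pi_lambda _ fun i => ?_)
    have h1 : Measurable (Z i) := (Lp.stronglyMeasurable (Z i)).measurable
    have h2 : Measurable fun x : Rn n => (wt (lam n M κ * t) 0 x : ℂ)⁻¹ :=
      (Complex.measurable_ofReal.comp (continuous_wt _ 0).measurable).inv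
    exact Complex.continuous_conj.measurable.comp (h2.mul h1)
  · have e : T (wtConst hs w) = ∑ i, w i • Z i := by
      have : w = ∑ i, w i • EuclideanSpace.single i (1 : ℂ) := by
        ext j
        simp [Finset.sum_apply, Pi.single_apply]
      conv_lhs => rw [this]
      simp only [map_sum, map_smul, hZ]
    have e2 : ∀ᵐ x, (∑ i, w i • Z i : L2 n) x = ∑ i, w i * Z i x := by
      filter_upwards [Lp.coeFn_finsetSum Finset.univ fun i => w i • Z i,
        ae_all_iff.2 fun i => Lp.coeFn_smul (w i) (Z i)] with x h1 h2
      rw [h1, Finset.sum_apply]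
      refine Finset.sum_congr rfl fun i _ => ?_
      rw [h2 i]
      rfl
    rw [e]
    filter_upwards [e2] with x hx
    have hw : (wt (lam n M κ * t) 0 x : ℂ) ≠ 0 := by exact_mod_cast (wt_pos _ _ _).ne'
    rw [hx, PiLp.inner_apply, Finset.mul_sum]
    refine Finset.sum_congr rfl fun i _ => ?_
    rw [RCLike.inner_apply, hγ]
    simp only [Complex.conj_conj]
    field_simp

end KData

end

section

variable {n : ℕ}

/-! ### Translations -/

/-- Translation by `h` on `L²`. -/
def trL (h : Rn n) (X : Type) [NormedAddCommGroup X] [InnerProductSpace ℂ X] :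
    Lp X 2 (volume : Measure (Rn n)) →ₗᵢ[ℂ] Lp X 2 (volume : Measure (Rn n)) :=
  Lp.compMeasurePreservingₗᵢ ℂ (fun x => x + h) (measurePreserving_add_right volume h)

section
variable {X : Type} [NormedAddCommGroup X] [InnerProductSpace ℂ X]

theorem coeFn_trL (h : Rn n) (f : Lp X 2 (volume : Measure (Rn n))) :
    trL h X f =ᵐ[volume] fun x => f (x + h) :=
  Lp.coeFn_compMeasurePreserving f (measurePreserving_add_right volume h)

theorem ae_comp_add {p : Rn n → Prop} (hp : ∀ᵐ x, p x) (h : Rn n) : ∀ᵐ x : Rn n, p (x + h) :=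
  (measurePreserving_add_right volume h).quasiMeasurePreserving.ae hp

theorem trL_trL_neg (h : Rn n) (f : Lp X 2 (volume : Measure (Rn n))) :
    trL h X (trL (-h) X f) = f := by
  apply Lp.ext
  filter_upwards [coeFn_trL h (trL (-h) X f), ae_comp_add (coeFn_trL (-h) f) h] with x h1 h2
  rw [h1, h2, add_neg_cancel_right]

theorem inner_trL (h : Rn n) (f g : Lp X 2 (volume : Measure (Rn n))) :
    inner ℂ f (trL h X g) = inner ℂ (trL (-h) X f) g := by
  rw [← (trL h X).inner_map_map (trL (-h) X f) g, trL_trL_neg]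

end

theorem coordL_trL (h : Rn n) (i : Fin n) (q : Lc n) :
    coordL i (trL h (Cn n) q) = trL h ℂ (coordL i q) := by
  apply Lp.ext
  filter_upwards [coeFn_coordL i (trL h (Cn n) q), coeFn_trL h q, coeFn_trL h (coordL i q),
    ae_comp_add (coeFn_coordL i q) h] with x h1 h2 h3 h4
  rw [h1, h2, h3, h4]

theorem IsTest.comp_add {φ : Rn n → ℝ} (hφ : IsTest φ) (h : Rn n) : IsTest fun x => φ (x + h) :=
  ⟨hφ.1.comp (contDiff_id.add contDiff_const), hφ.2.comp_homeomorph (Homeomorph.addRight h)⟩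

theorem pd_comp_add (φ : Rn n → ℝ) (h : Rn n) (i : Fin n) :
    pd (fun x => φ (x + h)) i = fun x => pd φ i (x + h) := by
  ext x
  rw [pd, pd, fderiv_comp_add_right]

theorem IsTest.toL2_comp_add {φ : Rn n → ℝ} (hφ : IsTest φ) (h : Rn n) :
    toL2 (fun x => φ (x + h)) = trL h ℂ (toL2 φ) := by
  apply Lp.ext
  filter_upwards [(hφ.comp_add h).coeFn_toL2, coeFn_trL h (toL2 φ),
    ae_comp_add hφ.coeFn_toL2 h] with x h1 h2 h3
  rw [h1, h2, h3]

theorem IsWGrad.trL {u : L2 n} {q : Lc n} (hq : IsWGrad u q) (h : Rn n) :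
    IsWGrad (trL h ℂ u) (trL h (Cn n) q) := by
  intro i φ hφ
  rw [coordL_trL, inner_trL, inner_trL, ← hφ.toL2_comp_add, ← (hφ.pd i).toL2_comp_add,
    hq i _ (hφ.comp_add _), pd_comp_add]

theorem IsWGrad.sub {u u' : L2 n} {q q' : Lc n} (hq : IsWGrad u q) (hq' : IsWGrad u' q') :
    IsWGrad (u - u') (q - q') := by
  intro i φ hφ
  rw [map_sub, inner_sub_right, inner_sub_right, hq i φ hφ, hq' i φ hφ]
  ring

theorem fderiv_apply_eq_sum (φ : Rn n → ℝ) (y h : Rn n) :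
    fderiv ℝ φ y h = ∑ i, h i * pd φ i y := by
  have : h = ∑ i, h i • EuclideanSpace.single i (1 : ℝ) := by
    ext j
    simp [Finset.sum_apply, Pi.single_apply]
  conv_lhs => rw [this]
  simp [pd]

theorem norm_sum_coordL_le (h : Rn n) (q : Lc n) :
    ‖∑ i, (h i : ℂ) • coordL i q‖ ≤ ‖h‖ * ‖q‖ := by
  have e : ∀ᵐ x, ‖(∑ i, (h i : ℂ) • coordL i q : L2 n) x‖ ≤ ‖((‖h‖ : ℂ) • q : Lc n) x‖ := by
    filter_upwards [Lp.coeFn_finsetSum Finset.univ fun i => (h i : ℂ) • coordL i q,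
      ae_all_iff.2 fun i => Lp.coeFn_smul (h i : ℂ) (coordL i q),
      ae_all_iff.2 fun i => coeFn_coordL i q, Lp.coeFn_smul (‖h‖ : ℂ) q] with x h1 h2 h3 h4
    rw [h1, Finset.sum_apply, h4, Pi.smul_apply, norm_smul, Complex.norm_real, norm_norm]
    have : ∑ i, ((h i : ℂ) • coordL i q : L2 n) x
        = inner ℂ (WithLp.toLp 2 fun i => (h i : ℂ) : Cn n) (q x) := by
      rw [PiLp.inner_apply]
      refine Finset.sum_congr rfl fun i _ => ?_
      rw [h2 i, Pi.smul_apply, h3 i]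
      simp [mul_comm]
    rw [this]
    refine (norm_inner_le_norm _ _).trans_eq ?_
    congr 1
    simp [EuclideanSpace.norm_eq]
  refine (norm_le_norm_of_ae_le e).trans_eq ?_
  rw [norm_smul, Complex.norm_real, norm_norm]

open scoped Convolution in
theorem hasDerivAt_inner_translate {u : L2 n} {q : Lc n} (hq : IsWGrad u q) {φ : Rn n → ℝ}
    (hφ : IsTest φ) (h : Rn n) (s : ℝ) :
    HasDerivAt (fun s : ℝ => inner ℂ (toL2 fun x => φ (x + -(s • h))) u)
      (inner ℂ (toL2 fun x => φ (x + -(s • h))) (∑ i, (h i : ℂ) • coordL i q)) s := by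
  set L : ℂ →L[ℝ] ℝ →L[ℝ] ℂ := (ContinuousLinearMap.lsmul ℝ ℝ).flip with hL
  set ψ : Rn n → ℝ := fun y => φ (-y) with hψ
  have hψ1 : ContDiff ℝ 1 ψ := (hφ.1.of_le (by exact_mod_cast le_top)).comp contDiff_neg
  have hψ2 : HasCompactSupport ψ := hφ.2.comp_homeomorph (Homeomorph.neg _)
  have hu : LocallyIntegrable u (volume : Measure (Rn n)) :=
    (Lp.memLp u).locallyIntegrable one_le_two
  have hd := hψ2.hasFDerivAt_convolution_right L hu hψ1 (s • h)
  have hline : HasDerivAt (fun s : ℝ => s • h) h s := by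
    simpa using (hasDerivAt_id s).smul_const h
  have hd2 := hd.comp_hasDerivAt s hline
  rw [convolution_precompR_apply L hu (hψ2.fderiv ℝ) (hψ1.continuous_fderiv one_ne_zero)] at hd2
  have e1 : (fun s : ℝ => inner ℂ (toL2 fun x => φ (x + -(s • h))) u)
      = (fun x => (u ⋆[L, volume] ψ) x) ∘ fun s : ℝ => s • h := by
    ext s
    rw [(hφ.comp_add _).inner_toL2, Function.comp, convolution_def]
    refine integral_congr_ae (Filter.Eventually.of_forall fun x => ?_)
    simp [hL, hψ, sub_eq_add_neg]
  rw [e1]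
  refine hd2.congr_deriv ?_
  have hf : ∀ y, fderiv ℝ ψ y h = - fderiv ℝ φ (-y) h := fun y => by
    have h1 : HasFDerivAt φ (fderiv ℝ φ (-y)) (-y) :=
      ((hφ.1.differentiable (by simp)) (-y)).hasFDerivAt
    have h2 : HasFDerivAt ψ _ y := h1.comp y (hasFDerivAt_id y).neg
    rw [h2.fderiv]
    simp
  have hT := hφ.comp_add (-(s • h))
  rw [inner_sum, convolution_def]
  simp_rw [inner_smul_right, hq _ _ hT, (hT.pd _).inner_toL2]
  have e3 : ∀ i, Integrable (fun x => (pd (fun x => φ (x + -(s • h))) i x : ℂ) * u x) := fun i =>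
    (hT.pd i).memLp.integrable_mul (Lp.memLp u)
  simp_rw [mul_neg, ← integral_const_mul]
  rw [Finset.sum_neg_distrib, ← integral_finsetSum _ fun i _ => (e3 i).const_mul _,
    ← integral_neg]
  refine integral_congr_ae (Filter.Eventually.of_forall fun x => ?_)
  simp only [hL, hf, fderiv_apply_eq_sum, pd_comp_add]
  simp [sub_eq_add_neg, Finset.sum_mul, mul_assoc]

theorem norm_inner_trL_sub_le {u : L2 n} {q : Lc n} (hq : IsWGrad u q) {φ : Rn n → ℝ}
    (hφ : IsTest φ) (h : Rn n) :
    ‖inner ℂ (toL2 φ) (trL h ℂ u - u)‖ ≤ ‖h‖ * ‖q‖ * ‖toL2 φ‖ := by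
  have hb : ∀ s : ℝ, ‖inner ℂ (toL2 fun x => φ (x + -(s • h))) (∑ i, (h i : ℂ) • coordL i q)‖
      ≤ ‖h‖ * ‖q‖ * ‖toL2 φ‖ := fun s => by
    refine (norm_inner_le_norm _ _).trans ?_
    rw [hφ.toL2_comp_add, LinearIsometry.norm_map, mul_comm]
    exact mul_le_mul_of_nonneg_right (norm_sum_coordL_le h q) (norm_nonneg _)
  have := convex_univ.norm_image_sub_le_of_norm_hasDerivWithin_le
    (fun s _ => (hasDerivAt_inner_translate hq hφ h s).hasDerivWithinAt) (fun s _ => hb s)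
    (mem_univ (0 : ℝ)) (mem_univ (1 : ℝ))
  simp only [one_smul, zero_smul, neg_zero, add_zero, sub_zero, norm_one, mul_one] at this
  rwa [inner_sub_right, inner_trL, ← hφ.toL2_comp_add]

theorem norm_le_of_forall_isTest {z : L2 n} {B : ℝ} (hB : 0 ≤ B)
    (hz : ∀ φ, IsTest φ → ‖inner ℂ (toL2 φ) z‖ ≤ B * ‖toL2 φ‖) : ‖z‖ ≤ 2 * B := by
  have key : ∀ f : L2 n, ‖inner ℂ f z‖ ≤ 2 * B * ‖f‖ := by
    intro f
    have hd := Lp.dense_hasCompactSupport_contDiff (μ := (volume : Measure (Rn n))) (F := ℂ)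
      (p := 2) (by simp) f
    refine closure_minimal (t := {f : L2 n | ‖inner ℂ f z‖ ≤ 2 * B * ‖f‖}) ?_
      (isClosed_le (by fun_prop) (by fun_prop)) hd
    rintro f ⟨g, hfg, hc, hs⟩
    rw [mem_ofPred_eq]
    have t1 : IsTest fun x => (g x).re :=
      ⟨Complex.reCLM.contDiff.comp hs, hc.comp_left (g := Complex.re) Complex.zero_re⟩
    have t2 : IsTest fun x => (g x).im :=
      ⟨Complex.imCLM.contDiff.comp hs, hc.comp_left (g := Complex.im) Complex.zero_im⟩
    have e : f = toL2 (fun x => (g x).re) + Complex.I • toL2 (fun x => (g x).im) := by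
      apply Lp.ext
      filter_upwards [hfg, t1.coeFn_toL2, t2.coeFn_toL2,
        Lp.coeFn_add (toL2 (fun x => (g x).re)) (Complex.I • toL2 (fun x => (g x).im)),
        Lp.coeFn_smul Complex.I (toL2 (fun x => (g x).im))] with x h1 h2 h3 h4 h5
      rw [h4, Pi.add_apply, h5, Pi.smul_apply, h1, h2, h3, smul_eq_mul, mul_comm Complex.I]
      exact (Complex.re_add_im (g x)).symm
    have b1 : ‖toL2 (fun x => (g x).re)‖ ≤ ‖f‖ := by
      refine norm_le_norm_of_ae_le ?_
      filter_upwards [hfg, t1.coeFn_toL2] with x h1 h2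
      rw [h1, h2, Complex.norm_real]
      exact Complex.abs_re_le_norm _
    have b2 : ‖toL2 (fun x => (g x).im)‖ ≤ ‖f‖ := by
      refine norm_le_norm_of_ae_le ?_
      filter_upwards [hfg, t2.coeFn_toL2] with x h1 h2
      rw [h1, h2, Complex.norm_real]
      exact Complex.abs_im_le_norm _
    have c1 := (hz _ t1).trans (mul_le_mul_of_nonneg_left b1 hB)
    have c2 := (hz _ t2).trans (mul_le_mul_of_nonneg_left b2 hB)
    have : ‖inner ℂ f z‖ ≤ ‖inner ℂ (toL2 fun x => (g x).re) z‖
        + ‖inner ℂ (toL2 fun x => (g x).im) z‖ := by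
      conv_lhs => rw [e, inner_add_left, inner_smul_left]
      refine (norm_add_le _ _).trans (by simp)
    linarith
  have h1 := key z
  rw [inner_self_eq_norm_sq_to_K, norm_pow, RCLike.norm_ofReal, abs_norm, pow_two] at h1
  rcases eq_or_lt_of_le (norm_nonneg z) with h0 | h0
  · rw [← h0]; positivity
  · nlinarith only [h1, h0]

theorem IsWGrad.norm_trL_sub_le {u : L2 n} {q : Lc n} (hq : IsWGrad u q) (h : Rn n) :
    ‖_root_.trL h ℂ u - u‖ ≤ 2 * (‖h‖ * ‖q‖) :=
  norm_le_of_forall_isTest (by positivity) fun _ hφ => norm_inner_trL_sub_le hq hφ h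

/-- Translation estimate for the gradient of a function in the domain of the Laplacian. -/
theorem norm_trL_sub_le_of_inner {p ℓ : L2 n} {F : Lc n} (hF : IsWGrad p F)
    (hℓ : ∀ v q, IsWGrad v q → inner ℂ q F = inner ℂ v ℓ) (h : Rn n) :
    ‖trL h (Cn n) F - F‖ ≤ 2 * ‖h‖ * ‖ℓ‖ := by
  set w := trL h ℂ p - p
  set q := trL h (Cn n) F - F with hqdef
  have hq : IsWGrad w q := (hF.trL h).sub hF
  have e : inner ℂ q q = inner ℂ (trL (-h) ℂ w - w) ℓ := by
    conv_lhs => rw [hqdef, inner_sub_right, inner_trL]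
    rw [← hqdef, hℓ _ _ (hq.trL (-h)), hℓ _ _ hq, inner_sub_left (trL (-h) ℂ w)]
  have h1 : ‖q‖ * ‖q‖ ≤ 2 * (‖h‖ * ‖q‖) * ‖ℓ‖ := by
    have e2 : ‖q‖ * ‖q‖ = ‖inner ℂ q q‖ := by
      rw [inner_self_eq_norm_sq_to_K, norm_pow, RCLike.norm_ofReal, abs_norm, pow_two]
    rw [e2, e]
    refine (norm_inner_le_norm _ _).trans (mul_le_mul_of_nonneg_right ?_ (norm_nonneg _))
    simpa using hq.norm_trL_sub_le (-h)
  rcases eq_or_lt_of_le (norm_nonneg q) with h0 | h0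
  · rw [← h0]; positivity
  · nlinarith only [h1, h0]

end

section

variable {n : ℕ}

theorem wt_le_mul_wt {s r : ℝ} (hs : 0 < s) {x0 z : Rn n} (h : ‖x0 - z‖ ≤ r * s) (x : Rn n) :
    wt s x0 x ≤ (2 + 2 * r ^ 2) ^ (n + 2) * wt s z x := by
  have h1 : wt s x0 x = wt s (x0 - z) (x - z) := by
    rw [wt, wt, sub_sub_sub_cancel_right]
  have h2 : wt s z x = wt s 0 (x - z) := by
    rw [wt, wt, sub_zero]
  rw [h1, h2]
  refine (wt_le_mul_wt_zero s (x0 - z) (x - z)).trans ?_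
  have : ‖s⁻¹ • (x0 - z)‖ ≤ r := by
    rw [norm_smul, norm_inv, Real.norm_of_nonneg hs.le, inv_mul_le_iff₀ hs]
    linarith
  have := (wt_pos s 0 (x - z)).le
  gcongr

theorem measurable_wt_uncurry (s : ℝ) : Measurable fun p : Rn n × Rn n => wt s p.1 p.2 := by
  have := (contDiff_wt0 (n := n)).continuous
  unfold wt
  exact (this.comp (by fun_prop)).measurable

/-- Averaged translation estimate. -/
theorem lintegral_lintegral_wt_le {s B : ℝ} (hs : 0 < s) {F : Lc n}
    (hF : ∀ h, ‖trL h (Cn n) F - F‖ ≤ B * ‖h‖) :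
    ∫⁻ z, ∫⁻ x, ENNReal.ofReal (wt s z x ^ 2) * ‖F x - F z‖ₑ ^ 2 ≤
      ENNReal.ofReal (B ^ 2 * s ^ 2 * s ^ n) * wtMom n := by
  have hFm : Measurable F := (Lp.stronglyMeasurable F).measurable
  have h0 : Measurable (wt s (0 : Rn n)) := (continuous_wt s 0).measurable
  have e1 : ∀ z, ∫⁻ x, ENNReal.ofReal (wt s z x ^ 2) * ‖F x - F z‖ₑ ^ 2
      = ∫⁻ h, ENNReal.ofReal (wt s 0 h ^ 2) * ‖F (z + h) - F z‖ₑ ^ 2 := fun z => by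
    rw [← lintegral_add_left_eq_self _ z]
    refine lintegral_congr fun h => ?_
    rw [wt, wt, add_sub_cancel_left, sub_zero]
  simp_rw [e1]
  rw [lintegral_lintegral_swap (by fun_prop)]
  have hB : ∀ h, ENNReal.ofReal (‖trL h (Cn n) F - F‖ ^ 2) = ∫⁻ x, ‖F (x + h) - F x‖ₑ ^ 2 := fun h => by
    rw [ofReal_norm_sq]
    refine lintegral_congr_ae ?_
    filter_upwards [Lp.coeFn_sub (trL h (Cn n) F) F, coeFn_trL h F] with x h1 h2
    rw [h1, Pi.sub_apply, h2]
  rw [ENNReal.ofReal_mul (by positivity), mul_assoc, ← lintegral_moment_wt hs (0 : Rn n),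
    ← lintegral_const_mul' _ _ ENNReal.ofReal_ne_top]
  refine lintegral_mono fun h => ?_
  rw [lintegral_const_mul _ (by fun_prop), ← hB, ← ENNReal.ofReal_mul (by positivity),
    ← ENNReal.ofReal_mul (by positivity)]
  refine ENNReal.ofReal_le_ofReal ?_
  have h1 : ‖trL h (Cn n) F - F‖ ^ 2 ≤ (B * ‖h‖) ^ 2 := by gcongr; exact hF h
  have h2 : ‖s⁻¹ • (h - 0)‖ ^ 2 * s ^ 2 = ‖h‖ ^ 2 := by
    rw [sub_zero, norm_smul, norm_inv, Real.norm_of_nonneg hs.le]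
    field_simp
  have h3 := sq_nonneg (wt s 0 h)
  calc wt s 0 h ^ 2 * ‖trL h (Cn n) F - F‖ ^ 2 ≤ wt s 0 h ^ 2 * (B * ‖h‖) ^ 2 := by gcongr
    _ = B ^ 2 * (‖s⁻¹ • (h - 0)‖ ^ 2 * s ^ 2) * wt s 0 h ^ 2 := by rw [h2]; ring
    _ = B ^ 2 * s ^ 2 * (‖s⁻¹ • (h - 0)‖ ^ 2 * wt s 0 h ^ 2) := by ring
    _ ≤ _ := by
        gcongr
        linarith

theorem vol_mul_enorm_sub_cav_sq_le (k : ℤ) (m : Fin n → ℤ) (F : Lc n) (a : Cn n) :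
    ENNReal.ofReal (vol n k) * ‖a - cav k m F‖ₑ ^ 2 ≤ ∫⁻ z in cube k m, ‖a - F z‖ₑ ^ 2 := by
  have e : cav k m (fun z => a - F z) = a - cav k m F := by
    have hc : IntegrableOn (fun _ : Rn n => a) (cube k m) :=
      integrableOn_const (volume_cube_ne_top k m)
    rw [cav, cav, integral_sub hc (integrableOn_cube F k m), setIntegral_const, real_cube, smul_sub, smul_smul,
      inv_mul_cancel₀ (vol_pos n k).ne', one_smul]
  rw [← e]
  exact vol_mul_enorm_cav_sq_le
    (aestronglyMeasurable_const.sub (Lp.stronglyMeasurable F).aestronglyMeasurable)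

theorem lintegral_wt_sub_cav_le {s r : ℝ} (hs : 0 < s) (k : ℤ) (m : Fin n → ℤ) (F : Lc n)
    (hr : n * (2 : ℝ) ^ k ≤ r * s) {x0 : Rn n} (hx0 : x0 ∈ cube k m) :
    ENNReal.ofReal (vol n k) *
        ∫⁻ x, ENNReal.ofReal (wt s x0 x ^ 2) * ‖F x - cav k m F‖ₑ ^ 2 ≤
      ENNReal.ofReal (((2 + 2 * r ^ 2) ^ (n + 2)) ^ 2) *
        ∫⁻ z in cube k m, ∫⁻ x, ENNReal.ofReal (wt s z x ^ 2) * ‖F x - F z‖ₑ ^ 2 := by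
  have hFm : Measurable F := (Lp.stronglyMeasurable F).measurable
  have hw := measurable_wt_uncurry (n := n) s
  have hm : Measurable fun p : Rn n × Rn n => ENNReal.ofReal (wt s p.1 p.2 ^ 2) * ‖F p.2 - F p.1‖ₑ ^ 2 := by
    fun_prop
  rw [lintegral_lintegral_swap hm.aemeasurable,
    ← lintegral_const_mul' _ _ ENNReal.ofReal_ne_top,
    ← lintegral_const_mul' _ _ ENNReal.ofReal_ne_top]
  refine lintegral_mono fun x => ?_
  rw [← lintegral_const_mul' _ _ ENNReal.ofReal_ne_top]
  calc _ = ENNReal.ofReal (wt s x0 x ^ 2) * (ENNReal.ofReal (vol n k) * ‖F x - cav k m F‖ₑ ^ 2) := by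
        ring
    _ ≤ ENNReal.ofReal (wt s x0 x ^ 2) * ∫⁻ z in cube k m, ‖F x - F z‖ₑ ^ 2 := by
        gcongr
        exact vol_mul_enorm_sub_cav_sq_le k m F (F x)
    _ = ∫⁻ z in cube k m, ENNReal.ofReal (wt s x0 x ^ 2) * ‖F x - F z‖ₑ ^ 2 := by
        rw [lintegral_const_mul' _ _ ENNReal.ofReal_ne_top]
    _ ≤ _ := by
        refine setLIntegral_mono' (measurableSet_cube k m) fun z hz => ?_
        rw [← mul_assoc, ← ENNReal.ofReal_mul (by positivity), ← mul_pow]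
        have h1 := wt_le_mul_wt hs ((norm_sub_le_of_mem_cube hx0 hz).trans hr) x
        have h2 := (wt_pos s x0 x).le
        gcongr

namespace KData

variable {M κ : ℝ} {V : Type} [NormedAddCommGroup V] [InnerProductSpace ℂ V] [CompleteSpace V]
  (D : KData n M κ V)

/-- The principal part of `θ` at scale `2 ^ k`. -/
def gam (k : ℤ) : Rn n → Cn n := (D.exists_gamma (AccForm.two_zpow_pos k)).choose

theorem measurable_gam (k : ℤ) : Measurable (D.gam k) :=
  (D.exists_gamma (AccForm.two_zpow_pos k)).choose_spec.1

/-- The ratio between the size of a cube and the scale of the weight. -/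
def ratio (n : ℕ) (M κ : ℝ) : ℝ := n / lam n M κ

/-- The constant in the local comparison of `θ` and its principal part. -/
def cG (n : ℕ) (M κ : ℝ) : ℝ := ((1 + ratio n M κ ^ 2) ^ (n + 2)) ^ 2 * (8 * M ^ 2 / κ)

theorem cG_nonneg (D : KData n M κ V) : 0 ≤ cG n M κ := by
  have := D.κ_pos
  unfold cG
  positivity

theorem ratio_mul (D : KData n M κ V) (k : ℤ) : n * (2 : ℝ) ^ k = ratio n M κ * (lam n M κ * 2 ^ k) := by
  have := D.lam_pos
  unfold ratio
  field_simp

theorem lintegral_cube_theta_sub_le (k : ℤ) (m : Fin n → ℤ) (F : Lc n) (w : Cn n) {x0 : Rn n}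
    (hx0 : x0 ∈ cube k m) :
    ∫⁻ x in cube k m, ‖D.theta (2 ^ k) F x - inner ℂ (D.gam k x) w‖ₑ ^ 2 ≤
      ENNReal.ofReal (cG n M κ) *
        ∫⁻ x, ENNReal.ofReal (wt (lam n M κ * 2 ^ k) x0 x ^ 2) * ‖F x - w‖ₑ ^ 2 := by
  have hs : 0 < lam n M κ * 2 ^ k := mul_pos D.lam_pos (AccForm.two_zpow_pos k)
  have key := (D.exists_gamma (AccForm.two_zpow_pos k)).choose_spec.2 F w x0
  set r := ratio n M κ with hr
  have h1 : ∀ x ∈ cube k m, ‖D.theta (2 ^ k) F x - inner ℂ (D.gam k x) w‖ₑ ^ 2 ≤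
      ENNReal.ofReal (((1 + r ^ 2) ^ (n + 2)) ^ 2) *
        (ENNReal.ofReal (wt (lam n M κ * 2 ^ k) x0 x ^ 2) *
          ‖D.theta (2 ^ k) F x - inner ℂ (D.gam k x) w‖ₑ ^ 2) := fun x hx => by
    rw [← mul_assoc, ← ENNReal.ofReal_mul (by positivity)]
    refine le_mul_of_one_le_left (by positivity) ?_
    rw [← ENNReal.ofReal_one]
    refine ENNReal.ofReal_le_ofReal ?_
    have h2 := wt_ge_of_norm_sub_le hs
      ((norm_sub_le_of_mem_cube hx hx0).trans_eq (D.ratio_mul k))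
    rw [← hr, inv_le_iff_one_le_mul₀' (by positivity)] at h2
    rw [← mul_pow]
    exact one_le_pow₀ h2
  calc _ ≤ ∫⁻ x in cube k m, ENNReal.ofReal (((1 + r ^ 2) ^ (n + 2)) ^ 2) *
        (ENNReal.ofReal (wt (lam n M κ * 2 ^ k) x0 x ^ 2) *
          ‖D.theta (2 ^ k) F x - inner ℂ (D.gam k x) w‖ₑ ^ 2) :=
        setLIntegral_mono' (measurableSet_cube k m) h1
    _ ≤ ∫⁻ x, ENNReal.ofReal (((1 + r ^ 2) ^ (n + 2)) ^ 2) *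
        (ENNReal.ofReal (wt (lam n M κ * 2 ^ k) x0 x ^ 2) *
          ‖D.theta (2 ^ k) F x - inner ℂ (D.gam k x) w‖ₑ ^ 2) := setLIntegral_le_lintegral _ _
    _ ≤ _ := by
        rw [lintegral_const_mul' _ _ ENNReal.ofReal_ne_top, cG, ENNReal.ofReal_mul (by positivity),
          mul_assoc]
        gcongr
        exact key

/-- The constant in `lintegral_cube_gam_le`. -/
def cGam (n : ℕ) (M κ : ℝ) : ℝ := n * (cG n M κ * (lam n M κ ^ n * (wtMom n).toReal))

theorem cGam_nonneg (D : KData n M κ V) : 0 ≤ cGam n M κ := by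
  have := D.cG_nonneg
  have := D.lam_pos
  unfold cGam
  positivity

theorem exists_mem_cube (k : ℤ) (m : Fin n → ℤ) : (cube k m).Nonempty := by
  rw [nonempty_iff_ne_empty]
  intro h
  exact volume_cube_ne_zero k m (by rw [h]; exact measure_empty)

theorem lintegral_cube_gam_le (k : ℤ) (m : Fin n → ℤ) :
    ∫⁻ x in cube k m, ‖D.gam k x‖ₑ ^ 2 ≤ ENNReal.ofReal (cGam n M κ * vol n k) := by
  obtain ⟨x0, hx0⟩ := exists_mem_cube k m
  have hs : 0 < lam n M κ * 2 ^ k := mul_pos D.lam_pos (AccForm.two_zpow_pos k)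
  have hl := D.lam_pos
  have hc := D.cG_nonneg
  have hg := D.measurable_gam k
  have h1 : ∀ i, ∫⁻ x in cube k m, ‖D.gam k x i‖ₑ ^ 2 ≤
      ENNReal.ofReal (cG n M κ * (lam n M κ ^ n * (wtMom n).toReal) * vol n k) := fun i => by
    have h := D.lintegral_cube_theta_sub_le k m 0 (EuclideanSpace.single i 1) hx0
    have e1 : ∫⁻ x in cube k m, ‖D.theta (2 ^ k) 0 x -
        inner ℂ (D.gam k x) (EuclideanSpace.single i (1 : ℂ))‖ₑ ^ 2
        = ∫⁻ x in cube k m, ‖D.gam k x i‖ₑ ^ 2 := by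
      rw [map_zero]
      refine lintegral_congr_ae (ae_restrict_of_ae ?_)
      filter_upwards [Lp.coeFn_zero ℂ 2 (volume : Measure (Rn n))] with x hx
      rw [hx]
      simp [EuclideanSpace.inner_single_right]
    have e2 : ∫⁻ x, ENNReal.ofReal (wt (lam n M κ * 2 ^ k) x0 x ^ 2) *
        ‖(0 : Lc n) x - (EuclideanSpace.single i (1 : ℂ))‖ₑ ^ 2
        = ∫⁻ x, ENNReal.ofReal (wt (lam n M κ * 2 ^ k) x0 x ^ 2) := by
      refine lintegral_congr_ae ?_
      filter_upwards [Lp.coeFn_zero (Cn n) 2 (volume : Measure (Rn n))] with x hx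
      rw [hx, Pi.zero_apply, zero_sub, enorm_neg, ← ofReal_norm, PiLp.norm_single]
      simp
    rw [e1, e2] at h
    refine h.trans ((mul_le_mul_right (lintegral_wt_sq_le hs x0) _).trans_eq ?_)
    rw [← ENNReal.ofReal_toReal (wtMom_lt_top n).ne, ← ENNReal.ofReal_mul (by positivity),
      ← ENNReal.ofReal_mul hc, ENNReal.toReal_ofReal ENNReal.toReal_nonneg, vol, mul_pow]
    congr 1
    ring
  have e : ∀ x, ‖D.gam k x‖ₑ ^ 2 = ∑ i, ‖D.gam k x i‖ₑ ^ 2 := fun x => enorm_sq_eq_sum _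
  simp_rw [e]
  rw [lintegral_finsetSum _ fun i _ => by fun_prop]
  refine (Finset.sum_le_sum fun i _ => h1 i).trans_eq ?_
  rw [Finset.sum_const, Finset.card_univ, Fintype.card_fin, nsmul_eq_mul, cGam,
    ← ENNReal.ofReal_natCast, ← ENNReal.ofReal_mul (by positivity)]
  congr 1
  ring

/-- The constant in `lintegral_theta_sub_av_le`. -/
def cTh (n : ℕ) (M κ : ℝ) : ℝ :=
  cG n M κ * ((2 + 2 * ratio n M κ ^ 2) ^ (n + 2)) ^ 2 *
    (lam n M κ ^ 2 * lam n M κ ^ n * (wtMom n).toReal)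

theorem cTh_nonneg (D : KData n M κ V) : 0 ≤ cTh n M κ := by
  have := D.cG_nonneg
  have := D.lam_pos
  unfold cTh
  positivity

/-- Principal part approximation for functions with controlled translations. -/
theorem lintegral_theta_sub_av_le (k : ℤ) {F : Lc n} {B : ℝ}
    (hF : ∀ h, ‖trL h (Cn n) F - F‖ ≤ B * ‖h‖) :
    ∫⁻ x, ‖D.theta (2 ^ k) F x - inner ℂ (D.gam k x) (av k F x)‖ₑ ^ 2 ≤
      ENNReal.ofReal (cTh n M κ * ((2 : ℝ) ^ k * B) ^ 2) := by
  have hs : 0 < lam n M κ * 2 ^ k := mul_pos D.lam_pos (AccForm.two_zpow_pos k)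
  have hl := D.lam_pos
  have hc := D.cG_nonneg
  set s := lam n M κ * 2 ^ k with hsdef
  set a := ((2 + 2 * ratio n M κ ^ 2) ^ (n + 2)) ^ 2 with ha
  have hv := vol_pos n k
  have hv0 : ENNReal.ofReal (vol n k) ≠ 0 := (ENNReal.ofReal_pos.2 hv).ne'
  have h1 : ∀ m : Fin n → ℤ, ENNReal.ofReal (vol n k) *
      ∫⁻ x in cube k m, ‖D.theta (2 ^ k) F x - inner ℂ (D.gam k x) (av k F x)‖ₑ ^ 2 ≤
      ENNReal.ofReal (cG n M κ * a) * ∫⁻ z in cube k m, ∫⁻ x,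
        ENNReal.ofReal (wt s z x ^ 2) * ‖F x - F z‖ₑ ^ 2 := fun m => by
    obtain ⟨x0, hx0⟩ := exists_mem_cube k m
    have e : ∫⁻ x in cube k m, ‖D.theta (2 ^ k) F x - inner ℂ (D.gam k x) (av k F x)‖ₑ ^ 2
        = ∫⁻ x in cube k m, ‖D.theta (2 ^ k) F x - inner ℂ (D.gam k x) (cav k m F)‖ₑ ^ 2 :=
      setLIntegral_congr_fun (measurableSet_cube k m) fun x hx => by
        simp only [av_eq hx]
    rw [e, ENNReal.ofReal_mul hc, mul_assoc]
    calc _ ≤ ENNReal.ofReal (vol n k) * (ENNReal.ofReal (cG n M κ) *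
          ∫⁻ x, ENNReal.ofReal (wt s x0 x ^ 2) * ‖F x - cav k m F‖ₑ ^ 2) := by
          gcongr
          exact D.lintegral_cube_theta_sub_le k m F _ hx0
      _ = ENNReal.ofReal (cG n M κ) * (ENNReal.ofReal (vol n k) *
          ∫⁻ x, ENNReal.ofReal (wt s x0 x ^ 2) * ‖F x - cav k m F‖ₑ ^ 2) := by ring
      _ ≤ _ := by
          exact mul_le_mul_right (lintegral_wt_sub_cav_le hs k m F (D.ratio_mul k).le hx0) _
  have h2 : ENNReal.ofReal (vol n k) *
      ∫⁻ x, ‖D.theta (2 ^ k) F x - inner ℂ (D.gam k x) (av k F x)‖ₑ ^ 2 ≤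
      ENNReal.ofReal (vol n k) * ENNReal.ofReal (cTh n M κ * ((2 : ℝ) ^ k * B) ^ 2) := by
    calc _ ≤ ENNReal.ofReal (cG n M κ * a) * ∫⁻ z, ∫⁻ x,
          ENNReal.ofReal (wt s z x ^ 2) * ‖F x - F z‖ₑ ^ 2 := by
          rw [lintegral_eq_tsum_cube k, lintegral_eq_tsum_cube k, ← ENNReal.tsum_mul_left,
            ← ENNReal.tsum_mul_left]
          exact ENNReal.tsum_le_tsum h1
      _ ≤ ENNReal.ofReal (cG n M κ * a) * (ENNReal.ofReal (B ^ 2 * s ^ 2 * s ^ n) * wtMom n) := by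
          gcongr
          exact lintegral_lintegral_wt_le hs hF
      _ = _ := by
          rw [← ENNReal.ofReal_toReal (wtMom_lt_top n).ne, ← ENNReal.ofReal_mul (by positivity),
            ← ENNReal.ofReal_mul (by positivity), ← ENNReal.ofReal_mul hv.le, cTh, ← ha, vol,
            hsdef, mul_pow, mul_pow]
          congr 1
          ring
  exact (ENNReal.mul_le_mul_iff_right hv0 ENNReal.ofReal_ne_top).1 h2

end KData

end

section

variable {n : ℕ}

theorem lintegral_enorm_add_sq_le {α X : Type*} [MeasurableSpace α] [NormedAddCommGroup X]
    {μ : Measure α} {f : α → X} (hf : AEStronglyMeasurable f μ) (g : α → X) :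
    ∫⁻ x, ‖f x + g x‖ₑ ^ 2 ∂μ ≤ 2 * ∫⁻ x, ‖f x‖ₑ ^ 2 ∂μ + 2 * ∫⁻ x, ‖g x‖ₑ ^ 2 ∂μ := by
  rw [← lintegral_const_mul' _ _ ENNReal.ofNat_ne_top, ← lintegral_const_mul' _ _ ENNReal.ofNat_ne_top,
    ← lintegral_add_left' ((hf.enorm.pow_const 2).const_mul 2)]
  refine lintegral_mono fun x => ?_
  refine le_trans ?_ (ENNReal.add_sq_le ‖f x‖ₑ ‖g x‖ₑ)
  gcongr
  exact enorm_add_le _ _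

theorem lintegral_enorm_sub_sq_le {α X : Type*} [MeasurableSpace α] [NormedAddCommGroup X]
    {μ : Measure α} {f : α → X} (hf : AEStronglyMeasurable f μ) (g : α → X) :
    ∫⁻ x, ‖f x - g x‖ₑ ^ 2 ∂μ ≤ 2 * ∫⁻ x, ‖f x‖ₑ ^ 2 ∂μ + 2 * ∫⁻ x, ‖g x‖ₑ ^ 2 ∂μ := by
  simpa [sub_eq_add_neg] using lintegral_enorm_add_sq_le hf fun x => - g x

theorem AccForm.J_sub_R_J {V E : Type*} [NormedAddCommGroup V] [InnerProductSpace ℂ V]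
    [CompleteSpace V] [NormedAddCommGroup E] [InnerProductSpace ℂ E] [CompleteSpace E]
    (a : AccForm V E) {t : ℝ} (ht : 0 < t) {v q : V} {s : E}
    (h : a.N v = ContinuousLinearMap.adjoint a.J s + q) :
    a.J v - a.R t (a.J v) =
      ((t ^ 2 : ℝ) : ℂ) • a.R t s + (t : ℂ) • a.J ((t : ℂ) • a.Minv t q) := by
  rw [a.R_apply, ← map_sub, a.rho_J ht, h, map_smul, map_add, map_add, smul_add, map_smul, smul_smul,
    ofReal_pow, sq]
  rfl

theorem AccForm.Rd_eq_add {V E : Type*} [NormedAddCommGroup V] [InnerProductSpace ℂ V]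
    [CompleteSpace V] [NormedAddCommGroup E] [InnerProductSpace ℂ E] [CompleteSpace E]
    (a : AccForm V E) (k : ℤ) (u p : E) :
    a.Rd k u = a.R (2 ^ k) (u - p) + a.R (2 ^ k) p := by
  rw [← map_add, sub_add_cancel]
  rfl

theorem inv_smul_add_sq_smul_add {E : Type*} [AddCommGroup E] [Module ℂ E] {t : ℝ}
    (ht : (t : ℂ) ≠ 0) (x y z : E) :
    (t : ℂ)⁻¹ • (x + (((t ^ 2 : ℝ) : ℂ) • y + (t : ℂ) • z)) =
      ((t⁻¹ : ℝ) : ℂ) • x + (t : ℂ) • y + z := by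
  rw [smul_add, smul_add, smul_smul, smul_smul, inv_mul_cancel₀ ht, one_smul, ofReal_inv,
    ofReal_pow, sq, inv_mul_cancel_left₀ ht, add_assoc]

namespace KData

open ContinuousLinearMap

variable {M κ : ℝ} {V : Type} [NormedAddCommGroup V] [InnerProductSpace ℂ V] [CompleteSpace V]
  (D : KData n M κ V)

/-- The domain of `D₁†D₁ + D₂†D₂` is contained in the domain of the Laplacian, with an estimate. -/
def LapBound (cb : ℝ) : Prop :=
  ∀ (π : V) (g : L2 n),
    (∀ v, inner ℂ (D.D1 v) (D.D1 π) + inner ℂ (D.D2 v) (D.D2 π) = inner ℂ (D.J v) g) →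
    ∃ ℓ : L2 n, ‖ℓ‖ ≤ cb * ‖g‖ ∧ ∀ v q, IsWGrad v q → inner ℂ q (D.D2 π) = inner ℂ v ℓ

theorem J_sub_R_J {t : ℝ} (ht : 0 < t) {π : V} {s : L2 n}
    (hs : ∀ v, inner ℂ (D.D1 v) (D.D1 π) = inner ℂ (D.J v) s) :
    D.J π - D.form.R t (D.J π) =
      ((t ^ 2 : ℝ) : ℂ) • D.form.R t s + (t : ℂ) • D.theta t (D.D2 π) := by
  have hN : D.form.N π = adjoint D.J s + adjoint D.D2 (D.AL (D.D2 π)) := by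
    refine ext_inner_left ℂ fun v => ?_
    rw [D.inner_form_N, hs, inner_add_right, adjoint_inner_right, adjoint_inner_right]
  rw [show D.J π - D.form.R t (D.J π) = D.form.J π - D.form.R t (D.form.J π) from rfl,
    D.form.J_sub_R_J ht hN, D.theta_apply]
  rfl

/-- Splitting of `t⁻¹(1 - R_t)J v` through the resolvents of the self-adjoint form. -/
theorem exists_split {cb : ℝ} (hcb : 0 ≤ cb) (hD : D.LapBound cb) (k : ℤ) (v : V) :
    ∃ (Z : L2 n), ‖Z‖ ≤ (2 + cb) * D.formT.tau v k ∧
      (∀ h, ‖trL h (Cn n) (D.D2 (D.formT.pi k v)) - D.D2 (D.formT.pi k v)‖ ≤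
        2 * (cb * (((2 : ℝ) ^ k)⁻¹ * D.formT.tau v k)) * ‖h‖) ∧
      (((2 : ℝ) ^ k)⁻¹ : ℂ) • (D.J v - D.form.Rd k (D.J v)) =
        Z + D.theta (2 ^ k) (D.D2 (D.formT.pi k v)) := by
  have ht : (0 : ℝ) < 2 ^ k := AccForm.two_zpow_pos k
  set t : ℝ := 2 ^ k with htd
  set π := D.formT.pi k v with hπ
  set u := D.J v with hu
  have hp : D.formT.Rd k u = D.J π := rfl
  set g : L2 n := ((t ^ 2 : ℝ) : ℂ)⁻¹ • (u - D.J π) with hg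
  have hτ : ‖u - D.J π‖ = t * D.formT.tau v k := D.formT.norm_sub_eq_tau v k
  have hτ0 := D.formT.tau_nonneg v k
  have hgn : ‖g‖ = t⁻¹ * D.formT.tau v k := by
    rw [hg, norm_smul, norm_inv, Complex.norm_real, hτ, Real.norm_of_nonneg (by positivity)]
    field_simp
  have hgeq : ∀ w, inner ℂ (D.D1 w) (D.D1 π) + inner ℂ (D.D2 w) (D.D2 π) = inner ℂ (D.J w) g := by
    intro w
    have hN : D.formT.N π = ((t ^ 2 : ℝ) : ℂ)⁻¹ • adjoint D.J (u - D.J π) := D.formT.N_rho ht u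
    rw [← D.inner_formT_N, hN, inner_smul_right, adjoint_inner_right, hg, inner_smul_right]
  obtain ⟨ℓ, hℓ, hℓ2⟩ := hD π g hgeq
  have hs : ∀ w, inner ℂ (D.D1 w) (D.D1 π) = inner ℂ (D.J w) (g - ℓ) := fun w => by
    rw [inner_sub_right, ← hgeq w, hℓ2 _ _ (D.isWGrad w)]
    ring
  refine ⟨((t⁻¹ : ℝ) : ℂ) • ((u - D.J π) - D.form.R t (u - D.J π)) +
    (t : ℂ) • D.form.R t (g - ℓ), ?_, ?_, ?_⟩
  · have h1 := D.form.norm_sub_R_le ht (u - D.J π)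
    have h2 := (D.form.norm_R_le ht (g - ℓ)).trans (norm_sub_le _ _)
    refine (norm_add_le _ _).trans ?_
    rw [norm_smul, norm_smul, Complex.norm_real, Complex.norm_real,
      Real.norm_of_nonneg (by positivity : (0 : ℝ) ≤ t⁻¹), Real.norm_of_nonneg ht.le]
    have h3 : t⁻¹ * ‖(u - D.J π) - D.form.R t (u - D.J π)‖ ≤ t⁻¹ * (t * D.formT.tau v k) := by
      rw [← hτ]
      gcongr
    have h4 : t * ‖D.form.R t (g - ℓ)‖ ≤ t * ((1 + cb) * (t⁻¹ * D.formT.tau v k)) := by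
      gcongr
      rw [← hgn]
      linarith
    have e1 : t⁻¹ * (t * D.formT.tau v k) = D.formT.tau v k := by field_simp
    have e2 : t * ((1 + cb) * (t⁻¹ * D.formT.tau v k)) = (1 + cb) * D.formT.tau v k := by field_simp
    linarith
  · intro h
    refine (norm_trL_sub_le_of_inner (D.isWGrad π) hℓ2 h).trans ?_
    rw [← hgn]
    nlinarith only [mul_le_mul_of_nonneg_left hℓ (norm_nonneg h)]
  · have h := D.J_sub_R_J ht hs
    have hR : D.form.Rd k u = D.form.R t (u - D.J π) + D.form.R t (D.J π) :=
      D.form.Rd_eq_add k u _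
    have ht' : (t : ℂ) ≠ 0 := by exact_mod_cast ht.ne'
    have e : u - D.form.Rd k u = ((u - D.J π) - D.form.R t (u - D.J π)) +
        (((t ^ 2 : ℝ) : ℂ) • D.form.R t (g - ℓ) + (t : ℂ) • D.theta t (D.D2 π)) := by
      rw [← h, hR]
      abel
    have e1 : (((2 : ℝ) : ℂ) ^ k)⁻¹ = (t : ℂ)⁻¹ := by rw [htd, ofReal_zpow]
    rw [e, e1]
    exact inv_smul_add_sq_smul_add (E := L2 n) ht' _ _ _

/-- The multiplication by `γ` of averages is bounded. -/
theorem lintegral_gam_av_le (k : ℤ) (F : Lc n) :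
    ∫⁻ x, ‖inner ℂ (D.gam k x) (av k F x)‖ₑ ^ 2 ≤ ENNReal.ofReal (cGam n M κ * ‖avL k F‖ ^ 2) := by
  rw [ENNReal.ofReal_mul D.cGam_nonneg, ofReal_norm_avL_sq, lintegral_eq_tsum_cube k,
    lintegral_eq_tsum_cube k, ← ENNReal.tsum_mul_left]
  refine ENNReal.tsum_le_tsum fun m => ?_
  calc _ ≤ ∫⁻ x in cube k m, ‖D.gam k x‖ₑ ^ 2 * ‖cav k m F‖ₑ ^ 2 := by
        refine setLIntegral_mono' (measurableSet_cube k m) fun x hx => ?_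
        rw [av_eq hx, ← mul_pow]
        gcongr
        simp only [← ofReal_norm]
        rw [← ENNReal.ofReal_mul (norm_nonneg _)]
        exact ENNReal.ofReal_le_ofReal (norm_inner_le_norm _ _)
    _ = (∫⁻ x in cube k m, ‖D.gam k x‖ₑ ^ 2) * ‖cav k m F‖ₑ ^ 2 :=
        lintegral_mul_const' _ _ (by finiteness)
    _ ≤ ENNReal.ofReal (cGam n M κ * vol n k) * ‖cav k m F‖ₑ ^ 2 := by
        gcongr
        exact D.lintegral_cube_gam_le k m
    _ = ENNReal.ofReal (cGam n M κ) * ∫⁻ x in cube k m, ‖cav k m F‖ₑ ^ 2 := by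
        rw [setLIntegral_const, volume_cube, ENNReal.ofReal_mul D.cGam_nonneg]
        ring
    _ = _ := by
        congr 1
        exact setLIntegral_congr_fun (measurableSet_cube k m) fun x hx => by simp only [av_eq hx]

theorem measurable_gam_av (k : ℤ) (F : Rn n → Cn n) :
    Measurable fun x => inner ℂ (D.gam k x) (av k F x) := by
  have := D.measurable_gam k
  have := (stronglyMeasurable_av k F).measurable
  fun_prop

theorem lintegral_gam_av_sub_le {cb : ℝ} (hcb : 0 ≤ cb) (hD : D.LapBound cb) (k : ℤ) (v : V) :
    ∫⁻ x, ‖inner ℂ (D.gam k x) (av k (D.D2 v) x) -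
        ((((2 : ℝ) ^ k)⁻¹ : ℂ) • (D.J v - D.form.Rd k (D.J v)) : L2 n) x‖ₑ ^ 2 ≤
      ENNReal.ofReal (2 * cGam n M κ * ‖avL k (D.D2 (v - D.formT.pi k v))‖ ^ 2 +
        16 * (cTh n M κ + 1) * ((1 + cb) * D.formT.tau v k) ^ 2) := by
  obtain ⟨Z, hZ, htr, hsplit⟩ := D.exists_split hcb hD k v
  set π := D.formT.pi k v
  have hτ0 := D.formT.tau_nonneg v k
  set τ := D.formT.tau v k
  have hc1 := D.cGam_nonneg
  have hc2 := D.cTh_nonneg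
  have ht : (0 : ℝ) < 2 ^ k := AccForm.two_zpow_pos k
  have hav : ∀ x, av k (D.D2 v) x = av k (D.D2 (v - π)) x + av k (D.D2 π) x := by
    intro x
    have h := congrFun (av_add k (D.D2 (v - π)) (D.D2 π)) x
    rw [← map_add, sub_add_cancel] at h
    exact h
  rw [hsplit]
  have e : ∀ᵐ x, inner ℂ (D.gam k x) (av k (D.D2 v) x) - (Z + D.theta (2 ^ k) (D.D2 π) : L2 n) x
      = inner ℂ (D.gam k x) (av k (D.D2 (v - π)) x) -
        ((D.theta (2 ^ k) (D.D2 π) x - inner ℂ (D.gam k x) (av k (D.D2 π) x)) + Z x) := by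
    filter_upwards [Lp.coeFn_add Z (D.theta (2 ^ k) (D.D2 π))] with x hx
    rw [hx, hav, inner_add_right, Pi.add_apply]
    ring
  have m1 := (D.measurable_gam_av k (D.D2 (v - π))).aestronglyMeasurable (μ := volume)
  have m2 := (D.measurable_gam_av k (D.D2 π)).aestronglyMeasurable (μ := volume)
  have m3 := (Lp.stronglyMeasurable (D.theta (2 ^ k) (D.D2 π))).aestronglyMeasurable (μ := volume)
  have b1 := D.lintegral_gam_av_le k (D.D2 (v - π))
  have b2 := D.lintegral_theta_sub_av_le k htr
  have b3 : ∫⁻ x, ‖Z x‖ₑ ^ 2 ≤ ENNReal.ofReal (((2 + cb) * τ) ^ 2) := by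
    rw [← ofReal_norm_sq]
    exact ENNReal.ofReal_le_ofReal (by gcongr)
  calc _ = ∫⁻ x, ‖inner ℂ (D.gam k x) (av k (D.D2 (v - π)) x) -
        ((D.theta (2 ^ k) (D.D2 π) x - inner ℂ (D.gam k x) (av k (D.D2 π) x)) + Z x)‖ₑ ^ 2 := by
        refine lintegral_congr_ae ?_
        filter_upwards [e] with x hx
        rw [hx]
    _ ≤ 2 * ENNReal.ofReal (cGam n M κ * ‖avL k (D.D2 (v - π))‖ ^ 2) + 2 * (2 * ENNReal.ofReal
          (cTh n M κ * (2 ^ k * (2 * (cb * (((2 : ℝ) ^ k)⁻¹ * τ)))) ^ 2) +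
          2 * ENNReal.ofReal (((2 + cb) * τ) ^ 2)) := by
        refine (lintegral_enorm_sub_sq_le m1 _).trans (add_le_add (mul_le_mul_right b1 2)
          (mul_le_mul_right ?_ 2))
        exact (lintegral_enorm_add_sq_le (m3.sub m2) _).trans
          (add_le_add (mul_le_mul_right b2 2) (mul_le_mul_right b3 2))
    _ = ENNReal.ofReal (2 * (cGam n M κ * ‖avL k (D.D2 (v - π))‖ ^ 2) + 2 * (2 * (cTh n M κ *
          (2 ^ k * (2 * (cb * (((2 : ℝ) ^ k)⁻¹ * τ)))) ^ 2) + 2 * ((2 + cb) * τ) ^ 2)) := by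
        rw [ENNReal.ofReal_add (by positivity) (by positivity),
          ENNReal.ofReal_mul (by positivity : (0 : ℝ) ≤ 2),
          ENNReal.ofReal_mul (by positivity : (0 : ℝ) ≤ 2),
          ENNReal.ofReal_add (by positivity) (by positivity),
          ENNReal.ofReal_mul (by positivity : (0 : ℝ) ≤ 2),
          ENNReal.ofReal_mul (by positivity : (0 : ℝ) ≤ 2), ENNReal.ofReal_ofNat]
    _ ≤ _ := by
        refine ENNReal.ofReal_le_ofReal ?_
        have e1 : (2 : ℝ) ^ k * (2 * (cb * (((2 : ℝ) ^ k)⁻¹ * τ))) = 2 * (cb * τ) := by field_simp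
        rw [e1]
        have h1 : (cb * τ) ^ 2 ≤ ((1 + cb) * τ) ^ 2 := by gcongr; linarith
        have h2 : ((2 + cb) * τ) ^ 2 ≤ (2 * ((1 + cb) * τ)) ^ 2 := by
          refine pow_le_pow_left₀ (by positivity) ?_ 2
          nlinarith only [hcb, hτ0, mul_nonneg hcb hτ0]
        nlinarith only [mul_le_mul_of_nonneg_left h1 hc2, h2]

theorem energy_nonneg_eq (v : V) : ‖v‖ ^ 2 - ‖D.J v‖ ^ 2 = ‖D.D1 v‖ ^ 2 + ‖D.D2 v‖ ^ 2 := by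
  rw [D.norm_sq v]
  ring

end KData

/-- Principal part approximation of the square function. -/
theorem exists_principal_part (n : ℕ) (M κ : ℝ) : ∃ C : ℝ, 0 ≤ C ∧
    ∀ {V : Type} [NormedAddCommGroup V] [InnerProductSpace ℂ V] [CompleteSpace V]
      (D : KData n M κ V) {cb : ℝ} (_ : 0 ≤ cb) (_ : D.LapBound cb) (v : V) (m : ℤ) (N : ℕ),
      ∑ i ∈ Finset.range N, ∫⁻ x, ‖inner ℂ (D.gam (m + i) x) (av (m + i) (D.D2 v) x) -
        ((((2 : ℝ) ^ (m + i : ℤ))⁻¹ : ℂ) • (D.J v - D.form.Rd (m + i) (D.J v)) : L2 n) x‖ₑ ^ 2 ≤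
      ENNReal.ofReal (C * (1 + cb) ^ 2 * (‖D.D1 v‖ ^ 2 + ‖D.D2 v‖ ^ 2)) := by
  obtain ⟨C₀, hC₀, h0⟩ := AccForm.exists_sum_sq_sub_pi_le
  obtain ⟨C₁, hC₁, h1⟩ := exists_norm_avL_sq_le n
  refine ⟨2 * |KData.cGam n M κ| * (C₀ * C₁) + 16 * (|KData.cTh n M κ| + 1) * (4 / 3), by positivity, ?_⟩
  intro V _ _ _ D cb hcb hD v m N
  rw [abs_of_nonneg D.cGam_nonneg, abs_of_nonneg D.cTh_nonneg]
  have hc1 := D.cGam_nonneg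
  have hc2 := D.cTh_nonneg
  have key := h0 D.isSymm_formT (fun k => (avL k).comp D.D2) hC₁ (fun k w s hs hs1 => by
    refine (h1 _ _ (D.isWGrad w) k s hs hs1).trans ?_
    have : ‖D.D2 w‖ ^ 2 ≤ ‖w‖ ^ 2 - ‖D.J w‖ ^ 2 := by
      rw [D.energy_nonneg_eq]
      linarith [sq_nonneg ‖D.D1 w‖]
    change _ ≤ C₁ * ((s ^ 2)⁻¹ * (((2 : ℝ) ^ k) ^ 2)⁻¹ * ‖D.J w‖ ^ 2 + s * (‖w‖ ^ 2 - ‖D.J w‖ ^ 2))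
    gcongr) v m N
  have key2 := D.isSymm_formT.sum_sq_le v m N
  change _ ≤ _ * (‖v‖ ^ 2 - ‖D.J v‖ ^ 2) at key key2
  rw [D.energy_nonneg_eq] at key key2
  set Q := ‖D.D1 v‖ ^ 2 + ‖D.D2 v‖ ^ 2 with hQ
  have hQ0 : 0 ≤ Q := by positivity
  refine (Finset.sum_le_sum fun (i : ℕ) _ => D.lintegral_gam_av_sub_le hcb hD (m + (i : ℤ)) v).trans ?_
  rw [← ENNReal.ofReal_sum_of_nonneg fun i _ => by positivity]
  refine ENNReal.ofReal_le_ofReal ?_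
  rw [Finset.sum_add_distrib, ← Finset.mul_sum, ← Finset.mul_sum]
  simp_rw [mul_pow]
  rw [← Finset.mul_sum]
  have k1 : ∑ i ∈ Finset.range N, ‖avL (m + i) (D.D2 (v - D.formT.pi (m + i) v))‖ ^ 2 ≤
      C₀ * C₁ * Q := key
  have k2 : ∑ i ∈ Finset.range N, D.formT.tau v (m + i) ^ 2 ≤ 4 / 3 * Q := key2
  have h1cb : 1 ≤ (1 + cb) ^ 2 := one_le_pow₀ (by linarith)
  calc _ ≤ 2 * KData.cGam n M κ * (C₀ * C₁ * Q) + 16 * (KData.cTh n M κ + 1) * ((1 + cb) ^ 2 * (4 / 3 * Q)) := by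
        gcongr
    _ ≤ 2 * KData.cGam n M κ * (C₀ * C₁ * Q) * (1 + cb) ^ 2 +
        16 * (KData.cTh n M κ + 1) * ((1 + cb) ^ 2 * (4 / 3 * Q)) := by
        exact add_le_add_left (le_mul_of_one_le_right (by positivity) h1cb) _
    _ = _ := by ring

end

section

variable {n : ℕ}

section Tree

variable {ι : Type*} (kids : ι → Finset ι)

/-- Sum of `a` over the first `d` generations of descendants. -/
def treeSum (a : ℤ → ι → ℝ) : ℕ → ℤ → ι → ℝ
  | 0, _, _ => 0
  | d + 1, k, m => a k m + ∑ c ∈ kids m, treeSum a d (k - 1) c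

variable {kids} {V : ℤ → ℝ} {a b I E : ℤ → ι → ℝ}

theorem treeSum_nonneg (ha : ∀ k m, 0 ≤ a k m) : ∀ d k m, 0 ≤ treeSum kids a d k m
  | 0, _, _ => le_rfl
  | d + 1, k, m => add_nonneg (ha k m) (Finset.sum_nonneg fun c _ => treeSum_nonneg ha d (k - 1) c)

theorem treeSum_le {C : ℝ} (hVk : ∀ k m, ∑ _c ∈ kids m, V (k - 1) = V k)
    (ha : ∀ k m, a k m ≤ C * V k) : ∀ d k m, treeSum kids a d k m ≤ d * C * V k
  | 0, k, m => by simp [treeSum]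
  | d + 1, k, m => by
    have h : ∑ c ∈ kids m, treeSum kids a d (k - 1) c ≤ ∑ _c ∈ kids m, d * C * V (k - 1) :=
      Finset.sum_le_sum fun c _ => treeSum_le hVk ha d (k - 1) c
    rw [← Finset.mul_sum, hVk] at h
    have := ha k m
    simp only [treeSum]
    push_cast
    linarith

theorem bellman_step {a I V W K : ℝ} (ha : 0 ≤ a) (hK : 0 < K) (hW : 0 < W) (hV : 0 < V)
    (h : W + a / K ≤ 2 * V) :
    a * I ^ 2 / V ^ 2 ≤ 4 * K * (I ^ 2 / W - I ^ 2 / (W + a / K)) := by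
  have ha' : 0 ≤ a / K := by positivity
  have e : I ^ 2 / W - I ^ 2 / (W + a / K) = I ^ 2 * (a / K) / (W * (W + a / K)) := by
    have : W + a / K ≠ 0 := by positivity
    field_simp
    ring
  have h1 : W * (W + a / K) ≤ (2 * V) * (2 * V) := by
    apply mul_le_mul (by linarith) h (by positivity) (by positivity)
  have h2 : I ^ 2 * (a / K) / ((2 * V) * (2 * V)) ≤ I ^ 2 * (a / K) / (W * (W + a / K)) := by
    gcongr
  rw [e]
  calc _ = 4 * K * (I ^ 2 * (a / K) / ((2 * V) * (2 * V))) := by field_simp; ring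
    _ ≤ _ := by gcongr

/-- Carleson embedding on a tree. -/
theorem treeSum_le_of_carleson (hV : ∀ k, 0 < V k) (hVk : ∀ k m, ∑ _c ∈ kids m, V (k - 1) = V k)
    (ha : ∀ k m, 0 ≤ a k m) (hI : ∀ k m, ∑ c ∈ kids m, I (k - 1) c = I k m)
    (hE : ∀ k m, ∑ c ∈ kids m, E (k - 1) c = E k m) (hIE : ∀ k m, I k m ^ 2 ≤ V k * E k m)
    {K : ℝ} (hK : 0 < K) (hS : ∀ d k m, treeSum kids a d k m ≤ K * V k)
    (hb : ∀ k m, b k m ≤ a k m * I k m ^ 2 / V k ^ 2) :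
    ∀ d k m, treeSum kids b d k m ≤
      4 * K * (E k m - I k m ^ 2 / (V k + treeSum kids a d k m / K))
  | 0, k, m => by
    have h : I k m ^ 2 / V k ≤ E k m := (div_le_iff₀' (hV k)).2 (hIE k m)
    simp only [treeSum, zero_div, add_zero]
    exact mul_nonneg (by positivity) (by linarith)
  | d + 1, k, m => by
    have ih : ∑ c ∈ kids m, treeSum kids b d (k - 1) c ≤ ∑ c ∈ kids m, _ :=
      Finset.sum_le_sum fun c _ => treeSum_le_of_carleson hV hVk ha hI hE hIE hK hS hb d (k - 1) c
    have hp : ∀ c ∈ kids m, 0 < V (k - 1) + treeSum kids a d (k - 1) c / K := fun c _ =>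
      add_pos_of_pos_of_nonneg (hV _) (div_nonneg (treeSum_nonneg ha _ _ _) hK.le)
    have hne : (kids m).Nonempty := by
      by_contra h
      rw [Finset.not_nonempty_iff_eq_empty] at h
      have := hVk k m
      rw [h, Finset.sum_empty] at this
      exact (hV k).ne this
    have hc := Finset.sq_sum_div_le_sum_sq_div (kids m) (fun c => I (k - 1) c) hp
    have hW := Finset.sum_pos hp hne
    have eW : ∑ c ∈ kids m, (V (k - 1) + treeSum kids a d (k - 1) c / K) =
      V k + (∑ c ∈ kids m, treeSum kids a d (k - 1) c) / K := by
      rw [Finset.sum_add_distrib, hVk, Finset.sum_div]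
    rw [eW] at hW hc
    rw [hI] at hc
    rw [← Finset.mul_sum, Finset.sum_sub_distrib, hE] at ih
    have hS1 := hS (d + 1) k m
    simp only [treeSum] at hS1 ⊢
    set σ := ∑ c ∈ kids m, treeSum kids a d (k - 1) c
    have e2 : V k + (a k m + σ) / K = V k + σ / K + a k m / K := by ring
    have hs : V k + σ / K + a k m / K ≤ 2 * V k := by
      rw [← e2, two_mul]
      gcongr
      exact (div_le_iff₀' hK).2 hS1
    have h1 := bellman_step (I := I k m) (ha k m) hK hW (hV k) hs
    rw [e2]
    have h2 := mul_le_mul_of_nonneg_left hc (by positivity : 0 ≤ 4 * K)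
    nlinarith only [h1, h2, ih, hb k m]

/-- Stopping time argument: `a` is controlled by `b` up to stopping regions of sizes `α₁`, `α₂`. -/
theorem exists_stopping (hV : ∀ k, 0 < V k) (hVk : ∀ k m, ∑ _c ∈ kids m, V (k - 1) = V k)
    (hb0 : ∀ k m, 0 ≤ b k m)
    (hI : ∀ k m, ∑ c ∈ kids m, I (k - 1) c = I k m) (hE0 : ∀ k m, 0 ≤ E k m)
    (hE : ∀ k m, ∑ c ∈ kids m, E (k - 1) c = E k m) (hIE : ∀ k m, I k m ^ 2 ≤ V k * E k m)
    {ε : ℝ} (hε : 0 ≤ ε) (hab : ∀ k m, I k m ≤ 3 / 4 * V k ∨ V k ≤ ε * E k m ∨ a k m ≤ 4 * b k m)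
    {K : ℝ} {d₀ : ℕ} (hS : ∀ d ≤ d₀, ∀ k m, treeSum kids a d k m ≤ K * V k) :
    ∀ d ≤ d₀, ∀ k m, ∃ α₁ α₂ i : ℝ, α₁ ≤ V k ∧ i ≤ 3 / 4 * α₁ ∧
      (I k m - i) ^ 2 ≤ (V k - α₁) * E k m ∧ α₂ ≤ ε * E k m ∧
      treeSum kids a d k m ≤ 4 * treeSum kids b d k m + K * (α₁ + α₂)
  | 0, _, k, m => ⟨0, 0, 0, (hV k).le, by simp, by simpa using hIE k m,
      mul_nonneg hε (hE0 k m), by simp [treeSum]⟩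
  | d + 1, hd, k, m => by
    have hb1 := treeSum_nonneg (kids := kids) hb0 (d + 1) k m
    have hS1 := hS (d + 1) hd k m
    rcases hab k m with h | h | h
    · exact ⟨V k, 0, I k m, le_rfl, h, by simp, mul_nonneg hε (hE0 k m), by linarith⟩
    · exact ⟨0, V k, 0, (hV k).le, by simp, by simpa using hIE k m, h, by linarith⟩
    · choose α₁ α₂ i h1 h2 h3 h4 h5 using
        exists_stopping hV hVk hb0 hI hE0 hE hIE hε hab hS d (Nat.le_of_succ_le hd) (k - 1)
      refine ⟨∑ c ∈ kids m, α₁ c, ∑ c ∈ kids m, α₂ c, ∑ c ∈ kids m, i c, ?_, ?_, ?_, ?_, ?_⟩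
      · rw [← hVk k m]
        exact Finset.sum_le_sum fun c _ => h1 c
      · rw [Finset.mul_sum]
        exact Finset.sum_le_sum fun c _ => h2 c
      · rw [← hVk k m, ← hI k m, ← hE k m, ← Finset.sum_sub_distrib, ← Finset.sum_sub_distrib]
        exact Finset.sum_sq_le_sum_mul_sum_of_sq_le_mul _ (fun c _ => sub_nonneg.2 (h1 c))
          (fun c _ => hE0 _ c) fun c _ => h3 c
      · rw [← hE k m, Finset.mul_sum]
        exact Finset.sum_le_sum fun c _ => h4 c
      · have := Finset.sum_le_sum fun c (_ : c ∈ kids m) => h5 c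
        rw [Finset.sum_add_distrib, ← Finset.mul_sum, ← Finset.mul_sum,
          Finset.sum_add_distrib] at this
        simp only [treeSum]
        linarith

theorem stopping_bound {V I i α₁ α₂ E C₀ S T K C₁ : ℝ} (hV : 0 < V) (hC₀ : 0 < C₀)
    (h1 : α₁ ≤ V) (h2 : i ≤ 3 / 4 * α₁) (h3 : (I - i) ^ 2 ≤ (V - α₁) * E)
    (h4 : α₂ ≤ (1 / (256 * C₀ ^ 2)) * E) (h5 : S ≤ 4 * T + K * (α₁ + α₂)) (hK : 0 ≤ K)
    (hE : E ≤ C₀ * V) (hI : 7 / 8 * V ≤ I) (hT : T ≤ C₁ * V) :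
    S ≤ (4 * C₁ + (1 - 1 / (128 * C₀)) * K) * V := by
  have a1 : V / 8 ≤ I - i := by linarith
  have a2 : (V / 8) ^ 2 ≤ (V - α₁) * (C₀ * V) :=
    (pow_le_pow_left₀ (by positivity) a1 2).trans (h3.trans
      (mul_le_mul_of_nonneg_left hE (sub_nonneg.2 h1)))
  have a3 : V / (64 * C₀) ≤ V - α₁ := by
    rw [div_le_iff₀ (by positivity)]
    nlinarith only [a2, hV]
  have a4 : α₂ ≤ V / (256 * C₀) := by
    refine h4.trans ((mul_le_mul_of_nonneg_left hE (by positivity)).trans (le_of_eq ?_))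
    field_simp
  have a5 : V / (64 * C₀) - V / (256 * C₀) - V / (128 * C₀) = V / (256 * C₀) := by
    field_simp
    norm_num
  have a6 : 0 ≤ V / (256 * C₀) := by positivity
  have a7 : α₁ + α₂ ≤ V - V / (128 * C₀) := by linarith
  have a8 : (1 - 1 / (128 * C₀)) * K * V = K * (V - V / (128 * C₀)) := by
    field_simp
  nlinarith only [mul_le_mul_of_nonneg_left a7 hK, a8, h5, hT]

theorem le_of_forall_contract {P : ℝ → Prop} {A q K₀ L : ℝ} (hq : 0 ≤ q) (hq1 : q < 1) (hA : 0 ≤ A)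
    (hK₀ : 0 ≤ K₀) (h0 : P K₀) (hP : ∀ K, 0 ≤ K → P K → P (A + q * K)) (hPL : ∀ K, P K → L ≤ K) :
    L ≤ A / (1 - q) := by
  have h1q : 0 < 1 - q := by linarith
  have h : ∀ j : ℕ, ∃ K, 0 ≤ K ∧ P K ∧ K ≤ A / (1 - q) + q ^ j * K₀ := by
    intro j
    induction j with
    | zero => exact ⟨K₀, hK₀, h0, by simpa using by positivity⟩
    | succ j ih =>
      obtain ⟨K, hK, hPK, hle⟩ := ih
      refine ⟨_, by positivity, hP K hK hPK, ?_⟩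
      have e : A + q * (A / (1 - q) + q ^ j * K₀) = A / (1 - q) + q ^ (j + 1) * K₀ := by
        field_simp
        ring
      rw [← e]
      gcongr
  have ht : Filter.Tendsto (fun j : ℕ => A / (1 - q) + q ^ j * K₀) Filter.atTop
      (nhds (A / (1 - q) + 0 * K₀)) :=
    ((tendsto_pow_atTop_nhds_zero_of_lt_one hq hq1).mul_const K₀).const_add _
  rw [zero_mul, add_zero] at ht
  exact ge_of_tendsto' ht fun j => by
    obtain ⟨K, -, hPK, hle⟩ := h j
    exact (hPL K hPK).trans hle

end Tree

theorem sum_vol_kids_sub (k : ℤ) (m : Fin n → ℤ) : ∑ _c ∈ kids m, vol n (k - 1) = vol n k := by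
  have := sum_vol_kids (n := n) (k - 1) m
  rwa [sub_add_cancel] at this

theorem sum_lintegral_cube_eq {g : ℤ → Rn n → ENNReal} {a : ℤ → (Fin n → ℤ) → ℝ}
    (ha : ∀ k m, 0 ≤ a k m) (hg : ∀ k m, ∫⁻ x in cube k m, g k x = ENNReal.ofReal (a k m)) :
    ∀ (d : ℕ) k m, ∑ j ∈ Finset.range d, ∫⁻ x in cube k m, g (k - j) x =
      ENNReal.ofReal (treeSum kids a d k m)
  | 0, k, m => by simp [treeSum]
  | d + 1, k, m => by
    rw [Finset.sum_range_succ', treeSum, add_comm, Nat.cast_zero, sub_zero, hg,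
      ENNReal.ofReal_add (ha k m) (Finset.sum_nonneg fun c _ => treeSum_nonneg ha _ _ _),
      ENNReal.ofReal_sum_of_nonneg fun c _ => treeSum_nonneg ha _ _ _]
    congr 1
    simp_rw [← sum_lintegral_cube_eq ha hg d (k - 1)]
    rw [Finset.sum_comm]
    refine Finset.sum_congr rfl fun j _ => ?_
    have := lintegral_cube_succ (k - 1) m (g (k - 1 - j))
    rw [sub_add_cancel] at this
    rw [← this]
    congr! 2
    push_cast
    ring_nf

theorem sum_setIntegral_kids {X : Type*} [NormedAddCommGroup X] [NormedSpace ℝ X] (k : ℤ)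
    (m : Fin n → ℤ) {f : Rn n → X} (hf : IntegrableOn f (cube k m)) :
    ∑ c ∈ kids m, ∫ x in cube (k - 1) c, f x = ∫ x in cube k m, f x := by
  have := integral_cube_succ (k - 1) m (f := f) (by rwa [sub_add_cancel])
  rw [← this, sub_add_cancel]

theorem sq_setIntegral_le {s : Set (Rn n)} (hs : volume s ≠ ⊤) {X : Type*} [NormedAddCommGroup X]
    [NormedSpace ℝ X] {f : Rn n → X} (hf : MemLp f 2 (volume.restrict s)) :
    ‖∫ x in s, f x‖ ^ 2 ≤ volume.real s * ∫ x in s, ‖f x‖ ^ 2 := by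
  have h := enorm_setIntegral_sq_le hf.1
  have hi : Integrable (fun x => ‖f x‖ ^ 2) (volume.restrict s) := hf.integrable_norm_pow (by norm_num)
  have e : ∫⁻ x in s, ‖f x‖ₑ ^ 2 = ENNReal.ofReal (∫ x in s, ‖f x‖ ^ 2) := by
    rw [ofReal_integral_eq_lintegral_ofReal hi (Filter.Eventually.of_forall fun x => by positivity)]
    refine lintegral_congr fun x => ?_
    rw [ENNReal.ofReal_pow (norm_nonneg _), ofReal_norm]
  rw [e, ← ofReal_norm, ← ENNReal.ofReal_pow (norm_nonneg _), ← ENNReal.ofReal_toReal hs,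
    ← ENNReal.ofReal_mul ENNReal.toReal_nonneg] at h
  exact (ENNReal.ofReal_le_ofReal_iff (mul_nonneg ENNReal.toReal_nonneg
    (integral_nonneg fun x => by positivity))).1 h

theorem lintegral_cube_enorm_sq {X : Type*} [NormedAddCommGroup X]
    (F : Lp X 2 (volume : Measure (Rn n))) (k : ℤ) (m : Fin n → ℤ) :
    ∫⁻ x in cube k m, ‖F x‖ₑ ^ 2 = ENNReal.ofReal (∫ x in cube k m, ‖F x‖ ^ 2) := by
  rw [ofReal_integral_eq_lintegral_ofReal (((Lp.memLp F).restrict _).integrable_norm_pow (by norm_num))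
    (Filter.Eventually.of_forall fun x => by positivity)]
  refine lintegral_congr fun x => ?_
  rw [ENNReal.ofReal_pow (norm_nonneg _), ofReal_norm]

/-- Carleson embedding for dyadic averages. -/
theorem lintegral_mul_av_sq_le_of_carleson {h : ℤ → Rn n → ENNReal} {K : ℝ} (hK : 0 < K)
    (hS : ∀ (d : ℕ) k m, ∑ j ∈ Finset.range d, ∫⁻ x in cube k m, h (k - j) x ≤
      ENNReal.ofReal (K * vol n k)) (F : Lc n) (d : ℕ) (k : ℤ) :
    ∑ j ∈ Finset.range d, ∫⁻ x, h (k - j) x * ‖av (k - j) F x‖ₑ ^ 2 ≤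
      ENNReal.ofReal (4 * K * ‖F‖ ^ 2) := by
  have hfin : ∀ k m, ∫⁻ x in cube k m, h k x ≠ ⊤ := fun k m => by
    have := hS 1 k m
    simp only [Finset.sum_range_one, Nat.cast_zero, sub_zero] at this
    exact (this.trans_lt ENNReal.ofReal_lt_top).ne
  set a : ℤ → (Fin n → ℤ) → ℝ := fun k m => (∫⁻ x in cube k m, h k x).toReal
  have ha : ∀ k m, 0 ≤ a k m := fun k m => ENNReal.toReal_nonneg
  have hha : ∀ k m, ∫⁻ x in cube k m, h k x = ENNReal.ofReal (a k m) := fun k m =>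
    (ENNReal.ofReal_toReal (hfin k m)).symm
  set b : ℤ → (Fin n → ℤ) → ℝ := fun k m => a k m * ‖cav k m F‖ ^ 2
  have hb : ∀ k m, 0 ≤ b k m := fun k m => mul_nonneg (ha k m) (sq_nonneg _)
  have hhb : ∀ k m, ∫⁻ x in cube k m, h k x * ‖av k F x‖ₑ ^ 2 = ENNReal.ofReal (b k m) :=
    fun k m => by
      rw [lintegral_cube_av_sq, hha, ENNReal.ofReal_mul (ha k m), ENNReal.ofReal_pow (norm_nonneg _),
        ofReal_norm]
  have hF : ∀ k m, MemLp F 2 (volume.restrict (cube k m)) := fun k m => (Lp.memLp F).restrict _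
  have key := treeSum_le_of_carleson (kids := kids) (V := vol n) (a := a) (b := b)
    (I := fun k m => ∫ x in cube k m, ‖F x‖) (E := fun k m => ∫ x in cube k m, ‖F x‖ ^ 2)
    (vol_pos n) sum_vol_kids_sub ha
    (fun k m => sum_setIntegral_kids k m (integrableOn_cube F k m).norm)
    (fun k m => sum_setIntegral_kids k m ((hF k m).integrable_norm_pow (by norm_num)))
    (fun k m => by
      have := sq_setIntegral_le (volume_cube_ne_top k m) (hF k m).norm
      rw [real_cube] at this
      simpa using this) hK
    (fun d k m => by
      have := hS d k m
      rw [sum_lintegral_cube_eq ha hha] at this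
      exact (ENNReal.ofReal_le_ofReal_iff (mul_nonneg hK.le (vol_pos n k).le)).1 this)
    (fun k m => by
      have hv := vol_pos n k
      have : ‖cav k m F‖ ≤ (∫ x in cube k m, ‖F x‖) / vol n k := by
        rw [cav, norm_smul, norm_inv, Real.norm_of_nonneg hv.le, div_eq_inv_mul]
        gcongr
        exact norm_integral_le_integral_norm _
      rw [mul_div_assoc, ← div_pow]
      exact mul_le_mul_of_nonneg_left (pow_le_pow_left₀ (norm_nonneg _) this 2) (ha k m)) d k
  have e : ∀ j : ℕ, ∫⁻ x, h (k - j) x * ‖av (k - j) F x‖ₑ ^ 2 =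
      ∑' m, ∫⁻ x in cube k m, h (k - j) x * ‖av (k - j) F x‖ₑ ^ 2 := fun j =>
    lintegral_eq_tsum_cube k _
  simp_rw [e]
  rw [← Summable.tsum_finsetSum fun _ _ => ENNReal.summable,
    ENNReal.ofReal_mul (by positivity), ofReal_norm_sq, lintegral_eq_tsum_cube k,
    ← ENNReal.tsum_mul_left]
  refine ENNReal.tsum_le_tsum fun m => ?_
  rw [sum_lintegral_cube_eq (g := fun k x => h k x * ‖av k F x‖ₑ ^ 2) hb hhb,
    lintegral_cube_enorm_sq, ← ENNReal.ofReal_mul (by positivity)]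
  refine ENNReal.ofReal_le_ofReal ((key m).trans ?_)
  have hv := vol_pos n k
  have hs := treeSum_nonneg (kids := kids) ha d k m
  gcongr
  exact sub_le_self _ (by positivity)

end

section

variable {n : ℕ}

theorem lintegral_cube_le_of_descendants {g : Rn n → ENNReal} {c : ℝ} (hc : 0 ≤ c) :
    ∀ (j : ℕ) (k : ℤ) (m : Fin n → ℤ),
      (∀ m', cube (k - j) m' ⊆ cube k m →
        ∫⁻ x in cube (k - j) m', g x ≤ ENNReal.ofReal (c * vol n (k - j))) →
      ∫⁻ x in cube k m, g x ≤ ENNReal.ofReal (c * vol n k)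
  | 0, k, m, h => by
    simp only [Nat.cast_zero, sub_zero] at h
    exact h m le_rfl
  | j + 1, k, m, h => by
    have e := lintegral_cube_succ (k - 1) m g
    rw [sub_add_cancel] at e
    rw [e, ← sum_vol_kids_sub k m, Finset.mul_sum,
      ENNReal.ofReal_sum_of_nonneg fun _ _ => mul_nonneg hc (vol_pos n _).le]
    refine Finset.sum_le_sum fun m₁ hm₁ => lintegral_cube_le_of_descendants hc j (k - 1) m₁ ?_
    have e2 : k - 1 - (j : ℤ) = k - ((j + 1 : ℕ) : ℤ) := by push_cast; ring
    rw [e2]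
    intro m' hm'
    have h3 := cube_subset_of_mem_kids (k := k - 1) hm₁
    rw [sub_add_cancel] at h3
    exact h m' (hm'.trans h3)

/-- The measure of the neighbourhood of a unit cube that is used for cutting off constants. -/
def nbhdVol (n : ℕ) : ℝ := (n + 1) ^ n * volume.real (Metric.ball (0 : Rn n) 1)

theorem nbhdVol_nonneg (n : ℕ) : 0 ≤ nbhdVol n := by unfold nbhdVol; positivity

theorem exists_cutoff_const (k : ℤ) (m : Fin n → ℤ) {w : Cn n} (hw : ‖w‖ = 1) :
    ∃ G : Lc n, ‖G‖ ^ 2 ≤ nbhdVol n * vol n k ∧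
      (∀ x0 ∈ cube k m, ∀ᵐ x, ‖G x - w‖ ≤ ‖x - x0‖ / 2 ^ k) ∧
      ∀ᵐ x, x ∈ cube k m → G x = w := by
  obtain ⟨y, hy⟩ := KData.exists_mem_cube k m
  have ht : (0 : ℝ) < 2 ^ k := by positivity
  set B := Metric.closedBall y ((n + 1) * 2 ^ k) with hB
  have hBm : MeasurableSet B := Metric.isClosed_closedBall.measurableSet
  have hBf : volume B ≠ ⊤ := (measure_closedBall_lt_top).ne
  have hG : (indicatorConstLp 2 hBm hBf w : Lc n) =ᵐ[volume] B.indicator fun _ => w :=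
    indicatorConstLp_coeFn
  have hsub : cube k m ⊆ B := fun x hx => by
    rw [hB, Metric.mem_closedBall, dist_eq_norm]
    refine (norm_sub_le_of_mem_cube hx hy).trans ?_
    gcongr
    linarith
  refine ⟨indicatorConstLp 2 hBm hBf w, ?_, ?_, ?_⟩
  · refine norm_sq_le_of_lintegral_le (mul_nonneg (nbhdVol_nonneg n) (vol_pos n k).le) ?_
    have e : ∫⁻ x, ‖(indicatorConstLp 2 hBm hBf w : Lc n) x‖ₑ ^ 2 =
        ∫⁻ x, B.indicator (fun _ => 1) x := by
      refine lintegral_congr_ae ?_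
      filter_upwards [hG] with x hx
      rw [hx]
      by_cases h : x ∈ B
      · simp [h, ← ofReal_norm, hw]
      · simp [h]
    rw [e, lintegral_indicator_const hBm, one_mul, hB,
      Measure.addHaar_closedBall _ _ (by positivity), finrank_euclideanSpace, Fintype.card_fin,
      ← ENNReal.ofReal_toReal (measure_ball_lt_top (μ := volume) (x := (0 : Rn n)) (r := 1)).ne,
      ← ENNReal.ofReal_mul (by positivity)]
    refine ENNReal.ofReal_le_ofReal (le_of_eq ?_)
    rw [nbhdVol, vol, mul_pow, Measure.real]
    ring
  · intro x0 hx0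
    filter_upwards [hG] with x hx
    rw [hx]
    by_cases h : x ∈ B
    · simp only [h, indicator_of_mem, sub_self, norm_zero]
      positivity
    · simp only [h, not_false_eq_true, indicator_of_notMem, zero_sub, norm_neg, hw]
      rw [le_div_iff₀ ht, one_mul]
      rw [hB, Metric.mem_closedBall, dist_eq_norm, not_le] at h
      have h1 := norm_sub_le_of_mem_cube hx0 hy
      have h2 : ‖x - y‖ ≤ ‖x - x0‖ + ‖x0 - y‖ := norm_sub_le_norm_sub_add_norm_sub _ _ _
      linarith
  · filter_upwards [hG] with x hx h
    rw [hx, indicator_of_mem (hsub h)]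

theorem sum_geom_four_le {c : ℝ} (hc : 0 ≤ c) (k : ℤ) (d : ℕ) :
    ∑ j ∈ Finset.range d, c * ((2 : ℝ) ^ (k - (j : ℤ)) / 2 ^ k) ^ 2 ≤ 4 / 3 * c := by
  have e : ∀ j : ℕ, ((2 : ℝ) ^ (k - (j : ℤ)) / 2 ^ k) ^ 2 = (1 / 4) ^ j := fun j => by
    rw [zpow_sub₀ (by norm_num), zpow_natCast, div_div_cancel_left' (by positivity), inv_pow,
      ← pow_mul, mul_comm j 2, pow_mul, one_div, inv_pow]
    norm_num
  simp_rw [e]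
  rw [← Finset.mul_sum, mul_comm]
  gcongr
  rw [geom_sum_eq (by norm_num)]
  have h : (0 : ℝ) ≤ (1 / 4) ^ d := by positivity
  rw [div_le_iff_of_neg (by norm_num)]
  linarith

namespace KData

open ContinuousLinearMap

variable {M κ : ℝ} {V : Type} [NormedAddCommGroup V] [InnerProductSpace ℂ V] [CompleteSpace V]
  (D : KData n M κ V)

/-- The constant in the tail estimate. -/
def cTail (n : ℕ) (M κ : ℝ) : ℝ := cG n M κ * (lam n M κ ^ (n + 2) * (wtMom n).toReal)

theorem cTail_nonneg (D : KData n M κ V) : 0 ≤ cTail n M κ := by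
  have := D.cG_nonneg
  have := D.lam_pos
  unfold cTail
  positivity

theorem lintegral_cube_theta_tail_le (k : ℤ) (m : Fin n → ℤ) (F : Lc n) (w : Cn n) {x0 : Rn n}
    (hx0 : x0 ∈ cube k m) {l : ℝ} (hl : 0 < l) (hF : ∀ᵐ x, ‖F x - w‖ ≤ ‖x - x0‖ / l) :
    ∫⁻ x in cube k m, ‖D.theta (2 ^ k) F x - inner ℂ (D.gam k x) w‖ₑ ^ 2 ≤
      ENNReal.ofReal (cTail n M κ * (2 ^ k / l) ^ 2 * vol n k) := by
  have ht : (0 : ℝ) < 2 ^ k := AccForm.two_zpow_pos k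
  have hs : 0 < lam n M κ * 2 ^ k := mul_pos D.lam_pos ht
  have hcG := D.cG_nonneg
  have hlam := D.lam_pos
  refine (D.lintegral_cube_theta_sub_le k m F w hx0).trans ?_
  set s := lam n M κ * 2 ^ k with hsd
  calc _ ≤ ENNReal.ofReal (cG n M κ) * ∫⁻ x, ENNReal.ofReal ((s / l) ^ 2) *
        ENNReal.ofReal ((1 + ‖s⁻¹ • (x - x0)‖ ^ 2) * wt s x0 x ^ 2) := by
        refine mul_le_mul_right (lintegral_mono_ae ?_) _
        filter_upwards [hF] with x hx
        rw [← ofReal_norm, ← ENNReal.ofReal_pow (norm_nonneg _), ← ENNReal.ofReal_mul (by positivity),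
          ← ENNReal.ofReal_mul (by positivity)]
        refine ENNReal.ofReal_le_ofReal ?_
        have h1 : ‖F x - w‖ ^ 2 ≤ (‖x - x0‖ / l) ^ 2 := pow_le_pow_left₀ (norm_nonneg _) hx 2
        have h2 : (‖x - x0‖ / l) ^ 2 = (s / l) ^ 2 * ‖s⁻¹ • (x - x0)‖ ^ 2 := by
          rw [norm_smul, norm_inv, Real.norm_of_nonneg hs.le]
          field_simp
        rw [h2] at h1
        calc _ ≤ wt s x0 x ^ 2 * ((s / l) ^ 2 * ‖s⁻¹ • (x - x0)‖ ^ 2) := by gcongr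
          _ = (s / l) ^ 2 * (‖s⁻¹ • (x - x0)‖ ^ 2 * wt s x0 x ^ 2) := by ring
          _ ≤ _ := by gcongr; linarith
    _ = ENNReal.ofReal (cG n M κ * ((s / l) ^ 2 * (s ^ n * (wtMom n).toReal))) := by
        rw [lintegral_const_mul' _ _ ENNReal.ofReal_ne_top, lintegral_moment_wt hs,
          ENNReal.ofReal_mul hcG, ENNReal.ofReal_mul (by positivity), ENNReal.ofReal_mul (by positivity),
          ENNReal.ofReal_toReal (wtMom_lt_top n).ne]
    _ ≤ _ := by
        refine ENNReal.ofReal_le_ofReal (le_of_eq ?_)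
        rw [cTail, vol, hsd, mul_pow]
        field_simp
        ring

theorem neg_smul_sig_bounds {s : ℝ} (hs : 0 < s) (G : Lc n) :
    ‖D.J (-((s : ℂ) • D.sig s G))‖ ^ 2 ≤ s ^ 2 * (M ^ 2 / (2 * κ) * ‖G‖ ^ 2) ∧
    ‖D.D1 (-((s : ℂ) • D.sig s G))‖ ^ 2 + ‖D.D2 (-((s : ℂ) • D.sig s G))‖ ^ 2 ≤
      (M / κ) ^ 2 * ‖G‖ ^ 2 := by
  have h := D.energy_sig_le hs G
  have hκ := D.κ_pos
  rw [D.theta_apply] at h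
  simp only [map_neg, map_smul, norm_neg, norm_smul, Complex.norm_real, Real.norm_of_nonneg hs.le,
    mul_pow]
  constructor
  · refine mul_le_mul_of_nonneg_left (le_trans ?_ h) (by positivity)
    exact le_add_of_nonneg_right (by positivity)
  · have h1 : κ / 2 * (s ^ 2 * (‖D.D1 (D.sig s G)‖ ^ 2 + ‖D.D2 (D.sig s G)‖ ^ 2)) ≤
        M ^ 2 / (2 * κ) * ‖G‖ ^ 2 := (le_add_of_nonneg_left (by positivity)).trans h
    rw [← mul_le_mul_iff_right₀ (by positivity : 0 < κ / 2)]
    refine le_trans (le_of_eq (by ring)) (h1.trans (le_of_eq ?_))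
    field_simp

theorem J_sub_R_J_neg_smul_sig {s t : ℝ} (hs : 0 < s) (ht : 0 < t) (G : Lc n) :
    D.J (-((s : ℂ) • D.sig s G)) - D.form.R t (D.J (-((s : ℂ) • D.sig s G))) =
      ((t ^ 2 : ℝ) : ℂ) • D.form.R t (-(((s ^ 2)⁻¹ : ℝ) : ℂ) • D.J (-((s : ℂ) • D.sig s G)))
        + (t : ℂ) • (- D.theta t G) := by
  set v := -((s : ℂ) • D.sig s G) with hv
  have hN : D.form.N v = adjoint D.J (-(((s ^ 2)⁻¹ : ℝ) : ℂ) • D.J v) +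
      - adjoint D.D2 (D.AL G) := by
    refine ext_inner_left ℂ fun z => ?_
    have h := D.sig_eq hs G z
    have hs' : (s : ℂ) ≠ 0 := by exact_mod_cast hs.ne'
    rw [D.inner_form_N, inner_add_right, adjoint_inner_right, inner_neg_right, adjoint_inner_right]
    simp only [hv, map_neg, map_smul, inner_neg_right, inner_smul_right, smul_neg, neg_smul, neg_neg]
    push_cast at h ⊢
    have h' : inner ℂ (D.D2 z) (D.AL G) = (s : ℂ)⁻¹ * (inner ℂ (D.J z) (D.J (D.sig s G)) + (s : ℂ) ^ 2 *
      (inner ℂ (D.D1 z) (D.D1 (D.sig s G)) + inner ℂ (D.D2 z) (D.AL (D.D2 (D.sig s G))))) := by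
      rw [h, inv_mul_cancel_left₀ hs']
    rw [h']
    field_simp
    ring
  have h := D.form.J_sub_R_J ht hN
  rw [(D.form.Minv t).map_neg, smul_neg] at h
  exact h.trans (congrArg (fun z => _ + (t : ℂ) • z) (D.form.J.map_neg _))

end KData

end

section

variable {n : ℕ}

theorem cube_idx_subset {k : ℤ} {m : Fin n → ℤ} {x : Rn n} (hx : x ∈ cube k m) :
    ∀ j : ℕ, cube (k - j) (idx (k - j) x) ⊆ cube k m
  | 0 => by
    simp only [Nat.cast_zero, sub_zero]
    rw [(hx : idx k x = m)]
  | j + 1 => by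
    refine Subset.trans ?_ (cube_idx_subset hx j)
    have e : k - ((j + 1 : ℕ) : ℤ) + 1 = k - j := by push_cast; ring
    have := cube_subset_of_mem_kids (k := k - ((j + 1 : ℕ) : ℤ))
      (idx_mem_kids.2 (mem_cube_idx (k - ((j + 1 : ℕ) : ℤ) + 1) x))
    rwa [e] at this

theorem av_eq_of_ae_eq_const {k : ℤ} {m : Fin n → ℤ} {x : Rn n} (hx : x ∈ cube k m) (j : ℕ)
    {F : Rn n → Cn n} {w : Cn n} (hF : ∀ᵐ y, y ∈ cube k m → F y = w) : av (k - j) F x = w := by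
  have e : ∫ y in cube (k - j) (idx (k - j) x), F y =
      ∫ _y in cube (k - j) (idx (k - j) x), w := by
    refine setIntegral_congr_ae (measurableSet_cube _ _) ?_
    filter_upwards [hF] with y hy h
    exact hy (cube_idx_subset hx j h)
  rw [av, cav, e, setIntegral_const, real_cube, smul_smul, inv_mul_cancel₀ (vol_pos n _).ne', one_smul]

theorem sum_range_sub_eq {X : Type*} [AddCommMonoid X] (g : ℤ → X) (k : ℤ) (d : ℕ) :
    ∑ j ∈ Finset.range d, g (k - j) = ∑ i ∈ Finset.range d, g (k - d + 1 + i) := by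
  rw [← Finset.sum_range_reflect]
  refine Finset.sum_congr rfl fun i hi => ?_
  have : i + 1 ≤ d := Finset.mem_range.1 hi
  congr 1
  rw [Nat.sub_sub, Nat.cast_sub (by omega)]
  push_cast
  ring

theorem setIntegral_re_inner (F : Lc n) (w : Cn n) (k : ℤ) (m : Fin n → ℤ) :
    ∫ x in cube k m, (inner ℂ w (F x)).re = vol n k * (inner ℂ w (cav k m F)).re := by
  have hi := integrableOn_cube F k m
  have a1 : ∫ x in cube k m, (inner ℂ w (F x)).re = (∫ x in cube k m, inner ℂ w (F x)).re :=
    integral_re (hi.const_inner (𝕜 := ℂ) w)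
  have a2 : ∫ x in cube k m, inner ℂ w (F x) = inner ℂ w (∫ x in cube k m, F x) :=
    integral_inner hi w
  rw [a1, a2, cav, inner_smul_right_eq_smul, smul_re, smul_eq_mul,
    mul_inv_cancel_left₀ (vol_pos n k).ne']

theorem lintegral_enorm_add_add_sq_le {α : Type*} [MeasurableSpace α] {μ : Measure α}
    {p q r : α → ℂ} {b₁ b₂ b₃ : ENNReal} (hp : AEStronglyMeasurable p μ)
    (hq : AEStronglyMeasurable q μ) (h₁ : ∫⁻ x, ‖p x‖ₑ ^ 2 ∂μ ≤ b₁) (h₂ : ∫⁻ x, ‖q x‖ₑ ^ 2 ∂μ ≤ b₂)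
    (h₃ : ∫⁻ x, ‖r x‖ₑ ^ 2 ∂μ ≤ b₃) :
    ∫⁻ x, ‖p x + (q x + r x)‖ₑ ^ 2 ∂μ ≤ 2 * b₁ + 2 * (2 * b₂ + 2 * b₃) :=
  (lintegral_enorm_add_sq_le hp fun x => q x + r x).trans (add_le_add (mul_le_mul_right h₁ 2)
    (mul_le_mul_right ((lintegral_enorm_add_sq_le hq r).trans
      (add_le_add (mul_le_mul_right h₂ 2) (mul_le_mul_right h₃ 2))) 2))

namespace KData

open ContinuousLinearMap

variable {M κ : ℝ} {V : Type} [NormedAddCommGroup V] [InnerProductSpace ℂ V] [CompleteSpace V]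
  (D : KData n M κ V)

set_option maxHeartbeats 1000000 in
theorem lintegral_cube_gam_av_test_le {s : ℝ} (hs : 0 < s) (k : ℤ) (m : Fin n → ℤ) (j : ℕ)
    {w : Cn n} {G : Lc n} (hG1 : ∀ x0 ∈ cube k m, ∀ᵐ x, ‖G x - w‖ ≤ ‖x - x0‖ / 2 ^ k)
    (hG2 : ∀ᵐ x, x ∈ cube k m → G x = w) :
    ∫⁻ x in cube k m, ‖inner ℂ (D.gam (k - j) x)
        (av (k - j) (G + D.D2 (-((s : ℂ) • D.sig s G)) : Lc n) x)‖ₑ ^ 2 ≤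
      ENNReal.ofReal (2 * (cTail n M κ * (2 ^ (k - (j : ℤ)) / 2 ^ k) ^ 2 * vol n k) +
        4 * (M ^ 2 / (2 * κ) * ‖G‖ ^ 2 * (2 ^ k / s) ^ 2 * (2 ^ (k - (j : ℤ)) / 2 ^ k) ^ 2)) +
      4 * ∫⁻ x, ‖inner ℂ (D.gam (k - j) x) (av (k - j) (D.D2 (-((s : ℂ) • D.sig s G))) x) -
        ((((2 : ℝ) ^ (k - j : ℤ))⁻¹ : ℂ) • (D.J (-((s : ℂ) • D.sig s G)) -
          D.form.Rd (k - j) (D.J (-((s : ℂ) • D.sig s G)))) : L2 n) x‖ₑ ^ 2 := by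
  set v := -((s : ℂ) • D.sig s G) with hv
  have ht : (0 : ℝ) < 2 ^ (k - (j : ℤ)) := AccForm.two_zpow_pos _
  have hJ := (D.neg_smul_sig_bounds hs G).1
  have hR := D.J_sub_R_J_neg_smul_sig hs ht G
  rw [← hv] at hJ hR
  set k' := k - (j : ℤ) with hk'
  set t : ℝ := 2 ^ k' with htd
  have hκ := D.κ_pos
  have hcT := D.cTail_nonneg
  have hvol := vol_pos n k
  set Z : L2 n := (t : ℂ) • D.form.R t (-(((s ^ 2)⁻¹ : ℝ) : ℂ) • D.J v) with hZ
  have hZn : ‖Z‖ ^ 2 ≤ M ^ 2 / (2 * κ) * ‖G‖ ^ 2 * (2 ^ k / s) ^ 2 * (t / 2 ^ k) ^ 2 := by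
    have h1 := D.form.norm_R_le ht (-(((s ^ 2)⁻¹ : ℝ) : ℂ) • D.J v)
    rw [norm_smul, norm_neg, Complex.norm_real, Real.norm_of_nonneg (by positivity)] at h1
    rw [hZ, norm_smul, Complex.norm_real, Real.norm_of_nonneg ht.le]
    calc (t * ‖D.form.R t (-(((s ^ 2)⁻¹ : ℝ) : ℂ) • D.J v)‖) ^ 2 ≤
          (t * ((s ^ 2)⁻¹ * ‖D.J v‖)) ^ 2 := by gcongr
      _ = t ^ 2 * ((s ^ 2)⁻¹) ^ 2 * ‖D.J v‖ ^ 2 := by ring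
      _ ≤ t ^ 2 * ((s ^ 2)⁻¹) ^ 2 * (s ^ 2 * (M ^ 2 / (2 * κ) * ‖G‖ ^ 2)) := by gcongr
      _ = _ := by
        have : (2 : ℝ) ^ k ≠ 0 := by positivity
        field_simp
  set Y : L2 n := ((((2 : ℝ) ^ (k' : ℤ))⁻¹ : ℂ) • (D.J v - D.form.Rd k' (D.J v)) : L2 n) with hY
  have hYZ : Y = Z - D.theta t G := by
    have e1 : (((2 : ℝ) : ℂ) ^ k')⁻¹ = (t : ℂ)⁻¹ := by rw [htd, ofReal_zpow]
    have ht' : (t : ℂ) ≠ 0 := by exact_mod_cast ht.ne'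
    have e2 : D.J v - D.form.Rd k' (D.J v) = (0 : L2 n) + (((t ^ 2 : ℝ) : ℂ) •
      D.form.R t (-(((s ^ 2)⁻¹ : ℝ) : ℂ) • D.J v) + (t : ℂ) • (- D.theta t G)) := by
      rw [zero_add]
      exact hR
    rw [hY, e2, e1, inv_smul_add_sq_smul_add (E := L2 n) ht', smul_zero, zero_add, ← sub_eq_add_neg]
  clear_value Y Z v
  have e : ∀ᵐ x ∂volume.restrict (cube k m), inner ℂ (D.gam k' x) (av k' (G + D.D2 v : Lc n) x) =
      - (D.theta t G x - inner ℂ (D.gam k' x) w) +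
        ((inner ℂ (D.gam k' x) (av k' (D.D2 v) x) - Y x) + Z x) := by
    rw [ae_restrict_iff' (measurableSet_cube k m)]
    filter_upwards [Lp.coeFn_sub Z (D.theta t G)] with x hx hxm
    rw [hYZ, hx, Pi.sub_apply, av_add, Pi.add_apply, inner_add_right,
      av_eq_of_ae_eq_const hxm j hG2]
    ring
  have m1 : AEStronglyMeasurable (fun x => - (D.theta t G x - inner ℂ (D.gam k' x) w))
      (volume.restrict (cube k m)) := by
    refine (((Lp.stronglyMeasurable (D.theta t G)).measurable.sub ?_).neg).aestronglyMeasurable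
    have := D.measurable_gam k'
    fun_prop
  have m2 : AEStronglyMeasurable (fun x => inner ℂ (D.gam k' x) (av k' (D.D2 v) x) - Y x)
      (volume.restrict (cube k m)) :=
    ((D.measurable_gam_av k' (D.D2 v)).sub (Lp.stronglyMeasurable Y).measurable).aestronglyMeasurable
  have b1 : ∫⁻ x in cube k m, ‖- (D.theta t G x - inner ℂ (D.gam k' x) w)‖ₑ ^ 2 ≤
      ENNReal.ofReal (cTail n M κ * (t / 2 ^ k) ^ 2 * vol n k) := by
    simp_rw [enorm_neg]
    refine lintegral_cube_le_of_descendants (by positivity) j k m fun m' hm' => ?_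
    obtain ⟨x0, hx0⟩ := exists_mem_cube (k - (j : ℤ)) m'
    exact D.lintegral_cube_theta_tail_le _ m' G w hx0 (by positivity) (hG1 x0 (hm' hx0))
  have b3 : ∫⁻ x in cube k m, ‖Z x‖ₑ ^ 2 ≤ ENNReal.ofReal
      (M ^ 2 / (2 * κ) * ‖G‖ ^ 2 * (2 ^ k / s) ^ 2 * (t / 2 ^ k) ^ 2) := by
    refine (setLIntegral_le_lintegral _ _).trans ?_
    rw [← ofReal_norm_sq]
    exact ENNReal.ofReal_le_ofReal hZn
  have b2 := setLIntegral_le_lintegral (μ := volume) (cube k m)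
    fun x => ‖inner ℂ (D.gam k' x) (av k' (D.D2 v) x) - Y x‖ₑ ^ 2
  rw [lintegral_congr_ae (e.mono fun x hx => by rw [hx])]
  refine (lintegral_enorm_add_add_sq_le m1 m2 b1 b2 b3).trans (le_of_eq ?_)
  rw [ENNReal.ofReal_add (by positivity) (by positivity),
    ENNReal.ofReal_mul (by positivity : (0 : ℝ) ≤ 2),
    ENNReal.ofReal_mul (by positivity : (0 : ℝ) ≤ 4), ENNReal.ofReal_ofNat, ENNReal.ofReal_ofNat]
  ring

end KData

set_option maxHeartbeats 1000000 in
theorem exists_test_function (n : ℕ) {M κ : ℝ} (hκ : 0 < κ) : ∃ C₀ C₁ : ℝ, 0 < C₀ ∧ 0 ≤ C₁ ∧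
    ∀ {V : Type} [NormedAddCommGroup V] [InnerProductSpace ℂ V] [CompleteSpace V]
      (D : KData n M κ V) {cb : ℝ} (_ : 0 ≤ cb) (_ : D.LapBound cb) {w : Cn n} (_ : ‖w‖ = 1)
      (d : ℕ) (k : ℤ) (m : Fin n → ℤ), ∃ f : Lc n,
      ∫ x in cube k m, ‖f x‖ ^ 2 ≤ C₀ * vol n k ∧
      7 / 8 * vol n k ≤ ∫ x in cube k m, (inner ℂ w (f x)).re ∧
      ∑ j ∈ Finset.range d, ∫⁻ x in cube k m,
        ‖inner ℂ (D.gam (k - j) x) (av (k - j) f x)‖ₑ ^ 2 ≤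
        ENNReal.ofReal (C₁ * (1 + cb) ^ 2 * vol n k) := by
  obtain ⟨Ca, hCa, hav⟩ := exists_vol_mul_enorm_cav_sq_le n
  obtain ⟨Cp, hCp, hpr⟩ := exists_principal_part n M κ
  have hcS := nbhdVol_nonneg n
  set cS := nbhdVol n
  set B₁ := M ^ 2 / (2 * κ) with hB₁
  set B₂ := (M / κ) ^ 2 with hB₂
  have hB₁0 : 0 ≤ B₁ := by positivity
  have hB₂0 : 0 ≤ B₂ := by positivity
  set τ := min 1 (1 / (64 * (cS * Ca * (B₁ + B₂) + 1))) with hτd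
  have hτ : 0 < τ := lt_min one_pos (by positivity)
  have hτ1 : τ ≤ 1 := min_le_left _ _
  have hτ2 : cS * Ca * (B₁ + B₂) * τ ≤ 1 / 64 := by
    have h : τ ≤ 1 / (64 * (cS * Ca * (B₁ + B₂) + 1)) := min_le_right _ _
    rw [le_div_iff₀ (by positivity)] at h
    nlinarith only [h, hτ]
  refine ⟨2 * cS * (1 + B₂) + 1, 2 * (4 / 3 * |KData.cTail n M κ|) +
    4 * (4 / 3 * (B₁ * cS * ((τ ^ 2)⁻¹) ^ 2)) + 4 * (Cp * (B₂ * cS)), by positivity, by positivity, ?_⟩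
  intro V _ _ _ D cb hcb hD w hw d k m
  have hcT := D.cTail_nonneg
  rw [abs_of_nonneg hcT]
  have hvol := vol_pos n k
  have hl : (0 : ℝ) < 2 ^ k := AccForm.two_zpow_pos k
  have hs : 0 < τ ^ 2 * 2 ^ k := by positivity
  obtain ⟨G, hG0, hG1, hG2⟩ := exists_cutoff_const k m hw
  have hb := D.neg_smul_sig_bounds hs G
  have hT := fun j => D.lintegral_cube_gam_av_test_le hs k m j hG1 hG2
  set s := τ ^ 2 * 2 ^ k with hsd
  set v := -((s : ℂ) • D.sig s G) with hv
  have hJv : ‖D.J v‖ ^ 2 ≤ s ^ 2 * (B₁ * (cS * vol n k)) := hb.1.trans (by gcongr)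
  have hDv : ‖D.D1 v‖ ^ 2 + ‖D.D2 v‖ ^ 2 ≤ B₂ * (cS * vol n k) := hb.2.trans (by gcongr)
  have hD2v : ‖D.D2 v‖ ^ 2 ≤ B₂ * (cS * vol n k) := by linarith [sq_nonneg ‖D.D1 v‖]
  refine ⟨G + D.D2 v, ?_, ?_, ?_⟩
  · have h1 : ∫ x in cube k m, ‖(G + D.D2 v : Lc n) x‖ ^ 2 ≤ ‖(G + D.D2 v : Lc n)‖ ^ 2 := by
      rw [← ENNReal.ofReal_le_ofReal_iff (by positivity), ← lintegral_cube_enorm_sq, ofReal_norm_sq]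
      exact setLIntegral_le_lintegral _ _
    have h2 : ‖(G + D.D2 v : Lc n)‖ ^ 2 ≤ 2 * ‖G‖ ^ 2 + 2 * ‖D.D2 v‖ ^ 2 :=
      (pow_le_pow_left₀ (norm_nonneg _) (norm_add_le _ _) 2).trans
        (by nlinarith only [sq_nonneg (‖G‖ - ‖D.D2 v‖)])
    nlinarith only [h1, h2, hG0, hD2v, hvol]
  · have h := hav (D.J v) (D.D2 v) (D.isWGrad v) k m τ hτ hτ1
    have hc : ‖cav k m (D.D2 v)‖ ≤ 1 / 8 := by
      have h1 : ENNReal.ofReal (vol n k * ‖cav k m (D.D2 v)‖ ^ 2) ≤ ENNReal.ofReal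
          (Ca * ((τ ^ 2)⁻¹ * (((2 : ℝ) ^ k) ^ 2)⁻¹) * ‖D.J v‖ ^ 2 + Ca * τ * ‖D.D2 v‖ ^ 2) := by
        rw [ENNReal.ofReal_mul hvol.le, ENNReal.ofReal_pow (norm_nonneg _), ofReal_norm]
        refine h.trans ?_
        rw [ENNReal.ofReal_add (by positivity) (by positivity),
          ENNReal.ofReal_mul (by positivity : 0 ≤ Ca * ((τ ^ 2)⁻¹ * (((2 : ℝ) ^ k) ^ 2)⁻¹)),
          ENNReal.ofReal_mul (by positivity : 0 ≤ Ca * τ), ofReal_norm_sq, ofReal_norm_sq]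
        exact add_le_add (mul_le_mul_right (setLIntegral_le_lintegral _ _) _)
          (mul_le_mul_right (setLIntegral_le_lintegral _ _) _)
      have h2 := (ENNReal.ofReal_le_ofReal_iff (by positivity)).1 h1
      have h3 : vol n k * ‖cav k m (D.D2 v)‖ ^ 2 ≤ vol n k * (1 / 64) := by
        calc _ ≤ _ := h2
          _ ≤ Ca * ((τ ^ 2)⁻¹ * (((2 : ℝ) ^ k) ^ 2)⁻¹) * (s ^ 2 * (B₁ * (cS * vol n k))) +
            Ca * τ * (B₂ * (cS * vol n k)) := by gcongr
          _ = vol n k * (cS * Ca * (B₁ * τ + B₂) * τ) := by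
            rw [hsd]
            field_simp
          _ ≤ vol n k * (cS * Ca * (B₁ * 1 + B₂) * τ) := by gcongr
          _ ≤ _ := by rw [mul_one]; gcongr
      have h4 : ‖cav k m (D.D2 v)‖ ^ 2 ≤ (1 / 8) ^ 2 :=
        (le_of_mul_le_mul_left h3 hvol).trans (by norm_num)
      exact le_of_sq_le_sq h4 (by norm_num)
    have hiD := integrableOn_cube (D.D2 v) k m
    have e1 : ∫ x in cube k m, (inner ℂ w ((G + D.D2 v : Lc n) x)).re =
        ∫ x in cube k m, (1 + (inner ℂ w (D.D2 v x)).re) := by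
      refine setIntegral_congr_ae (measurableSet_cube k m) ?_
      filter_upwards [hG2, Lp.coeFn_add G (D.D2 v)] with x hx hx2 hxm
      rw [hx2, Pi.add_apply, hx hxm, inner_add_right, add_re, inner_self_eq_norm_sq_to_K, hw]
      simp
    have hiI : IntegrableOn (fun x => inner ℂ w (D.D2 v x)) (cube k m) := hiD.const_inner w
    have hre : IntegrableOn (fun x => (inner ℂ w (D.D2 v x)).re) (cube k m) := hiI.re
    have hone : IntegrableOn (fun _ : Rn n => (1 : ℝ)) (cube k m) :=
      integrableOn_const (volume_cube_ne_top k m)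
    rw [e1, integral_add hone hre, setIntegral_const, real_cube, smul_eq_mul, mul_one,
      setIntegral_re_inner]
    have h5 : |(inner ℂ w (cav k m (D.D2 v))).re| ≤ 1 / 8 :=
      (abs_re_le_norm _).trans ((norm_inner_le_norm _ _).trans (by rw [hw, one_mul]; exact hc))
    nlinarith only [(abs_le.1 h5).1, hvol]
  · refine (Finset.sum_le_sum fun j _ => hT j).trans ?_
    rw [Finset.sum_add_distrib, ← Finset.mul_sum,
      ← ENNReal.ofReal_sum_of_nonneg fun _ _ => by positivity,
      sum_range_sub_eq (fun k' => ∫⁻ x, ‖inner ℂ (D.gam k' x) (av k' (D.D2 v) x) -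
        ((((2 : ℝ) ^ (k' : ℤ))⁻¹ : ℂ) • (D.J v - D.form.Rd k' (D.J v)) : L2 n) x‖ₑ ^ 2)]
    refine (add_le_add_right (mul_le_mul_right (hpr D hcb hD v _ d) 4) _).trans ?_
    rw [← ENNReal.ofReal_ofNat 4, ← ENNReal.ofReal_mul (by norm_num)]
    refine (ENNReal.ofReal_add (Finset.sum_nonneg fun j _ => ?_) ?_).symm.trans_le ?_
    · positivity
    · positivity
    refine ENNReal.ofReal_le_ofReal ?_
    have hs1 : 2 ^ k / s = (τ ^ 2)⁻¹ := by rw [hsd]; field_simp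
    rw [hs1, Finset.sum_add_distrib, ← Finset.mul_sum, ← Finset.mul_sum]
    have g1 : ∑ j ∈ Finset.range d, KData.cTail n M κ * (2 ^ (k - (j : ℤ)) / 2 ^ k) ^ 2 * vol n k ≤
        4 / 3 * KData.cTail n M κ * vol n k := by
      rw [← Finset.sum_mul]
      gcongr
      exact sum_geom_four_le hcT k d
    have g2 : ∑ j ∈ Finset.range d, B₁ * ‖G‖ ^ 2 * (τ ^ 2)⁻¹ ^ 2 * (2 ^ (k - (j : ℤ)) / 2 ^ k) ^ 2 ≤
        4 / 3 * (B₁ * (cS * vol n k) * (τ ^ 2)⁻¹ ^ 2) :=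
      (sum_geom_four_le (by positivity) k d).trans (by gcongr)
    have h1cb : 1 ≤ (1 + cb) ^ 2 := one_le_pow₀ (by linarith)
    calc _ ≤ (2 * (4 / 3 * KData.cTail n M κ * vol n k) +
          4 * (4 / 3 * (B₁ * (cS * vol n k) * (τ ^ 2)⁻¹ ^ 2))) * (1 + cb) ^ 2 +
          4 * (Cp * (1 + cb) ^ 2 * (B₂ * (cS * vol n k))) := by
          gcongr
          refine le_trans ?_ (le_mul_of_one_le_right (by positivity) h1cb)
          gcongr
      _ = _ := by ring

end

section

variable {n : ℕ}

theorem norm_le_of_mem_cone {δ R : ℝ} {ξ w F : Cn n} (hδ : 0 ≤ δ)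
    (hξ : ‖ξ - (‖ξ‖ : ℂ) • w‖ ≤ δ * ‖ξ‖) (hF : ‖F‖ ≤ R) (hR : δ * R ≤ 1 / 4)
    (hw : 3 / 4 ≤ (inner ℂ w F).re) : ‖ξ‖ ≤ 2 * ‖inner ℂ ξ F‖ := by
  have e : inner ℂ ξ F = (‖ξ‖ : ℂ) * inner ℂ w F + inner ℂ (ξ - (‖ξ‖ : ℂ) • w) F := by
    rw [inner_sub_left, inner_smul_left, conj_ofReal]
    ring
  have h1 : ‖inner ℂ (ξ - (‖ξ‖ : ℂ) • w) F‖ ≤ 1 / 4 * ‖ξ‖ :=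
    (norm_inner_le_norm _ _).trans ((mul_le_mul hξ hF (norm_nonneg _) (by positivity)).trans
      (by nlinarith only [hR, norm_nonneg ξ]))
  have h2 := (abs_le.1 (abs_re_le_norm (inner ℂ (ξ - (‖ξ‖ : ℂ) • w) F))).1
  have h3 : (inner ℂ ξ F).re ≤ ‖inner ℂ ξ F‖ := re_le_norm _
  have h4 := congrArg Complex.re e
  rw [add_re, re_ofReal_mul] at h4
  nlinarith only [h1, h2, h3, h4, hw, norm_nonneg ξ]

theorem vol_mul_norm_cav_sq_le (F : Lc n) (k : ℤ) (m : Fin n → ℤ) :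
    vol n k * ‖cav k m F‖ ^ 2 ≤ ∫ x in cube k m, ‖F x‖ ^ 2 := by
  have hv := vol_pos n k
  have h := sq_setIntegral_le (volume_cube_ne_top k m) ((Lp.memLp F).restrict (cube k m))
  have e : ∫ x in cube k m, F x = vol n k • cav k m F := by
    rw [cav, smul_inv_smul₀ hv.ne']
  rw [e, norm_smul, Real.norm_of_nonneg hv.le, real_cube] at h
  exact le_of_mul_le_mul_left (by linarith) hv

namespace KData

variable {M κ : ℝ} {V : Type} [NormedAddCommGroup V] [InnerProductSpace ℂ V] [CompleteSpace V]
  (D : KData n M κ V)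

/-- The set of points at which `γ_k` lies in the cone of aperture `δ` around `w`. -/
def coneSet (δ : ℝ) (w : Cn n) (k : ℤ) : Set (Rn n) :=
  {x | ‖D.gam k x - (‖D.gam k x‖ : ℂ) • w‖ ≤ δ * ‖D.gam k x‖}

theorem measurableSet_coneSet (δ : ℝ) (w : Cn n) (k : ℤ) : MeasurableSet (D.coneSet δ w k) := by
  have := D.measurable_gam k
  exact measurableSet_le (by fun_prop) (by fun_prop)

/-- The part of `‖γ_k‖²` in the cone of aperture `δ` around `w`. -/
def coneGam (δ : ℝ) (w : Cn n) (k : ℤ) : Rn n → ENNReal :=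
  (D.coneSet δ w k).indicator fun x => ‖D.gam k x‖ₑ ^ 2

theorem coneGam_le (δ : ℝ) (w : Cn n) (k : ℤ) (x : Rn n) :
    D.coneGam δ w k x ≤ ‖D.gam k x‖ₑ ^ 2 :=
  indicator_le_self (D.coneSet δ w k) (fun x => ‖D.gam k x‖ₑ ^ 2) x

theorem lintegral_coneGam_le (δ : ℝ) (w : Cn n) (k : ℤ) (m : Fin n → ℤ) :
    ∫⁻ x in cube k m, D.coneGam δ w k x ≤ ENNReal.ofReal (cGam n M κ * vol n k) :=
  (lintegral_mono fun x => D.coneGam_le δ w k x).trans (D.lintegral_cube_gam_le k m)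

theorem lintegral_coneGam_le_of_cav {δ R : ℝ} (hδ : 0 ≤ δ) {w : Cn n} {F : Rn n → Cn n} {k : ℤ}
    {m : Fin n → ℤ} (hF : ‖cav k m F‖ ≤ R) (hR : δ * R ≤ 1 / 4)
    (hw : 3 / 4 ≤ (inner ℂ w (cav k m F)).re) :
    ∫⁻ x in cube k m, D.coneGam δ w k x ≤
      4 * ∫⁻ x in cube k m, ‖inner ℂ (D.gam k x) (av k F x)‖ₑ ^ 2 := by
  rw [← lintegral_const_mul' _ _ ENNReal.ofNat_ne_top]
  refine setLIntegral_mono' (measurableSet_cube k m) fun x hx => ?_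
  rw [av_eq hx, coneGam]
  refine indicator_apply_le' (fun hxc => ?_) fun _ => zero_le
  have h := norm_le_of_mem_cone hδ hxc hF hR hw
  have h2 : ‖D.gam k x‖ₑ ≤ 2 * ‖inner ℂ (D.gam k x) (cav k m F)‖ₑ := by
    have h2 := ENNReal.ofReal_le_ofReal h
    rwa [ofReal_norm, ENNReal.ofReal_mul zero_le_two, ENNReal.ofReal_ofNat, ofReal_norm] at h2
  calc _ ≤ (2 * ‖inner ℂ (D.gam k x) (cav k m F)‖ₑ) ^ 2 := by gcongr
    _ = _ := by rw [mul_pow]; norm_num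

end KData

theorem exists_carleson_cone (n : ℕ) {M κ : ℝ} (hκ : 0 < κ) : ∃ δ C : ℝ, 0 < δ ∧ 0 ≤ C ∧
    ∀ {V : Type} [NormedAddCommGroup V] [InnerProductSpace ℂ V] [CompleteSpace V]
      (D : KData n M κ V) {cb : ℝ} (_ : 0 ≤ cb) (_ : D.LapBound cb) {w : Cn n} (_ : ‖w‖ = 1)
      (d : ℕ) (k : ℤ) (m : Fin n → ℤ),
      ∑ j ∈ Finset.range d, ∫⁻ x in cube k m, D.coneGam δ w (k - j) x ≤
        ENNReal.ofReal (C * (1 + cb) ^ 2 * vol n k) := by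
  obtain ⟨C₀', C₁, hC₀', hC₁, htest⟩ := exists_test_function n (M := M) hκ
  set C₀ := max C₀' 1 with hC₀d
  have hC₀1 : 1 ≤ C₀ := le_max_right _ _
  have hC₀ : 0 < C₀ := by linarith
  refine ⟨1 / (64 * C₀), 4 * C₁ * (128 * C₀), by positivity, by positivity, ?_⟩
  intro V _ _ _ D cb hcb hD w hw d₀ k₀ m₀
  have hcG := D.cGam_nonneg
  set δ := 1 / (64 * C₀) with hδ
  have hfin : ∀ k m, ∫⁻ x in cube k m, D.coneGam δ w k x ≠ ⊤ := fun k m =>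
    ((D.lintegral_coneGam_le δ w k m).trans_lt ENNReal.ofReal_lt_top).ne
  set a : ℤ → (Fin n → ℤ) → ℝ := fun k m => (∫⁻ x in cube k m, D.coneGam δ w k x).toReal with ha
  have ha0 : ∀ k m, 0 ≤ a k m := fun k m => ENNReal.toReal_nonneg
  have hae : ∀ k m, ∫⁻ x in cube k m, D.coneGam δ w k x = ENNReal.ofReal (a k m) := fun k m =>
    (ENNReal.ofReal_toReal (hfin k m)).symm
  have hale : ∀ k m, a k m ≤ KData.cGam n M κ * vol n k := fun k m => by
    have hv := vol_pos n k
    exact ENNReal.toReal_le_of_le_ofReal (by positivity) (D.lintegral_coneGam_le δ w k m)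
  rw [sum_lintegral_cube_eq ha0 hae]
  refine ENNReal.ofReal_le_ofReal ((div_le_iff₀ (vol_pos n k₀)).1 ?_)
  have hq1 : 1 / (128 * C₀) ≤ 1 := by
    rw [div_le_one (by positivity)]
    linarith
  have key := le_of_forall_contract (A := 4 * (C₁ * (1 + cb) ^ 2)) (q := 1 - 1 / (128 * C₀))
    (K₀ := d₀ * KData.cGam n M κ) (L := treeSum kids a d₀ k₀ m₀ / vol n k₀)
    (P := fun K => ∀ d ≤ d₀, ∀ k m, treeSum kids a d k m ≤ K * vol n k) (by linarith)
    (sub_lt_self _ (by positivity)) (by positivity) (by positivity) ?_ ?_ ?_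
  · refine key.trans (le_of_eq ?_)
    rw [sub_sub_cancel]
    field_simp
  · intro d hd k m
    have hv := vol_pos n k
    refine (treeSum_le (fun k m => sum_vol_kids_sub k m) hale d k m).trans ?_
    gcongr
  · intro K hK hP d hd k m
    have hv := vol_pos n k
    obtain ⟨f, hf1, hf2, hf3⟩ := htest D hcb hD hw d k m
    set b : ℤ → (Fin n → ℤ) → ℝ := fun k m =>
      (∫⁻ x in cube k m, ‖inner ℂ (D.gam k x) (av k f x)‖ₑ ^ 2).toReal with hb
    have hb0 : ∀ k m, 0 ≤ b k m := fun k m => ENNReal.toReal_nonneg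
    have hbe : ∀ k m, ∫⁻ x in cube k m, ‖inner ℂ (D.gam k x) (av k f x)‖ₑ ^ 2 =
        ENNReal.ofReal (b k m) := fun k m => (ENNReal.ofReal_toReal (((setLIntegral_le_lintegral _ _).trans
          (D.lintegral_gam_av_le k f)).trans_lt ENNReal.ofReal_lt_top).ne).symm
    rw [sum_lintegral_cube_eq (g := fun k x => ‖inner ℂ (D.gam k x) (av k f x)‖ₑ ^ 2) hb0 hbe,
      ENNReal.ofReal_le_ofReal_iff (by positivity)] at hf3
    have hre : ∀ k m, IntegrableOn (fun x => (inner ℂ w (f x)).re) (cube k m) := fun k m =>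
      ((integrableOn_cube f k m).const_inner (𝕜 := ℂ) w).re
    have hsq : ∀ k m, IntegrableOn (fun x => ‖f x‖ ^ 2) (cube k m) := fun k m =>
      ((Lp.memLp f).restrict _).integrable_norm_pow (by norm_num)
    have hE := fun k m => vol_mul_norm_cav_sq_le f k m
    have hIE : ∀ k m, (∫ x in cube k m, (inner ℂ w (f x)).re) ^ 2 ≤
        vol n k * ∫ x in cube k m, ‖f x‖ ^ 2 := fun k m => by
      have hv := vol_pos n k
      have h1 : (inner ℂ w (cav k m f)).re ^ 2 ≤ ‖cav k m f‖ ^ 2 := by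
        rw [← sq_abs]
        refine pow_le_pow_left₀ (abs_nonneg _) ((abs_re_le_norm _).trans ?_) 2
        exact (norm_inner_le_norm _ _).trans (by rw [hw, one_mul])
      simp only [setIntegral_re_inner]
      calc _ = vol n k * (vol n k * (inner ℂ w (cav k m f)).re ^ 2) := by ring
        _ ≤ vol n k * (vol n k * ‖cav k m f‖ ^ 2) := by gcongr
        _ ≤ _ := by gcongr; exact hE k m
    have hab : ∀ k m, ∫ x in cube k m, (inner ℂ w (f x)).re ≤ 3 / 4 * vol n k ∨
        vol n k ≤ 1 / (256 * C₀ ^ 2) * ∫ x in cube k m, ‖f x‖ ^ 2 ∨ a k m ≤ 4 * b k m := fun k m => by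
      have hv := vol_pos n k
      simp only [setIntegral_re_inner]
      refine or_iff_not_imp_left.2 fun h1 => or_iff_not_imp_left.2 fun h2 => ?_
      rw [not_le] at h1 h2
      rw [mul_comm, mul_lt_mul_iff_right₀ hv] at h1
      rw [one_div, inv_mul_lt_iff₀ (by positivity)] at h2
      have h3 : ‖cav k m f‖ ≤ 16 * C₀ := by
        refine le_of_sq_le_sq (le_of_mul_le_mul_left (((hE k m).trans h2.le).trans (le_of_eq ?_)) hv)
          (by positivity)
        ring
      have h4 := D.lintegral_coneGam_le_of_cav (by positivity) h3
        (by rw [hδ]; field_simp; norm_num : δ * (16 * C₀) ≤ 1 / 4) h1.le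
      rw [hae, hbe, ← ENNReal.ofReal_ofNat 4, ← ENNReal.ofReal_mul (by norm_num)] at h4
      exact (ENNReal.ofReal_le_ofReal_iff (mul_nonneg (by norm_num) (hb0 k m))).1 h4
    obtain ⟨α₁, α₂, i, g1, g2, g3, g4, g5⟩ := exists_stopping (kids := kids) (V := vol n) (a := a)
      (b := b) (I := fun k m => ∫ x in cube k m, (inner ℂ w (f x)).re)
      (E := fun k m => ∫ x in cube k m, ‖f x‖ ^ 2) (ε := 1 / (256 * C₀ ^ 2)) (K := K) (d₀ := d₀)
      (vol_pos n) (fun k m => sum_vol_kids_sub k m) hb0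
      (fun k m => sum_setIntegral_kids k m (hre k m))
      (fun k m => integral_nonneg fun x => by positivity)
      (fun k m => sum_setIntegral_kids k m (hsq k m)) hIE (by positivity) hab
      hP d hd k m
    have := stopping_bound hv hC₀ g1 g2 g3 g4 g5 hK
      (hf1.trans (mul_le_mul_of_nonneg_right (le_max_left _ _) hv.le)) hf2 hf3
    exact this
  · intro K hP
    exact (div_le_iff₀ (vol_pos n k₀)).2 (hP d₀ le_rfl k₀ m₀)

end

section

variable {n : ℕ}

theorem two_mul_ofReal_add {a b : ℝ} (ha : 0 ≤ a) (hb : 0 ≤ b) :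
    2 * ENNReal.ofReal a + 2 * ENNReal.ofReal b = ENNReal.ofReal (2 * a + 2 * b) := by
  rw [ENNReal.ofReal_add (by positivity) (by positivity), ENNReal.ofReal_mul zero_le_two,
    ENNReal.ofReal_mul zero_le_two, ENNReal.ofReal_ofNat]

theorem KData.enorm_gam_sq_le_sum {M κ : ℝ} {V : Type} [NormedAddCommGroup V]
    [InnerProductSpace ℂ V] [CompleteSpace V] (D : KData n M κ V) {δ : ℝ} {T : Finset (Cn n)}
    (hT : ∀ ξ : Cn n, ‖ξ‖ = 1 → ∃ w ∈ T, ‖ξ - w‖ ≤ δ) (k : ℤ) (x : Rn n) :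
    ‖D.gam k x‖ₑ ^ 2 ≤ ∑ w ∈ T, D.coneGam δ w k x := by
  by_cases h0 : D.gam k x = 0
  · simp [h0]
  have hp : 0 < ‖D.gam k x‖ := norm_pos_iff.2 h0
  have hpc : (‖D.gam k x‖ : ℂ) ≠ 0 := by exact_mod_cast hp.ne'
  obtain ⟨w, hw, h⟩ := hT (((‖D.gam k x‖ : ℂ)⁻¹) • D.gam k x) (by
    rw [norm_smul, norm_inv, Complex.norm_real, norm_norm, inv_mul_cancel₀ hp.ne'])
  refine le_trans (le_of_eq ?_) (Finset.single_le_sum (fun w _ => (zero_le : 0 ≤ D.coneGam δ w k x)) hw)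
  refine (indicator_of_mem (s := D.coneSet δ w k) ?_ fun x => ‖D.gam k x‖ₑ ^ 2).symm
  have e : D.gam k x - (‖D.gam k x‖ : ℂ) • w =
      (‖D.gam k x‖ : ℂ) • (((‖D.gam k x‖ : ℂ)⁻¹) • D.gam k x - w) := by
    rw [smul_sub, smul_inv_smul₀ hpc]
  change ‖D.gam k x - (‖D.gam k x‖ : ℂ) • w‖ ≤ _
  rw [e, norm_smul, Complex.norm_real, norm_norm, mul_comm]
  exact mul_le_mul_of_nonneg_right h hp.le

theorem exists_carleson (n : ℕ) {M κ : ℝ} (hκ : 0 < κ) : ∃ C : ℝ, 0 ≤ C ∧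
    ∀ {V : Type} [NormedAddCommGroup V] [InnerProductSpace ℂ V] [CompleteSpace V]
      (D : KData n M κ V) {cb : ℝ} (_ : 0 ≤ cb) (_ : D.LapBound cb) (d : ℕ) (k : ℤ)
      (m : Fin n → ℤ), ∑ j ∈ Finset.range d, ∫⁻ x in cube k m, ‖D.gam (k - j) x‖ₑ ^ 2 ≤
        ENNReal.ofReal (C * (1 + cb) ^ 2 * vol n k) := by
  obtain ⟨δ, C, hδ, hC, h⟩ := exists_carleson_cone n (M := M) hκ
  obtain ⟨t, hts, htf, htc⟩ := (isCompact_sphere (0 : Cn n) 1).finite_cover_balls hδ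
  have hT : ∀ ξ : Cn n, ‖ξ‖ = 1 → ∃ w ∈ htf.toFinset, ‖ξ - w‖ ≤ δ := fun ξ hξ => by
    obtain ⟨w, hw, hb⟩ := mem_iUnion₂.1 (htc (mem_sphere_zero_iff_norm.2 hξ))
    exact ⟨w, htf.mem_toFinset.2 hw, (mem_ball_iff_norm.1 hb).le⟩
  refine ⟨htf.toFinset.card * C, by positivity, ?_⟩
  intro V _ _ _ D cb hcb hD d k m
  have hmeas : ∀ w k, Measurable (D.coneGam δ w k) := fun w k =>
    ((D.measurable_gam k).enorm.pow_const 2).indicator (D.measurableSet_coneSet δ w k)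
  calc _ ≤ ∑ j ∈ Finset.range d, ∫⁻ x in cube k m, ∑ w ∈ htf.toFinset, D.coneGam δ w (k - j) x :=
        Finset.sum_le_sum fun j _ => lintegral_mono fun x => D.enorm_gam_sq_le_sum hT _ x
    _ = ∑ w ∈ htf.toFinset, ∑ j ∈ Finset.range d, ∫⁻ x in cube k m, D.coneGam δ w (k - j) x := by
        rw [Finset.sum_comm]
        exact Finset.sum_congr rfl fun j _ => lintegral_finsetSum _ fun w _ => hmeas w _
    _ ≤ ∑ w ∈ htf.toFinset, ENNReal.ofReal (C * (1 + cb) ^ 2 * vol n k) :=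
        Finset.sum_le_sum fun w hw =>
          h D hcb hD (mem_sphere_zero_iff_norm.1 (hts (htf.mem_toFinset.1 hw))) d k m
    _ = _ := by
        rw [Finset.sum_const, nsmul_eq_mul, ← ENNReal.ofReal_natCast,
          ← ENNReal.ofReal_mul (by positivity)]
        congr 1
        ring

theorem exists_square_function (n : ℕ) {M κ : ℝ} (hκ : 0 < κ) : ∃ C : ℝ, 0 ≤ C ∧
    ∀ {V : Type} [NormedAddCommGroup V] [InnerProductSpace ℂ V] [CompleteSpace V]
      (D : KData n M κ V) {cb : ℝ} (_ : 0 ≤ cb) (_ : D.LapBound cb) (v : V) (m : ℤ) (N : ℕ),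
      ∑ i ∈ Finset.range N, (((2 : ℝ) ^ (m + (i : ℤ)))⁻¹ *
        ‖D.J v - D.form.Rd (m + (i : ℤ)) (D.J v)‖) ^ 2 ≤
        C * (1 + cb) ^ 2 * (‖D.D1 v‖ ^ 2 + ‖D.D2 v‖ ^ 2) := by
  obtain ⟨C₁, hC₁, h1⟩ := exists_carleson n (M := M) hκ
  obtain ⟨C₂, hC₂, h2⟩ := exists_principal_part n M κ
  refine ⟨8 * (C₁ + 1) + 2 * C₂, by positivity, ?_⟩
  intro V _ _ _ D cb hcb hD v m N
  have h1' : ∀ (d : ℕ) k m, ∑ j ∈ Finset.range d, ∫⁻ x in cube k m, ‖D.gam (k - j) x‖ₑ ^ 2 ≤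
      ENNReal.ofReal ((C₁ + 1) * (1 + cb) ^ 2 * vol n k) := fun d k m => by
    have hv := vol_pos n k
    refine (h1 D hcb hD d k m).trans (ENNReal.ofReal_le_ofReal ?_)
    gcongr
    linarith
  have h3 := lintegral_mul_av_sq_le_of_carleson (h := fun k x => ‖D.gam k x‖ₑ ^ 2)
    (K := (C₁ + 1) * (1 + cb) ^ 2) (by positivity) h1' (D.D2 v) N (m + N - 1)
  rw [sum_range_sub_eq (fun k => ∫⁻ x, ‖D.gam k x‖ₑ ^ 2 * ‖av k (D.D2 v) x‖ₑ ^ 2)] at h3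
  have e0 : m + (N : ℤ) - 1 - N + 1 = m := by ring
  rw [e0] at h3
  have h4 := h2 D hcb hD v m N
  have hterm : ∀ i : ℕ, ENNReal.ofReal ((((2 : ℝ) ^ (m + (i : ℤ)))⁻¹ *
      ‖D.J v - D.form.Rd (m + (i : ℤ)) (D.J v)‖) ^ 2) ≤
      2 * (∫⁻ x, ‖D.gam (m + i) x‖ₑ ^ 2 * ‖av (m + i) (D.D2 v) x‖ₑ ^ 2) +
      2 * ∫⁻ x, ‖inner ℂ (D.gam (m + i) x) (av (m + i) (D.D2 v) x) -
        ((((2 : ℝ) ^ (m + i : ℤ))⁻¹ : ℂ) • (D.J v - D.form.Rd (m + i) (D.J v)) : L2 n) x‖ₑ ^ 2 := by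
    intro i
    set k : ℤ := m + i
    have hn : ((2 : ℝ) ^ k)⁻¹ * ‖D.J v - D.form.Rd k (D.J v)‖ =
        ‖((((2 : ℝ) ^ k)⁻¹ : ℂ) • (D.J v - D.form.Rd k (D.J v)) : L2 n)‖ := by
      rw [norm_smul, norm_inv, norm_zpow, Complex.norm_real, Real.norm_of_nonneg (by norm_num)]
    rw [hn, ofReal_norm_sq]
    set Y : L2 n := ((((2 : ℝ) ^ k)⁻¹ : ℂ) • (D.J v - D.form.Rd k (D.J v)) : L2 n)
    clear_value Y
    have s1 := lintegral_enorm_sub_sq_le (μ := volume) (D.measurable_gam_av k (D.D2 v)).aestronglyMeasurable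
      (fun x => inner ℂ (D.gam k x) (av k (D.D2 v) x) - Y x)
    simp only [sub_sub_cancel] at s1
    refine s1.trans (add_le_add_left (mul_le_mul_right (lintegral_mono fun x => ?_) 2) _)
    rw [← mul_pow, ← ofReal_norm, ← ofReal_norm, ← ofReal_norm, ← ENNReal.ofReal_mul (norm_nonneg _)]
    gcongr
    exact norm_inner_le_norm _ _
  have hsum := Finset.sum_le_sum fun i (_ : i ∈ Finset.range N) => hterm i
  rw [Finset.sum_add_distrib, ← Finset.mul_sum, ← Finset.mul_sum,
    ← ENNReal.ofReal_sum_of_nonneg fun _ _ => by positivity] at hsum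
  have hfin := hsum.trans (add_le_add (mul_le_mul_right h3 2) (mul_le_mul_right h4 2))
  rw [two_mul_ofReal_add (by positivity) (by positivity),
    ENNReal.ofReal_le_ofReal_iff (by positivity)] at hfin
  refine hfin.trans ?_
  have h5 : ‖D.D2 v‖ ^ 2 ≤ ‖D.D1 v‖ ^ 2 + ‖D.D2 v‖ ^ 2 := by linarith [sq_nonneg ‖D.D1 v‖]
  calc _ ≤ 2 * (4 * ((C₁ + 1) * (1 + cb) ^ 2) * (‖D.D1 v‖ ^ 2 + ‖D.D2 v‖ ^ 2)) +
        2 * (C₂ * (1 + cb) ^ 2 * (‖D.D1 v‖ ^ 2 + ‖D.D2 v‖ ^ 2)) := by gcongr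
    _ = _ := by ring

end

section

variable {n : ℕ}

/-! ### Weak gradients and the form domain -/

theorem memLp_vecOf {u : L2 n} {g : Fin n → Rn n → ℂ} (h : ∀ i, IsWeakPartial u i (g i)) :
    MemLp (vecOf g) 2 (volume : Measure (Rn n)) :=
  MemLp.of_eval_piLp fun i => (h i).1

theorem IsWeakPartial.congr {u : L2 n} {i : Fin n} {g g' : Rn n → ℂ} (h : IsWeakPartial u i g)
    (hg : g =ᵐ[volume] g') : IsWeakPartial u i g' := by
  refine ⟨h.1.ae_eq hg, fun φ h1 h2 => ?_⟩
  rw [← h.2 φ h1 h2]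
  refine integral_congr_ae ?_
  filter_upwards [hg] with x hx
  rw [hx]

theorem isWGrad_of_vecOf {u : L2 n} {g : Fin n → Rn n → ℂ} (h : ∀ i, IsWeakPartial u i (g i))
    {q : Lc n} (hq : q =ᵐ[volume] vecOf g) : IsWGrad u q := by
  refine isWGrad_iff.2 fun i => (h i).congr ?_
  filter_upwards [hq] with x hx
  rw [hx]
  rfl

/-- `g` is (a representative of) the gradient of the element `v` of the form domain. -/
def KData.IsRep {M κ : ℝ} {V : Type} [NormedAddCommGroup V] [InnerProductSpace ℂ V]
    (D : KData n M κ V) (b : Rn n → Cn n) (v : V) (g : Fin n → Rn n → ℂ) : Prop :=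
  D.D1 v =ᵐ[volume] gradPlusB b (D.J v) g ∧ D.D2 v =ᵐ[volume] vecOf g

/-- The form domain of `D` is `H¹_b`. -/
structure KData.IsModel {M κ : ℝ} {V : Type} [NormedAddCommGroup V] [InnerProductSpace ℂ V]
    (D : KData n M κ V) (b : Rn n → Cn n) : Prop where
  exists_rep : ∀ v, ∃ g, MemH1b b (D.J v) g ∧ D.IsRep b v g
  exists_vec : ∀ u g, MemH1b b u g → ∃ v, D.J v = u ∧ D.IsRep b v g

section FormDomain

variable {b : Rn n → Cn n} {hb : AEStronglyMeasurable b volume}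

theorem inner_eq_integral {X : Type*} [NormedAddCommGroup X] [InnerProductSpace ℂ X]
    {f g : Lp X 2 (volume : Measure (Rn n))} {f' g' : Rn n → X} (hf : f =ᵐ[volume] f')
    (hg : g =ᵐ[volume] g') : ∫ x, inner ℂ (f' x) (g' x) = inner ℂ f g := by
  rw [L2.inner_def]
  refine integral_congr_ae ?_
  filter_upwards [hf, hg] with x h1 h2
  rw [h1, h2]

theorem norm_sq_eq_integral {X : Type*} [NormedAddCommGroup X] [InnerProductSpace ℂ X]
    {f : Lp X 2 (volume : Measure (Rn n))} {f' : Rn n → X} (hf : f =ᵐ[volume] f') :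
    ∫ x, ‖f' x‖ ^ 2 = ‖f‖ ^ 2 := by
  have h1 := inner_eq_integral hf hf
  rw [inner_self_eq_norm_sq_to_K] at h1
  simp only [inner_self_eq_norm_sq_to_K] at h1
  have h2 : ((∫ x, ‖f' x‖ ^ 2 : ℝ) : ℂ) = ((‖f‖ ^ 2 : ℝ) : ℂ) := by
    rw [← integral_complex_ofReal, ofReal_pow]
    refine Eq.trans (integral_congr_ae (Filter.Eventually.of_forall fun x => ?_)) h1
    exact ofReal_pow _ _
  exact_mod_cast h2

theorem integral_inner_mulOp {A : Rn n → Cn n →L[ℂ] Cn n} (hA : AEStronglyMeasurable A volume)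
    {M : ℝ} (hM : ∀ᵐ x, ‖A x‖ ≤ M) {F G : Lc n} {f g : Rn n → Cn n} (hf : F =ᵐ[volume] f)
    (hg : G =ᵐ[volume] g) :
    ∫ x, inner ℂ (g x) (A x (f x)) = inner ℂ G (mulOp A hA hM F) := by
  refine inner_eq_integral hg ?_
  filter_upwards [coeFn_mulOp hA hM F, hf] with x h1 h2
  rw [h1, h2]

theorem eq_zero_of_J_eq_zero {v : VS b hb} (h : W.J (v : W n) = 0) : v = 0 := by
  obtain ⟨h1, h2⟩ := mem_VS.1 v.2
  have e2 : W.D2 (v : W n) = 0 := by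
    refine h1.unique ?_
    rw [h]
    intro i φ _
    simp
  have e1 : W.D1 (v : W n) = 0 := by
    rw [h, e2] at h2
    refine (Lp.eq_zero_iff_ae_eq_zero).2 ?_
    filter_upwards [h2, Lp.coeFn_zero (Cn n) 2 (volume : Measure (Rn n)),
      Lp.coeFn_zero ℂ 2 (volume : Measure (Rn n))] with x k1 k2 k3
    rw [k1, k2, k3]
    simp
  have h3 := W.norm_sq (v : W n)
  rw [h, e1, e2] at h3
  simpa using h3

theorem exists_mk {u : L2 n} {p q : Lc n} (h1 : IsWGrad u q)
    (h2 : ∀ᵐ x, p x = q x + u x • b x) :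
    ∃ w : VS b hb, W.J (w : W n) = u ∧ W.D1 (w : W n) = p ∧ W.D2 (w : W n) = q :=
  ⟨⟨WithLp.toLp 2 (u, WithLp.toLp 2 (p, q)), mem_VS.2 ⟨h1, h2⟩⟩, rfl, rfl, rfl⟩

theorem weight_mul_compat {ω : Rn n → ℝ} (h : IsWeight ω) {u : L2 n} {p q : Lc n}
    (h2 : ∀ᵐ x, p x = q x + u x • b x) :
    ∀ᵐ x, (h.mul (Cn n) p + h.gmul u : Lc n) x =
      (h.mul (Cn n) q + h.gmul u : Lc n) x + h.mul ℂ u x • b x := by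
  filter_upwards [h2, Lp.coeFn_add (h.mul (Cn n) p) (h.gmul u),
    Lp.coeFn_add (h.mul (Cn n) q) (h.gmul u), h.coeFn_mul p, h.coeFn_mul q, h.coeFn_mul u]
    with x k1 k2 k3 k4 k5 k6
  rw [k2, k3, Pi.add_apply, Pi.add_apply, k4, k5, k6, k1, smul_add, smul_assoc]
  abel

theorem exists_weight_mul {ω : Rn n → ℝ} (h : IsWeight ω) (v : VS b hb) :
    ∃ w : VS b hb, W.J (w : W n) = h.mul ℂ (W.J (v : W n)) ∧
      W.D1 (w : W n) = h.mul (Cn n) (W.D1 (v : W n)) + h.gmul (W.J (v : W n)) ∧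
      W.D2 (w : W n) = h.mul (Cn n) (W.D2 (v : W n)) + h.gmul (W.J (v : W n)) := by
  obtain ⟨h1, h2⟩ := mem_VS.1 v.2
  exact exists_mk (h.isWGrad_mul h1) (weight_mul_compat h h2)

/-- The data attached to the coefficients `A` and `b`. -/
def KData.ofCoeff {A : Rn n → Cn n →L[ℂ] Cn n} (hA : AEStronglyMeasurable A volume) {M : ℝ}
    (hM : ∀ᵐ x, ‖A x‖ ≤ M) (hM0 : 0 ≤ M) {κ : ℝ} (hκ : 0 < κ) (hκ1 : κ ≤ 1)
    (hG : ∀ u q, IsWGrad u q → κ * ‖q‖ ^ 2 ≤ (inner ℂ q (mulOp A hA hM q)).re)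
    (b : Rn n → Cn n) (hb : AEStronglyMeasurable b volume) : KData n M κ (VS b hb) where
  J := W.J ∘L (VS b hb).subtypeL
  D1 := W.D1 ∘L (VS b hb).subtypeL
  D2 := W.D2 ∘L (VS b hb).subtypeL
  AL := mulOp A hA hM
  norm_sq v := W.norm_sq (v : W n)
  isWGrad v := (mem_VS.1 v.2).1
  injective_J := (injective_iff_map_eq_zero _).2 fun _ hv => eq_zero_of_J_eq_zero hv
  norm_AL_le := norm_mulOp_le hA hM
  AL_mul h F := h.mul_mulOp hA hM F
  exists_mulV h v := exists_weight_mul h v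
  M_nonneg := hM0
  κ_pos := hκ
  κ_le := hκ1
  garding v := hG _ _ (mem_VS.1 v.2).1

theorem exists_rep_VS (v : VS b hb) :
    ∃ g, MemH1b b (W.J (v : W n)) g ∧ W.D1 (v : W n) =ᵐ[volume] gradPlusB b (W.J (v : W n)) g ∧
      W.D2 (v : W n) =ᵐ[volume] vecOf g := by
  obtain ⟨h1, h2⟩ := mem_VS.1 v.2
  refine ⟨fun i x => W.D2 (v : W n) x i, ⟨isWGrad_iff.1 h1, ?_⟩, h2, Filter.EventuallyEq.rfl⟩
  refine (Lp.memLp (W.D1 (v : W n) - W.D2 (v : W n))).ae_eq ?_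
  filter_upwards [h2, Lp.coeFn_sub (W.D1 (v : W n)) (W.D2 (v : W n))] with x e1 e2
  rw [e2, Pi.sub_apply, e1, add_sub_cancel_left]

theorem exists_vec_VS {u : L2 n} {g : Fin n → Rn n → ℂ} (h : MemH1b b u g) :
    ∃ v : VS b hb, W.J (v : W n) = u ∧ W.D1 (v : W n) =ᵐ[volume] gradPlusB b (W.J (v : W n)) g ∧
      W.D2 (v : W n) =ᵐ[volume] vecOf g := by
  have h2 : MemLp (vecOf g) 2 (volume : Measure (Rn n)) := memLp_vecOf h.1
  have h1 : MemLp (gradPlusB b u g) 2 (volume : Measure (Rn n)) := h2.add h.2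
  refine ⟨⟨WithLp.toLp 2 (u, WithLp.toLp 2 (h1.toLp _, h2.toLp _)), mem_VS.2 ⟨?_, ?_⟩⟩, rfl,
    h1.coeFn_toLp, h2.coeFn_toLp⟩
  · exact isWGrad_of_vecOf h.1 h2.coeFn_toLp
  · change ∀ᵐ x, h1.toLp _ x = h2.toLp _ x + u x • b x
    filter_upwards [h1.coeFn_toLp, h2.coeFn_toLp] with x e1 e2
    rw [e1, e2]
    rfl

theorem KData.isModel_ofCoeff {A : Rn n → Cn n →L[ℂ] Cn n} (hA : AEStronglyMeasurable A volume)
    {M : ℝ} (hM : ∀ᵐ x, ‖A x‖ ≤ M) (hM0 : 0 ≤ M) {κ : ℝ} (hκ : 0 < κ) (hκ1 : κ ≤ 1)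
    (hG : ∀ u q, IsWGrad u q → κ * ‖q‖ ^ 2 ≤ (inner ℂ q (mulOp A hA hM q)).re)
    (b : Rn n → Cn n) (hb : AEStronglyMeasurable b volume) :
    (KData.ofCoeff hA hM hM0 hκ hκ1 hG b hb).IsModel b :=
  ⟨fun v => exists_rep_VS v, fun _ _ h => exists_vec_VS h⟩

end FormDomain

namespace KData

variable {M κ : ℝ} {V : Type} [NormedAddCommGroup V] [InnerProductSpace ℂ V] {D : KData n M κ V}
  {b : Rn n → Cn n}

theorem IsModel.assoc (hD : D.IsModel b)
    {F : L2 n → L2 n → (Fin n → Rn n → ℂ) → (Fin n → Rn n → ℂ) → ℂ}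
    {T : UOp (L2 n)} (h : IsAssocOpH1b b F T) {B : V → V → ℂ}
    (hF : ∀ v w g g', D.IsRep b v g → D.IsRep b w g' → F (D.J v) (D.J w) g g' = B w v) :
    (∀ u ∈ T.dom, ∃ v, D.J v = u ∧ ∀ w, inner ℂ (D.J w) (T.toFun u) = B w v) ∧
    ∀ v f, (∀ w, inner ℂ (D.J w) f = B w v) → D.J v ∈ T.dom ∧ T.toFun (D.J v) = f := by
  refine ⟨fun u hu => ?_, fun v f hf => ?_⟩
  · obtain ⟨g, hg, h1⟩ := h.2.1 u hu
    obtain ⟨v, rfl, hv⟩ := hD.exists_vec _ _ hg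
    refine ⟨v, rfl, fun w => ?_⟩
    obtain ⟨g', hg', hw⟩ := hD.exists_rep w
    rw [h1 _ _ hg', hF v w g g' hv hw]
  · obtain ⟨g, hg, hv⟩ := hD.exists_rep v
    refine h.2.2 _ f g hg fun u g' hg' => ?_
    obtain ⟨w, rfl, hw⟩ := hD.exists_vec _ _ hg'
    rw [hf, hF v w g g' hv hw]

theorem IsRep.integral_D1 {v w : V} {g g' : Fin n → Rn n → ℂ} (hv : D.IsRep b v g)
    (hw : D.IsRep b w g') :
    ∫ x, inner ℂ (gradPlusB b (D.J w) g' x) (gradPlusB b (D.J v) g x) =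
      inner ℂ (D.D1 w) (D.D1 v) := inner_eq_integral hw.1 hv.1

theorem IsRep.integral_D2 {v w : V} {g g' : Fin n → Rn n → ℂ} (hv : D.IsRep b v g)
    (hw : D.IsRep b w g') :
    ∫ x, inner ℂ (vecOf g' x) (vecOf g x) = inner ℂ (D.D2 w) (D.D2 v) :=
  inner_eq_integral hw.2 hv.2

end KData

end

section

variable {n : ℕ}

namespace AccForm

open ContinuousLinearMap

variable {V E : Type*} [NormedAddCommGroup V] [InnerProductSpace ℂ V] [CompleteSpace V]
  [NormedAddCommGroup E] [InnerProductSpace ℂ E] [CompleteSpace E] {a : AccForm V E}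

/-- `L` is the operator associated with the form `a`. -/
def IsAssoc (a : AccForm V E) (L : UOp E) : Prop :=
  (∀ u ∈ L.dom, ∃ v, a.J v = u ∧ ∀ w, inner ℂ (a.J w) (L.toFun u) = inner ℂ w (a.N v)) ∧
  ∀ v f, (∀ w, inner ℂ (a.J w) f = inner ℂ w (a.N v)) → a.J v ∈ L.dom ∧ L.toFun (a.J v) = f

theorem IsAssoc.isSqrt {L S : UOp E} (h : a.IsAssoc L) (hS : S.IsMaximalAccretive)
    (hSL : UOp.EqOn (S.comp S) L) : a.IsSqrt S where
  maxAcc := hS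
  range_R t ht f := by
    have h1 := h.2 (a.rho t f) (((t ^ 2 : ℝ) : ℂ)⁻¹ • (f - a.R t f)) fun w => by
      rw [a.N_rho ht, inner_smul_right, inner_smul_right, adjoint_inner_right]
    have h2 : a.R t f ∈ (S.comp S).dom := by
      rw [hSL.1]
      exact h1.1
    exact ⟨h2.1, h2.2, (hSL.2 _ h2).trans h1.2⟩
  left_inv t ht u hu hu' := by
    have h2 : u ∈ (S.comp S).dom := ⟨hu, hu'⟩
    have h3 : S.toFun (S.toFun u) = L.toFun u := hSL.2 _ h2
    rw [hSL.1] at h2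
    obtain ⟨v, rfl, hv⟩ := h.1 u h2
    have h4 : a.N v = adjoint a.J (L.toFun (a.J v)) := ext_inner_left ℂ fun w => by
      rw [adjoint_inner_right, hv]
    have h5 : a.M t v = adjoint a.J (a.J v + ((t ^ 2 : ℝ) : ℂ) • L.toFun (a.J v)) := by
      rw [M_apply, h4, map_add, map_smul]
    rw [h3]
    change a.J (a.Minv t (adjoint a.J _)) = _
    rw [← h5, a.Minv_M_apply ht]

theorem IsAssoc.denseRange_J {T : UOp E} (h : a.IsAssoc T) (hT : T.IsLinear) :
    DenseRange a.J := by
  have h1 : (a.J.range : Submodule ℂ E).topologicalClosure = ⊤ := by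
    refine Submodule.topologicalClosure_eq_top_iff.2 ((Submodule.eq_bot_iff _).2 fun f hf => ?_)
    have h2 := h.2 0 f fun w => by
      rw [map_zero, inner_zero_right]
      exact hf _ ⟨w, rfl⟩
    have h3 := hT.2.2 0 0 hT.1
    rw [map_zero] at h2
    rw [← h2.2]
    simpa using h3.2
  have h2 := Submodule.dense_iff_topologicalClosure_eq_top.2 h1
  rwa [LinearMap.coe_range] at h2

end AccForm

theorem integral_zero_mul_add {F : ℂ} {f : Rn n → ℂ} :
    F + ∫ x, ((0 : ℝ) : ℂ) * f x = F := by simp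

theorem sum_integral_eq_inner {u v : L2 n} {p q : Lc n} {g g' : Fin n → Rn n → ℂ}
    (hg : ∀ i, IsWeakPartial u i (g i)) (hg' : ∀ i, IsWeakPartial v i (g' i))
    (hp : IsWGrad u p) (hq : IsWGrad v q) :
    ∑ i, ∫ x, g i x * (starRingEnd ℂ) (g' i x) = inner ℂ q p := by
  have ep : p =ᵐ[volume] vecOf g := by
    have h := (memLp_vecOf hg).coeFn_toLp
    rwa [← hp.unique (isWGrad_of_vecOf hg h)] at h
  have eq : q =ᵐ[volume] vecOf g' := by
    have h := (memLp_vecOf hg').coeFn_toLp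
    rwa [← hq.unique (isWGrad_of_vecOf hg' h)] at h
  rw [← inner_eq_integral eq ep, ← integral_finsetSum]
  · refine integral_congr_ae (Filter.Eventually.of_forall fun x => ?_)
    simp only [PiLp.inner_apply]
    rfl
  · intro i _
    exact (hg i).1.integrable_mul (hg' i).1.star

variable {M κ : ℝ} {V : Type} [NormedAddCommGroup V] [InnerProductSpace ℂ V] [CompleteSpace V]

theorem KData.lapBound {D : KData n M κ V} {T lap : UOp (L2 n)} (hT : D.formT.IsAssoc T)
    (hlap : IsFormOp (fun _ => (0 : ℝ)) lap) {cb : ℝ}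
    (h : ∀ u ∈ T.dom, u ∈ lap.dom ∧ ‖lap.toFun u‖ ≤ cb * ‖T.toFun u‖) : D.LapBound cb := by
  intro π g hg
  have h1 : D.J π ∈ T.dom ∧ T.toFun (D.J π) = g := hT.2 π g fun w => by
    rw [D.inner_formT_N]
    exact (hg w).symm
  have h2 := h _ h1.1
  rw [h1.2] at h2
  refine ⟨lap.toFun (D.J π), h2.2, fun v q hq => ?_⟩
  obtain ⟨g', hg', -, h3⟩ := hlap.2.2.2.2.2.1 _ h2.1
  have h4 := h3 v (fun i x => q x i) (isWGrad_iff.1 hq) (by simp)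
  rw [h4, integral_zero_mul_add]
  exact (sum_integral_eq_inner hg' (isWGrad_iff.1 hq) (D.isWGrad π) hq).symm

end

section

variable {n : ℕ}

theorem sqrt_sq_add_sq_le {p q : ℝ} (hp : 0 ≤ p) (hq : 0 ≤ q) : √(p ^ 2 + q ^ 2) ≤ p + q :=
  Real.sqrt_le_iff.2 ⟨by positivity, by nlinarith⟩

theorem add_le_two_mul_sqrt (p q : ℝ) : p + q ≤ 2 * √(p ^ 2 + q ^ 2) := by
  have h1 : p ≤ √(p ^ 2 + q ^ 2) := Real.le_sqrt_of_sq_le (by nlinarith [sq_nonneg q])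
  have h2 : q ≤ √(p ^ 2 + q ^ 2) := Real.le_sqrt_of_sq_le (by nlinarith [sq_nonneg p])
  linarith

/-- The Kato estimate for abstract data, from the square function estimate. -/
theorem KData.kato {M κ : ℝ} {V : Type} [NormedAddCommGroup V] [InnerProductSpace ℂ V]
    [CompleteSpace V] (D : KData n M κ V) {C : ℝ} (hC : 0 ≤ C) {S : UOp (L2 n)}
    (hS : D.form.IsSqrt S) (hd : DenseRange D.J)
    (hsq : ∀ (v : V) (m : ℤ) (N : ℕ), ∑ i ∈ Finset.range N,
      (((2 : ℝ) ^ (m + (i : ℤ)))⁻¹ * ‖D.J v - D.form.Rd (m + (i : ℤ)) (D.J v)‖) ^ 2 ≤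
        C ^ 2 * (‖D.D1 v‖ ^ 2 + ‖D.D2 v‖ ^ 2))
    (hsq' : ∀ (v : V) (m : ℤ) (N : ℕ), ∑ i ∈ Finset.range N,
      (((2 : ℝ) ^ (m + (i : ℤ)))⁻¹ * ‖D.J v - D.adj.form.Rd (m + (i : ℤ)) (D.J v)‖) ^ 2 ≤
        C ^ 2 * (‖D.D1 v‖ ^ 2 + ‖D.D2 v‖ ^ 2)) (v : V) :
    D.J v ∈ S.dom ∧ ‖S.toFun (D.J v)‖ ≤ 54 * C * (‖D.D1 v‖ + ‖D.D2 v‖) ∧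
      κ * (‖D.D1 v‖ + ‖D.D2 v‖) ≤ 108 * C * ‖S.toFun (D.J v)‖ := by
  have h1 := hS.apply_le_of_sum_le (u := D.J v)
    (A := C * √(‖D.D1 v‖ ^ 2 + ‖D.D2 v‖ ^ 2)) (by positivity) fun m N => by
      rw [mul_pow, Real.sq_sqrt (by positivity)]
      exact hsq v m N
  have hp := norm_nonneg (D.D1 v)
  have hq := norm_nonneg (D.D2 v)
  refine ⟨h1.1, h1.2.trans ?_, ?_⟩
  · have := mul_le_mul_of_nonneg_left (sqrt_sq_add_sq_le hp hq) (by positivity : 0 ≤ 54 * C)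
    linarith
  · have h2 := hS.le_norm_apply D.κ_le D.injective_J hd hC (fun w m N => by
      rw [← D.adj_form]
      refine (hsq' w m N).trans_eq ?_
      congr 1
      exact (D.energy_nonneg_eq w).symm) h1.1
    have h3 : ‖v‖ ^ 2 - ‖D.form.J v‖ ^ 2 = ‖D.D1 v‖ ^ 2 + ‖D.D2 v‖ ^ 2 := D.energy_nonneg_eq v
    rw [h3] at h2
    have h4 := mul_le_mul_of_nonneg_left (add_le_two_mul_sqrt ‖D.D1 v‖ ‖D.D2 v‖) D.κ_pos.le
    change κ * _ ≤ 54 * C * ‖S.toFun (D.J v)‖ at h2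
    linarith

theorem le_sq_of_bounds {s κ cb a y : ℝ} (hs : 0 ≤ s) (hκ : 0 < κ) (hcb : 0 < cb) (ha : 0 ≤ a)
    (hy : 0 ≤ y) (h1 : y ≤ 54 * (s * (1 + cb)) * a) (h2 : κ * a ≤ 108 * (s * (1 + cb)) * y) :
    (((1 + 54 * s + 108 * s / κ) * (1 + cb)) ^ 2)⁻¹ * a ≤ y ∧
      y ≤ ((1 + 54 * s + 108 * s / κ) * (1 + cb)) ^ 2 * a := by
  set r := 108 * s / κ with hr
  have hr0 : 0 ≤ r := by positivity
  have hrs : r * κ = 108 * s := by rw [hr]; field_simp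
  set B := (1 + 54 * s + r) * (1 + cb) with hB
  have hB1 : 1 ≤ B := by nlinarith [mul_nonneg hs hcb.le, mul_nonneg hr0 hcb.le]
  have hBB : B ≤ B ^ 2 := by nlinarith
  have hBs : 54 * (s * (1 + cb)) ≤ B := by nlinarith [mul_nonneg hr0 hcb.le]
  have hBr : r * (1 + cb) ≤ B := by nlinarith [mul_nonneg hs hcb.le]
  constructor
  · rw [inv_mul_le_iff₀ (by positivity)]
    have h3 : κ * a ≤ κ * (r * (1 + cb) * y) := by
      refine h2.trans_eq ?_
      linear_combination (-(1 + cb) * y) * hrs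
    refine (le_of_mul_le_mul_left h3 hκ).trans ?_
    exact mul_le_mul_of_nonneg_right (hBr.trans hBB) hy
  · exact h1.trans (mul_le_mul_of_nonneg_right (hBs.trans hBB) ha)

/-- The Kato estimate for data modelled on `H¹_b`. -/
theorem KData.IsModel.kato {M κ : ℝ} {V : Type} [NormedAddCommGroup V] [InnerProductSpace ℂ V]
    [CompleteSpace V] {D : KData n M κ V} {b : Rn n → Cn n} (hD : D.IsModel b)
    {A : Rn n → (Cn n →L[ℂ] Cn n)} (hA : AEStronglyMeasurable A volume) (hM : ∀ᵐ x, ‖A x‖ ≤ M)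
    (hAL : ∀ F, D.AL F = mulOp A hA hM F) {C : ℝ} (hC : 0 ≤ C)
    (hsq : ∀ (D : KData n M κ V) {cb : ℝ} (_ : 0 ≤ cb) (_ : D.LapBound cb) (v : V) (m : ℤ) (N : ℕ),
      ∑ i ∈ Finset.range N,
        (((2 : ℝ) ^ (m + (i : ℤ)))⁻¹ * ‖D.J v - D.form.Rd (m + (i : ℤ)) (D.J v)‖) ^ 2 ≤
          C * (1 + cb) ^ 2 * (‖D.D1 v‖ ^ 2 + ‖D.D2 v‖ ^ 2))
    {T : UOp (L2 n)}
    (hT : IsAssocOpH1b b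
      (fun u v g gv =>
        (∫ x, inner (𝕜 := ℂ) (gradPlusB b v gv x) (gradPlusB b u g x))
          + ∫ x, inner (𝕜 := ℂ) (vecOf gv x) (vecOf g x)) T)
    {lap : UOp (L2 n)} (hlap : IsFormOp (fun _ => (0 : ℝ)) lap) {cb : ℝ} (hcb : 0 < cb)
    (hdom : ∀ u ∈ T.dom, u ∈ lap.dom ∧ ‖lap.toFun u‖ ≤ cb * ‖T.toFun u‖)
    {LAb : UOp (L2 n)}
    (hL : IsAssocOpH1b b
      (fun u v g gv =>
        (∫ x, inner (𝕜 := ℂ) (vecOf gv x) (A x (vecOf g x)))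
          + ∫ x, inner (𝕜 := ℂ) (gradPlusB b v gv x) (gradPlusB b u g x)) LAb)
    {S : UOp (L2 n)} (hS : S.IsMaximalAccretive) (hSL : UOp.EqOn (S.comp S) LAb)
    {u : L2 n} {g : Fin n → Rn n → ℂ} (hu : MemH1b b u g) :
    u ∈ S.dom ∧
      (((1 + 54 * √C + 108 * √C / κ) * (1 + cb)) ^ 2)⁻¹ *
          (√(∫ x, ‖gradPlusB b u g x‖ ^ 2) + √(∫ x, ‖vecOf g x‖ ^ 2)) ≤ ‖S.toFun u‖ ∧
      ‖S.toFun u‖ ≤ ((1 + 54 * √C + 108 * √C / κ) * (1 + cb)) ^ 2 *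
          (√(∫ x, ‖gradPlusB b u g x‖ ^ 2) + √(∫ x, ‖vecOf g x‖ ^ 2)) := by
  have hTD : D.formT.IsAssoc T := hD.assoc hT (B := fun w v => inner ℂ w (D.formT.N v))
    fun v w g g' hv hw => by
      rw [D.inner_formT_N, hv.integral_D1 hw, hv.integral_D2 hw]
  have hLD : D.form.IsAssoc LAb := hD.assoc hL (B := fun w v => inner ℂ w (D.form.N v))
    fun v w g g' hv hw => by
      rw [D.inner_form_N, add_comm, hAL, hv.integral_D1 hw, integral_inner_mulOp hA hM hv.2 hw.2]
  have hlb : D.LapBound cb := KData.lapBound hTD hlap hdom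
  have hCsq : (√C * (1 + cb)) ^ 2 = C * (1 + cb) ^ 2 := by rw [mul_pow, Real.sq_sqrt hC]
  obtain ⟨v, rfl, hv⟩ := hD.exists_vec _ _ hu
  have key := D.kato (C := √C * (1 + cb)) (by positivity) (hLD.isSqrt hS hSL)
    (hTD.denseRange_J hT.1)
    (fun v m N => by rw [hCsq]; exact hsq D hcb.le hlb v m N)
    (fun v m N => by rw [hCsq]; exact hsq D.adj hcb.le hlb v m N) v
  rw [norm_sq_eq_integral hv.1, norm_sq_eq_integral hv.2, Real.sqrt_sq (norm_nonneg _),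
    Real.sqrt_sq (norm_nonneg _)]
  exact ⟨key.1, le_sq_of_bounds (Real.sqrt_nonneg C) D.κ_pos hcb (by positivity) (norm_nonneg _)
    key.2.1 key.2.2⟩

end

/-- **Kato square root with a first-order potential.** -/
theorem stmt19 (n : ℕ) (hn : 0 < n)
    (A : Rn n → (Cn n →L[ℂ] Cn n))
    (hAmeas : AEStronglyMeasurable A (volume : Measure (Rn n)))
    (hAbdd : ∃ M, ∀ᵐ x ∂(volume : Measure (Rn n)), ‖A x‖ ≤ M)
    (κA : ℝ) (hκA : 0 < κA)
    -- Gårding inequality for `A`: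
    (hG0 : ∀ (u : L2 n) (g : Fin n → Rn n → ℂ), (∀ i, IsWeakPartial u i (g i)) →
      κA * (∫ x, ‖vecOf g x‖ ^ 2)
        ≤ (∫ x, inner (𝕜 := ℂ) (vecOf g x) (A x (vecOf g x))).re) :
    -- there is a constant `c > 0` independent of `b` such that:
    ∃ c > 0,
      ∀ (b : Rn n → Cn n), MeasureTheory.LocallyIntegrable b volume →
      -- `(∇+b)*(∇+b) - Δ`, the self-adjoint operator of the form
      -- `u ↦ ‖(∇+b)u‖₂² + ‖∇u‖₂²` on `H¹_b`:
      ∀ (T : UOp (L2 n)),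
        IsAssocOpH1b b
          (fun u v g gv =>
            (∫ x, inner (𝕜 := ℂ) (gradPlusB b v gv x) (gradPlusB b u g x))
              + ∫ x, inner (𝕜 := ℂ) (vecOf gv x) (vecOf g x)) T →
        T.IsSelfAdjointOp → T.IsNonneg →
      -- `-Δ`:
      ∀ (lap : UOp (L2 n)), IsFormOp (fun _ => (0 : ℝ)) lap →
      -- `(∇+b)*(∇+b)`:
      ∀ (Sb : UOp (L2 n)),
        IsAssocOpH1b b
          (fun u v g gv =>
            ∫ x, inner (𝕜 := ℂ) (gradPlusB b v gv x) (gradPlusB b u g x)) Sb →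
      -- hypothesis: `D(T) ⊆ D(-Δ) ∩ D((∇+b)*(∇+b))` and
      -- `‖Δu‖₂ ≤ c_b ‖((∇+b)*(∇+b) - Δ)u‖₂`:
      ∀ (cb : ℝ), 0 < cb →
        (∀ u ∈ T.dom, u ∈ lap.dom ∧ u ∈ Sb.dom ∧
          ‖lap.toFun u‖ ≤ cb * ‖T.toFun u‖) →
      -- `L^A_b = (∇+b)*(∇+b) - div(A∇)` and its maximal accretive square root:
      ∀ (LAb : UOp (L2 n)),
        IsAssocOpH1b b
          (fun u v g gv =>
            (∫ x, inner (𝕜 := ℂ) (vecOf gv x) (A x (vecOf g x)))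
              + ∫ x, inner (𝕜 := ℂ) (gradPlusB b v gv x) (gradPlusB b u g x)) LAb →
      ∀ (sqrtL : UOp (L2 n)), sqrtL.IsMaximalAccretive →
        UOp.EqOn (sqrtL.comp sqrtL) LAb →
      -- conclusion: the Kato estimate on `H¹_b(ℝⁿ)`:
      ∀ (u : L2 n) (g : Fin n → Rn n → ℂ), MemH1b b u g →
        u ∈ sqrtL.dom ∧
        ((c * (1 + cb)) ^ 2)⁻¹ *
            (Real.sqrt (∫ x, ‖gradPlusB b u g x‖ ^ 2)
              + Real.sqrt (∫ x, ‖vecOf g x‖ ^ 2))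
          ≤ ‖sqrtL.toFun u‖ ∧
        ‖sqrtL.toFun u‖
          ≤ (c * (1 + cb)) ^ 2 *
              (Real.sqrt (∫ x, ‖gradPlusB b u g x‖ ^ 2)
                + Real.sqrt (∫ x, ‖vecOf g x‖ ^ 2)) := by
  obtain ⟨M', hM'⟩ := hAbdd
  obtain ⟨M, hM0, hM⟩ : ∃ M : ℝ, 0 ≤ M ∧ ∀ᵐ x ∂(volume : Measure (Rn n)), ‖A x‖ ≤ M :=
    ⟨max M' 0, le_max_right _ _, hM'.mono fun x hx => hx.trans (le_max_left _ _)⟩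
  obtain ⟨κ, hκ, hκ1, hκ2⟩ : ∃ κ : ℝ, 0 < κ ∧ κ ≤ 1 ∧ κ ≤ κA :=
    ⟨min 1 κA, lt_min one_pos hκA, min_le_left _ _, min_le_right _ _⟩
  have hG : ∀ (u : L2 n) (q : Lc n), IsWGrad u q →
      κ * ‖q‖ ^ 2 ≤ (inner ℂ q (mulOp A hAmeas hM q)).re := fun u q hq => by
    have h1 := hG0 u (fun i x => q x i) (isWGrad_iff.1 hq)
    have h2 : q =ᵐ[volume] vecOf fun i x => q x i := Filter.EventuallyEq.rfl
    rw [norm_sq_eq_integral h2, integral_inner_mulOp hAmeas hM h2 h2] at h1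
    exact le_trans (by gcongr) h1
  obtain ⟨C, hC, hsq⟩ := exists_square_function n (M := M) hκ
  refine ⟨1 + 54 * √C + 108 * √C / κ, by positivity, ?_⟩
  intro b hb T hT _ _ lap hlap Sb _ cb hcb hdom LAb hL S hS hSL u g hu
  have hbm := hb.aestronglyMeasurable
  exact (KData.isModel_ofCoeff hAmeas hM hM0 hκ hκ1 hG b hbm).kato (A := A) hAmeas hM (fun _ => rfl)
    hC (fun D' _ hcb v m N => hsq D' hcb v m N) hT hlap hcb
    (fun u hu => ⟨(hdom u hu).1, (hdom u hu).2.2⟩) hL hS hSL hu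

end
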